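/- Let F|K be an algebraic function field, P a place of F|K, ζ₁,…,ζ_m elements of the valuation ring 𝓞_F, and E|K any subextension of F|K with trdeg E|K = trdeg F|K. Then there exist a finite extension 𝓕 of F equipped with an extension of P, a finite purely inseparable extension 𝓚 of K inside 𝓕, such that 𝓕 is a normal extension of E and a normal extension of F, and (𝓕|𝓚,P) is uniformizable with respect to ζ₁,…,ζ_m. -/

import Mathlib

/-! Common valuation-theoretic notions, following F.-V. Kuhlmann,
"On local uniformization in arbitrary characteristic I".

A valued field `(F, P)` is modelled by a field `F` together with a
`ValuationSubring F` (the valuation ring `𝓞` of the place `P`). -/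

namespace LocalUnif

variable {F : Type*} [Field F]

/-- `x` lies in the maximal ideal of the valuation subring `O`,
i.e. the residue `xP` is `0` (equivalently `v_P x > 0`, or `x = 0`). -/
def InMax (O : ValuationSubring F) (x : F) : Prop := x = 0 ∨ x⁻¹ ∉ O

/-- `x` is a unit of the valuation subring `O`, i.e. `v_P x = 0`. -/
def IsVUnit (O : ValuationSubring F) (x : F) : Prop := x ≠ 0 ∧ x ∈ O ∧ x⁻¹ ∈ O

/-- The valuation with valuation ring `O` is trivial on the subfield `K`;
equivalently, every nonzero element of `K` is a unit of `O`. -/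
def TrivialOn (O : ValuationSubring F) (K : Subfield F) : Prop :=
  ∀ x ∈ K, x ∈ O ∧ x⁻¹ ∈ O

/-- The residue field of `O` equals (the isomorphic image of) the subfield `K`:
every element of `O` is congruent to an element of `K` modulo the maximal ideal.
(For a place `P` of `F|K` this says that `P` is a rational place, `FP = K`.) -/
def ResidueEq (O : ValuationSubring F) (K : Subfield F) : Prop :=
  ∀ x ∈ O, ∃ c ∈ K, InMax O (x - c)

/-- The residue field of `O` is algebraic over (the image of) `K`; for a place of
`F|K` this says that `P` is zero-dimensional. -/
def ResidueAlgebraic (O : ValuationSubring F) (K : Subfield F) : Prop :=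
  ∀ x ∈ O, ∃ p : Polynomial F, p ≠ 0 ∧ (∀ i, p.coeff i ∈ K) ∧ InMax O (Polynomial.eval x p)

/-- The values `v_P (x i)` are rationally independent modulo `v_P K`:
no nontrivial ℤ-linear combination of the values lies in `ℚ ⊗ v_P K`
(equivalently, in `v_P K`, by clearing denominators). -/
def ValIndepMod (O : ValuationSubring F) (K : Subfield F) {ρ : ℕ} (x : Fin ρ → F) : Prop :=
  (∀ i, x i ≠ 0) ∧
  ∀ e : Fin ρ → ℤ, (∃ c ∈ K, c ≠ 0 ∧ IsVUnit O ((∏ i, x i ^ e i) / c)) → e = 0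

/-- The residues `(y i)P` are algebraically independent over the residue field `KP`:
for every polynomial with coefficients in `𝓞_K = K ∩ O`, at least one of which is
a unit, the value of the polynomial at `y` is a unit (so its residue is nonzero). -/
def ResIndep (O : ValuationSubring F) (K : Subfield F) {τ : ℕ} (y : Fin τ → F) : Prop :=
  (∀ i, y i ∈ O) ∧
  ∀ p : MvPolynomial (Fin τ) F, (∀ m, p.coeff m ∈ K ∧ p.coeff m ∈ O) →
    (∃ m, IsVUnit O (p.coeff m)) → ¬ InMax O (MvPolynomial.eval y p)

/-- `dim_ℚ (ℚ ⊗ (v_P F / v_P K)) = ρ`: there is a maximal set of `ρ` elements of `F`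
whose values are rationally independent modulo `v_P K`. -/
def RatRankEq (O : ValuationSubring F) (K : Subfield F) (ρ : ℕ) : Prop :=
  (∃ x : Fin ρ → F, ValIndepMod O K x) ∧ ∀ x : Fin (ρ + 1) → F, ¬ ValIndepMod O K x

/-- `trdeg (FP | KP) = τ`: there is a maximal set of `τ` elements of `O` whose
residues are algebraically independent over `KP`. -/
def ResTrdegEq (O : ValuationSubring F) (K : Subfield F) (τ : ℕ) : Prop :=
  (∃ y : Fin τ → F, ResIndep O K y) ∧ ∀ y : Fin (τ + 1) → F, ¬ ResIndep O K y

/-- `trdeg (F | K) = d`. -/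
def TrdegEq (K : Subfield F) (d : ℕ) : Prop :=
  ∃ t : Fin d → F, IsTranscendenceBasis ↥K t

/-- `P` is an Abhyankar place of `F|K`:
`trdeg F|K = trdeg FP|K + dim_ℚ (ℚ ⊗ v_P F)`. -/
def IsAbhyankar (O : ValuationSubring F) (K : Subfield F) : Prop :=
  ∃ d ρ τ : ℕ, d = ρ + τ ∧ TrdegEq K d ∧ RatRankEq O K ρ ∧ ResTrdegEq O K τ

/-- The value group of `O` is archimedean ordered (rank at most 1):
for any two positive values `v_P a, v_P b` there is `n` with `n · v_P a ≥ v_P b`. -/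
def RankOne (O : ValuationSubring F) : Prop :=
  ∀ a b : F, a ≠ 0 → InMax O a → b ≠ 0 → InMax O b → ∃ n : ℕ, a ^ n / b ∈ O

/-- The value group of `O` has (rank) at least `r`: there is a chain of `r` positive
values, each infinitely larger than the previous one. -/
def RankAtLeast (O : ValuationSubring F) (r : ℕ) : Prop :=
  ∃ a : Fin r → F, (∀ i, a i ≠ 0 ∧ InMax O (a i)) ∧
    ∀ i j : Fin r, i < j → ∀ n : ℕ, a i ^ n / a j ∉ O

/-- The value group of `O` has rank exactly `r`. -/
def RankEq (O : ValuationSubring F) (r : ℕ) : Prop :=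
  RankAtLeast O r ∧ ¬ RankAtLeast O (r + 1)

/-- The valuation is discrete: its value group is order isomorphic to `ℤ`,
i.e. there is a uniformizer `π` with every value an integer multiple of `v_P π`. -/
def IsDiscrete (O : ValuationSubring F) : Prop :=
  ∃ π : F, π ≠ 0 ∧ InMax O π ∧ ∀ x : F, x ≠ 0 → ∃ n : ℤ, IsVUnit O (x / π ^ n)

/-- `F|K` is an algebraic function field: a finitely generated field extension of
transcendence degree at least 1. -/
def IsFunctionField (K : Subfield F) : Prop :=
  (∃ S : Finset F, IntermediateField.adjoin ↥K (S : Set F) = ⊤) ∧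
  ∃ x : F, Transcendental ↥K x

/-- The data of a weak uniformization of `(𝓛|𝓚, P)` (both subfields of an ambient
valued field `F`, `𝓚 ⊆ 𝓛`) with uniformizing transcendence basis `t` and generators
`η`: there are polynomials `f i` in `n` variables `X₁, …, Xₙ` with coefficients in
`𝓞_𝓚[t₁,…,tₛ]` such that (U1) `X j` does not occur in `f i` for `i < j`,
(U2) `f i (η) = 0`, and (U3) the residue of `det J_f (η)` is nonzero; moreover `t`
is a transcendence basis of `𝓛|𝓚` inside `𝓞_𝓛` and `𝓛 = 𝓚(t, η)`. -/
def UnifData (𝓛 𝓚 : Subfield F) (O : ValuationSubring F) {s n : ℕ}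
    (t : Fin s → F) (η : Fin n → F) : Prop :=
  (∀ i, t i ∈ 𝓛 ∧ t i ∈ O) ∧ (∀ i, η i ∈ 𝓛 ∧ η i ∈ O) ∧
  AlgebraicIndependent ↥𝓚 t ∧
  (∀ z ∈ 𝓛, IsAlgebraic ↥(IntermediateField.adjoin ↥𝓚 (Set.range t)) z) ∧
  Subfield.closure ((𝓚 : Set F) ∪ Set.range t ∪ Set.range η) = 𝓛 ∧
  ∃ f : Fin n → MvPolynomial (Fin n) F,
    (∀ i m, (f i).coeff m ∈
      Subring.closure ((↑(𝓚.toSubring ⊓ O.toSubring) : Set F) ∪ Set.range t)) ∧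
    (∀ i j : Fin n, (i : ℕ) < (j : ℕ) → MvPolynomial.degreeOf j (f i) = 0) ∧
    (∀ i, MvPolynomial.eval η (f i) = 0) ∧
    IsVUnit O (Matrix.det (Matrix.of fun i j : Fin n =>
      MvPolynomial.eval η (MvPolynomial.pderiv j (f i))))

/-- `(𝓛|𝓚, P)` is uniformizable with respect to `ζ₁, …, ζ_m`:
there is a weak uniformization whose generators `η` include all the `ζ k`. -/
def UnifWrt (𝓛 𝓚 : Subfield F) (O : ValuationSubring F) {m : ℕ} (ζ : Fin m → F) : Prop :=
  ∃ (s n : ℕ) (t : Fin s → F) (η : Fin n → F),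
    UnifData 𝓛 𝓚 O t η ∧ ∃ σ : Fin m → Fin n, ∀ k, η (σ k) = ζ k

/-- `(𝓛|𝓚, P)` is uniformizable: uniformizable with respect to every finite
list of elements of `𝓞_𝓛`. -/
def UnifIn (𝓛 𝓚 : Subfield F) (O : ValuationSubring F) : Prop :=
  ∀ (m : ℕ) (ζ : Fin m → F), (∀ k, ζ k ∈ 𝓛 ∧ ζ k ∈ O) → UnifWrt 𝓛 𝓚 O ζ

section Defectless

variable {K L : Type*} [Field K] [Field L]

/-- The values of the `a i` lie in pairwise distinct cosets modulo the value group of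
the ground field along `φ`; thus there are at least `e` distinct cosets. -/
def ValClassIndep (φ : K →+* L) (OL : ValuationSubring L) {e : ℕ} (a : Fin e → L) : Prop :=
  (∀ i, a i ≠ 0) ∧ ∀ i j : Fin e, i ≠ j →
    ¬ ∃ c : K, c ≠ 0 ∧ IsVUnit OL (a i / (a j * φ c))

/-- The ramification index `e = (v_P L : v_P K)` of `OL` over the ground field along `φ`. -/
def RamIdxEq (φ : K →+* L) (OL : ValuationSubring L) (e : ℕ) : Prop :=
  (∃ a : Fin e → L, ValClassIndep φ OL a) ∧ ∀ a : Fin (e + 1) → L, ¬ ValClassIndep φ OL a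

/-- The residues of the `b i` are linearly independent over the residue field of the
ground field along `φ`. -/
def ResLinIndep (φ : K →+* L) (OK : ValuationSubring K) (OL : ValuationSubring L)
    {f : ℕ} (b : Fin f → L) : Prop :=
  (∀ i, b i ∈ OL) ∧ ∀ c : Fin f → K, (∀ i, c i ∈ OK) → (∃ i, ¬ InMax OK (c i)) →
    ¬ InMax OL (∑ i, φ (c i) * b i)

/-- The inertia degree `f = [LP : KP]` of `OL` over `(K, OK)` along `φ`. -/
def InertiaDegEq (φ : K →+* L) (OK : ValuationSubring K) (OL : ValuationSubring L)
    (f : ℕ) : Prop :=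
  (∃ b : Fin f → L, ResLinIndep φ OK OL b) ∧ ∀ b : Fin (f + 1) → L, ¬ ResLinIndep φ OK OL b

end Defectless

/-- `(K, OK)` is a defectless (stable) valued field: for every finite extension `L|K`
(inside a fixed algebraic closure) the fundamental equality
`[L : K] = ∑ᵢ eᵢ fᵢ` holds, the sum running over all extensions of the valuation. -/
def IsDefectless (K : Type*) [Field K] (OK : ValuationSubring K) : Prop :=
  ∀ L : IntermediateField K (AlgebraicClosure K), FiniteDimensional K ↥L →
    ∃ (g : ℕ) (Os : Fin g → ValuationSubring ↥L) (e f : Fin g → ℕ),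
      Function.Injective Os ∧
      (∀ O' : ValuationSubring ↥L, O'.comap (algebraMap K ↥L) = OK ↔ ∃ i, O' = Os i) ∧
      (∀ i, RamIdxEq (algebraMap K ↥L) (Os i) (e i)) ∧
      (∀ i, InertiaDegEq (algebraMap K ↥L) OK (Os i) (f i)) ∧
      Module.finrank K ↥L = ∑ i, e i * f i

/-- The extension `𝓛|𝓚` of subfields of `F` is separable (in the general sense of
MacLane): every finitely generated subextension is separably generated, i.e. admits
a separating transcendence basis. -/
def IsSeparableExt (𝓚 𝓛 : Subfield F) : Prop :=
  ∀ S : Finset F, ↑S ⊆ (𝓛 : Set F) →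
    ∃ (d : ℕ) (u : Fin d → F), (∀ i, u i ∈ 𝓛) ∧ AlgebraicIndependent ↥𝓚 u ∧
      ∀ x ∈ Subfield.closure ((𝓚 : Set F) ∪ ↑S),
        IsSeparable ↥(IntermediateField.adjoin ↥𝓚 (Set.range u)) x

/-- The embedding of a subfield `K`, on which the valuation is trivial, into
the residue field of `O`. -/
noncomputable def resEmb (O : ValuationSubring F) (K : Subfield F) (h : ∀ x ∈ K, x ∈ O) :
    ↥K →+* IsLocalRing.ResidueField ↥O :=
  (IsLocalRing.residue ↥O).comp
    { toFun := fun x => (⟨x.1, h x.1 x.2⟩ : ↥O)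
      map_one' := rfl
      map_mul' := fun _ _ => rfl
      map_zero' := rfl
      map_add' := fun _ _ => rfl }

end LocalUnif

section Helpers
open Polynomial
theorem mle1 {G : Type*} [LinearOrderedCommGroupWithZero G] {a b c : G} (h1 : a ≤ c)
    (h2 : b ≤ 1) : a * b ≤ c := by
  simpa using mul_le_mul' h1 h2
theorem mle2 {G : Type*} [LinearOrderedCommGroupWithZero G] {a b c : G} (h1 : a ≤ 1)
    (h2 : b ≤ c) : a * b ≤ c := by
  simpa using mul_le_mul' h1 h2

section EtBasics
variable {U : Type*} [Field U] {Γ₀ : Type*} [LinearOrderedCommGroupWithZero Γ₀]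

/-- elements reached by successive etale (Hensel) steps from `R` inside `F`. -/
inductive Et (v : Valuation U Γ₀) (F : Subfield U) (R : Subring U) : U → Prop
  | base (x : U) (hR : x ∈ R) (hF : x ∈ F) (hv : v x ≤ 1) : Et v F R x
  | add (x y : U) (hx : Et v F R x) (hy : Et v F R y) : Et v F R (x + y)
  | mul (x y : U) (hx : Et v F R x) (hy : Et v F R y) : Et v F R (x * y)
  | root (f : Polynomial U) (η : U) (hf : ∀ i, Et v F R (f.coeff i)) (hF : η ∈ F) (hv : v η ≤ 1)
      (h0 : f.eval η = 0) (h1 : v (f.derivative.eval η) = 1) : Et v F R η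

variable {v : Valuation U Γ₀} {F F' : Subfield U} {R R' : Subring U}

theorem Et.mem {x : U} (h : Et v F R x) : x ∈ F := by
  induction h with
  | base => assumption
  | add x y _ _ h1 h2 => exact F.add_mem h1 h2
  | mul x y _ _ h1 h2 => exact F.mul_mem h1 h2
  | root => assumption

theorem Et.le_one {x : U} (h : Et v F R x) : v x ≤ 1 := by
  induction h with
  | base => assumption
  | add x y _ _ h1 h2 => exact v.map_add_le h1 h2
  | mul x y _ _ h1 h2 => rw [map_mul]; exact mul_le_one' h1 h2
  | root => assumption

theorem Et.zero : Et v F R 0 := .base 0 R.zero_mem F.zero_mem (by simp)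
theorem Et.one : Et v F R 1 := .base 1 R.one_mem F.one_mem (by simp)

theorem Et.neg {a : U} (ha : Et v F R a) : Et v F R (-a) := by
  have h1 : Et v F R (-1) :=
    .base _ (R.neg_mem R.one_mem) (F.neg_mem F.one_mem) (by simp [Valuation.map_neg])
  simpa using Et.mul _ _ h1 ha

/-- the subring of `Et` elements -/
def EtRing (v : Valuation U Γ₀) (F : Subfield U) (R : Subring U) : Subring U where
  carrier := {x | Et v F R x}
  mul_mem' := fun h1 h2 => Et.mul _ _ h1 h2
  one_mem' := Et.one
  add_mem' := fun h1 h2 => Et.add _ _ h1 h2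
  zero_mem' := Et.zero
  neg_mem' := Et.neg

theorem mem_EtRing {x : U} : x ∈ EtRing v F R ↔ Et v F R x := Iff.rfl

theorem Et.inv {a : U} (ha : Et v F R a) (h1 : v a = 1) : Et v F R a⁻¹ := by
  have ha0 : a ≠ 0 := by rintro rfl; simp at h1
  refine .root (C a * X + C (-1)) a⁻¹ ?_ (F.inv_mem ha.mem) (by simp [h1]) (by simp [ha0])
    (by simp [h1])
  intro i
  rcases i with _ | _ | i
  · simpa using Et.one.neg
  · simpa [coeff_one] using ha
  · simp only [coeff_add, coeff_C_mul, coeff_X, coeff_C]; simpa using Et.zero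

/-- transitivity -/
theorem Et.trans (hF : F ≤ F') (hR : ∀ r ∈ R, r ∈ F → v r ≤ 1 → Et v F' R' r) {x : U}
    (h : Et v F R x) : Et v F' R' x := by
  induction h with
  | base x h1 h2 h3 => exact hR x h1 h2 h3
  | add x y _ _ h1 h2 => exact .add _ _ h1 h2
  | mul x y _ _ h1 h2 => exact .mul _ _ h1 h2
  | root f η _ hη hv h0 h1 ih => exact .root f η ih (hF hη) hv h0 h1

theorem Et.mono (hF : F ≤ F') (hR : R ≤ R') {x : U} (h : Et v F R x) : Et v F' R' x :=
  h.trans hF fun r h1 h2 h3 => .base r (hR h1) (hF h2) h3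

/-- finite usage -/
theorem Et.finite {x : U} (h : Et v F R x) : ∃ S T : Finset U, (S : Set U) ⊆ F ∧
    (∀ r ∈ T, r ∈ R ∧ r ∈ F ∧ v r ≤ 1) ∧ ∀ (F' : Subfield U) (R' : Subring U), (S : Set U) ⊆ F' →
      (∀ r ∈ T, Et v F' R' r) → Et v F' R' x := by
  classical
  induction h with
  | base x h1 h2 h3 =>
    exact ⟨∅, {x}, by simp, by simp [h1, h2, h3], fun F' R' _ h => h x (by simp)⟩
  | add x y _ _ h1 h2 =>
    obtain ⟨S1, T1, a1, b1, c1⟩ := h1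
    obtain ⟨S2, T2, a2, b2, c2⟩ := h2
    refine ⟨S1 ∪ S2, T1 ∪ T2, by simp [a1, a2], ?_, fun F' R' hS hT => .add _ _ ?_ ?_⟩
    · intro r hr; rcases Finset.mem_union.1 hr with h | h
      exacts [b1 r h, b2 r h]
    · exact c1 F' R' (fun z hz => hS (by simp at hz ⊢; tauto)) fun r hr => hT r (by simp [hr])
    · exact c2 F' R' (fun z hz => hS (by simp at hz ⊢; tauto)) fun r hr => hT r (by simp [hr])
  | mul x y _ _ h1 h2 =>
    obtain ⟨S1, T1, a1, b1, c1⟩ := h1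
    obtain ⟨S2, T2, a2, b2, c2⟩ := h2
    refine ⟨S1 ∪ S2, T1 ∪ T2, by simp [a1, a2], ?_, fun F' R' hS hT => .mul _ _ ?_ ?_⟩
    · intro r hr; rcases Finset.mem_union.1 hr with h | h
      exacts [b1 r h, b2 r h]
    · exact c1 F' R' (fun z hz => hS (by simp at hz ⊢; tauto)) fun r hr => hT r (by simp [hr])
    · exact c2 F' R' (fun z hz => hS (by simp at hz ⊢; tauto)) fun r hr => hT r (by simp [hr])
  | root f η _ hη hv h0 h1 ih =>
    choose S T a b c using ih
    refine ⟨insert η ((Finset.range (f.natDegree+1)).biUnion S),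
      (Finset.range (f.natDegree+1)).biUnion T, ?_, ?_, fun F' R' hS hT => ?_⟩
    · intro z hz
      simp only [Finset.coe_insert, Finset.coe_biUnion, Set.mem_insert_iff, Set.mem_iUnion] at hz
      rcases hz with rfl | ⟨i, _, hz⟩
      exacts [hη, a i hz]
    · intro r hr
      obtain ⟨i, _, hr⟩ := Finset.mem_biUnion.1 hr
      exact b i r hr
    · refine .root f η (fun i => ?_) (hS (by simp)) hv h0 h1
      by_cases hi : i < f.natDegree + 1
      · refine c i F' R' (fun z hz => hS ?_) fun r hr => hT r ?_
        · simp only [Finset.coe_insert, Finset.coe_biUnion, Set.mem_insert_iff, Set.mem_iUnion]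
          exact Or.inr ⟨i, by simpa using hi, hz⟩
        · exact Finset.mem_biUnion.2 ⟨i, by simpa using hi, hr⟩
      · rw [coeff_eq_zero_of_natDegree_lt (by omega)]; exact Et.zero

/-- finite usage for a finite set -/
theorem Et.finite_set (Z : Finset U) (h : ∀ x ∈ Z, Et v F R x) : ∃ S T : Finset U,
    (S : Set U) ⊆ F ∧
    (∀ r ∈ T, r ∈ R ∧ r ∈ F ∧ v r ≤ 1) ∧ ∀ (F' : Subfield U) (R' : Subring U), (S : Set U) ⊆ F' →
      (∀ r ∈ T, Et v F' R' r) → ∀ x ∈ Z, Et v F' R' x := by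
  classical
  have h' : ∀ x : U, ∃ S T : Finset U, x ∈ Z → (S : Set U) ⊆ F ∧
    (∀ r ∈ T, r ∈ R ∧ r ∈ F ∧ v r ≤ 1) ∧ ∀ (F' : Subfield U) (R' : Subring U), (S : Set U) ⊆ F' →
      (∀ r ∈ T, Et v F' R' r) → Et v F' R' x := by
    intro x
    by_cases hx : x ∈ Z
    · obtain ⟨S, T, h⟩ := (h x hx).finite
      exact ⟨S, T, fun _ => h⟩
    · exact ⟨∅, ∅, fun h => absurd h hx⟩
  choose S T h' using h'
  refine ⟨Z.biUnion S, Z.biUnion T, ?_, ?_, fun F' R' hS hT x hx => ?_⟩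
  · intro z hz
    simp only [Finset.coe_biUnion, Set.mem_iUnion] at hz
    obtain ⟨x, hx, hz⟩ := hz
    exact (h' x hx).1 hz
  · intro r hr
    obtain ⟨x, hx, hr⟩ := Finset.mem_biUnion.1 hr
    exact (h' x hx).2.1 r hr
  · refine (h' x hx).2.2 F' R' (fun z hz => hS ?_) fun r hr => hT r ?_
    · simp only [Finset.coe_biUnion, Set.mem_iUnion]
      exact ⟨x, hx, hz⟩
    · exact Finset.mem_biUnion.2 ⟨x, hx, hr⟩

/-- generalized derivations along a valuation preserving homomorphism -/
structure PD (v : Valuation U Γ₀) (N : Subfield U) (φ δ : U → U) : Prop where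
  φ_add : ∀ x ∈ N, ∀ y ∈ N, φ (x + y) = φ x + φ y
  φ_mul : ∀ x ∈ N, ∀ y ∈ N, φ (x * y) = φ x * φ y
  φ_one : φ 1 = 1
  φ_val : ∀ x ∈ N, v (φ x) ≤ 1 ↔ v x ≤ 1
  δ_add : ∀ x ∈ N, ∀ y ∈ N, δ (x + y) = δ x + δ y
  δ_mul : ∀ x ∈ N, ∀ y ∈ N, δ (x * y) = δ x * φ y + x * δ y

namespace PD
variable {N : Subfield U} {φ δ : U → U}

theorem φ_zero (h : PD v N φ δ) : φ 0 = 0 := by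
  have := h.φ_add 0 N.zero_mem 0 N.zero_mem; simpa using this
theorem δ_zero (h : PD v N φ δ) : δ 0 = 0 := by
  have := h.δ_add 0 N.zero_mem 0 N.zero_mem; simpa using this
theorem δ_one (h : PD v N φ δ) : δ 1 = 0 := by
  have := h.δ_mul 1 N.one_mem 1 N.one_mem; simpa [h.φ_one] using this
theorem φ_neg (h : PD v N φ δ) {x : U} (hx : x ∈ N) : φ (-x) = - φ x := by
  have := h.φ_add x hx (-x) (N.neg_mem hx)
  rw [add_neg_cancel, h.φ_zero] at this
  linear_combination -this
theorem δ_neg (h : PD v N φ δ) {x : U} (hx : x ∈ N) : δ (-x) = - δ x := by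
  have := h.δ_add x hx (-x) (N.neg_mem hx)
  rw [add_neg_cancel, h.δ_zero] at this
  linear_combination -this
theorem φ_sub (h : PD v N φ δ) {x y : U} (hx : x ∈ N) (hy : y ∈ N) : φ (x - y) = φ x - φ y := by
  rw [sub_eq_add_neg, h.φ_add x hx _ (N.neg_mem hy), h.φ_neg hy]; ring
theorem δ_sub (h : PD v N φ δ) {x y : U} (hx : x ∈ N) (hy : y ∈ N) : δ (x - y) = δ x - δ y := by
  rw [sub_eq_add_neg, h.δ_add x hx _ (N.neg_mem hy), h.δ_neg hy]; ring

theorem φ_inv (h : PD v N φ δ) {x : U} (hx : x ∈ N) : φ x⁻¹ = (φ x)⁻¹ := by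
  by_cases h0 : x = 0
  · simp [h0, h.φ_zero]
  have := h.φ_mul x hx _ (N.inv_mem hx)
  rw [mul_inv_cancel₀ h0, h.φ_one] at this
  exact eq_inv_of_mul_eq_one_right this.symm

theorem φ_ne (h : PD v N φ δ) {x : U} (hx : x ∈ N) (h0 : x ≠ 0) : φ x ≠ 0 := by
  have := h.φ_mul x hx _ (N.inv_mem hx)
  rw [mul_inv_cancel₀ h0, h.φ_one] at this
  intro h; rw [h] at this; simp at this

/-- `φ` itself gives the generalized derivation `φ - 1`. -/
theorem phi_sub (h : PD v N φ δ) : PD v N φ (fun x => φ x - x) where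
  φ_add := h.φ_add
  φ_mul := h.φ_mul
  φ_one := h.φ_one
  φ_val := h.φ_val
  δ_add x hx y hy := by simp only [h.φ_add x hx y hy]; ring
  δ_mul x hx y hy := by simp only [h.φ_mul x hx y hy]; ring

theorem mono (h : PD v N φ δ) {N' : Subfield U} (hN : N' ≤ N) : PD v N' φ δ where
  φ_add x hx y hy := h.φ_add x (hN hx) y (hN hy)
  φ_mul x hx y hy := h.φ_mul x (hN hx) y (hN hy)
  φ_one := h.φ_one
  φ_val x hx := h.φ_val x (hN hx)
  δ_add x hx y hy := h.δ_add x (hN hx) y (hN hy)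
  δ_mul x hx y hy := h.δ_mul x (hN hx) y (hN hy)

theorem lt_one (h : PD v N φ δ) {x : U} (hx : x ∈ N) (hv : v x < 1) : v (φ x) < 1 := by
  by_cases h0 : x = 0
  · simp [h0, h.φ_zero]
  by_contra hc
  push Not at hc
  have h1 : v (φ x⁻¹) ≤ 1 := by
    rw [h.φ_inv hx, map_inv₀]; exact inv_le_one_of_one_le₀ hc
  rw [h.φ_val _ (N.inv_mem hx), map_inv₀] at h1
  have : v x ≠ 0 := by simpa using h0
  have : 1 ≤ v x := (inv_le_one₀ (zero_lt_iff.2 this)).1 h1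
  exact absurd hv (not_lt.2 this)

/-- kernel of `δ` -/
def ker (h : PD v N φ δ) : Subfield U where
  carrier := {x | x ∈ N ∧ δ x = 0}
  mul_mem' := by
    rintro a b ⟨ha, ha'⟩ ⟨hb, hb'⟩
    exact ⟨N.mul_mem ha hb, by rw [h.δ_mul a ha b hb, ha', hb']; ring⟩
  one_mem' := ⟨N.one_mem, h.δ_one⟩
  add_mem' := by
    rintro a b ⟨ha, ha'⟩ ⟨hb, hb'⟩
    exact ⟨N.add_mem ha hb, by rw [h.δ_add a ha b hb, ha', hb']; ring⟩
  zero_mem' := ⟨N.zero_mem, h.δ_zero⟩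
  neg_mem' := by
    rintro a ⟨ha, ha'⟩
    exact ⟨N.neg_mem ha, by rw [h.δ_neg ha, ha']; simp⟩
  inv_mem' := by
    rintro a ⟨ha, ha'⟩
    refine ⟨N.inv_mem ha, ?_⟩
    by_cases h0 : a = 0
    · simp [h0, h.δ_zero]
    have := h.δ_mul a ha _ (N.inv_mem ha)
    rw [mul_inv_cancel₀ h0, h.δ_one, ha'] at this
    simpa [h0] using this

theorem mem_ker (h : PD v N φ δ) {x : U} : x ∈ h.ker ↔ x ∈ N ∧ δ x = 0 := Iff.rfl

theorem φ_pow (h : PD v N φ δ) {x : U} (hx : x ∈ N) (n : ℕ) : φ (x ^ n) = φ x ^ n := by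
  induction n with
  | zero => simp [h.φ_one]
  | succ n ih => rw [pow_succ, h.φ_mul _ (N.pow_mem hx n) _ hx, ih, pow_succ]

theorem δ_pow (h : PD v N φ δ) {x : U} (hx : x ∈ N) (n : ℕ) :
    δ (x ^ n) = δ x * ∑ i ∈ Finset.range n, φ x ^ i * x ^ (n - 1 - i) := by
  induction n with
  | zero => simp [h.δ_one]
  | succ n ih =>
    rw [pow_succ', h.δ_mul _ hx _ (N.pow_mem hx n), ih, h.φ_pow hx, Finset.sum_range_succ]
    have : ∑ i ∈ Finset.range n, φ x ^ i * x ^ (n + 1 - 1 - i) =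
        x * ∑ i ∈ Finset.range n, φ x ^ i * x ^ (n - 1 - i) := by
      rw [Finset.mul_sum]
      refine Finset.sum_congr rfl fun i hi => ?_
      have := Finset.mem_range.1 hi
      rw [show n + 1 - 1 - i = (n - 1 - i) + 1 by omega, pow_succ]; ring
    rw [this]
    simp
    ring

theorem φ_sum (h : PD v N φ δ) {ι : Type*} (s : Finset ι) (g : ι → U) (hg : ∀ i ∈ s, g i ∈ N) :
    φ (∑ i ∈ s, g i) = ∑ i ∈ s, φ (g i) := by
  classical
  induction s using Finset.induction_on with
  | empty => simp [h.φ_zero]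
  | insert a s ha ih =>
    rw [Finset.sum_insert ha, Finset.sum_insert ha, h.φ_add _ (hg a (by simp)) _
      (N.sum_mem fun i hi => hg i (by simp [hi])), ih fun i hi => hg i (by simp [hi])]

theorem δ_sum (h : PD v N φ δ) {ι : Type*} (s : Finset ι) (g : ι → U) (hg : ∀ i ∈ s, g i ∈ N) :
    δ (∑ i ∈ s, g i) = ∑ i ∈ s, δ (g i) := by
  classical
  induction s using Finset.induction_on with
  | empty => simp [h.δ_zero]
  | insert a s ha ih =>
    rw [Finset.sum_insert ha, Finset.sum_insert ha, h.δ_add _ (hg a (by simp)) _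
      (N.sum_mem fun i hi => hg i (by simp [hi])), ih fun i hi => hg i (by simp [hi])]

/-- difference quotient of a polynomial -/
noncomputable def dq (f : Polynomial U) (y x : U) : U :=
  ∑ k ∈ Finset.range (f.natDegree + 1), f.coeff k *
    ∑ i ∈ Finset.range k, y ^ i * x ^ (k - 1 - i)

theorem dq_self (f : Polynomial U) (x : U) : dq f x x = f.derivative.eval x := by
  have : f.derivative.eval x = ∑ k ∈ Finset.range (f.natDegree + 1),
      f.coeff k * (k * x ^ (k - 1)) := by
    rw [derivative_eval, sum_over_range' _ _ _ (Nat.lt_succ_self _)]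
    · refine Finset.sum_congr rfl fun k _ => by ring
    · simp
  rw [this, dq]
  refine Finset.sum_congr rfl fun k _ => ?_
  congr 1
  rw [Finset.sum_congr rfl (g := fun _ => x ^ (k - 1))]
  · simp
  · intro i hi
    rw [← pow_add]; congr 1
    have := Finset.mem_range.1 hi
    omega

theorem δ_eval (h : PD v N φ δ) (f : Polynomial U) (hf : ∀ i, f.coeff i ∈ N) {x : U} (hx : x ∈ N) :
    δ (f.eval x) = (∑ k ∈ Finset.range (f.natDegree + 1), δ (f.coeff k) * φ x ^ k) +
      δ x * dq f (φ x) x := by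
  rw [eval_eq_sum_range, h.δ_sum _ _ fun i _ => N.mul_mem (hf i) (N.pow_mem hx i), dq,
    Finset.mul_sum, ← Finset.sum_add_distrib]
  refine Finset.sum_congr rfl fun k _ => ?_
  rw [h.δ_mul _ (hf k) _ (N.pow_mem hx k), h.φ_pow hx, h.δ_pow hx]
  ring

theorem v_pow_sub (x y : U) (hx : v x ≤ 1) (hy : v y ≤ 1) (i : ℕ) :
    v (y ^ i - x ^ i) ≤ v (y - x) := by
  rw [← (Commute.all y x).mul_geom_sum₂, map_mul]
  refine mul_le_of_le_one_right' (v.map_sum_le fun j _ => ?_)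
  rw [map_mul, map_pow, map_pow]
  exact mul_le_one' (pow_le_one' hy _) (pow_le_one' hx _)

theorem v_dq_sub (f : Polynomial U) (hf : ∀ i, v (f.coeff i) ≤ 1) {x y : U}
    (hx : v x ≤ 1) (hy : v y ≤ 1) : v (dq f y x - f.derivative.eval x) ≤ v (y - x) := by
  rw [← dq_self, dq, dq, ← Finset.sum_sub_distrib]
  refine v.map_sum_le fun k _ => ?_
  rw [← mul_sub, map_mul, ← Finset.sum_sub_distrib]
  refine mle2 (hf k) (v.map_sum_le fun i _ => ?_)
  rw [← sub_mul, map_mul, map_pow]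
  exact mle1 (v_pow_sub x y hx hy i) (pow_le_one' hx _)

theorem v_dq (f : Polynomial U) (hf : ∀ i, v (f.coeff i) ≤ 1) {x y : U}
    (hx : v x ≤ 1) (hxy : v (y - x) < 1) (h1 : v (f.derivative.eval x) = 1) :
    v (dq f y x) = 1 := by
  have hy : v y ≤ 1 := by
    have := v.map_add_le hxy.le hx
    simpa using this
  have h2 := (v_dq_sub f hf hx hy).trans_lt hxy
  have := Valuation.map_add_eq_of_lt_left v (h2.trans_eq h1.symm)
  rw [add_sub_cancel] at this
  rw [this, h1]

/-- Lipschitz property -/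
theorem lipschitz (h : PD v N φ δ) (hres : ∀ x ∈ N, v x ≤ 1 → v (φ x - x) < 1)
    (hFN : F ≤ N) (γ : Γ₀) (hR : ∀ r ∈ R, r ∈ F → v r ≤ 1 → v (δ r) ≤ γ) {x : U}
    (hx : Et v F R x) : v (δ x) ≤ γ := by
  induction hx with
  | base x h1 h2 h3 => exact hR x h1 h2 h3
  | add x y hx hy h1 h2 =>
    rw [h.δ_add x (hFN hx.mem) y (hFN hy.mem)]; exact v.map_add_le h1 h2
  | mul x y hx hy h1 h2 =>
    rw [h.δ_mul x (hFN hx.mem) y (hFN hy.mem)]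
    refine v.map_add_le ?_ ?_
    · rw [map_mul]
      exact mle1 h1 ((h.φ_val y (hFN hy.mem)).2 hy.le_one)
    · rw [map_mul]
      exact mle2 hx.le_one h2
  | root f η hf hη hv h0 h1 ih =>
    have e := h.δ_eval f (fun i => hFN (hf i).mem) (hFN hη)
    rw [h0, h.δ_zero] at e
    have e2 : v (δ η * dq f (φ η) η) ≤ γ := by
      rw [show δ η * dq f (φ η) η =
        - ∑ k ∈ Finset.range (f.natDegree + 1), δ (f.coeff k) * φ η ^ k by
          linear_combination -e, Valuation.map_neg]
      refine v.map_sum_le fun k _ => ?_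
      rw [map_mul, map_pow]
      exact mle1 (ih k)
        (pow_le_one' ((h.φ_val η (hFN hη)).2 hv) _)
    rwa [map_mul, v_dq f (fun i => (hf i).le_one) hv (hres η (hFN hη) hv) h1, mul_one] at e2
end PD

/-- `VFix v A N`: rigidity of `N` over `A`. -/
def VFix (v : Valuation U Γ₀) (A N : Subfield U) : Prop :=
  ∀ φ δ : U → U, PD v N φ δ → (∀ a ∈ A, φ a = a) → (∀ a ∈ A, δ a = 0) → ∀ x ∈ N, δ x = 0

theorem VFix.phi {A N : Subfield U} (h : VFix v A N) {φ δ : U → U} (hp : PD v N φ δ)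
    (h1 : ∀ a ∈ A, φ a = a) : ∀ x ∈ N, φ x = x := by
  intro x hx
  have := h φ _ hp.phi_sub h1 (fun a ha => by simp [h1 a ha]) x hx
  exact sub_eq_zero.1 this

/-- residue hypothesis transported -/
theorem PD.res {N L : Subfield U} {φ δ : U → U} (h : PD v N φ δ) (hLN : L ≤ N)
    (hL : ∀ a ∈ L, φ a = a)
    (hres : ∀ x ∈ N, v x ≤ 1 → ∃ l ∈ L, v (x - l) < 1) :
    ∀ x ∈ N, v x ≤ 1 → v (φ x - x) < 1 := by
  intro x hx hv
  obtain ⟨l, hl, hxl⟩ := hres x hx hv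
  have h1 : v (φ (x - l)) < 1 := h.lt_one (N.sub_mem hx (hLN hl)) hxl
  rw [h.φ_sub hx (hLN hl), hL l hl] at h1
  have := Valuation.map_sub_lt v h1 hxl
  simpa using this

end EtBasics

section Approx
variable {U : Type*} [Field U] {Γ₀ : Type*} [LinearOrderedCommGroupWithZero Γ₀]
variable {v : Valuation U Γ₀} {F F' L : Subfield U} {R R' : Subring U}

theorem eval_mem_subfield {F : Subfield U} {f : Polynomial U} (hf : ∀ i, f.coeff i ∈ F) {x : U}
    (hx : x ∈ F) : f.eval x ∈ F := by
  rw [eval_eq_sum_range]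
  exact F.sum_mem fun i _ => F.mul_mem (hf i) (F.pow_mem hx i)

theorem deriv_coeff_mem {F : Subfield U} {f : Polynomial U} (hf : ∀ i, f.coeff i ∈ F) :
    ∀ i, f.derivative.coeff i ∈ F := by
  intro i
  rw [coeff_derivative]
  exact F.mul_mem (hf _) (F.add_mem (natCast_mem F i) F.one_mem)

theorem eval_sub_eq_dq (f : Polynomial U) (y x : U) :
    f.eval y - f.eval x = (y - x) * PD.dq f y x := by
  rw [eval_eq_sum_range, eval_eq_sum_range, ← Finset.sum_sub_distrib, PD.dq, Finset.mul_sum]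
  refine Finset.sum_congr rfl fun k _ => ?_
  rw [← mul_sub, ← (Commute.all y x).mul_geom_sum₂]
  ring

theorem v_le_of_sub {x r : U} {γ : Γ₀} (h : v (x - r) ≤ γ) (hx : v x ≤ γ) : v r ≤ γ := by
  have := v.map_sub_le hx h
  simpa using this

theorem Et.approx (hLR : ∀ x ∈ L, x ∈ R) (hLF : L ≤ F)
    (hres : ∀ x ∈ F, v x ≤ 1 → ∃ l ∈ L, v (x - l) < 1)
    (harch : ∀ a ∈ F, v a < 1 → ∀ b ∈ F, b ≠ 0 → ∃ n : ℕ, v a ^ n ≤ v b) {b : U} (hb : b ∈ F)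
    (hb0 : b ≠ 0) (hb1 : v b ≤ 1) {x : U} (hx : Et v F R x) :
    ∃ r ∈ R, r ∈ F ∧ v (x - r) ≤ v b := by
  induction hx with
  | base x h1 h2 h3 => exact ⟨x, h1, h2, by simp⟩
  | add x y hx hy h1 h2 =>
    obtain ⟨r, hr, hrF, e1⟩ := h1
    obtain ⟨s, hs, hsF, e2⟩ := h2
    refine ⟨r + s, R.add_mem hr hs, F.add_mem hrF hsF, ?_⟩
    rw [show x + y - (r + s) = (x - r) + (y - s) by ring]
    exact v.map_add_le e1 e2
  | mul x y hx hy h1 h2 =>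
    obtain ⟨r, hr, hrF, e1⟩ := h1
    obtain ⟨s, hs, hsF, e2⟩ := h2
    refine ⟨r * s, R.mul_mem hr hs, F.mul_mem hrF hsF, ?_⟩
    rw [show x * y - (r * s) = (x - r) * y + r * (y - s) by ring]
    refine v.map_add_le ?_ ?_
    · rw [map_mul]; exact mle1 e1 hy.le_one
    · rw [map_mul]; exact mle2 (v_le_of_sub (e1.trans hb1) hx.le_one) e2
  | root f η hf hη hv h0 h1 ih =>
    choose r hrR hrF hr using ih
    obtain ⟨l0, hl0, hl0v⟩ := hres η hη hv
    have hfF : ∀ i, f.coeff i ∈ F := fun i => (hf i).mem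
    have hf' : f.derivative.eval η ∈ F := eval_mem_subfield (deriv_coeff_mem hfF) hη
    have hne : f.derivative.eval η ≠ 0 := by intro h; rw [h] at h1; simp at h1
    obtain ⟨μ, hμ, hμv⟩ := hres _ (F.inv_mem hf') (by simp [h1])
    have hμ1 : v μ ≤ 1 := v_le_of_sub hμv.le (by simp [h1])
    have hμ2 : v (1 - μ * f.derivative.eval η) < 1 := by
      rw [show 1 - μ * f.derivative.eval η = ((f.derivative.eval η)⁻¹ - μ) * f.derivative.eval η by
        rw [sub_mul, inv_mul_cancel₀ hne], map_mul, h1, mul_one]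
      exact hμv
    obtain ⟨a, haF, ha1, ha2, ha3⟩ : ∃ a ∈ F, v a < 1 ∧ v (1 - μ * f.derivative.eval η) ≤ v a ∧
        v (η - l0) ≤ v a := by
      rcases le_total (v (1 - μ * f.derivative.eval η)) (v (η - l0)) with h | h
      · exact ⟨_, F.sub_mem hη (hLF hl0), hl0v, h, le_rfl⟩
      · exact ⟨_, F.sub_mem F.one_mem (F.mul_mem (hLF hμ) hf'), hμ2, le_rfl, h⟩
    have key : ∀ n : ℕ, ∃ y ∈ R, y ∈ F ∧ (v (η - y) ≤ v b ∨ v (η - y) ≤ v a ^ (n+1)) := by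
      intro n
      induction n with
      | zero => exact ⟨l0, hLR _ hl0, hLF hl0, Or.inr (by simpa using ha3)⟩
      | succ n ihn =>
        obtain ⟨y, hyR, hyF, h | h⟩ := ihn
        · exact ⟨y, hyR, hyF, Or.inl h⟩
        have hya : v (y - η) ≤ v a := by
          rw [Valuation.map_sub_swap]
          refine h.trans ?_
          rw [pow_succ]
          exact mle2 (pow_le_one' ha1.le _) le_rfl
        have hy1 : v y ≤ 1 := by
          have := v.map_add_le (hya.trans ha1.le) hv
          simpa using this
        refine ⟨y - μ * ∑ i ∈ Finset.range (f.natDegree + 1), r i * y ^ i, ?_, ?_, ?_⟩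
        · exact R.sub_mem hyR (R.mul_mem (hLR _ hμ)
            (R.sum_mem fun i _ => R.mul_mem (hrR i) (R.pow_mem hyR i)))
        · exact F.sub_mem hyF (F.mul_mem (hLF hμ)
            (F.sum_mem fun i _ => F.mul_mem (hrF i) (F.pow_mem hyF i)))
        · have e : η - (y - μ * ∑ i ∈ Finset.range (f.natDegree + 1), r i * y ^ i) =
              (η - y) * ((1 - μ * f.derivative.eval η) - μ * (PD.dq f y η - f.derivative.eval η))
              - μ * ∑ i ∈ Finset.range (f.natDegree + 1), (f.coeff i - r i) * y ^ i := by
            have e1 := eval_sub_eq_dq f y η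
            rw [h0, eval_eq_sum_range] at e1
            simp only [sub_mul, Finset.sum_sub_distrib]
            linear_combination μ * e1
          have t1 : v ((η - y) * ((1 - μ * f.derivative.eval η) -
              μ * (PD.dq f y η - f.derivative.eval η))) ≤ v a ^ (n+1+1) := by
            rw [map_mul, pow_succ]
            refine mul_le_mul' h (v.map_sub_le ha2 ?_)
            rw [map_mul]
            exact mle2 hμ1 ((PD.v_dq_sub f (fun i => (hf i).le_one) hv hy1).trans hya)
          have t2 : v (μ * ∑ i ∈ Finset.range (f.natDegree + 1), (f.coeff i - r i) * y ^ i)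
              ≤ v b := by
            rw [map_mul]
            refine mle2 hμ1 (v.map_sum_le fun i _ => ?_)
            rw [map_mul, map_pow]
            exact mle1 (hr i) (pow_le_one' hy1 _)
          rw [e]
          rcases le_total (v b) (v a ^ (n+1+1)) with h | h
          · exact Or.inr (v.map_sub_le t1 (t2.trans h))
          · exact Or.inl (v.map_sub_le (t1.trans h) t2)
    obtain ⟨n, hn⟩ := harch a haF ha1 b hb hb0
    obtain ⟨y, h1, h2, h3⟩ := key n
    refine ⟨y, h1, h2, h3.elim id fun h => h.trans (le_trans ?_ hn)⟩
    rw [pow_succ]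
    exact mle1 le_rfl ha1.le

end Approx

section Sep
variable {U : Type*} [Field U] {Γ₀ : Type*} [LinearOrderedCommGroupWithZero Γ₀]
variable {v : Valuation U Γ₀}

/-- rigidity implies separability -/
theorem VFix.separable {A : Subfield U} {N : IntermediateField A U} [FiniteDimensional A N]
    (h : VFix v A N.toSubfield) : Algebra.IsSeparable A N := by
  classical
  have hD : ∀ D : Derivation A N N, D = 0 := by
    intro D
    ext x
    let δ : U → U := fun x => if hx : x ∈ N then (D ⟨x, hx⟩ : U) else 0
    have hδ : ∀ x (hx : x ∈ N), δ x = D ⟨x, hx⟩ := fun x hx => by simp [δ, hx]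
    have hpd : PD v N.toSubfield id δ := by
      refine ⟨fun _ _ _ _ => rfl, fun _ _ _ _ => rfl, rfl, fun _ _ => Iff.rfl, ?_, ?_⟩
      · intro x hx y hy
        rw [hδ x hx, hδ y hy, hδ _ (N.add_mem hx hy), ← N.coe_add, ← D.map_add]; rfl
      · intro x hx y hy
        rw [hδ x hx, hδ y hy, hδ _ (N.mul_mem hx hy)]
        have := D.leibniz (⟨x, hx⟩ : N) ⟨y, hy⟩
        have := congrArg (Subtype.val) this
        simp only [smul_eq_mul, N.coe_add, N.coe_mul] at this
        refine Eq.trans ?_ (this.trans ?_)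
        · rfl
        · simp; ring
    have := h id δ hpd (fun _ _ => rfl) (fun a ha => ?_) x x.2
    · rw [hδ x x.2] at this
      simpa using this
    · have hm : a ∈ N := N.algebraMap_mem ⟨a, ha⟩
      rw [hδ a hm]
      have : (⟨a, hm⟩ : N) = algebraMap A N ⟨a, ha⟩ := rfl
      rw [this, D.map_algebraMap]; rfl
  have hsub : Subsingleton (Ω[N⁄A]) := by
    by_contra hc
    rw [not_subsingleton_iff_nontrivial] at hc
    have hz : KaehlerDifferential.D A N = 0 → False := by
      intro h0
      have h1 := KaehlerDifferential.span_range_derivation A N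
      rw [h0] at h1
      have : Set.range (0 : Derivation A N (Ω[N⁄A])) ⊆ {0} := by rintro _ ⟨x, rfl⟩; simp
      have h2 := Submodule.span_mono (R := N) this
      rw [h1] at h2
      simp at h2
    apply hz
    ext x
    by_contra hx
    refine hx ((Module.forall_dual_apply_eq_zero_iff N _).1 fun f => ?_)
    have := hD (f.compDer (KaehlerDifferential.D A N))
    exact DFunLike.congr_fun this x
  have : Algebra.FormallyUnramified A N := ⟨hsub⟩
  exact Algebra.FormallyUnramified.isSeparable A N
end Sep

section Etale
variable {U : Type*} [Field U] {Γ₀ : Type*} [LinearOrderedCommGroupWithZero Γ₀]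
variable {v : Valuation U Γ₀}

theorem prod_coeff_le (s : Multiset U) (hs : ∀ r ∈ s, v r ≤ 1) :
    ∀ i, v ((s.map fun r => X - C r).prod.coeff i) ≤ 1 := by
  have : (s.map fun r => X - C r).prod ∈ Polynomial.lifts v.integer.subtype := by
    refine Subsemiring.multiset_prod_mem _ _ fun p hp => ?_
    obtain ⟨r, hr, rfl⟩ := Multiset.mem_map.1 hp
    rw [lifts_iff_coeff_lifts]
    intro n
    rw [coeff_sub, coeff_X, coeff_C]
    refine ⟨⟨(if 1 = n then 1 else 0) - (if n = 0 then r else 0), ?_⟩, rfl⟩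
    show v _ ≤ 1
    refine v.map_sub_le ?_ ?_
    · split_ifs <;> simp
    · split_ifs <;> simp [hs r hr]
  intro i
  rw [lifts_iff_coeff_lifts] at this
  obtain ⟨y, hy⟩ := this i
  rw [← hy]; exact y.2

/-- `b` is integral over `A ∩ O`. -/
def Itg (v : Valuation U Γ₀) (A : Subfield U) (b : U) : Prop :=
  IsIntegral (Subring.closure ((A.toSubring ⊓ v.integer : Subring U) : Set U)) b

theorem itg_iff {A : Subfield U} {b : U} : Itg v A b ↔
    ∀ V : ValuationSubring U, (∀ a ∈ A, v a ≤ 1 → a ∈ V) → b ∈ V := by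
  have h := iInf_valuationSubring_superset (K := U)
    (s := ((A.toSubring ⊓ v.integer : Subring U) : Set U))
  have h2 : Itg v A b ↔ b ∈ (integralClosure
    (Subring.closure ((A.toSubring ⊓ v.integer : Subring U) : Set U)) U).toSubring := Iff.rfl
  rw [h2, ← h, Subring.mem_iInf]
  constructor
  · intro h V hV
    exact h ⟨V, fun a ha => hV a ha.1 ha.2⟩
  · rintro h ⟨V, hV⟩
    exact h V fun a ha hv => hV ⟨ha, hv⟩

theorem Itg.map {A : Subfield U} {N : IntermediateField A U} (φ : N →ₐ[A] U) {b : N}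
    (hb : Itg v A b) : v (φ b) ≤ 1 := by
  obtain ⟨p, hp, hp0⟩ := hb
  have hcl := (Subring.closure_eq (A.toSubring ⊓ v.integer : Subring U)).le
  let f : (Subring.closure ((A.toSubring ⊓ v.integer : Subring U) : Set U)) →+* A :=
    { toFun := fun x => ⟨x.1, (hcl x.2).1⟩, map_one' := rfl, map_mul' := fun _ _ => rfl,
      map_zero' := rfl, map_add' := fun _ _ => rfl }
  have h0 : (p.map f).aeval b = 0 := by
    apply Subtype.val_injective
    have : ((aeval b (p.map f) : N) : U) = aeval (b : U) (p.map f) := by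
      rw [← IntermediateField.coe_val, ← Polynomial.aeval_algHom_apply]
    rw [this, aeval_def, eval₂_map]
    exact hp0
  have h1 : (p.map f).aeval (φ b) = 0 := by
    rw [Polynomial.aeval_algHom_apply, h0, map_zero]
  have hint : IsIntegral v.integer (φ b) := by
    refine ⟨p.map (Subring.inclusion (hcl.trans inf_le_right)), hp.map _, ?_⟩
    rw [eval₂_map]
    rw [aeval_def, eval₂_map] at h1
    exact h1
  exact (Valuation.integer.integers v).isIntegral_iff_v_le_one.1 hint

theorem Itg.add {A : Subfield U} {a b : U} (ha : Itg v A a) (hb : Itg v A b) : Itg v A (a + b) :=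
  IsIntegral.add ha hb
theorem Itg.mul {A : Subfield U} {a b : U} (ha : Itg v A a) (hb : Itg v A b) : Itg v A (a * b) :=
  IsIntegral.mul ha hb
theorem Itg.of_mem {A : Subfield U} {a : U} (ha : a ∈ A) (hv : v a ≤ 1) : Itg v A a :=
  itg_iff.2 fun _ hV => hV a ha hv
theorem Itg.zero {A : Subfield U} : Itg v A 0 := Itg.of_mem A.zero_mem (by simp)
theorem Itg.v_le {A : Subfield U} {b : U} (hb : Itg v A b) : v b ≤ 1 :=
  itg_iff.1 hb v.valuationSubring fun _ _ h => h

/-- every element of value at most one is a quotient of integral ones. -/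
theorem exists_itg_denom {A N : Subfield U} (hAN : A ≤ N) {x : U} (hxN : x ∈ N)
    (halg : IsAlgebraic A x) (hx : v x ≤ 1) :
    ∃ y ∈ N, v y = 1 ∧ Itg v A y ∧ Itg v A (x * y) := by
  classical
  obtain ⟨p, hp0, hpx⟩ := halg
  -- normalise
  obtain ⟨a, haA, ha1, ⟨k0, hk0⟩, d, had, hsum⟩ : ∃ a : ℕ → U, (∀ i, a i ∈ A) ∧
      (∀ i, v (a i) ≤ 1) ∧
      (∃ k, v (a k) = 1) ∧ ∃ d, (∀ i, d ≤ i → a i = 0) ∧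
        ∑ i ∈ Finset.range d, a i * x ^ i = 0 := by
    obtain ⟨m, hm, hmax⟩ := Finset.exists_max_image p.support (fun i => v (p.coeff i : U))
      (by simpa using hp0)
    have hm0 : (p.coeff m : U) ≠ 0 := by simpa using (Polynomial.mem_support_iff.1 hm)
    refine ⟨fun i => (p.coeff i : U) / p.coeff m, fun i => A.div_mem (p.coeff i).2 (p.coeff m).2,
      fun i => ?_, ⟨m, by simp [hm0]⟩, p.natDegree + 1, fun i hi => ?_, ?_⟩
    · rw [map_div₀]
      by_cases hi : i ∈ p.support
      · exact div_le_one_of_le₀ (hmax i hi) zero_le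
      · simp [Polynomial.notMem_support_iff.1 hi]
    · simp [Polynomial.coeff_eq_zero_of_natDegree_lt (show p.natDegree < i by omega)]
    · rw [aeval_eq_sum_range] at hpx
      have : ∑ i ∈ Finset.range (p.natDegree + 1), (p.coeff i : U) / p.coeff m * x ^ i =
        (∑ i ∈ Finset.range (p.natDegree + 1), (p.coeff i) • x ^ i) / p.coeff m := by
        rw [Finset.sum_div]
        refine Finset.sum_congr rfl fun i _ => ?_
        rw [Subfield.smul_def]; simp only [smul_eq_mul]; ring
      rw [this, hpx, zero_div]
  -- largest index with value one
  obtain ⟨k, hk1, hkd, hkmax⟩ : ∃ k, v (a k) = 1 ∧ k < d ∧ ∀ i, k < i → v (a i) < 1 := by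
    have hS : ((Finset.range d).filter fun i => v (a i) = 1).Nonempty := by
      refine ⟨k0, Finset.mem_filter.2 ⟨Finset.mem_range.2 ?_, hk0⟩⟩
      by_contra hc; rw [had k0 (by omega)] at hk0; simp at hk0
    refine ⟨_, (Finset.mem_filter.1 (Finset.max'_mem _ hS)).2,
      Finset.mem_range.1 (Finset.mem_filter.1 (Finset.max'_mem _ hS)).1, fun i hi => ?_⟩
    refine lt_of_le_of_ne (ha1 i) fun h => ?_
    have : i ∈ (Finset.range d).filter fun i => v (a i) = 1 := by
      refine Finset.mem_filter.2 ⟨Finset.mem_range.2 ?_, h⟩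
      by_contra hc; rw [had i (by omega)] at h; simp at h
    exact absurd hi (not_lt.2 (Finset.le_max' _ _ this))
  let y := ∑ i ∈ Finset.range (d - k), a (k + i) * x ^ i
  have hyx : y * x ^ k + ∑ i ∈ Finset.range k, a i * x ^ i = 0 := by
    rw [← hsum, show d = k + (d - k) by omega, Finset.sum_range_add, add_comm]
    congr 1
    simp only [y]
    rw [Finset.sum_mul]
    refine Finset.sum_congr rfl fun i _ => ?_
    rw [pow_add]; ring
  have hyN : y ∈ N := N.sum_mem fun i _ => N.mul_mem (hAN (haA _)) (N.pow_mem hxN _)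
  have key : ∀ V : ValuationSubring U, (∀ a ∈ A, v a ≤ 1 → a ∈ V) → y ∈ V ∧ x * y ∈ V := by
    intro V hV
    have haV : ∀ i, a i ∈ V := fun i => hV _ (haA i) (ha1 i)
    by_cases hxV : x ∈ V
    · have : y ∈ V := sum_mem fun i _ => mul_mem (haV _) (pow_mem hxV _)
      exact ⟨this, mul_mem hxV this⟩
    · have hx0 : x ≠ 0 := by rintro rfl; exact hxV V.zero_mem
      have hxi : x⁻¹ ∈ V := (V.mem_or_inv_mem x).resolve_left hxV
      have e : y * x = - ∑ i ∈ Finset.range k, a i * x⁻¹ ^ (k - 1 - i) := by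
        rcases Nat.eq_zero_or_pos k with hk | hk
        · subst hk
          simp at hyx; simp [hyx]
        have h1 : x ^ (k - 1) ≠ 0 := pow_ne_zero _ hx0
        apply mul_right_cancel₀ h1
        rw [mul_assoc, ← pow_succ', show k - 1 + 1 = k by omega, eq_neg_of_add_eq_zero_left hyx, neg_mul,
          Finset.sum_mul]
        congr 1
        refine Finset.sum_congr rfl fun i hi => ?_
        have := Finset.mem_range.1 hi
        rw [show k - 1 = (k - 1 - i) + i by omega, pow_add, show k - 1 - i + i - i = k - 1 - i by omega,
          inv_pow]
        field_simp
      have h2 : y * x ∈ V := by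
        rw [e]; exact neg_mem (sum_mem fun i _ => mul_mem (haV _) (pow_mem hxi _))
      refine ⟨?_, by rwa [mul_comm]⟩
      have := mul_mem h2 hxi
      rwa [mul_assoc, mul_inv_cancel₀ hx0, mul_one] at this
  refine ⟨y, hyN, ?_, itg_iff.2 fun V hV => (key V hV).1, itg_iff.2 fun V hV => (key V hV).2⟩
  have : y = a k + ∑ i ∈ Finset.range (d - k - 1), a (k + (i + 1)) * x ^ (i + 1) := by
    simp only [y]
    rw [show d - k = (d - k - 1) + 1 by omega, Finset.sum_range_succ']
    simp [add_comm]
  rw [this, Valuation.map_add_eq_of_lt_left, hk1]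
  rw [hk1]
  refine v.map_sum_lt one_ne_zero fun i _ => ?_
  rw [map_mul, map_pow]
  exact mul_lt_one_of_lt_of_le (hkmax _ (by omega)) (pow_le_one' hx _)

/-- generic linear combination -/
theorem avoid {ι : Type*} {L : Subfield U} (hL : (L : Set U).Infinite)
    (htriv : ∀ l ∈ L, l ≠ 0 → v l = 1) (s : Finset ι) (a c : ι → U) (ha : ∀ i ∈ s, v (a i) ≤ 1)
    (hc : ∀ i ∈ s, v (c i) ≤ 1) (hac : ∀ i ∈ s, v (a i) = 1 ∨ v (c i) = 1) :
    ∃ l ∈ L, l ≠ 0 ∧ ∀ i ∈ s, v (a i + l * c i) = 1 := by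
  classical
  have hL1 : ∀ l ∈ L, v l ≤ 1 := fun l hl => by
    by_cases h : l = 0
    · simp [h]
    · exact (htriv l hl h).le
  have hfin : ∀ i ∈ s, {l | l ∈ L ∧ v (a i + l * c i) < 1}.Subsingleton := by
    rintro i hi l ⟨hl, h1⟩ m ⟨hm, h2⟩
    by_contra hne
    have h3 := v.map_sub_lt h1 h2
    rw [show a i + l * c i - (a i + m * c i) = (l - m) * c i by ring, map_mul,
      htriv _ (L.sub_mem hl hm) (sub_ne_zero.2 hne), one_mul] at h3
    have h4 : v (l * c i) < 1 := by
      rw [map_mul]; exact (mle2 (hL1 l hl) le_rfl).trans_lt h3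
    have h5 := v.map_sub_lt h1 h4
    rw [add_sub_cancel_right] at h5
    rcases hac i hi with h | h
    · exact h5.ne h
    · exact h3.ne h
  have hbad : (insert 0 (⋃ i ∈ s, {l | l ∈ L ∧ v (a i + l * c i) < 1})).Finite :=
    (Set.Finite.biUnion s.finite_toSet fun i hi => (hfin i hi).finite).insert _
  obtain ⟨l, hl, hn⟩ := (hL.sdiff hbad).nonempty
  simp only [Set.mem_insert_iff, Set.mem_iUnion, not_or, not_exists] at hn
  refine ⟨l, hl, hn.1, fun i hi => ?_⟩
  refine le_antisymm (v.map_add_le (ha i hi) ?_) (not_lt.1 fun h => hn.2 i hi ⟨hl, h⟩)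
  rw [map_mul]; exact mle2 (hL1 l hl) (hc i hi)

variable [IsAlgClosed U]

/-- separated element -/
theorem separated_et {A : Subfield U} {N : IntermediateField A U} [FiniteDimensional A N]
    [Algebra.IsSeparable A N] {η : N} (hη : Itg v A (η : U))
    (hsep : ∀ φ : N →ₐ[A] U, φ ≠ N.val → v (φ η - η) = 1) :
    Et v N.toSubfield A.toSubring (η : U) := by
  classical
  have hint : IsIntegral A η := Algebra.IsIntegral.isIntegral η
  set f := (minpoly A η).map (algebraMap A U) with hf
  have hm : f.Monic := (minpoly.monic hint).map _
  have hsplit : f.Splits := IsAlgClosed.splits f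
  have h0 : f.IsRoot (η : U) := by
    have := minpoly.aeval A η
    rw [hf, IsRoot.def, eval_map, ← aeval_def, ← IntermediateField.coe_val,
      Polynomial.aeval_algHom_apply, this, map_zero]
  have hnd : f.roots.Nodup :=
    nodup_roots ((Polynomial.separable_map _).2 (Algebra.IsSeparable.isSeparable A η))
  have hroot : ∀ r ∈ f.roots, ∃ φ : N →ₐ[A] U, φ η = r := by
    intro r hr
    refine IntermediateField.exists_algHom_of_splits_of_aeval (fun s =>
      ⟨Algebra.IsIntegral.isIntegral s, IsAlgClosed.splits _⟩) ?_
    have := (mem_roots hm.ne_zero).1 hr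
    rwa [hf, IsRoot.def, eval_map, ← aeval_def] at this
  refine .root f η (fun i => ?_) η.2 hη.v_le h0 ?_
  · have hc : f.coeff i ∈ A := by rw [hf, coeff_map]; exact ((minpoly A η).coeff i).2
    refine .base _ hc (N.algebraMap_mem ⟨_, hc⟩) ?_
    rw [hsplit.eq_prod_roots_of_monic hm]
    refine prod_coeff_le _ (fun r hr => ?_) i
    obtain ⟨φ, rfl⟩ := hroot r hr
    exact hη.map φ
  · rw [hsplit.eval_root_derivative hm ((mem_roots hm.ne_zero).2 h0), map_multiset_prod,
      Multiset.map_map]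
    refine Multiset.prod_eq_one fun x hx => ?_
    obtain ⟨r, hr, rfl⟩ := Multiset.mem_map.1 hx
    rw [hnd.mem_erase_iff] at hr
    obtain ⟨φ, rfl⟩ := hroot r hr.2
    rw [Function.comp, Valuation.map_sub_swap]
    refine hsep φ ?_
    rintro rfl
    exact hr.1 rfl

/-- the etale lemma -/
theorem VFix.et {A L : Subfield U} {N : IntermediateField A U} [FiniteDimensional A N]
    (h : VFix v A N.toSubfield) (hLA : L ≤ A) (hL : (L : Set U).Infinite)
    (htriv : ∀ l ∈ L, l ≠ 0 → v l = 1) {b : U} (hb : b ∈ N) (hv : v b ≤ 1) :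
    Et v N.toSubfield A.toSubring b := by
  classical
  have := h.separable
  have hAN : A ≤ N.toSubfield := fun a ha => N.algebraMap_mem ⟨a, ha⟩
  have hden : ∀ x ∈ N, v x ≤ 1 → ∃ y ∈ N, v y = 1 ∧ Itg v A y ∧ Itg v A (x * y) := by
    intro x hx hv
    refine exists_itg_denom hAN hx ?_ hv
    exact (Algebra.IsAlgebraic.isAlgebraic (R := A) (⟨x, hx⟩ : N)).algHom N.val
  have hwit : ∀ φ : N →ₐ[A] U, φ ≠ N.val → ∃ y : N, Itg v A (y : U) ∧ v (φ y - y) = 1 := by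
    intro φ hφ
    by_contra hc
    push Not at hc
    have hlt : ∀ y : N, Itg v A (y : U) → v (φ y - y) < 1 := fun y hy =>
      lt_of_le_of_ne (v.map_sub_le (hy.map φ) hy.v_le) (hc y hy)
    have hone : ∀ y : N, Itg v A (y : U) → v (y : U) = 1 → v (φ y) = 1 := by
      intro y hy h1
      have := Valuation.map_add_eq_of_lt_left v ((hlt y hy).trans_eq h1.symm)
      rwa [add_sub_cancel, h1] at this
    have hle : ∀ x : N, v (x : U) ≤ 1 → v (φ x) ≤ 1 := by
      intro x hx
      obtain ⟨y, hy, h1, h2, h3⟩ := hden x x.2 hx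
      have := Itg.map (b := x * ⟨y, hy⟩) φ h3
      rwa [map_mul, map_mul, hone ⟨y, hy⟩ h2 h1, mul_one] at this
    have hl : ∀ x : N, v (x : U) < 1 → v (φ x) < 1 := by
      intro x hx
      obtain ⟨y, hy, h1, h2, h3⟩ := hden x x.2 hx.le
      have h4 := hlt (x * ⟨y, hy⟩) h3
      have h5 : v ((x * ⟨y, hy⟩ : N) : U) < 1 := by
        rw [N.coe_mul, map_mul, h1, mul_one]; exact hx
      have := v.map_add_lt h4 h5
      rwa [sub_add_cancel, map_mul, map_mul, hone ⟨y, hy⟩ h2 h1, mul_one] at this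
    let φ' : U → U := fun x => if hx : x ∈ N then φ ⟨x, hx⟩ else 0
    have hφ' : ∀ x (hx : x ∈ N), φ' x = φ ⟨x, hx⟩ := fun x hx => by simp [φ', hx]
    have hpd : PD v N.toSubfield φ' (fun x => φ' x - x) := by
      have e1 : ∀ x ∈ N.toSubfield, ∀ y ∈ N.toSubfield, φ' (x + y) = φ' x + φ' y := by
        intro x hx y hy
        rw [hφ' x hx, hφ' y hy, hφ' _ (N.add_mem hx hy), ← map_add]; rfl
      have e2 : ∀ x ∈ N.toSubfield, ∀ y ∈ N.toSubfield, φ' (x * y) = φ' x * φ' y := by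
        intro x hx y hy
        rw [hφ' x hx, hφ' y hy, hφ' _ (N.mul_mem hx hy), ← map_mul]; rfl
      refine ⟨e1, e2, ?_, fun x hx => ?_, fun x hx y hy => ?_, fun x hx y hy => ?_⟩
      · rw [hφ' 1 N.one_mem]; exact map_one φ
      · rw [hφ' x hx]
        refine ⟨fun h => ?_, fun h => hle ⟨x, hx⟩ h⟩
        by_contra hc
        push Not at hc
        have hx0 : x ≠ 0 := by rintro rfl; simp at hc
        have h1 := hl ⟨x, hx⟩⁻¹ (by
          show v x⁻¹ < 1
          rw [map_inv₀]; exact inv_lt_one_of_one_lt₀ hc)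
        rw [map_inv₀, map_inv₀] at h1
        have h2 : v (φ ⟨x, hx⟩) ≠ 0 := by
          simp [Subtype.ext_iff, hx0]
        exact absurd ((inv_lt_one₀ (zero_lt_iff.2 h2)).1 h1) (not_lt.2 h)
      · simp only [e1 x hx y hy]; ring
      · simp only [e2 x hx y hy]; ring
    apply hφ
    ext x
    have := h.phi hpd (fun a ha => ?_) x x.2
    · rw [hφ' x x.2] at this; exact this
    · rw [hφ' a (hAN ha)]
      exact φ.commutes ⟨a, ha⟩
  have hL1 : ∀ l ∈ L, v l ≤ 1 := fun l hl => by
    by_cases h : l = 0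
    · simp [h]
    · exact (htriv l hl h).le
  have hmap : ∀ (φ : N →ₐ[A] U) l (hl : l ∈ L) (a b : N), φ (a + algebraMap A N ⟨l, hLA hl⟩ * b) -
      ((a + algebraMap A N ⟨l, hLA hl⟩ * b : N) : U) = (φ a - a) + l * (φ b - b) := by
    intro φ l hl a b
    rw [map_add, map_mul, φ.commutes, N.coe_add, N.coe_mul]
    have h1 : algebraMap A U ⟨l, hLA hl⟩ = l := rfl
    have h2 : ((algebraMap A N ⟨l, hLA hl⟩ : N) : U) = l := rfl
    rw [h1, h2]; ring
  have hitg : ∀ l (hl : l ∈ L) (a b : N), Itg v A (a : U) → Itg v A (b : U) →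
      Itg v A ((a + algebraMap A N ⟨l, hLA hl⟩ * b : N) : U) := fun l hl a b ha hb =>
    ha.add ((Itg.of_mem (hLA hl) (hL1 l hl)).mul hb)
  have hex : ∀ s : Finset (N →ₐ[A] U), (∀ φ ∈ s, φ ≠ N.val) →
      ∃ y : N, Itg v A (y : U) ∧ ∀ φ ∈ s, v (φ y - y) = 1 := by
    intro s
    induction s using Finset.induction_on with
    | empty => exact fun _ => ⟨0, by simpa using Itg.zero, by simp⟩
    | insert φ s hφ ih =>
      intro hs
      obtain ⟨y, hy, hy1⟩ := ih fun ψ hψ => hs ψ (by simp [hψ])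
      obtain ⟨z, hz, hz1⟩ := hwit φ (hs φ (by simp))
      obtain ⟨l, hl, _, hl2⟩ := avoid hL htriv (insert φ s) (fun φ => φ y - y)
        (fun φ => φ z - z) (fun ψ _ => v.map_sub_le (hy.map ψ) hy.v_le)
        (fun ψ _ => v.map_sub_le (hz.map ψ) hz.v_le) (fun ψ hψ => by
          rcases Finset.mem_insert.1 hψ with rfl | h
          · exact Or.inr hz1
          · exact Or.inl (hy1 ψ h))
      refine ⟨y + algebraMap A N ⟨l, hLA hl⟩ * z, hitg l hl y z hy hz, fun ψ hψ => ?_⟩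
      rw [hmap _ l hl]; exact hl2 ψ hψ
  obtain ⟨η, hη, hη1⟩ := hex (Finset.univ.filter fun φ => φ ≠ N.val) (by simp)
  have hη2 := separated_et hη fun φ hφ => hη1 φ (by simp [hφ])
  have hall : ∀ z : N, Itg v A (z : U) → Et v N.toSubfield A.toSubring (z : U) := by
    intro z hz
    obtain ⟨l, hl, _, hl2⟩ := avoid hL htriv (Finset.univ.filter fun φ => φ ≠ N.val)
      (fun φ => φ z - z)
      (fun φ => φ η - η) (fun ψ _ => v.map_sub_le (hz.map ψ) hz.v_le)
      (fun ψ _ => v.map_sub_le (hη.map ψ) hη.v_le) (fun ψ hψ => Or.inr (hη1 ψ hψ))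
    have h1 := separated_et (hitg l hl z η hz hη) fun φ hφ => by
      rw [hmap _ l hl]; exact hl2 φ (by simp [hφ])
    have h2 : Et v N.toSubfield A.toSubring l := .base l (hLA hl) (hAN (hLA hl)) (hL1 l hl)
    have h3 := Et.add _ _ h1 (Et.mul _ _ h2 hη2).neg
    have e : ((z + algebraMap A N ⟨l, hLA hl⟩ * η : N) : U) + -(l * η) = z := by
      rw [N.coe_add, N.coe_mul]
      have h2 : ((algebraMap A N ⟨l, hLA hl⟩ : N) : U) = l := rfl
      rw [h2]; ring
    rwa [e] at h3
  obtain ⟨y, hy, h1, h2, h3⟩ := hden b hb hv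
  have hy0 : y ≠ 0 := by rintro rfl; simp at h1
  have := Et.mul _ _ (hall ⟨b * y, N.mul_mem hb hy⟩ h3) ((hall ⟨y, hy⟩ h2).inv h1)
  simpa [mul_assoc, hy0] using this
end Etale

section AS
theorem exists_AS {A F : Type*} [Field A] [Field F] [Algebra A F] [FiniteDimensional A F]
    [IsGalois A F] (p : ℕ) [Fact p.Prime] [CharP F p] (H : Subgroup (F ≃ₐ[A] F))
    (hH : IsPGroup p H) (hne : H ≠ ⊥) :
    ∃ θ : F, θ ^ p - θ ∈ IntermediateField.fixedField H ∧ θ ∉ IntermediateField.fixedField H := by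
  classical
  have hnt : Nontrivial H := (Subgroup.nontrivial_iff_ne_bot H).2 hne
  have hnil : Group.IsNilpotent H := hH.isNilpotent
  obtain ⟨H1, hH1, -⟩ := (IsCoatomic.eq_top_or_exists_le_coatom (⊥ : Subgroup H)).resolve_left bot_ne_top
  have hnorm : H1.Normal := Subgroup.NormalizerCondition.normal_of_coatom _ Group.normalizerCondition_of_isNilpotent hH1
  obtain ⟨σ, -, hσ⟩ := SetLike.exists_of_lt (lt_top_iff_ne_top.2 hH1.1)
  set K := H1.map H.subtype with hK
  have hσK : (σ : F ≃ₐ[A] F) ∉ K := by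
    rintro ⟨τ, hτ, h⟩
    exact hσ (by rwa [← Subtype.ext h])
  have hcharA : CharP A p := (algebraMap A F).charP_iff (algebraMap A F).injective p |>.2 ‹_›
  -- stability
  have hmemK : ∀ x : F, x ∈ IntermediateField.fixedField K ↔ ∀ τ ∈ H1, (τ : F ≃ₐ[A] F) x = x := by
    intro x
    rw [IntermediateField.mem_fixedField_iff]
    constructor
    · intro h τ hτ; exact h _ ⟨τ, hτ, rfl⟩
    · rintro h _ ⟨τ, hτ, rfl⟩; exact h τ hτ
  have hstab : ∀ x ∈ IntermediateField.fixedField K, (σ : F ≃ₐ[A] F) x ∈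
      IntermediateField.fixedField K := by
    intro x hx
    rw [hmemK] at hx ⊢
    intro τ hτ
    have := hx _ (hnorm.conj_mem τ hτ σ⁻¹)
    have h2 := congrArg (σ : F ≃ₐ[A] F) this
    simp only [Subgroup.coe_mul, AlgEquiv.mul_apply, inv_inv] at h2
    rw [← AlgEquiv.mul_apply, ← AlgEquiv.mul_apply] at h2
    simpa using h2
  obtain ⟨w, hw, hσw⟩ : ∃ w ∈ IntermediateField.fixedField K, (σ : F ≃ₐ[A] F) w ≠ w := by
    by_contra hc
    push Not at hc
    apply hσK
    rw [← IntermediateField.fixingSubgroup_fixedField K, IntermediateField.mem_fixingSubgroup_iff]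
    exact hc
  let T : Module.End A F := (σ : F ≃ₐ[A] F).toLinearMap - 1
  have hT : ∀ x, T x = (σ : F ≃ₐ[A] F) x - x := fun x => rfl
  obtain ⟨n, hn⟩ := hH σ
  have hTn : T ^ p ^ n = 0 := by
    have : CharP (Module.End A F) p := charP_of_injective_algebraMap
      (algebraMap A (Module.End A F)).injective p
    rw [sub_pow_char_pow_of_commute (p := p) (h := Commute.one_right _), one_pow]
    have e : ∀ m : ℕ, ((σ : F ≃ₐ[A] F).toLinearMap : Module.End A F) ^ m =
        (((σ ^ m : H) : F ≃ₐ[A] F).toLinearMap : Module.End A F) := by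
      intro m
      induction m with
      | zero => ext x; simp
      | succ m ih => rw [pow_succ, ih]; ext x; simp [pow_succ]
    rw [e, hn]; ext x; simp
  have hTs : ∀ m, (T ^ m) w ∈ IntermediateField.fixedField K := by
    intro m
    induction m with
    | zero => simpa using hw
    | succ m ih => rw [pow_succ', Module.End.mul_apply, hT]; exact sub_mem (hstab _ ih) ih
  have hex : ∃ k, (T ^ k) w = 0 := ⟨_, by rw [hTn]; rfl⟩
  obtain ⟨u, hu, hu1, hu2⟩ : ∃ u ∈ IntermediateField.fixedField K, T u ≠ 0 ∧ T (T u) = 0 := by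
    have hk := Nat.find_spec hex
    have hk2 := fun m => Nat.find_min (m := m) hex
    set k := Nat.find hex
    have h0 : k ≠ 0 := by
      intro h; rw [h] at hk; simp at hk; rw [hk] at hσw; simp at hσw
    have h1 : k ≠ 1 := by
      intro h; rw [h] at hk; simp [hT, sub_eq_zero] at hk; exact hσw hk
    refine ⟨(T ^ (k - 2)) w, hTs _, ?_, ?_⟩
    · rw [← Module.End.mul_apply, ← pow_succ']; exact hk2 _ (by omega)
    · have e : T ^ k = T * (T * T ^ (k - 2)) := by
        rw [← pow_succ', ← pow_succ', show k - 2 + 1 + 1 = k by omega]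
      rw [e] at hk; exact hk
  have hTu : T u ∈ IntermediateField.fixedField K := by rw [hT]; exact sub_mem (hstab _ hu) hu
  have hθσ : (σ : F ≃ₐ[A] F) (u / T u) = u / T u + 1 := by
    have e1 : (σ : F ≃ₐ[A] F) u = u + T u := by rw [hT]; ring
    have e2 : (σ : F ≃ₐ[A] F) (T u) = T u := by
      rw [hT (T u)] at hu2; exact sub_eq_zero.1 hu2
    rw [map_div₀, e1, e2]; field_simp
  have hθK : u / T u ∈ IntermediateField.fixedField K := div_mem hu hTu
  refine ⟨u / T u, ?_, ?_⟩
  · set y := (u / T u) ^ p - u / T u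
    have hy : y ∈ IntermediateField.fixedField K := sub_mem (pow_mem hθK _) hθK
    have hyσ : (σ : F ≃ₐ[A] F) y = y := by
      simp only [y]
      rw [map_sub, map_pow, hθσ, add_pow_char, one_pow]; ring
    let S : Subgroup H := (MulAction.stabilizer (F ≃ₐ[A] F) y).comap H.subtype
    have hS : S = ⊤ := by
      apply hH1.2
      refine lt_of_le_of_ne (fun τ hτ => (hmemK y).1 hy τ hτ) ?_
      intro h
      exact hσ (h ▸ (hyσ : σ ∈ S))
    rw [IntermediateField.mem_fixedField_iff]
    intro f hf
    have : (⟨f, hf⟩ : H) ∈ S := hS ▸ Subgroup.mem_top _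
    exact this
  · rw [IntermediateField.mem_fixedField_iff]
    intro h
    have := h _ σ.2
    rw [hθσ] at this
    simp at this
end AS

section Tower
variable {U : Type*} [Field U] {Γ₀ : Type*} [LinearOrderedCommGroupWithZero Γ₀]
variable {v : Valuation U Γ₀} {A : Subfield U}

/-- decomposition group -/
def decGp (v : Valuation U Γ₀) (F : IntermediateField A U) : Subgroup (F ≃ₐ[A] F) where
  carrier := {σ | ∀ x : F, v (σ x : U) ≤ 1 ↔ v (x : U) ≤ 1}
  mul_mem' := by
    intro a b ha hb x
    rw [AlgEquiv.mul_apply, ha, hb]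
  one_mem' := fun x => Iff.rfl
  inv_mem' := by
    intro a ha x
    rw [← ha, ← AlgEquiv.mul_apply, mul_inv_cancel]; rfl

theorem mem_decGp_of_le (F : IntermediateField A U) [FiniteDimensional A F] (σ : F ≃ₐ[A] F)
    (h : ∀ x : F, v (x : U) ≤ 1 → v (σ x : U) ≤ 1) : σ ∈ decGp v F := by
  intro x
  refine ⟨fun hx => ?_, h x⟩
  have hn : ∀ n : ℕ, v ((σ ^ n) (σ x) : U) ≤ 1 := by
    intro n
    induction n with
    | zero => simpa using hx
    | succ n ih => rw [pow_succ', AlgEquiv.mul_apply]; exact h _ ih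
  have := hn (orderOf σ - 1)
  rw [← AlgEquiv.mul_apply, ← pow_succ, Nat.sub_add_cancel (orderOf_pos σ), pow_orderOf_eq_one] at this
  exact this

theorem vfix_fixedField [IsAlgClosed U] (F : IntermediateField A U) [FiniteDimensional A F] [IsGalois A F] :
    VFix v A (IntermediateField.lift (IntermediateField.fixedField (decGp v F))).toSubfield := by
  classical
  set N := IntermediateField.lift (IntermediateField.fixedField (decGp v F)) with hN
  have hAN : A ≤ N.toSubfield := fun a ha => N.algebraMap_mem ⟨a, ha⟩
  have hNF : N ≤ F := IntermediateField.lift_le _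
  have hmemN : ∀ x : F, (x : U) ∈ N ↔ ∀ σ ∈ decGp v F, σ x = x := by
    intro x
    rw [hN, IntermediateField.mem_lift, IntermediateField.mem_fixedField_iff]
  have hid : ∀ φ δ : U → U, PD v N.toSubfield φ δ → (∀ a ∈ A, φ a = a) → ∀ x ∈ N, φ x = x := by
    intro φ δ h hA
    let φ0 : (IntermediateField.fixedField (decGp v F)) →ₐ[A] U :=
      { toFun := fun x => φ (x : F)
        map_one' := h.φ_one
        map_zero' := h.φ_zero
        map_add' := fun x y => h.φ_add _ ((IntermediateField.mem_lift _).2 x.2) _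
          ((IntermediateField.mem_lift _).2 y.2)
        map_mul' := fun x y => h.φ_mul _ ((IntermediateField.mem_lift _).2 x.2) _
          ((IntermediateField.mem_lift _).2 y.2)
        commutes' := fun a => hA a a.2 }
    obtain ⟨ψ, hψ⟩ := IntermediateField.exists_algHom_of_splits' (E := F) φ0 fun s =>
      ⟨Algebra.IsIntegral.isIntegral s, IsAlgClosed.splits _⟩
    have hψF : ∀ x : F, ψ x ∈ F := by
      intro x
      exact (AlgHom.fieldRange_of_normal ψ).le ⟨x, rfl⟩
    let σ0 : F →ₐ[A] F := ψ.codRestrict F.toSubalgebra hψF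
    let σ : F ≃ₐ[A] F := AlgEquiv.ofBijective σ0 (Algebra.IsAlgebraic.algHom_bijective σ0)
    have hσN : ∀ x (hx : x ∈ N), (σ ⟨x, hNF hx⟩ : U) = φ x := by
      intro x hx
      have h1 : (⟨x, hNF hx⟩ : F) ∈ IntermediateField.fixedField (decGp v F) :=
        (IntermediateField.mem_fixedField_iff _ _).2 ((hmemN ⟨x, hNF hx⟩).1 hx)
      exact DFunLike.congr_fun hψ ⟨_, h1⟩
    have hσ : σ ∈ decGp v F := by
      refine mem_decGp_of_le F σ fun x hx => ?_
      -- polynomial over N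
      let g : F[X] := ∏ τ : decGp v F, (X - C ((τ : F ≃ₐ[A] F) x))
      have hgm : g.Monic := monic_prod_of_monic _ _ fun τ _ => monic_X_sub_C _
      have hg0 : g.eval x = 0 := by
        simp only [g]
        rw [eval_prod]
        exact Finset.prod_eq_zero (Finset.mem_univ 1) (by simp)
      have hgN : ∀ i, (g.coeff i : U) ∈ N := by
        intro i
        rw [hmemN]
        intro τ hτ
        have : g.map (τ : F →+* F) = g := by
          simp only [g]
          rw [Polynomial.map_prod]
          refine Fintype.prod_equiv (Equiv.mulLeft (⟨τ, hτ⟩ : decGp v F)) _ _ fun ρ => ?_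
          simp
        have h2 := congrArg (fun q => q.coeff i) this
        simpa using h2
      have hgv : ∀ i, v (g.coeff i : U) ≤ 1 := by
        intro i
        have e : g.map (algebraMap F U) = ((Finset.univ.val.map
            fun τ : decGp v F => ((τ : F ≃ₐ[A] F) x : U)).map fun r => X - C r).prod := by
          simp only [g]
          rw [Polynomial.map_prod, Multiset.map_map]
          simp only [Polynomial.map_sub, map_X, map_C]
          rfl
        have := prod_coeff_le (v := v) (Finset.univ.val.map
            fun τ : decGp v F => ((τ : F ≃ₐ[A] F) x : U)) (by
              intro r hr
              obtain ⟨τ, _, rfl⟩ := Multiset.mem_map.1 hr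
              exact (τ.2 x).2 hx) i
        rw [← e, coeff_map] at this
        exact this
      have hroot : (g.map (σ : F →+* F)).eval (σ x) = 0 := by
        have := Polynomial.eval_map_apply (σ : F →+* F) (p := g) x
        rw [hg0, map_zero] at this
        exact this
      have hint : IsIntegral v.integer (σ x : U) := by
        have hc : ∀ i, v (((g.map (σ : F →+* F)).coeff i : F) : U) ≤ 1 := by
          intro i
          rw [coeff_map]
          have : ((σ : F →+* F) (g.coeff i) : U) = φ (g.coeff i) := hσN _ (hgN i)
          rw [this]
          exact (h.φ_val _ (hgN i)).2 (hgv i)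
        have hl : ((g.map (σ : F →+* F)).map (algebraMap F U)) ∈ lifts v.integer.subtype := by
          rw [lifts_iff_coeff_lifts]
          intro i
          rw [coeff_map]
          exact ⟨⟨_, hc i⟩, rfl⟩
        obtain ⟨q, hq, _, hqm⟩ := lifts_and_natDegree_eq_and_monic hl ((hgm.map _).map _)
        refine ⟨q, hqm, ?_⟩
        have e1 : algebraMap v.integer U = v.integer.subtype := rfl
        rw [e1, ← eval_map, hq]
        have := Polynomial.eval_map_apply (algebraMap F U) (p := g.map (σ : F →+* F)) (σ x)
        rw [hroot, map_zero] at this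
        exact this
      exact (Valuation.integer.integers v).isIntegral_iff_v_le_one.1 hint
    intro x hx
    rw [← hσN x hx, (hmemN ⟨x, hNF hx⟩).1 hx σ hσ]
  intro φ δ h hA hδA x hx
  have hφ := hid φ δ h hA
  have hsep : IsSeparable A (⟨x, hNF hx⟩ : F) := Algebra.IsSeparable.isSeparable A _
  set f := (minpoly A (⟨x, hNF hx⟩ : F)).map (algebraMap A U) with hf
  have h0 : f.eval x = 0 := by
    have := minpoly.aeval A (⟨x, hNF hx⟩ : F)
    have h2 := congrArg F.val this
    rw [← aeval_algHom_apply, map_zero] at h2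
    rw [hf, eval_map, ← aeval_def]; exact h2
  have hfA : ∀ i, f.coeff i ∈ A := fun i => by rw [hf, coeff_map]; exact ((minpoly A (⟨x, hNF hx⟩ : F)).coeff i).2
  have hd := h.δ_eval f (fun i => hAN (hfA i)) hx
  rw [h0, h.δ_zero, Finset.sum_eq_zero (fun i _ => by rw [hδA _ (hfA i), zero_mul]), zero_add,
    hφ x hx, PD.dq_self] at hd
  have hne : f.derivative.eval x ≠ 0 := by
    rw [hf, eval_map] at h0
    rw [hf, derivative_map, eval_map]
    exact Separable.eval₂_derivative_ne_zero _ hsep h0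
  exact (mul_eq_zero.1 hd.symm).resolve_right hne
end Tower

theorem charP_of_expChar_prime' {R : Type*} [Field R] (hq : (ringExpChar R).Prime) :
    CharP R (ringExpChar R) := by
  have h : ringExpChar R = ringChar R := by
    unfold ringExpChar at hq ⊢
    rcases max_choice (ringChar R) 1 with h | h
    · exact h
    · rw [h] at hq; exact absurd hq Nat.not_prime_one
  rw [h]; infer_instance

section Tower2
variable {U : Type*} [Field U] {Γ₀ : Type*} [LinearOrderedCommGroupWithZero Γ₀]
variable {v : Valuation U Γ₀} {A : Subfield U}

theorem exists_eigen (F : IntermediateField A U) (T : F ≃ₐ[A] F) (F1 : Subfield U)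
    (hst : ∀ x : F, (x : U) ∈ F1 → (T x : U) ∈ F1)
    (hA1 : ∀ a : A, ∀ x : F, (x : U) ∈ F1 → (a : U) ∈ F1 → ((a • x : F) : U) ∈ F1)
    (s : Multiset A) (hs : ∀ a ∈ s, (a : U) ∈ F1) :
    ∀ u : F, (u : U) ∈ F1 → u ≠ 0 →
      (aeval (T.toLinearMap : Module.End A F) (s.map fun a => X - C a).prod) u = 0 →
      ∃ w : F, (w : U) ∈ F1 ∧ w ≠ 0 ∧ ∃ a ∈ s, T w = a • w := by
  induction s using Multiset.induction_on with
  | empty => intro u _ h0 h; simp at h; exact absurd h h0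
  | cons a s ih =>
    intro u hu h0 h
    rw [Multiset.map_cons, Multiset.prod_cons, mul_comm, map_mul, Module.End.mul_apply] at h
    have e : (aeval (T.toLinearMap : Module.End A F) (X - C a)) u = T u - a • u := by
      simp [Module.algebraMap_end_apply]
    rw [e] at h
    by_cases h1 : T u - a • u = 0
    · exact ⟨u, hu, h0, a, by simp, sub_eq_zero.1 h1⟩
    · obtain ⟨w, h2, h3, b, hb, h4⟩ := ih (fun a ha => hs a (by simp [ha])) (T u - a • u)
        (F1.sub_mem (hst u hu) (hA1 a u hu (hs a (by simp)))) h1 h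
      exact ⟨w, h2, h3, b, by simp [hb], h4⟩

theorem decGp_prime (F : IntermediateField A U) [FiniteDimensional A F]
    (F1 L : Subfield U) [IsAlgClosed L] (hst : ∀ (σ : F ≃ₐ[A] F) (x : F), (x : U) ∈ F1 → (σ x : U) ∈ F1)
    (hgen : F.toSubfield ≤ Subfield.closure (A ∪ F1)) (hF1 : F1 ≤ F.toSubfield)
    (hLA : L ≤ A) (hL1 : L ≤ F1) (htriv : ∀ l ∈ L, l ≠ 0 → v l = 1)
    (hres : ∀ x ∈ F, v x ≤ 1 → ∃ l ∈ L, v (x - l) < 1)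
    (hPG : ∀ u ∈ F1, u ≠ 0 → ∃ k : ℕ, ∃ m ∈ A, v (u ^ ringExpChar U ^ k) = v m)
    (l : ℕ) (hl : l.Prime) (hdvd : l ∣ Nat.card (decGp v F)) : l = ringExpChar U := by
  classical
  by_contra hlq
  have : Fact l.Prime := ⟨hl⟩
  obtain ⟨σ', hσ'⟩ := exists_prime_orderOf_dvd_card' l hdvd
  obtain ⟨σ, hσ⟩ := σ'
  have hord : orderOf σ = l := by rw [← hσ']; exact (Subgroup.orderOf_mk σ hσ).symm
  -- l is nonzero
  have hl0 : (l : U) ≠ 0 := by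
    intro h
    have := ringChar.dvd h
    rcases (Nat.dvd_prime hl).1 this with h1 | h1
    · exact (CharP.ringChar_ne_one h1).elim
    · apply hlq
      rw [ringExpChar, h1, max_eq_left hl.one_le]
  -- nontrivial on F1
  obtain ⟨w, hw, hσw⟩ : ∃ w : F, (w : U) ∈ F1 ∧ σ w ≠ w := by
    by_contra hc
    push Not at hc
    have hall : ∀ x (hx : x ∈ F), σ ⟨x, hx⟩ = ⟨x, hx⟩ := by
      let D : IntermediateField A U :=
        IntermediateField.lift (IntermediateField.fixedField (Subgroup.zpowers σ))
      have hD : ∀ x (hx : x ∈ F), σ ⟨x, hx⟩ = ⟨x, hx⟩ → x ∈ D := by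
        intro x hx h
        refine (IntermediateField.mem_lift (⟨x, hx⟩ : F)).2 ?_
        rw [IntermediateField.mem_fixedField_iff]
        intro τ hτ
        have h2 : Subgroup.zpowers σ ≤ MulAction.stabilizer (F ≃ₐ[A] F) (⟨x, hx⟩ : F) := by
          rw [Subgroup.zpowers_le]; exact h
        exact h2 hτ
      have hle : F.toSubfield ≤ D.toSubfield := hgen.trans (Subfield.closure_le.2 (by
        rintro x (hx | hx)
        · exact D.algebraMap_mem ⟨x, hx⟩
        · exact hD x (hF1 hx) (hc ⟨x, hF1 hx⟩ hx)))
      intro x hx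
      have := (IntermediateField.mem_lift (⟨x, hx⟩ : F)).1 (hle hx)
      rw [IntermediateField.mem_fixedField_iff] at this
      exact this σ (Subgroup.mem_zpowers σ)
    have : σ = 1 := by ext x; exact congrArg Subtype.val (hall x x.2)
    rw [this, orderOf_one] at hord
    exact hl.one_lt.ne hord
  have hlL : (l : L) ≠ 0 := fun h => hl0 (by simpa using congrArg (Subtype.val) h)
  obtain ⟨s, hs, hsp⟩ : ∃ s : Multiset L, (∀ a ∈ s, a ^ l = 1 ∧ a ≠ 1) ∧
      (X ^ l - 1 : L[X]) = (X - C 1) * (s.map fun a => X - C a).prod := by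
    have hm : (X ^ l - 1 : L[X]).Monic := by
      simpa using monic_X_pow_sub_C (1 : L) hl.ne_zero
    have hnd : (X ^ l - 1 : L[X]).roots.Nodup :=
      nodup_roots (by rw [X_pow_sub_one_separable_iff]; exact hlL)
    have h1 : (1 : L) ∈ (X ^ l - 1 : L[X]).roots := by
      rw [mem_roots hm.ne_zero]; simp
    refine ⟨(X ^ l - 1 : L[X]).roots.erase 1, ?_, ?_⟩
    · intro a ha
      rw [hnd.mem_erase_iff, mem_roots hm.ne_zero] at ha
      exact ⟨by simpa [sub_eq_zero] using ha.2, ha.1⟩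
    · rw [← Multiset.prod_cons, ← Multiset.map_cons (fun a : L => X - C a), Multiset.cons_erase h1]
      exact (IsAlgClosed.splits _).eq_prod_roots_of_monic hm
  let ι : L →+* A := Subfield.inclusion hLA
  have hspA : (X ^ l - 1 : A[X]) = (X - C 1) * ((s.map ι).map fun a => X - C a).prod := by
    have := congrArg (Polynomial.map ι) hsp
    simpa [Polynomial.map_multiset_prod, Multiset.map_map, Function.comp_def] using this
  have hT := congrArg (fun f => aeval (σ.toLinearMap : Module.End A F) f w) hspA
  have hpow : ∀ (n : ℕ) (x : F), ((σ.toLinearMap : Module.End A F) ^ n) x = (σ ^ n) x := by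
    intro n; induction n with
    | zero => intro x; rfl
    | succ n ih => intro x; rw [pow_succ, pow_succ, Module.End.mul_apply, ih]; rfl
  have hTl : aeval (σ.toLinearMap : Module.End A F) (X ^ l - 1 : A[X]) w = 0 := by
    rw [map_sub, map_pow, aeval_X, map_one, LinearMap.sub_apply, hpow, ← hord, pow_orderOf_eq_one]
    simp
  simp only [hTl] at hT
  rw [mul_comm, map_mul, Module.End.mul_apply] at hT
  have hw1 : aeval (σ.toLinearMap : Module.End A F) (X - C 1 : A[X]) w = σ w - w := by simp
  rw [hw1] at hT
  obtain ⟨u, hu, hu0, a, ha, hσu⟩ := exists_eigen F σ F1 (hst σ)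
    (fun a x hx ha => by
      have : ((a • x : F) : U) = (a : U) * x := rfl
      rw [this]; exact F1.mul_mem ha hx) (s.map ι)
    (by intro a ha; obtain ⟨b, hb, rfl⟩ := Multiset.mem_map.1 ha; exact hL1 b.2)
    (σ w - w) (F1.sub_mem (hst σ w hw) hw) (sub_ne_zero.2 hσw) hT.symm
  obtain ⟨ξ, hξ, rfl⟩ := Multiset.mem_map.1 ha
  obtain ⟨hξl, hξ1⟩ := hs ξ hξ
  obtain ⟨k, m, hm, hvm⟩ := hPG u hu (by simpa using hu0)
  have hm0 : m ≠ 0 := by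
    rintro rfl
    rw [map_zero, map_eq_zero] at hvm
    exact hu0 (by simpa using eq_zero_of_pow_eq_zero hvm)
  let mA : A := ⟨m, hm⟩
  let y : F := mA⁻¹ • u ^ ringExpChar U ^ k
  have hy : (y : U) = m⁻¹ * (u : U) ^ ringExpChar U ^ k := rfl
  have hvy : v (y : U) = 1 := by
    rw [hy, map_mul, hvm, map_inv₀, inv_mul_cancel₀]; simpa using hm0
  obtain ⟨c, hc, hvc⟩ := hres y y.2 hvy.le
  let z : F := y - algebraMap A F ⟨c, hLA hc⟩
  have hz : (z : U) = y - c := rfl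
  have hσz : v (σ z : U) < 1 := by
    by_cases hz0 : z = 0
    · simp [hz0]
    have hz0' : (z : U) ≠ 0 := by simpa using hz0
    by_contra hcon
    push Not at hcon
    have h1 : v ((σ z⁻¹ : F) : U) ≤ 1 := by
      rw [map_inv₀]
      simpa using inv_le_one_of_one_le₀ hcon
    have h2 := (hσ z⁻¹).1 h1
    have h3 : (1:Γ₀) ≤ v (z : U) := by
      have : (v (z:U))⁻¹ ≤ 1 := by simpa using h2
      exact (inv_le_one₀ (by simpa [zero_lt_iff] using hz0)).1 this
    rw [hz] at h3
    exact absurd hvc h3.not_gt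
  have hσy : σ y = mA⁻¹ • ((ι ξ) ^ ringExpChar U ^ k • u ^ ringExpChar U ^ k) := by
    simp only [y, map_smul, map_pow, hσu, _root_.smul_pow]
  have hσz' : (σ z : U) = (ξ : U) ^ ringExpChar U ^ k * y - c := by
    simp only [z, map_sub, AlgEquiv.commutes, hσy]
    rw [hy]
    change m⁻¹ * ((ξ : U) ^ ringExpChar U ^ k * (u : U) ^ ringExpChar U ^ k) - c = _
    ring
  have hlt : v (((ξ : U) ^ ringExpChar U ^ k - 1) * y) < 1 := by
    have := v.map_sub_lt hσz hvc
    rw [hσz'] at this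
    convert this using 2; ring
  rw [map_mul, hvy, mul_one] at hlt
  have hξq : (ξ : U) ^ ringExpChar U ^ k = 1 := by
    by_contra hne
    exact hlt.ne (htriv _ (L.sub_mem (L.pow_mem ξ.2 _) L.one_mem) (sub_ne_zero.2 hne))
  have hξl' : (ξ : U) ^ l = 1 := by simpa using congrArg Subtype.val hξl
  have hcop : Nat.Coprime (ringExpChar U ^ k) l := by
    apply Nat.Coprime.pow_left
    have hex : ExpChar U (ringExpChar U) := inferInstance
    rcases expChar_is_prime_or_one U (ringExpChar U) with h | h
    · exact (Nat.coprime_primes h hl).2 (Ne.symm hlq)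
    · rw [h]; exact Nat.coprime_one_left _
  have := pow_gcd_eq_one.2 ⟨hξq, hξl'⟩
  rw [hcop.gcd_eq_one, pow_one] at this
  exact hξ1 (Subtype.ext this)

theorem tower [IsAlgClosed U] (F : IntermediateField A U) [FiniteDimensional A F] [IsGalois A F]
    (F1 L : Subfield U) [IsAlgClosed L] (hst : ∀ (σ : F ≃ₐ[A] F) (x : F), (x : U) ∈ F1 → (σ x : U) ∈ F1)
    (hgen : F.toSubfield ≤ Subfield.closure (A ∪ F1)) (hF1 : F1 ≤ F.toSubfield)
    (hLA : L ≤ A) (hL1 : L ≤ F1) (htriv : ∀ l ∈ L, l ≠ 0 → v l = 1)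
    (hres : ∀ x ∈ F, v x ≤ 1 → ∃ l ∈ L, v (x - l) < 1)
    (hPG : ∀ u ∈ F1, u ≠ 0 → ∃ k : ℕ, ∃ m ∈ A, v (u ^ ringExpChar U ^ k) = v m)
    (Q : Subfield U → Prop) (hbase : ∀ N, A ≤ N → N ≤ F.toSubfield → VFix v A N → Q N)
    (hstep : ∀ N θ, A ≤ N → N ≤ F.toSubfield → Q N → θ ∈ F → θ ∉ N →
      θ ^ ringExpChar U - θ ∈ N → (ringExpChar U).Prime → Q (Subfield.closure (N ∪ {θ}))) :
    Q F.toSubfield := by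
  classical
  have hAN : ∀ N : IntermediateField A F, A ≤ (IntermediateField.lift N).toSubfield := fun N x hx =>
    (IntermediateField.lift N).algebraMap_mem ⟨x, hx⟩
  have key : ∀ n : ℕ, ∀ H : Subgroup (F ≃ₐ[A] F), H ≤ decGp v F → Nat.card H = n →
      Q (IntermediateField.lift (IntermediateField.fixedField H)).toSubfield → Q F.toSubfield := by
    intro n
    induction n using Nat.strong_induction_on with
    | _ n ih =>
    intro H hH hn hQ
    by_cases hbot : H = ⊥
    · subst hbot
      rwa [IntermediateField.fixedField_bot, IntermediateField.lift_top] at hQ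
    have hcard1 : Nat.card H ≠ 1 := fun h => hbot (Subgroup.card_eq_one.1 h)
    have hpr : ∀ l : ℕ, l.Prime → l ∣ Nat.card H → l = ringExpChar U := fun l hl hd =>
      decGp_prime F F1 L hst hgen hF1 hLA hL1 htriv hres hPG l hl
        (hd.trans (Subgroup.card_dvd_of_le hH))
    obtain ⟨l, hl, hld⟩ := Nat.exists_prime_and_dvd hcard1
    have hq : (ringExpChar U).Prime := by rw [← hpr l hl hld]; exact hl
    have : Fact (ringExpChar U).Prime := ⟨hq⟩
    have hP : IsPGroup (ringExpChar U) H := IsPGroup.of_card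
      (Nat.eq_prime_pow_of_unique_prime_dvd Nat.card_pos.ne' (fun {d} hd h => hpr d hd h))
    have hch : CharP U (ringExpChar U) := by
      exact charP_of_expChar_prime' hq
    have : CharP F (ringExpChar U) :=
      (RingHom.charP_iff (algebraMap F U) (algebraMap F U).injective _).2 hch
    obtain ⟨θ, hθ1, hθ2⟩ := exists_AS (ringExpChar U) H hP hbot
    set N := IntermediateField.fixedField H with hN
    have hθU : (θ : U) ∉ (IntermediateField.lift N).toSubfield := fun h =>
      hθ2 ((IntermediateField.mem_lift θ).1 h)
    have hQ' := hstep (IntermediateField.lift N).toSubfield θ (hAN N) (IntermediateField.lift_le N)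
      hQ θ.2 hθU ((IntermediateField.mem_lift (θ ^ ringExpChar U - θ)).2 hθ1) hq
    let D : IntermediateField A U := Subfield.toIntermediateField
      (Subfield.closure ((IntermediateField.lift N).toSubfield ∪ {(θ : U)}))
      (fun x => Subfield.subset_closure (Or.inl (hAN N x.2)))
    have hDs : D.toSubfield = Subfield.closure ((IntermediateField.lift N).toSubfield ∪ {(θ : U)}) := rfl
    have hD : D ≤ F := by
      have : D.toSubfield ≤ F.toSubfield := by
        rw [hDs, Subfield.closure_le]
        rintro x (hx | hx)
        · exact IntermediateField.lift_le N hx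
        · rw [Set.mem_singleton_iff.1 hx]; exact θ.2
      exact this
    let N' := IntermediateField.restrict hD
    have hl' : IntermediateField.lift N' = D := IntermediateField.lift_restrict hD
    have hNN' : N ≤ N' := by
      intro x hx
      rw [← IntermediateField.mem_lift, hl']
      exact Subfield.subset_closure (Or.inl ((IntermediateField.mem_lift x).2 hx))
    have hθN' : θ ∈ N' := by
      rw [← IntermediateField.mem_lift, hl']
      exact Subfield.subset_closure (Or.inr rfl)
    have hK : N'.fixingSubgroup ≤ H := by
      have := IntermediateField.fixingSubgroup_antitone hNN'
      rwa [hN, IntermediateField.fixingSubgroup_fixedField] at this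
    have hfix : IntermediateField.fixedField N'.fixingSubgroup = N' :=
      IsGalois.fixedField_fixingSubgroup N'
    have hlt : Nat.card N'.fixingSubgroup < Nat.card H := by
      by_contra hc
      have := Subgroup.eq_of_le_of_card_ge hK (not_lt.1 hc)
      rw [this] at hfix
      exact hθ2 (by rw [hN, hfix]; exact hθN')
    refine ih _ (hn ▸ hlt) N'.fixingSubgroup (hK.trans hH) rfl ?_
    rw [hfix, hl', hDs]
    exact hQ'
  exact key _ _ le_rfl rfl (hbase _ (hAN _) (IntermediateField.lift_le _) (vfix_fixedField F))
end Tower2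

section Acl
variable {U : Type*} [Field U]

theorem lift_sub {E : Subfield U} {f : U[X]} (hc : ∀ i, f.coeff i ∈ E) :
    ∃ g : E[X], g.map E.subtype = f := by
  have : f ∈ Polynomial.lifts E.subtype := by
    rw [lifts_iff_coeff_lifts]; intro n; exact ⟨⟨_, hc n⟩, rfl⟩
  exact (mem_lifts f).1 this

theorem alg_iff {E : Subfield U} {x : U} : IsAlgebraic E x ↔
    ∃ f : U[X], f ≠ 0 ∧ (∀ i, f.coeff i ∈ E) ∧ f.eval x = 0 := by
  constructor
  · rintro ⟨g, hg, h⟩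
    refine ⟨g.map (algebraMap E U), (Polynomial.map_ne_zero_iff (algebraMap E U).injective).2 hg,
      fun i => ?_, ?_⟩
    · rw [coeff_map]; exact (g.coeff i).2
    · rwa [eval_map_algebraMap]
  · rintro ⟨f, hf, hc, h⟩
    obtain ⟨g, hg⟩ := lift_sub hc
    refine ⟨g, ?_, ?_⟩
    · rintro rfl; simp at hg; exact hf hg.symm
    · rw [← eval_map_algebraMap]; erw [hg]; exact h

/-- algebraic closure inside `U` -/
noncomputable def acl (E : Subfield U) : Subfield U := (algebraicClosure E U).toSubfield

theorem mem_acl {E : Subfield U} {x : U} : x ∈ acl E ↔ IsAlgebraic E x :=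
  mem_algebraicClosure_iff

theorem mem_acl' {E : Subfield U} {x : U} : x ∈ acl E ↔
    ∃ f : U[X], f ≠ 0 ∧ (∀ i, f.coeff i ∈ E) ∧ f.eval x = 0 := mem_acl.trans alg_iff

theorem le_acl (E : Subfield U) : E ≤ acl E := fun x hx =>
  mem_acl.2 (isAlgebraic_algebraMap (⟨x, hx⟩ : E))

theorem acl_mono {E E' : Subfield U} (h : E ≤ E') : acl E ≤ acl E' := fun x hx => by
  rw [mem_acl'] at hx ⊢
  obtain ⟨f, h1, h2, h3⟩ := hx
  exact ⟨f, h1, fun i => h (h2 i), h3⟩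

/-- relatively algebraically closed -/
def AC (M : Subfield U) : Prop := acl M ≤ M

theorem acl_acl (E : Subfield U) : AC (acl E) := by
  intro x hx
  have h : IsAlgebraic (algebraicClosure E U) x := mem_acl.1 hx
  exact mem_acl.2 (h.restrictScalars E)

theorem acl_le {E M : Subfield U} (hM : AC M) (h : E ≤ M) : acl E ≤ M := (acl_mono h).trans hM

theorem AC.root {M : Subfield U} (hM : AC M) {f : U[X]} (hf : f ≠ 0) (hc : ∀ i, f.coeff i ∈ M)
    {x : U} (hx : f.eval x = 0) : x ∈ M := hM (mem_acl'.2 ⟨f, hf, hc, hx⟩)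

theorem AC.of_pow {M : Subfield U} (hM : AC M) {n : ℕ} (hn : n ≠ 0) {x : U} (hx : x ^ n ∈ M) :
    x ∈ M := by
  refine hM.root (f := X ^ n - C (x ^ n)) (X_pow_sub_C_ne_zero (Nat.pos_of_ne_zero hn) _) ?_ (by simp)
  intro i
  rw [coeff_sub, coeff_X_pow, coeff_C]
  refine M.sub_mem ?_ ?_ <;> split_ifs <;> simp [M.one_mem, M.zero_mem, hx]

theorem AC.isAlgClosed [IsAlgClosed U] {M : Subfield U} (hM : AC M) : IsAlgClosed M := by
  refine IsAlgClosed.of_exists_root _ fun p hp hi => ?_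
  obtain ⟨x, hx⟩ := IsAlgClosed.exists_aeval_eq_zero U p (degree_pos_of_irreducible hi).ne'
  have : x ∈ M := hM (mem_acl.2 ⟨p, hp.ne_zero, hx⟩)
  refine ⟨⟨x, this⟩, ?_⟩
  apply M.subtype.injective
  rw [map_zero, ← hx]
  exact (Polynomial.aeval_algebraMap_apply U (⟨x, this⟩ : M) p).symm

theorem acl_matroid {E : Subfield U} (s : Set U) (z : U) : z ∈ acl (Subfield.closure (E ∪ s)) ↔
      z ∈ (AlgebraicIndependent.matroid E U).closure s := by
  rw [AlgebraicIndependent.matroid_closure_eq]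
  have e : (Subfield.closure (E ∪ s)) = (IntermediateField.adjoin E s).toSubfield := by
    rw [IntermediateField.adjoin_toSubfield]
    congr 2
    ext a; exact ⟨fun h => ⟨⟨a, h⟩, rfl⟩, by rintro ⟨b, rfl⟩; exact b.2⟩
  have h1 : z ∈ acl (Subfield.closure (E ∪ s)) ↔ IsAlgebraic (IntermediateField.adjoin E s) z := by
    rw [e]; exact mem_acl
  rw [h1, IntermediateField.isAlgebraic_adjoin_iff]
  rfl

theorem acl_exchange {E : Subfield U} {x y : U} (h : y ∈ acl (Subfield.closure (E ∪ {x})))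
    (hy : y ∉ acl E) : x ∈ acl (Subfield.closure (E ∪ {y})) := by
  rw [acl_matroid] at h ⊢
  have hE : E = Subfield.closure (E ∪ (∅ : Set U)) := by simp
  rw [hE, acl_matroid] at hy
  have := (AlgebraicIndependent.matroid E U).closure_exchange (X := ∅) (e := y) (f := x) (by simpa using ⟨h, hy⟩)
  simpa using this.1
end Acl

section GG
variable {U : Type*} [Field U]

theorem fin_sf {S T : Set U} {x : U} (h : x ∈ Subfield.closure (S ∪ T)) :
    ∃ S0 : Finset U, (S0 : Set U) ⊆ S ∧ x ∈ Subfield.closure (S0 ∪ T) := by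
  classical
  have mn : ∀ {A B : Finset U}, (A : Set U) ⊆ B → Subfield.closure ((A : Set U) ∪ T) ≤ Subfield.closure (B ∪ T) :=
    fun h => Subfield.closure_mono (Set.union_subset_union_left _ h)
  induction h using Subfield.closure_induction with
  | mem x hx =>
    rcases hx with hx | hx
    · exact ⟨{x}, by simpa using hx, Subfield.subset_closure (by simp)⟩
    · exact ⟨∅, by simp, Subfield.subset_closure (by simp [hx])⟩
  | one => exact ⟨∅, by simp, one_mem _⟩
  | add x y _ _ h1 h2 =>
    obtain ⟨A, hA, h1⟩ := h1
    obtain ⟨B, hB, h2⟩ := h2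
    exact ⟨A ∪ B, by simp [hA, hB], add_mem (mn (by simp) h1) (mn (by simp) h2)⟩
  | neg x _ h1 =>
    obtain ⟨A, hA, h1⟩ := h1
    exact ⟨A, hA, neg_mem h1⟩
  | inv x _ h1 =>
    obtain ⟨A, hA, h1⟩ := h1
    exact ⟨A, hA, inv_mem h1⟩
  | mul x y _ _ h1 h2 =>
    obtain ⟨A, hA, h1⟩ := h1
    obtain ⟨B, hB, h2⟩ := h2
    exact ⟨A ∪ B, by simp [hA, hB], mul_mem (mn (by simp) h1) (mn (by simp) h2)⟩

theorem fin_sr {S T : Set U} {x : U} (h : x ∈ Subring.closure (S ∪ T)) :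
    ∃ S0 : Finset U, (S0 : Set U) ⊆ S ∧ x ∈ Subring.closure (S0 ∪ T) := by
  classical
  have mn : ∀ {A B : Finset U}, (A : Set U) ⊆ B → Subring.closure ((A : Set U) ∪ T) ≤ Subring.closure (B ∪ T) :=
    fun h => Subring.closure_mono (Set.union_subset_union_left _ h)
  induction h using Subring.closure_induction with
  | mem x hx =>
    rcases hx with hx | hx
    · exact ⟨{x}, by simpa using hx, Subring.subset_closure (by simp)⟩
    · exact ⟨∅, by simp, Subring.subset_closure (by simp [hx])⟩
  | one => exact ⟨∅, by simp, one_mem _⟩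
  | zero => exact ⟨∅, by simp, zero_mem _⟩
  | add x y _ _ h1 h2 =>
    obtain ⟨A, hA, h1⟩ := h1
    obtain ⟨B, hB, h2⟩ := h2
    exact ⟨A ∪ B, by simp [hA, hB], add_mem (mn (by simp) h1) (mn (by simp) h2)⟩
  | neg x _ h1 =>
    obtain ⟨A, hA, h1⟩ := h1
    exact ⟨A, hA, neg_mem h1⟩
  | mul x y _ _ h1 h2 =>
    obtain ⟨A, hA, h1⟩ := h1
    obtain ⟨B, hB, h2⟩ := h2
    exact ⟨A ∪ B, by simp [hA, hB], mul_mem (mn (by simp) h1) (mn (by simp) h2)⟩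

theorem fin_sfs {S T : Set U} (W : Finset U) (h : ∀ x ∈ W, x ∈ Subfield.closure (S ∪ T)) :
    ∃ S0 : Finset U, (S0 : Set U) ⊆ S ∧ ∀ x ∈ W, x ∈ Subfield.closure ((S0 : Set U) ∪ T) := by
  classical
  choose! f hf hP using fun x hx => fin_sf (h x hx)
  refine ⟨W.biUnion f, ?_, fun x hx => Subfield.closure_mono (Set.union_subset_union_left T
    (Finset.coe_subset.2 (Finset.subset_biUnion_of_mem f hx))) (hP x hx)⟩
  intro y hy
  simp only [Finset.coe_biUnion, Set.mem_iUnion] at hy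
  obtain ⟨x, hx, hy⟩ := hy
  exact hf x hx hy

theorem fin_srs {S T : Set U} (W : Finset U) (h : ∀ x ∈ W, x ∈ Subring.closure (S ∪ T)) :
    ∃ S0 : Finset U, (S0 : Set U) ⊆ S ∧ ∀ x ∈ W, x ∈ Subring.closure ((S0 : Set U) ∪ T) := by
  classical
  choose! f hf hP using fun x hx => fin_sr (h x hx)
  refine ⟨W.biUnion f, ?_, fun x hx => Subring.closure_mono (Set.union_subset_union_left T
    (Finset.coe_subset.2 (Finset.subset_biUnion_of_mem f hx))) (hP x hx)⟩
  intro y hy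
  simp only [Finset.coe_biUnion, Set.mem_iUnion] at hy
  obtain ⟨x, hx, hy⟩ := hy
  exact hf x hx hy

theorem exists_poly_of_alg {E : Subfield U} (W : Finset U) (h : ∀ x ∈ W, x ∈ acl E) :
    ∃ p : U[X], p ≠ 0 ∧ (∀ i, p.coeff i ∈ E) ∧ ∀ x ∈ W, p.eval x = 0 := by
  classical
  induction W using Finset.induction_on with
  | empty => exact ⟨1, one_ne_zero, fun i => by rw [coeff_one]; split_ifs; exacts [E.one_mem, E.zero_mem], by simp⟩
  | insert a W ha ih =>
    obtain ⟨p, h1, h2, h3⟩ := ih (fun x hx => h x (by simp [hx]))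
    obtain ⟨f, g1, g2, g3⟩ := mem_acl'.1 (h a (by simp))
    refine ⟨f * p, mul_ne_zero g1 h1, fun i => ?_, ?_⟩
    · rw [coeff_mul]; exact E.sum_mem fun x _ => E.mul_mem (g2 _) (h2 _)
    · intro x hx
      rcases Finset.mem_insert.1 hx with rfl | hx
      · simp [g3]
      · simp [h3 x hx]

/-- the field generated by `B`, `E` and the roots of `q` -/
def Fd (B E : Subfield U) (q : U[X]) : Subfield U :=
  Subfield.closure ((B : Set U) ∪ (E ∪ {x | q.eval x = 0}))

theorem Fd_B {B E : Subfield U} {q : U[X]} : B ≤ Fd B E q := fun _ hx =>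
  Subfield.subset_closure (Or.inl hx)
theorem Fd_E {B E : Subfield U} {q : U[X]} : E ≤ Fd B E q := fun _ hx =>
  Subfield.subset_closure (Or.inr (Or.inl hx))
theorem Fd_root {B E : Subfield U} {q : U[X]} {x : U} (hx : q.eval x = 0) : x ∈ Fd B E q :=
  Subfield.subset_closure (Or.inr (Or.inr hx))
theorem Fd_le {B E N : Subfield U} {q : U[X]} (hB : B ≤ N) (hE : E ≤ N)
    (h : ∀ x, q.eval x = 0 → x ∈ N) : Fd B E q ≤ N := by
  refine Subfield.closure_le.2 ?_
  rintro x (hx | hx | hx)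
  exacts [hB hx, hE hx, h x hx]
theorem Fd_mono {B B' E E' : Subfield U} {p q : U[X]} (hB : B ≤ B') (hE : E ≤ E') (h : p ∣ q) :
    Fd B E p ≤ Fd B' E' q := by
  obtain ⟨r, rfl⟩ := h
  exact Fd_le (hB.trans Fd_B) (hE.trans Fd_E) (fun x hx => Fd_root (by simp [hx]))

variable {Γ₀ : Type*} [LinearOrderedCommGroupWithZero Γ₀]

/-- base ring -/
def Rg (v : Valuation U Γ₀) (B : Subfield U) {n : ℕ} (t : Fin n → U) : Subring U :=
  Subring.closure ({b | b ∈ B ∧ v b ≤ 1} ∪ Set.range t)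

/-- relative uniformization statement -/
def GU (v : Valuation U Γ₀) (B E : Subfield U) (n : ℕ) : Prop :=
  ∀ p : U[X], p ≠ 0 → (∀ i, p.coeff i ∈ E) → ∀ Z : Finset U, (∀ z ∈ Z, z ∈ Fd B E p ∧ v z ≤ 1) →
    ∃ q : U[X], q ≠ 0 ∧ (∀ i, q.coeff i ∈ E) ∧ p ∣ q ∧ ∃ t : Fin n → U,
      (∀ i, t i ∈ Fd B E q ∧ v (t i) ≤ 1) ∧ (∀ z ∈ Z, Et v (Fd B E q) (Rg v B t) z) ∧
      Fd B E q ≤ Subfield.closure ((B : Set U) ∪ {y | Et v (Fd B E q) (Rg v B t) y})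

theorem GU.trans {v : Valuation U Γ₀} {B E1 E2 : Subfield U} {n m : ℕ} (hE : E1 ≤ E2) (X0 : Finset U)
    (hX0 : E2 = Subfield.closure ((E1 : Set U) ∪ X0)) (hB : B ≤ acl E1) (h1 : GU v B E1 n)
    (h2 : GU v (acl E1) E2 m) : GU v B E2 (n + m) := by
  classical
  intro p hp hpE Z hZ
  obtain ⟨q, hq, hqE, hpq, t, ht, hZt, hgen⟩ := h2 p hp hpE Z
    (fun z hz => ⟨Fd_mono hB le_rfl dvd_rfl (hZ z hz).1, (hZ z hz).2⟩)
  set M := acl E1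
  set F2 := Fd M E2 q
  set R2 := Rg v M t
  let W : Finset U := X0 ∪ q.roots.toFinset
  have hW : ∀ x ∈ W, x ∈ Subfield.closure ({y | Et v F2 R2 y} ∪ (M : Set U)) := by
    intro x hx
    rw [Set.union_comm]
    apply hgen
    rcases Finset.mem_union.1 hx with hx | hx
    · apply Fd_E; rw [hX0]; exact Subfield.subset_closure (Or.inr hx)
    · exact Fd_root (by simpa [hq] using hx)
  obtain ⟨Y, hY, hWY⟩ := fin_sfs W hW
  obtain ⟨V3, hV3, hWV⟩ := fin_sfs (S := M) (T := Y) W (fun x hx => by rw [Set.union_comm]; exact hWY x hx)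
  obtain ⟨S, T, hS, hT, htr⟩ := Et.finite_set (v := v) (F := F2) (R := R2) (Y ∪ Z) (by
    intro x hx
    rcases Finset.mem_union.1 hx with hx | hx
    · exact hY hx
    · exact hZt x hx)
  obtain ⟨V1, hV1, hTV⟩ := fin_srs T (fun x hx => (hT x hx).1)
  obtain ⟨V2, hV2, hSV⟩ := fin_sfs (S ∪ Finset.univ.image t) (S := M) (T := E2 ∪ {x | q.eval x = 0}) (by
    intro x hx
    rcases Finset.mem_union.1 hx with hx | hx
    · exact hS hx
    · obtain ⟨i, -, rfl⟩ := Finset.mem_image.1 hx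
      exact (ht i).1)
  obtain ⟨p1, hp1, hp1E, hp1r⟩ := exists_poly_of_alg (E := E1) (V1 ∪ V2 ∪ V3) (by
    intro x hx
    simp only [Finset.mem_union] at hx
    rcases hx with (hx | hx) | hx
    exacts [(hV1 hx).1, hV2 hx, hV3 hx])
  obtain ⟨q1, hq1, hq1E, hpq1, t1, ht1, hZ1, hgen1⟩ := h1 p1 hp1 hp1E V1
    (fun z hz => ⟨Fd_root (hp1r z (by simp [hz])), (hV1 hz).2⟩)
  set F1 := Fd B E1 q1
  set R1 := Rg v B t1
  set F := Fd B E2 (q * q1) with hF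
  have hF1 : F1 ≤ F := Fd_mono le_rfl hE (dvd_mul_left _ _)
  have hroot : ∀ x, p1.eval x = 0 → x ∈ F := fun x hx => by
    obtain ⟨r, hr⟩ := hpq1
    exact hF1 (Fd_root (by rw [hr]; simp [hx]))
  have hVF : ∀ x ∈ V1 ∪ V2 ∪ V3, x ∈ F := fun x hx => hroot x (hp1r x hx)
  have hSF : ∀ x ∈ S ∪ Finset.univ.image t, x ∈ F := by
    intro x hx
    refine (Subfield.closure_le.2 ?_) (hSV x hx)
    rintro y (hy | hy | hy)
    · exact hVF y (by simp at hy; simp [hy])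
    · exact Fd_E hy
    · exact Fd_root (by have : q.eval y = 0 := hy; simp [this])
  let tt : Fin (n + m) → U := Fin.append t1 t
  set R := Rg v B tt
  have hR1 : R1 ≤ R := Subring.closure_mono (Set.union_subset_union_right _ (by
    rintro _ ⟨i, rfl⟩; exact ⟨Fin.castAdd m i, Fin.append_left ..⟩))
  have htR : ∀ i, t i ∈ R := fun i => Subring.subset_closure (Or.inr ⟨Fin.natAdd n i, Fin.append_right ..⟩)
  have hTE : ∀ r ∈ T, Et v F R r := by
    intro r hr
    rw [← mem_EtRing]
    refine (Subring.closure_le.2 ?_) (hTV r hr)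
    rintro y (hy | ⟨i, rfl⟩)
    · exact (hZ1 y hy).mono hF1 hR1
    · exact .base _ (htR i) (hSF _ (by simp)) (ht i).2
  have hYZ := htr F R (fun x hx => hSF x (by simp at hx; simp [hx])) hTE
  refine ⟨q * q1, mul_ne_zero hq hq1, fun i => ?_, hpq.mul_right _, tt, ?_, ?_, ?_⟩
  · rw [coeff_mul]; exact E2.sum_mem fun x _ => E2.mul_mem (hqE _) (hE (hq1E _))
  · intro i
    induction i using Fin.addCases with
    | left i => simp only [tt, Fin.append_left]; exact ⟨hF1 (ht1 i).1, (ht1 i).2⟩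
    | right i => simp only [tt, Fin.append_right]; exact ⟨hSF _ (by simp), (ht i).2⟩
  · exact fun z hz => hYZ z (by simp [hz])
  · set D := Subfield.closure ((B : Set U) ∪ {y | Et v F R y})
    have hF1D : F1 ≤ D := hgen1.trans (Subfield.closure_mono (Set.union_subset_union_right _
      (fun y hy => Et.mono hF1 hR1 hy)))
    have hWD : ∀ x ∈ W, x ∈ D := by
      intro x hx
      refine (Subfield.closure_le.2 ?_) (hWV x hx)
      rintro y (hy | hy)
      · obtain ⟨r, hr⟩ := hpq1
        exact hF1D (Fd_root (by rw [hr]; simp [hp1r y (by simp at hy; simp [hy])]))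
      · exact Subfield.subset_closure (Or.inr (hYZ y (by simp at hy; simp [hy])))
    refine Fd_le (fun x hx => Subfield.subset_closure (Or.inl hx)) ?_ ?_
    · rw [hX0]
      refine Subfield.closure_le.2 ?_
      rintro x (hx | hx)
      · exact hF1D (Fd_E hx)
      · exact hWD x (by simp at hx; simp [W, hx])
    · intro x hx
      rw [eval_mul, mul_eq_zero] at hx
      rcases hx with hx | hx
      · exact hWD x (by simp [W, hx, hq])
      · exact hF1D (Fd_root hx)
end GG

section Rescale
variable {U : Type*} [Field U] {Γ₀ : Type*} [LinearOrderedCommGroupWithZero Γ₀]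
variable {Γ₁ : Type*} [LinearOrderedCommGroupWithZero Γ₁]
variable {v : Valuation U Γ₀} {w : Valuation U Γ₁}

theorem v_eval_sub {f : U[X]} (hf : ∀ i, v (f.coeff i) ≤ 1) {x y : U} (hx : v x ≤ 1) (hy : v y ≤ 1) :
    v (f.eval y - f.eval x) ≤ v (y - x) := by
  rw [eval_eq_sum_range, eval_eq_sum_range, ← Finset.sum_sub_distrib]
  refine v.map_sum_le fun k _ => ?_
  rw [← mul_sub, map_mul]
  exact mle2 (hf k) (PD.v_pow_sub x y hx hy k)

/-- eventually, for small `d` -/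
def Evd (v : Valuation U Γ₀) (L : Subfield U) (P : U → Prop) : Prop :=
  ∃ d0 ∈ L, d0 ≠ 0 ∧ ∀ d ∈ L, d ≠ 0 → v d ≤ v d0 → P d

theorem Evd.and {L : Subfield U} {P Q : U → Prop} (h1 : Evd v L P) (h2 : Evd v L Q) :
    Evd v L (fun d => P d ∧ Q d) := by
  obtain ⟨a, ha, ha0, h1⟩ := h1
  obtain ⟨b, hb, hb0, h2⟩ := h2
  rcases le_total (v a) (v b) with h | h
  · exact ⟨a, ha, ha0, fun d hd hd0 hv => ⟨h1 d hd hd0 hv, h2 d hd hd0 (hv.trans h)⟩⟩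
  · exact ⟨b, hb, hb0, fun d hd hd0 hv => ⟨h1 d hd hd0 (hv.trans h), h2 d hd hd0 hv⟩⟩

theorem Evd.mono {L : Subfield U} {P Q : U → Prop} (h1 : Evd v L P) (h : ∀ d ∈ L, d ≠ 0 → P d → Q d) :
    Evd v L Q := by
  obtain ⟨a, ha, ha0, h1⟩ := h1
  exact ⟨a, ha, ha0, fun d hd hd0 hv => h d hd hd0 (h1 d hd hd0 hv)⟩

theorem Evd.all {L : Subfield U} {P : U → Prop} (h : ∀ d ∈ L, d ≠ 0 → P d) : Evd v L P :=
  ⟨1, L.one_mem, one_ne_zero, fun d hd hd0 _ => h d hd hd0⟩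

theorem Evd.fin {L : Subfield U} {ι : Type*} (s : Finset ι) {P : ι → U → Prop}
    (h : ∀ i ∈ s, Evd v L (P i)) : Evd v L (fun d => ∀ i ∈ s, P i d) := by
  classical
  induction s using Finset.induction_on with
  | empty => exact Evd.all (by simp)
  | insert a s ha ih =>
    refine ((h a (by simp)).and (ih fun i hi => h i (by simp [hi]))).mono ?_
    rintro d - - ⟨h1, h2⟩ i hi
    rcases Finset.mem_insert.1 hi with rfl | hi
    exacts [h1, h2 i hi]

theorem lt_one_of_coarse (hvw : ∀ x, v x ≤ 1 → w x ≤ 1) {x : U} (h : w x < 1) : v x < 1 := by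
  by_contra hc
  push Not at hc
  have hx : x ≠ 0 := by rintro rfl; simp at hc
  have h1 : w x⁻¹ ≤ 1 := hvw _ (by rw [map_inv₀]; exact inv_le_one_of_one_le₀ hc)
  rw [map_inv₀] at h1
  exact h.not_ge ((inv_le_one₀ (zero_lt_iff.2 (by simpa using hx))).1 h1)

theorem exists_small {L : Subfield U} (S : Finset U) (hS : ∀ x ∈ S, x ∈ L ∧ x ≠ 0) :
    ∃ e ∈ L, e ≠ 0 ∧ ∀ x ∈ S, v e ≤ v x := by
  classical
  obtain ⟨e, he, hm⟩ := Finset.exists_min_image (insert 1 S) v ⟨1, by simp⟩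
  refine ⟨e, ?_, ?_, fun x hx => hm x (by simp [hx])⟩
  · rcases Finset.mem_insert.1 he with rfl | h
    exacts [L.one_mem, (hS e h).1]
  · rcases Finset.mem_insert.1 he with rfl | h
    exacts [one_ne_zero, (hS e h).2]

theorem rescale_et (hvw : ∀ x, v x ≤ 1 → w x ≤ 1) {L F : Subfield U}
    (hL : ∀ l ∈ L, l ≠ 0 → w l = 1) (hLF : L ≤ F)
    (hres : ∀ x ∈ F, w x ≤ 1 → ∃ l ∈ L, w (x - l) < 1) {n : ℕ} (t s : Fin n → U)
    (htF : ∀ i, t i ∈ F) (hs : ∀ i, s i ∈ L) (hts : ∀ i, w (t i - s i) < 1)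
    {x : U} (hx : Et w F (Rg w L t) x) :
    ∃ l ∈ L, w (x - l) < 1 ∧ ∀ c ∈ L, Evd v L fun d =>
      Et v F (Rg v L fun i => (t i - s i) / d) (c * (x - l)) := by
  have hL1 : ∀ l ∈ L, w l ≤ 1 := fun l hl => by
    by_cases h : l = 0
    · simp [h]
    · exact (hL l hl h).le
  have hL0 : ∀ l ∈ L, w l < 1 → l = 0 := fun l hl h => by
    by_contra h0; exact h.ne (hL l hl h0)
  have hbase : ∀ l ∈ L, v l ≤ 1 → ∀ d, Et v F (Rg v L fun i => (t i - s i) / d) l := fun l hl hv d =>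
    .base l (Subring.subset_closure (Or.inl ⟨hl, hv⟩)) (hLF hl) hv
  have hadd : ∀ x y, (∃ l ∈ L, w (x - l) < 1 ∧ ∀ c ∈ L, Evd v L fun d =>
      Et v F (Rg v L fun i => (t i - s i) / d) (c * (x - l))) → (∃ l ∈ L, w (y - l) < 1 ∧ ∀ c ∈ L, Evd v L fun d =>
      Et v F (Rg v L fun i => (t i - s i) / d) (c * (y - l))) → ∃ l ∈ L, w (x + y - l) < 1 ∧ ∀ c ∈ L, Evd v L fun d =>
      Et v F (Rg v L fun i => (t i - s i) / d) (c * (x + y - l)) := by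
    rintro x y ⟨l, hl, h1, h2⟩ ⟨m, hm, h3, h4⟩
    refine ⟨l + m, L.add_mem hl hm, ?_, fun c hc => ?_⟩
    · rw [show x + y - (l + m) = (x - l) + (y - m) by ring]; exact w.map_add_lt h1 h3
    · refine ((h2 c hc).and (h4 c hc)).mono ?_
      rintro d - - ⟨e1, e2⟩
      rw [show c * (x + y - (l + m)) = c * (x - l) + c * (y - m) by ring]
      exact .add _ _ e1 e2
  have hmul : ∀ x y, (∃ l ∈ L, w (x - l) < 1 ∧ ∀ c ∈ L, Evd v L fun d =>
      Et v F (Rg v L fun i => (t i - s i) / d) (c * (x - l))) → (∃ l ∈ L, w (y - l) < 1 ∧ ∀ c ∈ L, Evd v L fun d =>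
      Et v F (Rg v L fun i => (t i - s i) / d) (c * (y - l))) → ∃ l ∈ L, w (x * y - l) < 1 ∧ ∀ c ∈ L, Evd v L fun d =>
      Et v F (Rg v L fun i => (t i - s i) / d) (c * (x * y - l)) := by
    rintro x y ⟨l, hl, h1, h2⟩ ⟨m, hm, h3, h4⟩
    refine ⟨l * m, L.mul_mem hl hm, ?_, fun c hc => ?_⟩
    · rw [show x * y - (l * m) = ((x - l) * (y - m) + m * (x - l)) + l * (y - m) by ring]
      refine w.map_add_lt (w.map_add_lt ?_ ?_) ?_
      · rw [map_mul]; exact mul_lt_one_of_nonneg_of_lt_one_left zero_le h1 h3.le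
      · rw [map_mul, mul_comm]; exact mul_lt_one_of_nonneg_of_lt_one_left zero_le h1 (hL1 m hm)
      · rw [map_mul, mul_comm]; exact mul_lt_one_of_nonneg_of_lt_one_left zero_le h3 (hL1 l hl)
    · refine (((h2 c hc).and (h4 1 L.one_mem)).and ((h2 (c * m) (L.mul_mem hc hm)).and
        (h4 (c * l) (L.mul_mem hc hl)))).mono ?_
      rintro d - - ⟨⟨e1, e2⟩, e3, e4⟩
      rw [show c * (x * y - (l * m)) = (c * (x - l)) * (1 * (y - m)) + c * m * (x - l) + c * l * (y - m) by ring]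
      exact .add _ _ (.add _ _ (.mul _ _ e1 e2) e3) e4
  have hLg : ∀ l ∈ L, ∃ m ∈ L, w (l - m) < 1 ∧ ∀ c ∈ L, Evd v L fun d =>
      Et v F (Rg v L fun i => (t i - s i) / d) (c * (l - m)) := fun l hl =>
    ⟨l, hl, by simp, fun c _ => Evd.all fun d _ _ => by simpa using Et.zero⟩
  induction hx with
  | base x h1 h2 h3 =>
    clear h2 h3
    induction h1 using Subring.closure_induction with
    | mem x hx =>
      rcases hx with hx | ⟨i, rfl⟩
      · exact hLg x hx.1
      · refine ⟨s i, hs i, hts i, fun c hc => ?_⟩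
        by_cases hc0 : c = 0
        · exact Evd.all fun d _ _ => by simpa [hc0] using Et.zero
        refine ⟨c⁻¹, L.inv_mem hc, inv_ne_zero hc0, fun d hd hd0 hv => ?_⟩
        rw [show c * (t i - s i) = (c * d) * ((t i - s i) / d) by field_simp]
        refine .mul _ _ (hbase _ (L.mul_mem hc hd) ?_ d) (.base _ (Subring.subset_closure
          (Or.inr ⟨i, rfl⟩)) (F.div_mem (F.sub_mem (htF i) (hLF (hs i))) (hLF hd)) ?_)
        · rw [map_mul]
          calc v c * v d ≤ v c * v c⁻¹ := by gcongr
            _ = 1 := by rw [← map_mul, mul_inv_cancel₀ hc0, map_one]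
        · refine (lt_one_of_coarse hvw ?_).le
          rw [map_div₀, hL d hd hd0, div_one]; exact hts i
    | one => exact hLg 1 L.one_mem
    | zero => exact hLg 0 L.zero_mem
    | add x y _ _ h1 h2 => exact hadd x y h1 h2
    | neg x _ h1 => simpa using hmul (-1) x (hLg (-1) (L.neg_mem L.one_mem)) h1
    | mul x y _ _ h1 h2 => exact hmul x y h1 h2
  | add x y _ _ h1 h2 => exact hadd x y h1 h2
  | mul x y _ _ h1 h2 => exact hmul x y h1 h2
  | root f η hf hη hv h0 h1 ih =>
    choose a ha haw hac using ih
    obtain ⟨l, hl, hlw⟩ := hres η hη hv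
    refine ⟨l, hl, hlw, fun c hc => ?_⟩
    by_cases hc0 : c = 0
    · exact Evd.all fun d _ _ => by simpa [hc0] using Et.zero
    have hlw' : w (l - η) < 1 := by rwa [Valuation.map_sub_swap]
    have hw1 : w l ≤ 1 := hL1 l hl
    set g := taylor l f with hg
    -- decomposition of taylor coefficients
    have hdec : ∀ k, ∃ b ∈ L, w (g.coeff k - b) < 1 ∧ ∀ c ∈ L, Evd v L fun d =>
        Et v F (Rg v L fun i => (t i - s i) / d) (c * (g.coeff k - b)) := by
      intro k
      have e : g.coeff k = ∑ i ∈ Finset.range (f.natDegree + 1), f.coeff i * ((i.choose k : U) * l ^ (i - k)) := by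
        rw [hg, taylor_coeff, hasseDeriv_apply, sum_over_range, eval_finsetSum]
        · refine Finset.sum_congr rfl fun i _ => ?_
          rw [eval_monomial]; ring
        · intro i; simp
      rw [e]
      generalize f.natDegree + 1 = m
      induction m with
      | zero => simpa using hLg 0 L.zero_mem
      | succ m ihm =>
        rw [Finset.sum_range_succ]
        exact hadd _ _ ihm (hmul _ _ ⟨a m, ha m, haw m, hac m⟩
          (hLg _ (L.mul_mem (natCast_mem L _) (L.pow_mem hl _))))
    choose b hb hbw hbc using hdec
    have hg0 : w (g.coeff 0) < 1 := by
      rw [hg, taylor_coeff_zero]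
      have := v_eval_sub (v := w) (fun i => (hf i).le_one) hv hw1
      rw [h0, sub_zero] at this
      exact this.trans_lt hlw'
    have hb0 : b 0 = 0 := hL0 _ (hb 0) (by
      have := w.map_sub_lt hg0 (hbw 0)
      simpa using this)
    have hfd : ∀ i, w (f.derivative.coeff i) ≤ 1 := fun i => by
      rw [coeff_derivative, map_mul]
      exact mul_le_one' (hf _).le_one (hL1 _ (L.add_mem (natCast_mem L _) L.one_mem))
    have hr : w (f.derivative.eval η - b 1) < 1 := by
      have h2 := (v_eval_sub (v := w) hfd hw1 hv).trans_lt hlw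
      have h3 := hbw 1
      rw [hg, taylor_coeff_one] at h3
      have := w.map_add_lt h2 h3
      simpa using this
    set r := b 1 with hrd
    have hr0 : r ≠ 0 := by
      intro h; rw [h, sub_zero, h1] at hr; exact lt_irrefl _ hr
    classical
    obtain ⟨e, he, he0, hes⟩ := exists_small (v := v) (L := L)
      ({1, c⁻¹} ∪ ((Finset.range (f.natDegree + 1)).filter (fun k => b k ≠ 0)).image (fun k => r / b k)) (by
        intro x hx
        simp only [Finset.mem_union, Finset.mem_insert, Finset.mem_singleton, Finset.mem_image,
          Finset.mem_filter] at hx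
        rcases hx with (rfl | rfl) | ⟨k, ⟨-, hk⟩, rfl⟩
        · exact ⟨L.one_mem, one_ne_zero⟩
        · exact ⟨L.inv_mem hc, inv_ne_zero hc0⟩
        · exact ⟨L.div_mem (hb 1) (hb k), div_ne_zero hr0 hk⟩)
    have he1 : v e ≤ 1 := by simpa using hes 1 (by simp)
    have hec : v (c * e) ≤ 1 := by
      have := hes c⁻¹ (by simp)
      rw [map_mul]
      calc v c * v e ≤ v c * v c⁻¹ := by gcongr
        _ = 1 := by rw [← map_mul, mul_inv_cancel₀ hc0, map_one]
    have heb : ∀ k ∈ Finset.range (f.natDegree + 1), v (b k * e / r) ≤ 1 := by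
      intro k hk
      by_cases hk0 : b k = 0
      · simp [hk0]
      have := hes (r / b k) (by
        refine Finset.mem_union_right _ (Finset.mem_image.2 ⟨k, ?_, rfl⟩)
        simp only [Finset.mem_filter]; exact ⟨hk, hk0⟩)
      rw [map_div₀, map_mul]
      calc v (b k) * v e / v r ≤ v (b k) * v (r / b k) / v r := by
            rw [div_eq_mul_inv, div_eq_mul_inv]; exact mul_le_mul_left (mul_le_mul_right this _) _
        _ = 1 := by rw [← map_mul, ← map_div₀]; rw [show b k * (r / b k) / r = 1 by field_simp]; simp
    let y := (η - l) / e
    have hy : e * y = η - l := by simp only [y]; field_simp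
    let H : U[X] := C (r * e)⁻¹ * g.comp (C e * X)
    have hHc : ∀ k, H.coeff k = (r * e)⁻¹ * (g.coeff k * e ^ k) := fun k => by
      simp only [H, coeff_C_mul, comp_C_mul_X_coeff]
    have hev : Evd v L fun d => ∀ k ∈ Finset.range (f.natDegree + 1),
        Et v F (Rg v L fun i => (t i - s i) / d) (H.coeff k) := by
      refine Evd.fin _ fun k hk => ?_
      refine (hbc k ((r * e)⁻¹ * e ^ k) (L.mul_mem (L.inv_mem (L.mul_mem (hb 1) he)) (L.pow_mem he k))).mono ?_
      intro d hd hd0 h3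
      rw [hHc, show (r * e)⁻¹ * (g.coeff k * e ^ k) = (r * e)⁻¹ * e ^ k * (g.coeff k - b k) +
        (r * e)⁻¹ * e ^ k * b k by ring]
      refine .add _ _ h3 (hbase _ (L.mul_mem (L.mul_mem (L.inv_mem (L.mul_mem (hb 1) he)) (L.pow_mem he k)) (hb k)) ?_ d)
      rcases k with _ | _ | k
      · simp [hb0]
      · rw [show (r * e)⁻¹ * e ^ (0 + 1) * b (0 + 1) = 1 by
          rw [zero_add, ← hrd]; field_simp]
        simp
      · rw [show (r * e)⁻¹ * e ^ (k + 1 + 1) * b (k + 1 + 1) = (b (k + 1 + 1) * e / r) * e ^ k by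
          field_simp; ring, map_mul, map_pow]
        exact mul_le_one' (heb _ hk) (pow_le_one' he1 k)
    refine hev.mono fun d hd hd0 hk => ?_
    have hH : ∀ k, Et v F (Rg v L fun i => (t i - s i) / d) (H.coeff k) := fun k => by
      by_cases hkn : k ∈ Finset.range (f.natDegree + 1)
      · exact hk k hkn
      · rw [hHc, coeff_eq_zero_of_natDegree_lt]
        · simpa using Et.zero
        · rw [hg, natDegree_taylor]; simpa using hkn
    rw [show c * (η - l) = c * e * y by rw [← hy]; ring]
    refine .mul _ _ (hbase _ (L.mul_mem hc he) hec d) (.root H y hH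
      (F.div_mem (F.sub_mem hη (hLF hl)) (hLF he)) ?_ ?_ ?_)
    · refine (lt_one_of_coarse hvw ?_).le
      simp only [y]
      rw [map_div₀, hL e he he0, div_one]; exact hlw
    · simp only [H, eval_mul, eval_C, eval_comp, eval_X, hy, hg, taylor_eval, sub_add_cancel, h0, mul_zero]
    · have hd : H.derivative.eval y = f.derivative.eval η / r := by
        simp only [H, derivative_mul, derivative_comp, derivative_C, derivative_X, eval_mul, eval_C,
          eval_comp, eval_X, hy, hg, eval_add, zero_mul, zero_add, eval_zero, mul_one]
        have : eval (η - l) (derivative (taylor l f)) = eval η (derivative f) := by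
          rw [← taylor_coeff_one, taylor_taylor, taylor_coeff_one, sub_add_cancel]
        rw [this]
        field_simp
      rw [hd]
      have h4 : v (f.derivative.eval η / r - 1) < 1 := by
        refine lt_one_of_coarse hvw ?_
        rw [div_sub_one hr0, map_div₀, hL r (hb 1) hr0, div_one]; exact hr
      have := Valuation.map_add_eq_of_lt_left v (h4.trans_eq (map_one v).symm)
      rwa [add_sub_cancel, map_one] at this

theorem GU.rescale (hvw : ∀ x, v x ≤ 1 → w x ≤ 1) {L E C : Subfield U}
    (hL : ∀ l ∈ L, l ≠ 0 → w l = 1) (hC : AC C) (hLC : L ≤ C) (hEC : E ≤ C)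
    (hres : ∀ x ∈ C, w x ≤ 1 → ∃ l ∈ L, w (x - l) < 1) (X0 : Finset U)
    (hX0 : E ≤ Subfield.closure ((L : Set U) ∪ X0)) (hX0E : (X0 : Set U) ⊆ E) {n : ℕ}
    (h : GU w L E n) : GU v L E n := by
  classical
  intro p hp hpE Z hZ
  obtain ⟨q, hq, hqE, hpq, t, ht, hZt, hgen⟩ := h p hp hpE Z (fun z hz => ⟨(hZ z hz).1, hvw _ (hZ z hz).2⟩)
  set F := Fd L E q
  have hFC : F ≤ C := Fd_le hLC hEC fun x hx => hC.root hq (fun i => hEC (hqE i)) hx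
  choose s hs hsw using fun i => hres (t i) (hFC (ht i).1) (ht i).2
  let W : Finset U := X0 ∪ q.roots.toFinset
  obtain ⟨Y, hY, hWY⟩ := fin_sfs (S := {y | Et w F (Rg w L t) y}) (T := L) W (by
    intro x hx
    rw [Set.union_comm]
    apply hgen
    rcases Finset.mem_union.1 hx with hx | hx
    · exact Fd_E (hX0E hx)
    · exact Fd_root (by simpa [hq] using hx))
  have hYZ : ∀ y ∈ Y ∪ Z, Et w F (Rg w L t) y := by
    intro y hy
    rcases Finset.mem_union.1 hy with hy | hy
    exacts [hY hy, hZt y hy]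
  have key := fun y (hy : y ∈ Y ∪ Z) => rescale_et (v := v) hvw hL (F := F) Fd_B
    (fun x hx => hres x (hFC hx)) t s (fun i => (ht i).1) hs hsw (hYZ y hy)
  choose! a ha haw hae using key
  obtain ⟨d, hd, hd0, hde⟩ := Evd.fin (Y ∪ Z) (fun y hy => hae y hy 1 L.one_mem)
  have hde := hde d hd hd0 le_rfl
  simp only [one_mul] at hde
  set R := Rg v L fun i => (t i - s i) / d
  refine ⟨q, hq, hqE, hpq, fun i => (t i - s i) / d, fun i => ⟨?_, ?_⟩, ?_, ?_⟩
  · exact (Fd L E q).div_mem (sub_mem (ht i).1 (Fd_B (hs i))) (Fd_B hd)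
  · refine (lt_one_of_coarse hvw ?_).le
    rw [map_div₀, hL d hd hd0, div_one]; exact hsw i
  · intro z hz
    have hzm : z ∈ Y ∪ Z := by simp [hz]
    have h1 := lt_one_of_coarse hvw (haw z hzm)
    have := Et.add _ _ (hde z hzm) (.base (a z) (Subring.subset_closure (Or.inl ⟨ha z hzm,
      v_le_of_sub h1.le (hZ z hz).2⟩)) (Fd_B (ha z hzm)) (v_le_of_sub h1.le (hZ z hz).2))
    simpa using this
  · have hW : ∀ x ∈ W, x ∈ Subfield.closure ((L : Set U) ∪ {y | Et v F R y}) := by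
      intro x hx
      refine (Subfield.closure_le.2 ?_) (hWY x hx)
      rintro y (hy | hy)
      · have hym : y ∈ Y ∪ Z := by simp at hy; simp [hy]
        have := add_mem (Subfield.subset_closure (s := (L : Set U) ∪ {y | Et v F R y}) (Or.inr (hde y hym)))
          (Subfield.subset_closure (Or.inl (ha y hym)))
        simpa using this
      · exact Subfield.subset_closure (Or.inl hy)
    refine Fd_le (fun x hx => Subfield.subset_closure (Or.inl hx)) ?_ ?_
    · refine hX0.trans (Subfield.closure_le.2 ?_)
      rintro x (hx | hx)
      · exact Subfield.subset_closure (Or.inl hx)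
      · exact hW x (by simp at hx; simp [W, hx])
    · intro x hx
      exact hW x (by simp [W, hx, hq])
end Rescale

section Sep
variable {U : Type*} [Field U]

/-- `x` is separable over `D` -/
def Sp (D : Subfield U) (x : U) : Prop :=
  ∃ f : U[X], f.Separable ∧ (∀ i, f.coeff i ∈ D) ∧ f.eval x = 0

theorem Sp.isSeparable {D : Subfield U} {x : U} (h : Sp D x) : IsSeparable D x := by
  obtain ⟨f, h1, h2, h3⟩ := h
  obtain ⟨g, hg⟩ := lift_sub h2
  have hg' : g.map (algebraMap D U) = f := hg
  rw [← hg', separable_map] at h1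
  exact Separable.of_dvd h1 (minpoly.dvd _ _ (by rw [← eval_map_algebraMap, hg', h3]))

theorem sep_pow {D : Subfield U} {r : U} (h : r ∈ acl D) : ∃ k, ∀ l, k ≤ l → Sp D (r ^ ringExpChar U ^ l) := by
  have : ExpChar D (ringExpChar U) := RingHom.expChar (algebraMap D U) (algebraMap D U).injective _
  have hi : IsIntegral D r := (mem_acl.1 h).isIntegral
  obtain ⟨g, hg, m, hm⟩ := (minpoly.irreducible hi).hasSeparableContraction (ringExpChar U)
  have h0 : Sp D (r ^ ringExpChar U ^ m) := by
    refine ⟨g.map (algebraMap D U), hg.map, fun i => by rw [coeff_map]; exact (g.coeff i).2, ?_⟩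
    rw [eval_map_algebraMap, ← expand_aeval, hm, minpoly.aeval]
  refine ⟨m, fun l hl => ?_⟩
  obtain ⟨f, h1, h2, h3⟩ := h0
  have hx : IsSeparable D (r ^ ringExpChar U ^ m) := Sp.isSeparable ⟨f, h1, h2, h3⟩
  have hx2 : IsSeparable D (r ^ ringExpChar U ^ l) := by
    have h4 := mem_separableClosure_iff.2 hx
    rw [← Nat.sub_add_cancel hl, add_comm, pow_add, pow_mul]
    exact mem_separableClosure_iff.1 (pow_mem h4 _)
  refine ⟨(minpoly D (r ^ ringExpChar U ^ l)).map (algebraMap D U), Polynomial.Separable.map hx2,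
    fun i => by rw [coeff_map]; exact (coeff (minpoly D _) i).2, ?_⟩
  rw [eval_map_algebraMap, minpoly.aeval]

theorem sep_pow_fin {D : Subfield U} (W : Finset U) (h : ∀ r ∈ W, r ∈ acl D) :
    ∃ k, ∀ r ∈ W, Sp D (r ^ ringExpChar U ^ k) := by
  choose! k hk using fun r hr => sep_pow (h r hr)
  exact ⟨W.sup k, fun r hr => hk r hr _ (Finset.le_sup hr)⟩

theorem qpow_inj (k : ℕ) {x y : U} (h : x ^ ringExpChar U ^ k = y ^ ringExpChar U ^ k) : x = y :=
  iterateFrobenius_inj U (ringExpChar U) k h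

theorem qpos (k : ℕ) : ringExpChar U ^ k ≠ 0 := pow_ne_zero _ (expChar_pos U _).ne'

theorem Sp.root [IsAlgClosed U] {B : Subfield U} (hB : AC B) {m : ℕ} {x y : Fin m → U} {n k : ℕ}
    (hy : ∀ i, y i ^ (n * ringExpChar U ^ k) = x i) {r : U}
    (h : Sp (Subfield.closure ((B : Set U) ∪ Set.range x)) (r ^ ringExpChar U ^ k)) :
    Sp (Subfield.closure ((B : Set U) ∪ Set.range y)) r := by
  set A := Subfield.closure ((B : Set U) ∪ Set.range y)
  let φ := iterateFrobenius U (ringExpChar U) k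
  have hle : Subfield.closure ((B : Set U) ∪ Set.range x) ≤ A.map φ := by
    refine Subfield.closure_le.2 ?_
    rintro z (hz | ⟨i, rfl⟩)
    · obtain ⟨w, hw⟩ := IsAlgClosed.exists_pow_nat_eq z (n := ringExpChar U ^ k) (Nat.pos_of_ne_zero (qpos k))
      exact ⟨w, Subfield.subset_closure (Or.inl (hB.of_pow (qpos k) (by rw [hw]; exact hz))), hw⟩
    · refine ⟨y i ^ n, A.pow_mem (Subfield.subset_closure (Or.inr ⟨i, rfl⟩)) _, ?_⟩
      rw [← hy i, pow_mul]; rfl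
  obtain ⟨f, h1, h2, h3⟩ := h
  have : ∃ g : A[X], g.map (φ.comp A.subtype) = f := by
    have : f ∈ Polynomial.lifts (φ.comp A.subtype) := by
      rw [lifts_iff_coeff_lifts]; intro n
      obtain ⟨a, ha, hb⟩ := hle (h2 n)
      exact ⟨⟨a, ha⟩, hb⟩
    exact (mem_lifts f).1 this
  obtain ⟨g, rfl⟩ := this
  refine ⟨g.map A.subtype, ((separable_map _).1 h1).map, fun i => by rw [coeff_map]; exact (g.coeff i).2, ?_⟩
  apply φ.injective
  rw [map_zero]
  change eval (φ r) _ = 0 at h3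
  rw [← Polynomial.map_map, eval_map, eval₂_at_apply] at h3
  exact h3

theorem galois_of [IsAlgClosed U] {A : Subfield U} {q : U[X]} (hq : q ≠ 0) (hqA : ∀ i, q.coeff i ∈ A)
    (hs : ∀ r, q.eval r = 0 → Sp A r) : ∃ F : IntermediateField A U, FiniteDimensional A F ∧
    IsGalois A F ∧ F.toSubfield = Subfield.closure ((A : Set U) ∪ {x | q.eval x = 0}) := by
  obtain ⟨g, hg⟩ := lift_sub hqA
  have hg' : g.map (algebraMap A U) = q := hg
  have hg0 : g ≠ 0 := by rintro rfl; simp at hg'; exact hq hg'.symm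
  let F := IntermediateField.adjoin A (g.rootSet U)
  have hsp : (g.map (algebraMap A U)).Splits := IsAlgClosed.splits _
  have := IntermediateField.adjoin_rootSet_isSplittingField hsp
  have h1 : FiniteDimensional A F := IsSplittingField.finiteDimensional F g
  have h2 : Normal A F := Normal.of_isSplittingField g
  have hmem : ∀ x, x ∈ g.rootSet U ↔ q.eval x = 0 := fun x => by
    rw [mem_rootSet_of_ne hg0, ← eval_map_algebraMap, hg']
  have h3 : Algebra.IsSeparable A F := by
    rw [IntermediateField.isSeparable_adjoin_iff_isSeparable]
    exact fun x hx => (hs x ((hmem x).1 hx)).isSeparable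
  refine ⟨F, h1, ⟨⟩, ?_⟩
  have : g.rootSet U = {x | q.eval x = 0} := Set.ext hmem
  rw [← this]
  apply le_antisymm
  · intro x hx
    exact IntermediateField.adjoin_le_iff (T := (Subfield.closure ((A : Set U) ∪ g.rootSet U)).toIntermediateField
      fun a => Subfield.subset_closure (Or.inl a.2)).2 (fun y hy => Subfield.subset_closure (Or.inr hy)) hx
  · refine Subfield.closure_le.2 ?_
    rintro y (hy | hy)
    · exact F.algebraMap_mem ⟨y, hy⟩
    · exact IntermediateField.subset_adjoin _ _ hy

theorem setup [IsAlgClosed U] {B E : Subfield U} (hB : AC B) {m : ℕ} (x : Fin m → U) (hx0 : ∀ i, x i ≠ 0)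
    (hxE : ∀ i, x i ∈ E) (hE : E ≤ Subfield.closure ((B : Set U) ∪ Set.range x)) {p : U[X]} (hp : p ≠ 0)
    (hpE : ∀ i, p.coeff i ∈ E) {n : ℕ} (hn : (n : U) ≠ 0) : ∃ q : U[X], q ≠ 0 ∧ (∀ i, q.coeff i ∈ E) ∧ p ∣ q ∧
    ∃ y : Fin m → U, (∀ i, q.eval (y i) = 0) ∧ ∃ k, (∀ i, y i ^ (n * ringExpChar U ^ k) = x i) ∧
    ∃ F : IntermediateField (Subfield.closure ((B : Set U) ∪ Set.range y)) U,
      FiniteDimensional (Subfield.closure ((B : Set U) ∪ Set.range y)) F ∧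
      IsGalois (Subfield.closure ((B : Set U) ∪ Set.range y)) F ∧ F.toSubfield = Fd B E q ∧
      (∀ r, q.eval r = 0 → p.eval r = 0 ∨ ∃ i, r ^ n = y i ^ n) := by
  classical
  obtain ⟨k, hk⟩ := sep_pow_fin (D := Subfield.closure ((B : Set U) ∪ Set.range x)) p.roots.toFinset
    (fun r hr => mem_acl'.2 ⟨p, hp, fun i => hE (hpE i), by simpa [hp] using hr⟩)
  have hn0 : n ≠ 0 := by rintro rfl; simp at hn
  have hN : n * ringExpChar U ^ k ≠ 0 := mul_ne_zero hn0 (qpos k)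
  choose y hy using fun i => IsAlgClosed.exists_pow_nat_eq (x i) (Nat.pos_of_ne_zero hN)
  have hX : ∀ i, (X ^ (n * ringExpChar U ^ k) - C (x i)) ≠ 0 := fun i => X_pow_sub_C_ne_zero (Nat.pos_of_ne_zero hN) _
  let q := p * ∏ i, (X ^ (n * ringExpChar U ^ k) - C (x i))
  have hq : q ≠ 0 := mul_ne_zero hp (Finset.prod_ne_zero_iff.2 fun i _ => hX i)
  have hqE : ∀ i, q.coeff i ∈ E := by
    have h1 : ∀ f : U[X], (∀ i, f.coeff i ∈ E) ↔ f ∈ Polynomial.lifts E.subtype := fun f => by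
      rw [lifts_iff_coeff_lifts]; simp
    rw [h1]
    refine mul_mem ((h1 _).1 hpE) (prod_mem fun i _ => ?_)
    rw [sub_eq_add_neg, ← C_neg]
    exact add_mem (pow_mem (X_mem_lifts _) _) (C'_mem_lifts (f := E.subtype) ⟨⟨-x i, E.neg_mem (hxE i)⟩, rfl⟩)
  have hqy : ∀ i, q.eval (y i) = 0 := fun i => by
    simp only [q, eval_mul, eval_prod]
    rw [Finset.prod_eq_zero (Finset.mem_univ i), mul_zero]
    simp [hy]
  have hroot : ∀ r, q.eval r = 0 → p.eval r = 0 ∨ ∃ i, r ^ n = y i ^ n := fun r hr => by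
    simp only [q, eval_mul, eval_prod, mul_eq_zero, Finset.prod_eq_zero_iff] at hr
    refine hr.imp_right fun ⟨i, _, hi⟩ => ⟨i, qpow_inj k ?_⟩
    rw [← pow_mul, ← pow_mul, hy]
    simpa [sub_eq_zero] using hi
  set A := Subfield.closure ((B : Set U) ∪ Set.range y) with hA
  have hyA : ∀ i, y i ∈ A := fun i => Subfield.subset_closure (Or.inr ⟨i, rfl⟩)
  have hEA : E ≤ A := hE.trans (Subfield.closure_le.2 (by
    rintro z (hz | ⟨i, rfl⟩)
    · exact Subfield.subset_closure (Or.inl hz)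
    · rw [← hy i]; exact A.pow_mem (hyA i) _))
  obtain ⟨F, h1, h2, h3⟩ := galois_of (A := A) hq (fun i => hEA (hqE i)) (by
    intro r hr
    rcases hroot r hr with h | ⟨i, hi⟩
    · exact Sp.root hB hy (hk r (by simpa [hp] using h))
    · refine ⟨X ^ n - C (y i ^ n), separable_X_pow_sub_C _ hn ?_, fun j => ?_, by simp [hi]⟩
      · intro h
        apply hx0 i
        rw [← hy i, pow_mul, h, zero_pow (qpos k)]
      · rw [coeff_sub, coeff_X_pow, coeff_C]
        refine A.sub_mem ?_ ?_ <;> split_ifs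
        exacts [A.one_mem, A.zero_mem, A.pow_mem (hyA i) _, A.zero_mem])
  refine ⟨q, hq, hqE, dvd_mul_right _ _, y, hqy, k, hy, F, h1, h2, h3.trans (le_antisymm ?_ ?_), hroot⟩
  · refine Subfield.closure_le.2 ?_
    rintro z (hz | hz)
    · refine (Subfield.closure_le.2 ?_) hz
      rintro z (hz | ⟨i, rfl⟩)
      exacts [Fd_B hz, Fd_root (hqy i)]
    · exact Fd_root hz
  · exact Fd_le (fun z hz => Subfield.subset_closure (Or.inl (Subfield.subset_closure (Or.inl hz))))
      (fun z hz => Subfield.subset_closure (Or.inl (hEA hz))) fun z hz => Subfield.subset_closure (Or.inr hz)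
end Sep

section TR
variable {U : Type*} [Field U] {Γ₀ : Type*} [LinearOrderedCommGroupWithZero Γ₀] {v : Valuation U Γ₀}

theorem v_sum_eq {ι : Type*} (s : Finset ι) (f : ι → U) {i : ι} (hi : i ∈ s)
    (h : ∀ j ∈ s, j ≠ i → v (f j) < v (f i)) : v (∑ j ∈ s, f j) = v (f i) := by
  classical
  rw [← Finset.add_sum_erase s f hi]
  by_cases h0 : v (f i) = 0
  · have : s.erase i = ∅ := by
      refine Finset.eq_empty_of_forall_notMem fun j hj => ?_
      have := h j (Finset.mem_of_mem_erase hj) (Finset.ne_of_mem_erase hj)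
      rw [h0] at this
      exact not_lt_zero this
    rw [this]; simp
  · exact Valuation.map_add_eq_of_lt_left v (v.map_sum_lt h0 fun j hj =>
      h j (Finset.mem_of_mem_erase hj) (Finset.ne_of_mem_erase hj))

theorem val_algb {A : Subfield U} {y : U} {f : U[X]} (hf : f ≠ 0) (hc : ∀ i, f.coeff i ∈ A) (h0 : f.eval y = 0) (hy0 : y ≠ 0) :
    ∃ n : ℕ, n ≠ 0 ∧ n ≤ f.natDegree ∧ ∃ a ∈ A, a ≠ 0 ∧ v y ^ n = v a := by
  obtain ⟨i, hi, hmax⟩ := Finset.exists_max_image f.support (fun i => v (f.coeff i * y ^ i))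
    (by simpa using hf)
  have hne : ∀ j ∈ f.support, f.coeff j ≠ 0 := fun j hj => mem_support_iff.1 hj
  have key : ∃ j ∈ f.support, j ≠ i ∧ v (f.coeff j * y ^ j) = v (f.coeff i * y ^ i) := by
    by_contra hcon
    push Not at hcon
    have := v_sum_eq (v := v) f.support (fun i => f.coeff i * y ^ i) hi
      (fun j hj hji => lt_of_le_of_ne (hmax j hj) (hcon j hj hji))
    rw [show ∑ j ∈ f.support, f.coeff j * y ^ j = 0 by rw [← h0, eval_eq_sum, Polynomial.sum_def], map_zero] at this
    exact mul_ne_zero (hne i hi) (pow_ne_zero _ hy0) (by simpa using this.symm)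
  obtain ⟨j, hj, hji, he⟩ := key
  have hyv : v y ≠ 0 := (Valuation.ne_zero_iff v).2 hy0
  have aux : ∀ {i j}, i ∈ f.support → j ∈ f.support → v (f.coeff j * y ^ j) = v (f.coeff i * y ^ i) → i < j →
      ∃ n : ℕ, n ≠ 0 ∧ n ≤ f.natDegree ∧ ∃ a ∈ A, a ≠ 0 ∧ v y ^ n = v a := by
    intro i j hi hj he hlt
    refine ⟨j - i, by omega, (Nat.sub_le _ _).trans (le_natDegree_of_mem_supp j hj), f.coeff i / f.coeff j, A.div_mem (hc i) (hc j), div_ne_zero (hne i hi) (hne j hj), ?_⟩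
    have h1 : v (f.coeff j) ≠ 0 := (Valuation.ne_zero_iff v).2 (hne j hj)
    rw [map_div₀, eq_div_iff h1]
    rw [map_mul, map_mul, map_pow, map_pow, ← Nat.sub_add_cancel hlt.le, pow_add, ← mul_assoc] at he
    have := mul_right_cancel₀ (pow_ne_zero _ hyv) he
    rw [← this, Nat.sub_add_cancel hlt.le, mul_comm]
  rcases lt_or_gt_of_ne hji with h | h
  · exact aux hj hi he.symm h
  · exact aux hi hj he h

theorem val_alg {A : Subfield U} {y : U} (hy : y ∈ acl A) (hy0 : y ≠ 0) :
    ∃ n : ℕ, n ≠ 0 ∧ ∃ a ∈ A, a ≠ 0 ∧ v y ^ n = v a := by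
  obtain ⟨f, hf, hc, h0⟩ := mem_acl'.1 hy
  obtain ⟨n, hn, -, h⟩ := val_algb (v := v) hf hc h0 hy0
  exact ⟨n, hn, h⟩

theorem triv_acl {A : Subfield U} (h : ∀ a ∈ A, a ≠ 0 → v a = 1) : ∀ a ∈ acl A, a ≠ 0 → v a = 1 := by
  intro y hy hy0
  obtain ⟨n, hn, a, ha, ha0, e⟩ := val_alg (v := v) hy hy0
  rw [h a ha ha0] at e
  exact (pow_eq_one_iff.1 e).resolve_right hn

theorem GU.triv [IsAlgClosed U] {K : Subfield U} {n : ℕ} (e : Fin n → U) (he0 : ∀ i, e i ≠ 0)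
    (h : ∀ a ∈ Subfield.closure ((K : Set U) ∪ Set.range e), a ≠ 0 → v a = 1) :
    GU v (acl K) (Subfield.closure ((K : Set U) ∪ Set.range e)) n := by
  set E := Subfield.closure ((K : Set U) ∪ Set.range e)
  intro p hp hpE Z hZ
  obtain ⟨q, hq, hqE, hpq, y, hqy, k, hy, hF⟩ := setup (acl_acl K) e he0
    (fun i => Subfield.subset_closure (Or.inr ⟨i, rfl⟩))
    (Subfield.closure_mono (Set.union_subset_union_left _ (le_acl K))) hp hpE (n := 1) (by simp)
  set A := Subfield.closure ((acl K : Set U) ∪ Set.range y)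
  obtain ⟨F, h1, h2, h3, -⟩ := hF
  have hKE : K ≤ E := fun z hz => Subfield.subset_closure (Or.inl hz)
  have hFE : Fd (acl K) E q ≤ acl E := Fd_le (acl_mono hKE) (le_acl E) fun z hz => mem_acl'.2 ⟨q, hq, hqE, hz⟩
  have htr : ∀ z ∈ Fd (acl K) E q, z ≠ 0 → v z = 1 := fun z hz => triv_acl h z (hFE hz)
  have htr' : ∀ z ∈ Fd (acl K) E q, v z ≤ 1 := fun z hz => by
    by_cases h : z = 0
    · simp [h]
    · exact (htr z hz h).le
  have hA : ∀ a ∈ A, Et v (Fd (acl K) E q) (Rg v (acl K) y) a := by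
    intro a ha
    induction ha using Subfield.closure_induction with
    | mem x hx =>
      rcases hx with hx | ⟨i, rfl⟩
      · exact .base _ (Subring.subset_closure (Or.inl ⟨hx, htr' x (Fd_B hx)⟩)) (Fd_B hx) (htr' x (Fd_B hx))
      · exact .base _ (Subring.subset_closure (Or.inr ⟨i, rfl⟩)) (Fd_root (hqy i)) (htr' _ (Fd_root (hqy i)))
    | one => exact .one
    | add x y _ _ h1 h2 => exact .add _ _ h1 h2
    | neg x _ h1 => exact .neg h1
    | inv x _ h1 =>
      by_cases hx : x = 0
      · simpa [hx] using Et.zero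
      · exact .inv h1 (htr _ h1.mem hx)
    | mul x y _ _ h1 h2 => exact .mul _ _ h1 h2
  have hall : ∀ z ∈ Fd (acl K) E q, Et v (Fd (acl K) E q) (Rg v (acl K) y) z := by
    intro z hz
    have hzF : z ∈ F := by change z ∈ F.toSubfield; rw [h3]; exact hz
    have hsep : (minpoly A (⟨z, hzF⟩ : F)).Separable := Algebra.IsSeparable.isSeparable A (⟨z, hzF⟩ : F)
    have hmp : minpoly A (⟨z, hzF⟩ : F) = minpoly A z := (minpoly.algebraMap_eq (algebraMap F U).injective _).symm
    rw [hmp] at hsep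
    have he0 : ((minpoly A z).map (algebraMap A U)).eval z = 0 := by
      rw [eval_map_algebraMap, minpoly.aeval]
    have hs := (separable_map (algebraMap A U)).2 hsep
    refine .root ((minpoly A z).map (algebraMap A U)) z (fun i => by rw [coeff_map]; exact hA _ (coeff (minpoly A z) i).2) hz
      (htr' z hz) he0 ?_
    refine htr _ ?_ ?_
    · refine eval_mem_subfield (fun i => deriv_coeff_mem (fun i => ?_) _) hz
      rw [coeff_map]; exact (hA _ (coeff (minpoly A z) i).2).mem
    · have := hs.eval₂_derivative_ne_zero (RingHom.id U) (x := z) (by simpa [eval₂_id] using he0)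
      simpa [eval₂_id] using this
  exact ⟨q, hq, hqE, hpq, y, fun i => ⟨Fd_root (hqy i), htr' _ (Fd_root (hqy i))⟩, fun z hz =>
    hall z (Fd_mono le_rfl le_rfl hpq (hZ z hz).1), fun z hz => Subfield.subset_closure (Or.inr (hall z hz))⟩
end TR

section Prep
variable {U : Type*} [Field U] {Γ₀ : Type*} [LinearOrderedCommGroupWithZero Γ₀] {v : Valuation U Γ₀}

theorem PD.as_int {N : Subfield U} {φ δ : U → U} (h : PD v N φ δ) (hp : (ringExpChar U).Prime) {θ : U}
    (hθ : θ ∈ N) (hv : v θ ≤ 1) (hφ : v (φ θ - θ) < 1) (hd : δ (θ ^ ringExpChar U - θ) = 0) : δ θ = 0 := by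
  have := charP_of_expChar_prime' hp
  let f : U[X] := X ^ ringExpChar U - X
  have hc : ∀ i, f.coeff i = 0 ∨ f.coeff i = 1 ∨ f.coeff i = -1 := fun i => by
    simp only [f, coeff_sub, coeff_X_pow, coeff_X]
    have := hp.one_lt
    split_ifs with h1 h2 h2 <;> simp <;> omega
  have h1 : v (PD.dq f (φ θ) θ) = 1 := by
    refine PD.v_dq f (fun i => ?_) hv hφ ?_
    · rcases hc i with h | h | h <;> simp [h]
    · have : (ringExpChar U : U) = 0 := CharP.cast_eq_zero U _
      simp [f, derivative_X_pow, this]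
  have h2 := h.δ_eval f (fun i => by
    rcases hc i with h | h | h <;> rw [h]
    exacts [N.zero_mem, N.one_mem, N.neg_mem N.one_mem]) hθ
  rw [Finset.sum_eq_zero, zero_add] at h2
  · have h3 : δ θ * PD.dq f (φ θ) θ = 0 := by rw [← h2, ← hd]; simp [f]
    refine (mul_eq_zero.1 h3).resolve_right fun h => ?_
    rw [h] at h1; simp at h1
  · intro k _
    rcases hc k with h4 | h4 | h4 <;> rw [h4]
    · rw [h.δ_zero, zero_mul]
    · rw [h.δ_one, zero_mul]
    · rw [h.δ_neg N.one_mem, h.δ_one]; simp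

theorem v_AS_eq {θ : U} {n : ℕ} (hn : 2 ≤ n) (h : 1 < v θ) : v (θ ^ n - θ) = v θ ^ n := by
  rw [← map_pow]
  apply Valuation.map_sub_eq_of_lt_left
  rw [map_pow]
  exact lt_self_pow₀ h (by omega)

theorem v_AS_le {θ : U} {n : ℕ} (hn : 2 ≤ n) (h : v (θ ^ n - θ) ≤ 1) : v θ ≤ 1 := by
  by_contra hc
  push Not at hc
  rw [v_AS_eq hn hc] at h
  exact (one_lt_pow₀ hc (by omega)).not_ge h

theorem PD.lip_Rg {N B : Subfield U} {φ δ : U → U} (h : PD v N φ δ) (hBN : B ≤ N) (hB : ∀ b ∈ B, δ b = 0)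
    {n : ℕ} {t : Fin n → U} (ht : ∀ i, t i ∈ N) (htv : ∀ i, v (t i) ≤ 1) {γ : Γ₀} (hδ : ∀ i, v (δ (t i)) ≤ γ) :
    ∀ r ∈ Rg v B t, r ∈ N ∧ v r ≤ 1 ∧ v (δ r) ≤ γ := by
  intro r hr
  induction hr using Subring.closure_induction with
  | mem x hx =>
    rcases hx with hx | ⟨i, rfl⟩
    · exact ⟨hBN hx.1, hx.2, by rw [hB x hx.1]; simp⟩
    · exact ⟨ht i, htv i, hδ i⟩
  | one => exact ⟨N.one_mem, by simp, by simp [h.δ_one]⟩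
  | zero => exact ⟨N.zero_mem, by simp, by simp [h.δ_zero]⟩
  | add x y _ _ h1 h2 =>
    refine ⟨N.add_mem h1.1 h2.1, v.map_add_le h1.2.1 h2.2.1, ?_⟩
    rw [h.δ_add _ h1.1 _ h2.1]; exact v.map_add_le h1.2.2 h2.2.2
  | neg x _ h1 =>
    refine ⟨N.neg_mem h1.1, by simpa using h1.2.1, ?_⟩
    rw [h.δ_neg h1.1, Valuation.map_neg]; exact h1.2.2
  | mul x y _ _ h1 h2 =>
    refine ⟨N.mul_mem h1.1 h2.1, by rw [map_mul]; exact mul_le_one' h1.2.1 h2.2.1, ?_⟩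
    rw [h.δ_mul _ h1.1 _ h2.1]
    refine v.map_add_le ?_ ?_ <;> rw [map_mul]
    · exact mle1 h1.2.2 ((h.φ_val _ h2.1).2 h2.2.1)
    · exact mle2 h1.2.1 h2.2.2

theorem adjoin_toSubfield' (A : Subfield U) (S : Set U) :
    (IntermediateField.adjoin A S).toSubfield = Subfield.closure ((A : Set U) ∪ S) := by
  have : Set.range (algebraMap A U) = A := Subtype.range_coe
  rw [← this]; rfl

theorem fg_between {A : Subfield U} {F : IntermediateField A U} [FiniteDimensional A F] {N : Subfield U}
    (hAN : A ≤ N) (hNF : N ≤ F.toSubfield) : ∃ S : Finset U, N = Subfield.closure ((A : Set U) ∪ S) := by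
  let N' : IntermediateField A U := N.toIntermediateField fun a => hAN a.2
  have hN' : N' ≤ F := hNF
  have : FiniteDimensional A N' := FiniteDimensional.of_injective (IntermediateField.inclusion hN').toLinearMap
    (IntermediateField.inclusion hN').injective
  obtain ⟨S, hS⟩ := N'.fg_of_fg_toSubalgebra (Subalgebra.fg_of_fg_toSubmodule
    (Module.Finite.iff_fg.1 (inferInstanceAs (Module.Finite A N'.toSubalgebra.toSubmodule))))
  exact ⟨S, by rw [← adjoin_toSubfield', hS]; rfl⟩

theorem fd_of {A N : Subfield U} (S : Finset U) (hN : N = Subfield.closure ((A : Set U) ∪ S))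
    (hS : ∀ s ∈ S, s ∈ acl A) : ∃ N' : IntermediateField A U, N'.toSubfield = N ∧ FiniteDimensional A N' :=
  ⟨IntermediateField.adjoin A (S : Set U), by rw [hN, adjoin_toSubfield'],
    IntermediateField.finiteDimensional_adjoin fun s hs => (mem_acl.1 (hS s hs)).isIntegral⟩

theorem fd_between {M A A' : Subfield U} {F : IntermediateField A U} [FiniteDimensional A F] {N : Subfield U}
    (hAN : A ≤ N) (hNF : N ≤ F.toSubfield) (S : Finset U) (hA : A = Subfield.closure ((M : Set U) ∪ S))
    (hMA : M ≤ A') (hA' : A' ≤ N) (h : N ≤ acl A') :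
    ∃ N' : IntermediateField A' U, N'.toSubfield = N ∧ FiniteDimensional A' N' := by
  classical
  obtain ⟨S1, hS1⟩ := fg_between hAN hNF
  have hsub : ∀ s ∈ S ∪ S1, s ∈ N := by
    intro s hs
    rcases Finset.mem_union.1 hs with hs | hs
    · apply hAN; rw [hA]; exact Subfield.subset_closure (Or.inr hs)
    · rw [hS1]; exact Subfield.subset_closure (Or.inr hs)
  refine fd_of (S ∪ S1) (le_antisymm ?_ ?_) fun s hs => h (hsub s hs)
  · set D := Subfield.closure ((A' : Set U) ∪ (S ∪ S1 : Finset U))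
    rw [hS1, hA]
    refine Subfield.closure_le.2 ?_
    rintro x (hx | hx)
    · refine (Subfield.closure_le.2 ?_) hx
      rintro x (hx | hx)
      · exact Subfield.subset_closure (Or.inl (hMA hx))
      · exact Subfield.subset_closure (Or.inr (by simp at hx; simp [hx]))
    · exact Subfield.subset_closure (Or.inr (by simp at hx; simp [hx]))
  · refine Subfield.closure_le.2 ?_
    rintro x (hx | hx)
    exacts [hA' hx, hsub x hx]

theorem mem_ring_cl {M : Subfield U} {t u : U} (h : u ∈ Subring.closure ((M : Set U) ∪ {t})) :
    ∃ f : U[X], (∀ i, f.coeff i ∈ M) ∧ f.eval t = u := by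
  have hM : ∀ f : U[X], f ∈ Polynomial.lifts M.subtype → ∀ i, f.coeff i ∈ M := fun f hf i => by
    rw [lifts_iff_coeff_lifts] at hf
    obtain ⟨a, ha⟩ := hf i
    rw [← ha]; exact a.2
  suffices h : ∃ f : M[X], (f.map M.subtype).eval t = u by
    obtain ⟨f, hf⟩ := h
    exact ⟨_, fun i => by rw [coeff_map]; exact (f.coeff i).2, hf⟩
  induction h using Subring.closure_induction with
  | mem x hx =>
    rcases hx with hx | hx
    · exact ⟨C ⟨x, hx⟩, by simp⟩
    · exact ⟨X, by simpa using hx.symm⟩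
  | one => exact ⟨1, by simp⟩
  | zero => exact ⟨0, by simp⟩
  | add x y _ _ h1 h2 =>
    obtain ⟨f, rfl⟩ := h1; obtain ⟨g, rfl⟩ := h2
    exact ⟨f + g, by simp⟩
  | neg x _ h1 => obtain ⟨f, rfl⟩ := h1; exact ⟨-f, by simp⟩
  | mul x y _ _ h1 h2 =>
    obtain ⟨f, rfl⟩ := h1; obtain ⟨g, rfl⟩ := h2
    exact ⟨f * g, by simp⟩

theorem mem_field_cl {M : Subfield U} {t u : U} (h : u ∈ Subfield.closure ((M : Set U) ∪ {t})) :
    ∃ f g : U[X], (∀ i, f.coeff i ∈ M) ∧ (∀ i, g.coeff i ∈ M) ∧ f.eval t / g.eval t = u := by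
  obtain ⟨y, hy, z, hz, rfl⟩ := Subfield.mem_closure_iff.1 h
  obtain ⟨f, hf, rfl⟩ := mem_ring_cl hy
  obtain ⟨g, hg, rfl⟩ := mem_ring_cl hz
  exact ⟨f, g, hf, hg, rfl⟩
end Prep

section Red
variable {U : Type*} [Field U] [IsAlgClosed U]

/-- iterated Frobenius root -/
noncomputable def rt (k : ℕ) : U ≃+* U := (iterateFrobeniusEquiv U (ringExpChar U) k).symm

theorem rt_pow (k : ℕ) (a : U) : rt k a ^ ringExpChar U ^ k = a :=
  (iterateFrobeniusEquiv U (ringExpChar U) k).apply_symm_apply a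

theorem rt_zero (a : U) : rt 0 a = a := by simpa using rt_pow 0 a

theorem rt_succ (k : ℕ) (a : U) : rt (k + 1) (a ^ ringExpChar U) = rt k a := by
  apply qpow_inj (k + 1)
  rw [rt_pow, pow_succ, pow_mul, rt_pow]

/-- reduced coefficients modulo Artin-Schreier -/
noncomputable def redc (K : ℕ) (f : U[X]) (j : ℕ) : U :=
  ∑ k ∈ Finset.range K, rt k (f.coeff (j * ringExpChar U ^ k))

theorem redc_add (K : ℕ) (f g : U[X]) (j : ℕ) : redc K (f + g) j = redc K f j + redc K g j := by
  simp only [redc, coeff_add, map_add, Finset.sum_add_distrib]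

theorem redc_AS (hp : (ringExpChar U).Prime) {K n j : ℕ} (hK : n < K) {H : U[X]} (hH : H.natDegree ≤ n)
    (hj : ¬ ringExpChar U ∣ j) : redc K (H ^ ringExpChar U - H) j = 0 := by
  obtain ⟨K, rfl⟩ := Nat.exists_eq_add_of_lt (Nat.zero_lt_of_lt hK)
  rw [zero_add] at *
  have hc : ∀ i, (H ^ ringExpChar U).coeff (i * ringExpChar U) = H.coeff i ^ ringExpChar U := fun i => by
    rw [← map_frobenius_expand (ringExpChar U), coeff_map, coeff_expand_mul hp.pos]; rfl
  have h0 : (H ^ ringExpChar U).coeff j = 0 := by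
    rw [← map_frobenius_expand (ringExpChar U), coeff_map, coeff_expand hp.pos, if_neg hj, map_zero]
  have hj0 : j ≠ 0 := by rintro rfl; simp at hj
  have hlast : H.coeff (j * ringExpChar U ^ K) = 0 := by
    apply coeff_eq_zero_of_natDegree_lt
    calc H.natDegree ≤ n := hH
      _ ≤ K := by omega
      _ < ringExpChar U ^ K := Nat.lt_pow_self hp.one_lt
      _ ≤ j * ringExpChar U ^ K := Nat.le_mul_of_pos_left _ (Nat.pos_of_ne_zero hj0)
  simp only [redc, coeff_sub, map_sub, Finset.sum_sub_distrib]
  rw [Finset.sum_range_succ', Finset.sum_range_succ (fun k => rt k (H.coeff (j * ringExpChar U ^ k))), hlast]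
  simp only [pow_succ, ← mul_assoc, hc, rt_succ, pow_zero, mul_one, h0, map_zero, add_zero, sub_self]

theorem degree_AS (hp : (ringExpChar U).Prime) (a : U) : (X ^ ringExpChar U - X - C a : U[X]).degree = ringExpChar U := by
  have h1 := hp.one_lt
  have h2 : (X + C a : U[X]).degree < (X ^ ringExpChar U : U[X]).degree := by
    rw [degree_X_add_C, degree_X_pow]; exact_mod_cast h1
  rw [sub_sub, degree_sub_eq_left_of_degree_lt h2, degree_X_pow]

theorem red_exists (hp : (ringExpChar U).Prime) {M : Subfield U} (hM : AC M) {n : ℕ} {f : U[X]}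
    (hf : ∀ i, f.coeff i ∈ M) (hn : f.natDegree ≤ n) : ∃ H Q : U[X], (∀ i, H.coeff i ∈ M) ∧ (∀ i, Q.coeff i ∈ M) ∧
    H.natDegree ≤ n ∧ Q.natDegree ≤ n ∧ (∀ j, ringExpChar U ∣ j → Q.coeff j = 0) ∧
    f = Q + (H ^ ringExpChar U - H) := by
  have add : ∀ f g : U[X], (∃ H Q : U[X], (∀ i, H.coeff i ∈ M) ∧ (∀ i, Q.coeff i ∈ M) ∧
    H.natDegree ≤ n ∧ Q.natDegree ≤ n ∧ (∀ j, ringExpChar U ∣ j → Q.coeff j = 0) ∧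
    f = Q + (H ^ ringExpChar U - H)) → (∃ H Q : U[X], (∀ i, H.coeff i ∈ M) ∧ (∀ i, Q.coeff i ∈ M) ∧
    H.natDegree ≤ n ∧ Q.natDegree ≤ n ∧ (∀ j, ringExpChar U ∣ j → Q.coeff j = 0) ∧
    g = Q + (H ^ ringExpChar U - H)) → (∃ H Q : U[X], (∀ i, H.coeff i ∈ M) ∧ (∀ i, Q.coeff i ∈ M) ∧
    H.natDegree ≤ n ∧ Q.natDegree ≤ n ∧ (∀ j, ringExpChar U ∣ j → Q.coeff j = 0) ∧
    f + g = Q + (H ^ ringExpChar U - H)) := by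
    rintro _ _ ⟨H, Q, h1, h2, h3, h4, h5, rfl⟩ ⟨H', Q', g1, g2, g3, g4, g5, rfl⟩
    refine ⟨H + H', Q + Q', fun i => by rw [coeff_add]; exact M.add_mem (h1 i) (g1 i),
      fun i => by rw [coeff_add]; exact M.add_mem (h2 i) (g2 i), natDegree_add_le_of_degree_le h3 g3,
      natDegree_add_le_of_degree_le h4 g4, fun j hj => by rw [coeff_add, h5 j hj, g5 j hj, add_zero], ?_⟩
    rw [add_pow_expChar]; ring
  have mon : ∀ i, i ≤ n → ∀ a ∈ M, (∃ H Q : U[X], (∀ i, H.coeff i ∈ M) ∧ (∀ i, Q.coeff i ∈ M) ∧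
    H.natDegree ≤ n ∧ Q.natDegree ≤ n ∧ (∀ j, ringExpChar U ∣ j → Q.coeff j = 0) ∧
    monomial i a = Q + (H ^ ringExpChar U - H)) := by
    intro i
    induction i using Nat.strong_induction_on with
    | _ i ih =>
      intro hin a ha
      by_cases hpi : ringExpChar U ∣ i
      · obtain ⟨i', rfl⟩ := hpi
        by_cases hi' : i' = 0
        · subst hi'
          obtain ⟨h, hh⟩ := IsAlgClosed.exists_root (X ^ ringExpChar U - X - C a) (by
            rw [degree_AS hp]; exact_mod_cast hp.ne_zero)
          have hhM : h ∈ M := hM.root (f := X ^ ringExpChar U - X - C a) (by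
            intro h0; have := degree_AS hp a; rw [h0] at this; simp at this) (fun i => by
              rw [coeff_sub, coeff_sub, coeff_X_pow, coeff_X, coeff_C]
              refine M.sub_mem (M.sub_mem ?_ ?_) ?_ <;> split_ifs <;> first | exact ha | exact M.one_mem | exact M.zero_mem) hh
          refine ⟨C h, 0, fun i => ?_, fun i => by simp, by simp, by simp, by simp, ?_⟩
          · rw [coeff_C]; split_ifs; exacts [hhM, M.zero_mem]
          · rw [mul_zero, monomial_zero_left, zero_add, ← C_pow, ← C_sub]
            simp at hh
            rw [sub_eq_zero.1 hh]
        · have hlt : i' < ringExpChar U * i' := lt_mul_of_one_lt_left (Nat.pos_of_ne_zero hi') hp.one_lt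
          have hb : rt 1 a ^ ringExpChar U = a := by simpa using rt_pow 1 a
          have hbM : rt 1 a ∈ M := hM.of_pow hp.ne_zero (by rw [hb]; exact ha)
          have e : (monomial (ringExpChar U * i') a : U[X]) = monomial i' (rt 1 a) +
              ((monomial i' (rt 1 a)) ^ ringExpChar U - monomial i' (rt 1 a)) := by
            rw [monomial_pow, hb, mul_comm]; ring
          rw [e]
          refine add _ _ (ih i' hlt (by omega) _ hbM) ⟨monomial i' (rt 1 a), 0, fun i => ?_, by simp,
            (natDegree_monomial_le _).trans (by omega), by simp, by simp, by simp⟩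
          rw [coeff_monomial]; split_ifs; exacts [hbM, M.zero_mem]
      · refine ⟨0, monomial i a, by simp, fun j => ?_, by simp, (natDegree_monomial_le _).trans hin, fun j hj => ?_, ?_⟩
        · rw [coeff_monomial]; split_ifs; exacts [ha, M.zero_mem]
        · rw [coeff_monomial, if_neg]; rintro rfl; exact hpi hj
        · simp [hp.ne_zero]
  rw [f.as_sum_range' (n + 1) (by omega)]
  have : ∀ m, m ≤ n + 1 → (∃ H Q : U[X], (∀ i, H.coeff i ∈ M) ∧ (∀ i, Q.coeff i ∈ M) ∧
    H.natDegree ≤ n ∧ Q.natDegree ≤ n ∧ (∀ j, ringExpChar U ∣ j → Q.coeff j = 0) ∧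
    ∑ i ∈ Finset.range m, monomial i (f.coeff i) = Q + (H ^ ringExpChar U - H)) := by
    intro m
    induction m with
    | zero => intro _; exact ⟨0, 0, by simp, by simp, by simp, by simp, by simp, by simp [hp.ne_zero]⟩
    | succ m ih =>
      intro hm
      rw [Finset.sum_range_succ]
      exact add _ _ (ih (by omega)) (mon m (by omega) _ (hf m))
  exact this _ le_rfl

theorem redc_eq (hp : (ringExpChar U).Prime) {K n : ℕ} (hK : n < K) {H Q : U[X]} (hH : H.natDegree ≤ n)
    (hQ : ∀ j, ringExpChar U ∣ j → Q.coeff j = 0) {j : ℕ} (hj : ¬ ringExpChar U ∣ j) :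
    redc K (Q + (H ^ ringExpChar U - H)) j = Q.coeff j := by
  rw [redc_add, redc_AS hp hK hH hj, add_zero, redc, Finset.sum_eq_single 0]
  · rw [pow_zero, mul_one, rt_zero]
  · intro k _ hk
    rw [hQ, map_zero]
    exact Dvd.dvd.mul_left (dvd_pow_self _ hk) _
  · intro h; simp at h; omega

/-- polynomial in `c` giving a power of the reduced coefficient of the Taylor expansion at `c` -/
theorem redc_taylor (K : ℕ) (P : U[X]) (j : ℕ) {M : Subfield U} (hP : ∀ i, P.coeff i ∈ M) :
    ∃ G : U[X], (∀ i, G.coeff i ∈ M) ∧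
    ∀ c, redc K (taylor c P) j ^ ringExpChar U ^ K = G.eval c := by
  let G : U[X] := ∑ k ∈ Finset.range K, hasseDeriv (j * ringExpChar U ^ k) P ^ ringExpChar U ^ (K - k)
  refine ⟨G, ?_, fun c => ?_⟩
  · have h1 : ∀ f : U[X], (∀ i, f.coeff i ∈ M) ↔ f ∈ Polynomial.lifts M.subtype := fun f => by
      rw [lifts_iff_coeff_lifts]; simp
    rw [h1]
    refine sum_mem fun k _ => pow_mem ((h1 _).1 fun i => ?_) _
    rw [hasseDeriv_coeff]
    exact M.mul_mem (natCast_mem M _) (hP _)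
  · rw [redc, sum_pow_char_pow]
    simp only [G, eval_finsetSum, eval_pow, taylor_coeff]
    refine Finset.sum_congr rfl fun k hk => ?_
    rw [show ringExpChar U ^ K = ringExpChar U ^ k * ringExpChar U ^ (K - k) by
      rw [← pow_add]; congr 1; have := Finset.mem_range.1 hk; omega, pow_mul, rt_pow]
end Red

section Imm
variable {U : Type*} [Field U] {Γ₀ : Type*} [LinearOrderedCommGroupWithZero Γ₀] {v : Valuation U Γ₀}

/-- an immediate situation -/
structure Imm (v : Valuation U Γ₀) (L M C : Subfield U) : Prop where
  hL : AC L
  hM : AC M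
  hC : AC C
  hLM : L ≤ M
  hMC : M ≤ C
  htriv : ∀ l ∈ L, l ≠ 0 → v l = 1
  h1 : ∀ y ∈ C, v y ≤ 1 → ∃ l ∈ L, v (y - l) < 1
  h2 : ∀ y ∈ C, y ≠ 0 → ∃ e ∈ M, v y = v e
  h3 : ∀ a ∈ C, v a < 1 → ∀ b ∈ C, b ≠ 0 → ∃ n : ℕ, v a ^ n ≤ v b

/-- eventually, for `c` close to `t` -/
def Ev (v : Valuation U Γ₀) (M : Subfield U) (t : U) (P : U → Prop) : Prop :=
  ∃ c0 ∈ M, ∀ c ∈ M, v (t - c) ≤ v (t - c0) → P c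

variable {L M C N : Subfield U} {t : U}

theorem Ev.and {P Q : U → Prop} (h1 : Ev v M t P) (h2 : Ev v M t Q) : Ev v M t (fun d => P d ∧ Q d) := by
  obtain ⟨a, ha, h1⟩ := h1
  obtain ⟨b, hb, h2⟩ := h2
  rcases le_total (v (t - a)) (v (t - b)) with h | h
  · exact ⟨a, ha, fun d hd hv => ⟨h1 d hd hv, h2 d hd (hv.trans h)⟩⟩
  · exact ⟨b, hb, fun d hd hv => ⟨h1 d hd (hv.trans h), h2 d hd hv⟩⟩

theorem Ev.mono {P Q : U → Prop} (h1 : Ev v M t P) (h : ∀ d ∈ M, P d → Q d) : Ev v M t Q := by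
  obtain ⟨a, ha, h1⟩ := h1
  exact ⟨a, ha, fun d hd hv => h d hd (h1 d hd hv)⟩

theorem Ev.all {P : U → Prop} (h : ∀ d ∈ M, P d) : Ev v M t P := ⟨1, M.one_mem, fun d hd _ => h d hd⟩

theorem Ev.ex {P : U → Prop} (h : Ev v M t P) : ∃ c ∈ M, P c := by
  obtain ⟨a, ha, h⟩ := h
  exact ⟨a, ha, h a ha le_rfl⟩

theorem Ev.fin {ι : Type*} (s : Finset ι) {P : ι → U → Prop}
    (h : ∀ i ∈ s, Ev v M t (P i)) : Ev v M t (fun d => ∀ i ∈ s, P i d) := by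
  classical
  induction s using Finset.induction_on with
  | empty => exact Ev.all (by simp)
  | insert a s ha ih =>
    refine ((h a (by simp)).and (ih fun i hi => h i (by simp [hi]))).mono ?_
    rintro d - ⟨h1, h2⟩ i hi
    rcases Finset.mem_insert.1 hi with rfl | hi
    exacts [h1, h2 i hi]

theorem Imm.ne (htM : t ∉ M) {c : U} (hc : c ∈ M) : t - c ≠ 0 := fun h => htM (by rwa [sub_eq_zero.1 h])

theorem Imm.ex (I : Imm v L M C) (ht : t ∈ C) (htM : t ∉ M) {c : U} (hc : c ∈ M) :
    ∃ e ∈ M, e ≠ 0 ∧ v e = v (t - c) := by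
  obtain ⟨e, he, h⟩ := I.h2 (t - c) (C.sub_mem ht (I.hMC hc)) (Imm.ne htM hc)
  refine ⟨e, he, ?_, h.symm⟩
  rintro rfl
  rw [map_zero, map_eq_zero] at h
  exact Imm.ne htM hc h

theorem Imm.closer (I : Imm v L M C) (ht : t ∈ C) (htM : t ∉ M) {c : U} (hc : c ∈ M) :
    ∃ c' ∈ M, v (t - c') < v (t - c) := by
  obtain ⟨e, he, he0, h⟩ := I.ex ht htM hc
  have hv0 : v e ≠ 0 := by simpa using he0
  obtain ⟨l, hl, hv⟩ := I.h1 ((t - c) / e) (C.div_mem (C.sub_mem ht (I.hMC hc)) (I.hMC he)) (by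
    rw [map_div₀, h, div_self (h ▸ hv0)])
  refine ⟨c + e * l, M.add_mem hc (M.mul_mem he (I.hLM hl)), ?_⟩
  rw [show t - (c + e * l) = ((t - c) / e - l) * e by field_simp; ring, map_mul, ← h]
  exact mul_lt_of_lt_one_left (zero_lt_iff.2 hv0) hv

theorem Imm.ev_lt (I : Imm v L M C) (ht : t ∈ C) (htM : t ∉ M) {b : U} (hb : b ∈ M) :
    Ev v M t fun c => v (t - c) < v (t - b) ∧ v (c - b) = v (t - b) := by
  obtain ⟨c', hc', h⟩ := I.closer ht htM hb
  refine ⟨c', hc', fun c _ hv => ⟨hv.trans_lt h, ?_⟩⟩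
  rw [show c - b = (t - b) - (t - c) by ring]
  exact Valuation.map_sub_eq_of_lt_left _ (hv.trans_lt h)

theorem Imm.ev_bad (I : Imm v L M C) (ht : t ∈ C) (htM : t ∉ M) {P : Γ₀ → Prop}
    (hP : ∀ g ≠ 0, ∀ g' ≠ 0, P g → P g' → g = g') : Ev v M t fun c => ¬ P (v (t - c)) := by
  by_cases h : ∃ c0 ∈ M, P (v (t - c0))
  · obtain ⟨c0, hc0, h⟩ := h
    refine (I.ev_lt ht htM hc0).mono fun c hc h1 h2 => ?_
    exact h1.1.ne (hP _ (by simpa using Imm.ne htM hc) _ (by simpa using Imm.ne htM hc0) h2 h)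
  · push Not at h; exact Ev.all h

theorem poly_split [IsAlgClosed U] (hM : AC M) {f : U[X]} (hf : ∀ i, f.coeff i ∈ M) (hf0 : f ≠ 0) :
    ∃ a ∈ M, ∃ s : Multiset U, (∀ r ∈ s, r ∈ M) ∧ f = Polynomial.C a * (s.map fun r => X - Polynomial.C r).prod := by
  refine ⟨f.leadingCoeff, hf _, f.roots, fun r hr => hM.root hf0 hf ((mem_roots hf0).1 hr), ?_⟩
  exact (IsAlgClosed.splits f).eq_prod_roots

theorem Imm.ev_poly [IsAlgClosed U] (I : Imm v L M C) (ht : t ∈ C) (htM : t ∉ M) {f : U[X]} (hf : ∀ i, f.coeff i ∈ M) :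
    Ev v M t fun c => v (f.eval c) = v (f.eval t) := by
  by_cases hf0 : f = 0
  · exact Ev.all fun c _ => by simp [hf0]
  obtain ⟨a, ha, s, hs, rfl⟩ := poly_split I.hM hf hf0
  clear hf hf0
  simp only [eval_mul, eval_C, map_mul]
  refine Ev.mono (P := fun c => v (eval c (s.map fun r => X - Polynomial.C r).prod) = v (eval t (s.map fun r => X - Polynomial.C r).prod)) ?_
    fun c _ h => by rw [h]
  induction s using Multiset.induction_on with
  | empty => exact Ev.all fun c _ => by simp
  | cons r s ih =>
    refine ((I.ev_lt ht htM (hs r (by simp))).and (ih fun r hr => hs r (by simp [hr]))).mono ?_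
    rintro c - ⟨h1, h2⟩
    simp only [Multiset.map_cons, Multiset.prod_cons, eval_mul, map_mul, h2, eval_sub, eval_X, eval_C, h1.2]

/-- a unit times a constant -/
def GoodU (v : Valuation U Γ₀) (M N : Subfield U) (t c u : U) : Prop := ∀ e ∈ M, v e = v (t - c) →
  ∃ m ∈ M, ∃ ε, Et v N (Rg v M fun _ : Fin 1 => (t - c) / e) ε ∧ v ε = 1 ∧ u = m * ε

theorem Imm.ratU [IsAlgClosed U] (I : Imm v L M C) (ht : t ∈ C) (htM : t ∉ M) (hMN : M ≤ N) (htN : t ∈ N) {u : U}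
    (hu : u ∈ Subfield.closure ((M : Set U) ∪ {t})) (hv : v u ≤ 1) : Ev v M t fun c => ∀ e ∈ M, v e = v (t - c) →
      Et v N (Rg v M fun _ : Fin 1 => (t - c) / e) u := by
  have hbase : ∀ c e m, m ∈ M → v m ≤ 1 → Et v N (Rg v M fun _ : Fin 1 => (t - c) / e) m := fun c e m hm hv =>
    Et.base _ (Subring.subset_closure (Or.inl ⟨hm, hv⟩)) (hMN hm) hv
  have hpoly : ∀ f : U[X], (∀ i, f.coeff i ∈ M) → f ≠ 0 → Ev v M t fun c => GoodU v M N t c (f.eval t) := by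
    intro f hf hf0
    obtain ⟨a, ha, s, hs, rfl⟩ := poly_split I.hM hf hf0
    clear hf hf0
    simp only [eval_mul, eval_C]
    refine Ev.mono (P := fun c => GoodU v M N t c (eval t (s.map fun r => X - Polynomial.C r).prod)) ?_
      fun c _ h e he hv => ?_
    · induction s using Multiset.induction_on with
      | empty => exact Ev.all fun c _ e _ _ => ⟨1, M.one_mem, 1, Et.one, by simp, by simp⟩
      | cons r s ih =>
        have hr := hs r (by simp)
        refine ((I.ev_lt ht htM hr).and (ih fun r hr => hs r (by simp [hr]))).mono ?_
        rintro c hc ⟨h1, h2⟩ e he hv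
        obtain ⟨m, hm, ε, h3, h4, h5⟩ := h2 e he hv
        have hcr : c - r ≠ 0 := fun h => by
          have := h1.2; rw [h, map_zero] at this; exact Imm.ne htM hr (by simpa using this.symm)
        have he0 : e ≠ 0 := by rintro rfl; rw [map_zero] at hv; exact Imm.ne htM hc (by simpa using hv.symm)
        have hlt : v (e / (c - r)) < 1 := by
          rw [map_div₀, h1.2, hv]
          exact (div_lt_one₀ (zero_lt_iff.2 (by simpa using Imm.ne htM hr))).2 h1.1
        have hs1 : v ((t - c) / e) = 1 := by
          rw [map_div₀, hv, div_self]; simpa using Imm.ne htM hc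
        refine ⟨(c - r) * m, M.mul_mem (M.sub_mem hc hr) hm, (1 + (e / (c - r)) * ((t - c) / e)) * ε,
          Et.mul _ _ (Et.add _ _ Et.one (Et.mul _ _ (hbase _ _ _ (M.div_mem he (M.sub_mem hc hr)) hlt.le) (Et.base _
            (Subring.subset_closure (Or.inr ⟨0, rfl⟩)) (N.div_mem (N.sub_mem htN (hMN hc)) (hMN he)) hs1.le))) h3, ?_, ?_⟩
        · rw [map_mul, h4, mul_one]
          apply Valuation.map_one_add_of_lt
          rw [map_mul, hs1, mul_one]; exact hlt
        · simp only [Multiset.map_cons, Multiset.prod_cons, eval_mul, h5, eval_sub, eval_X, eval_C]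
          field_simp; ring
    · obtain ⟨m, hm, ε, h3, h4, h5⟩ := h e he hv
      exact ⟨a * m, M.mul_mem ha hm, ε, h3, h4, by rw [h5, mul_assoc]⟩
  by_cases hu0 : u = 0
  · rw [hu0]; exact Ev.all fun c _ e _ _ => Et.zero
  obtain ⟨f, g, hf, hg, rfl⟩ := mem_field_cl hu
  have hf0 : f ≠ 0 := by rintro rfl; simp at hu0
  have hg0 : g ≠ 0 := by rintro rfl; simp at hu0
  refine ((hpoly f hf hf0).and (hpoly g hg hg0)).mono ?_
  rintro c hc ⟨h1, h2⟩ e he hve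
  obtain ⟨m, hm, ε, a1, a2, a3⟩ := h1 e he hve
  obtain ⟨m', hm', ε', b1, b2, b3⟩ := h2 e he hve
  rw [a3, b3] at hv ⊢
  rw [mul_div_mul_comm] at hv ⊢
  rw [map_mul, map_div₀ v ε, a2, b2, div_one, mul_one] at hv
  exact Et.mul _ _ (hbase _ _ _ (M.div_mem hm hm') hv) (by rw [div_eq_mul_inv ε]; exact Et.mul _ _ a1 (b1.inv b2))
end Imm

section ImmStep
variable {U : Type*} [Field U] {Γ₀ : Type*} [LinearOrderedCommGroupWithZero Γ₀] {v : Valuation U Γ₀}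
variable {L M C N : Subfield U} {t : U}

theorem vfix_up {A A' N N' : Subfield U} {θ : U} (hN' : N' = Subfield.closure ((N : Set U) ∪ {θ})) (h : VFix v A N)
    (H : ∀ φ δ, PD v N' φ δ → (∀ a ∈ A', φ a = a) → (∀ a ∈ A', δ a = 0) →
      (∀ a ∈ A, δ a = 0) ∧ ((∀ x ∈ N, δ x = 0) → δ θ = 0)) : VFix v A' N' := by
  intro φ δ hp h1 h2 x hx
  have hNN : N ≤ N' := fun x hx => by rw [hN']; exact Subfield.subset_closure (Or.inl hx)
  have hθ : θ ∈ N' := by rw [hN']; exact Subfield.subset_closure (Or.inr rfl)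
  have h3 := (H φ _ hp.phi_sub h1 fun a ha => by simp [h1 a ha]).1
  obtain ⟨h4, h5⟩ := H φ δ hp h1 h2
  have h6 := h φ δ (hp.mono hNN) (fun a ha => sub_eq_zero.1 (h3 a ha)) h4
  have : N' ≤ hp.ker := by
    conv_lhs => rw [hN']
    refine Subfield.closure_le.2 ?_
    rintro x (hx | rfl)
    exacts [⟨hNN hx, h6 x hx⟩, ⟨hθ, h5 h6⟩]
  exact (this hx).2

theorem vfix_AS1 {A N N' : Subfield U} {θ θ' : U} (hN' : N' = Subfield.closure ((N : Set U) ∪ {θ})) (h : VFix v A N)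
    (hp : (ringExpChar U).Prime) (hLN : L ≤ N) (hLA : L ≤ A) (hres : ∀ x ∈ N', v x ≤ 1 → ∃ l ∈ L, v (x - l) < 1)
    (hθ : θ - θ' ∈ N) (h1 : θ' ^ ringExpChar U - θ' ∈ N) (h2 : v (θ' ^ ringExpChar U - θ') ≤ 1) : VFix v A N' := by
  have hNN : N ≤ N' := fun x hx => by rw [hN']; exact Subfield.subset_closure (Or.inl hx)
  have hθN : θ ∈ N' := by rw [hN']; exact Subfield.subset_closure (Or.inr rfl)
  have hθN' : θ' ∈ N' := by simpa using N'.sub_mem hθN (hNN hθ)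
  refine vfix_up hN' h fun φ δ hpd h3 h4 => ⟨h4, fun h5 => ?_⟩
  have h6 := hpd.res (hLN.trans hNN) (fun a ha => h3 a (hLA ha)) hres
  have h7 := v_AS_le hp.two_le h2
  have h8 := hpd.as_int hp hθN' h7 (h6 _ hθN' h7) (h5 _ h1)
  have h9 := h5 _ hθ
  rw [hpd.δ_sub hθN hθN', h8, sub_zero] at h9
  exact h9

theorem hasse_eval (Q : U[X]) (k : ℕ) (d : U) : (hasseDeriv k Q).eval d =
    ∑ i ∈ Q.support, (i.choose k : U) * Q.coeff i * d ^ (i - k) := by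
  rw [hasseDeriv_apply, Polynomial.sum, eval_finsetSum]
  simp only [eval_monomial]

theorem nat_le (v : Valuation U Γ₀) (n : ℕ) : v (n : U) ≤ 1 := by
  induction n with
  | zero => simp
  | succ n ih => rw [Nat.cast_succ]; exact v.map_add_le ih (by simp)

theorem redc_val [IsAlgClosed U] (hp : (ringExpChar U).Prime) {Q : U[X]} (hQ : ∀ j, ringExpChar U ∣ j → Q.coeff j = 0)
    (hcast : ∀ j : ℕ, ¬ ringExpChar U ∣ j → v (j : U) = 1) {d : U} (hd : d ≠ 0) {j0 : ℕ}
    (h1 : 1 < v (Q.coeff j0) * v d ^ j0) (h2 : ∀ j, j ≠ j0 → v (Q.coeff j) * v d ^ j < v (Q.coeff j0) * v d ^ j0)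
    {K : ℕ} (hK : 0 < K) : v (redc K (taylor d Q) 1) * v d = v (Q.coeff j0) * v d ^ j0 := by
  set μ := v (Q.coeff j0) * v d ^ j0 with hμ
  have hd0 : 0 < v d := zero_lt_iff.2 (by simpa using hd)
  have hj : ¬ ringExpChar U ∣ j0 := fun h => by rw [hμ, hQ j0 h] at h1; simp at h1
  have hle : ∀ j, v (Q.coeff j) * v d ^ j ≤ μ := fun j => by
    by_cases h : j = j0
    · rw [h]
    · exact (h2 j h).le
  have e1 : v ((taylor d Q).coeff 1) * v d = μ := by
    rw [taylor_coeff, hasse_eval, ← map_mul, Finset.sum_mul, v_sum_eq (i := j0)]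
    · have : j0 ≠ 0 := by rintro rfl; simp at hj
      rw [Nat.choose_one_right, mul_assoc, mul_assoc, ← pow_succ, Nat.sub_add_cancel (by omega), map_mul, hcast j0 hj,
        one_mul, map_mul, map_pow]
    · rw [mem_support_iff]; intro h; rw [hμ, h] at h1; simp at h1
    · intro j hjs hjj
      have hj1 : ¬ ringExpChar U ∣ j := fun h => (mem_support_iff.1 hjs) (hQ j h)
      have aux : ∀ j : ℕ, ¬ ringExpChar U ∣ j → v (↑(j.choose 1) * Q.coeff j * d ^ (j - 1) * d) = v (Q.coeff j) * v d ^ j := by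
        intro j hj
        have : j ≠ 0 := by rintro rfl; simp at hj
        rw [Nat.choose_one_right, mul_assoc, mul_assoc, ← pow_succ, Nat.sub_add_cancel (by omega), map_mul, hcast j hj,
          one_mul, map_mul, map_pow]
      rw [aux j hj1, aux j0 hj]
      exact h2 j hjj
  have e2 : ∀ k, v ((taylor d Q).coeff k) * v d ^ k ≤ μ := by
    intro k
    rw [taylor_coeff, hasse_eval, ← map_pow, ← map_mul, Finset.sum_mul]
    refine v.map_sum_le fun i _ => ?_
    by_cases hi : i < k
    · simp [Nat.choose_eq_zero_of_lt hi]
    · rw [mul_assoc, mul_assoc, ← pow_add, Nat.sub_add_cancel (by omega), map_mul, map_mul, map_pow]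
      exact mle2 (nat_le v _) (hle i)
  have hrt0 : rt 0 ((taylor d Q).coeff (1 * ringExpChar U ^ 0)) = (taylor d Q).coeff 1 := by
    rw [rt_zero]; simp
  rw [redc, v_sum_eq (i := 0) _ _ (Finset.mem_range.2 hK), hrt0, e1]
  intro k _ hk
  rw [hrt0]
  have hk1 : ringExpChar U ^ k ≠ 0 := qpos k
  refine lt_of_mul_lt_mul_right (a := v d) ?_ (zero_le)
  rw [e1]
  refine lt_of_pow_lt_pow_left₀ (ringExpChar U ^ k) (zero_le) ?_
  rw [mul_pow, ← map_pow, rt_pow, one_mul]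
  exact (e2 _).trans_lt (lt_self_pow₀ h1 (Nat.one_lt_pow hk hp.one_lt))

theorem AC.infinite [IsAlgClosed U] (hM : AC M) : (M : Set U).Infinite := by
  have := hM.isAlgClosed
  exact Set.infinite_coe_iff.1 (inferInstanceAs (Infinite M))

theorem Imm.ev_et [IsAlgClosed U] (I : Imm v L M C) (htC : t ∈ C) (htM : t ∉ M) (N1 : IntermediateField (Subfield.closure ((M : Set U) ∪ {t})) U)
    [FiniteDimensional (Subfield.closure ((M : Set U) ∪ {t})) N1]
    (hVF : VFix v (Subfield.closure ((M : Set U) ∪ {t})) N1.toSubfield) (Z : Finset U) (hZ : ∀ z ∈ Z, z ∈ N1 ∧ v z ≤ 1) :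
    Ev v M t fun c => ∀ e ∈ M, v e = v (t - c) → ∀ z ∈ Z, Et v N1.toSubfield (Rg v M fun _ : Fin 1 => (t - c) / e) z := by
  have hA : Subfield.closure ((M : Set U) ∪ {t}) ≤ N1.toSubfield := fun x hx => N1.algebraMap_mem ⟨x, hx⟩
  have hMA : M ≤ Subfield.closure ((M : Set U) ∪ {t}) := fun x hx => Subfield.subset_closure (Or.inl hx)
  have htA : t ∈ Subfield.closure ((M : Set U) ∪ {t}) := Subfield.subset_closure (Or.inr rfl)
  obtain ⟨S, T, hS, hT, h⟩ := Et.finite_set Z fun z hz => hVF.et (I.hLM.trans hMA) I.hL.infinite I.htriv (hZ z hz).1 (hZ z hz).2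
  refine (Ev.fin T fun r hr => I.ratU htC htM (hMA.trans hA) (hA htA) (hT r hr).1 (hT r hr).2.2).mono fun c _ h1 e he hv => ?_
  exact h _ _ hS fun r hr => h1 r hr e he hv

theorem Imm.decomp [IsAlgClosed U] (I : Imm v L M C) (htC : t ∈ C) (htM : t ∉ M) (N1 : IntermediateField (Subfield.closure ((M : Set U) ∪ {t})) U)
    [FiniteDimensional (Subfield.closure ((M : Set U) ∪ {t})) N1] (hNC : N1.toSubfield ≤ C)
    (hVF : VFix v (Subfield.closure ((M : Set U) ∪ {t})) N1.toSubfield) {a : U} (ha : a ∈ N1) :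
    ∃ P : U[X], (∀ i, P.coeff i ∈ M) ∧ ∃ o ∈ N1, v o < 1 ∧ a = P.eval t + o := by
  have hA : Subfield.closure ((M : Set U) ∪ {t}) ≤ N1.toSubfield := fun x hx => N1.algebraMap_mem ⟨x, hx⟩
  have hMA : M ≤ Subfield.closure ((M : Set U) ∪ {t}) := fun x hx => Subfield.subset_closure (Or.inl hx)
  have htA : t ∈ Subfield.closure ((M : Set U) ∪ {t}) := Subfield.subset_closure (Or.inr rfl)
  obtain ⟨m, hm, hm1, hma⟩ : ∃ m ∈ M, 1 ≤ v m ∧ v a ≤ v m := by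
    rcases le_total (v a) 1 with h | h
    · exact ⟨1, M.one_mem, by simp, by simpa using h⟩
    · obtain ⟨m, hm, e⟩ := I.h2 a (hNC ha) (by rintro rfl; simp at h)
      exact ⟨m, hm, e ▸ h, e.le⟩
  have hm0 : m ≠ 0 := by rintro rfl; simp at hm1
  have hvm : 0 < v m := zero_lt_iff.2 (by simpa using hm0)
  obtain ⟨π, hπ, hπ0, hπ1⟩ : ∃ π ∈ M, π ≠ 0 ∧ v π < 1 := by
    obtain ⟨c, hc, h⟩ := I.closer htC htM M.zero_mem
    obtain ⟨e, he, he0, h1⟩ := I.ex htC htM hc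
    obtain ⟨e', he', he0', h1'⟩ := I.ex htC htM M.zero_mem
    refine ⟨e / e', M.div_mem he he', div_ne_zero he0 he0', ?_⟩
    rw [map_div₀, h1, h1']
    exact (div_lt_one₀ (zero_lt_iff.2 (by simpa using Imm.ne htM M.zero_mem))).2 h
  set R := Subring.closure ((M : Set U) ∪ {t}) with hR
  have hMR : ∀ m ∈ M, m ∈ R := fun m hm => Subring.subset_closure (Or.inl hm)
  have h1 : Et v N1.toSubfield R (a / m) := by
    refine (hVF.et (I.hLM.trans hMA) I.hL.infinite I.htriv (N1.div_mem ha (hA (hMA hm))) ?_).trans le_rfl fun r hr _ hv => ?_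
    · rw [map_div₀]; exact (div_le_one₀ hvm).2 hma
    · obtain ⟨c, hc, h⟩ := (I.ratU htC htM (hMA.trans hA) (hA htA) hr hv).ex
      obtain ⟨e, he, -, hve⟩ := I.ex htC htM hc
      refine (h e he hve).mono le_rfl (Subring.closure_le.2 ?_)
      rintro x (hx | ⟨_, rfl⟩)
      · exact hMR x hx.1
      · dsimp only
        rw [div_eq_mul_inv]
        exact R.mul_mem (R.sub_mem (Subring.subset_closure (Or.inr rfl)) (hMR c hc)) (hMR _ (M.inv_mem he))
  obtain ⟨r, hr, hrN, h2⟩ := h1.approx (L := L) (fun x hx => hMR x (I.hLM hx)) (I.hLM.trans (hMA.trans hA))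
    (fun x hx => I.h1 x (hNC hx)) (fun a ha h b hb => I.h3 a (hNC ha) h b (hNC hb)) (b := π / m) (hA (hMA (M.div_mem hπ hm)))
    (div_ne_zero hπ0 hm0) (by rw [map_div₀]; exact (div_le_one₀ hvm).2 (hπ1.le.trans hm1))
  obtain ⟨P, hP, hPe⟩ := mem_ring_cl (R.mul_mem (hMR m hm) hr)
  refine ⟨P, hP, a - m * r, N1.sub_mem ha (N1.mul_mem (hA (hMA hm)) hrN), ?_, by rw [hPe]; ring⟩
  rw [show a - m * r = m * (a / m - r) by field_simp, map_mul]
  refine lt_of_le_of_lt (mul_le_mul_right h2 _) ?_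
  rw [map_div₀, mul_div_cancel₀ _ hvm.ne']; exact hπ1
end ImmStep

section ImmStep2
variable {U : Type*} [Field U] {Γ₀ : Type*} [LinearOrderedCommGroupWithZero Γ₀] {v : Valuation U Γ₀}
variable {L M C N : Subfield U} {t : U}

theorem cast_one (hL : ∀ l ∈ L, l ≠ 0 → v l = 1) (hp : (ringExpChar U).Prime) (j : ℕ) (hj : ¬ ringExpChar U ∣ j) : v (j : U) = 1 := by
  have := charP_of_expChar_prime' hp
  exact hL _ (natCast_mem L j) fun h => hj ((CharP.cast_eq_zero_iff U (ringExpChar U) j).1 h)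

theorem Imm.case2 [IsAlgClosed U] (I : Imm v L M C) (htC : t ∈ C) (htN : t ∈ N) {N' : Subfield U} {θ θ' o c e : U}
    (hN' : N' = Subfield.closure ((N : Set U) ∪ {θ})) (hNC' : N' ≤ C) (hMN : M ≤ N)
    (h : VFix v (Subfield.closure ((M : Set U) ∪ {t})) N) (hp : (ringExpChar U).Prime)
    (hθ : θ - θ' ∈ N) (hc : c ∈ M) (he : e ∈ M) (hve : v e = v (t - c)) (he0 : e ≠ 0) {Q : U[X]} (hQM : ∀ i, Q.coeff i ∈ M)
    (hAS : θ' ^ ringExpChar U - θ' = Q.eval (t - c) + o) (hoN : o ∈ N) (ho : Et v N (Rg v M fun _ : Fin 1 => (t - c) / e) o)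
    (h1 : 1 < v (Q.coeff 1) * v e) (h2 : ∀ j, j ≠ 1 → v (Q.coeff j) * v e ^ j < v (Q.coeff 1) * v e) :
    ∃ d ∈ M, d ≠ 0 ∧ VFix v (Subfield.closure ((M : Set U) ∪ {θ' / d})) N' := by
  have hNN : N ≤ N' := fun x hx => by rw [hN']; exact Subfield.subset_closure (Or.inl hx)
  have hθN : θ ∈ N' := by rw [hN']; exact Subfield.subset_closure (Or.inr rfl)
  have hθN' : θ' ∈ N' := by simpa using N'.sub_mem hθN (hNN hθ)
  have hve0 : v e ≠ 0 := by simpa using he0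
  have hq1 : Q.coeff 1 ≠ 0 := by intro h; rw [h] at h1; simp at h1
  have hq : rt 1 (Q.coeff 1 * e) ^ ringExpChar U = Q.coeff 1 * e := by simpa using rt_pow 1 (Q.coeff 1 * e)
  have hd0 : rt 1 (Q.coeff 1 * e) ≠ 0 := by
    intro h; rw [h, zero_pow hp.ne_zero] at hq; exact mul_ne_zero hq1 he0 hq.symm
  have hdM : rt 1 (Q.coeff 1 * e) ∈ M := I.hM.of_pow hp.ne_zero (by rw [hq]; exact M.mul_mem (hQM 1) he)
  generalize rt 1 (Q.coeff 1 * e) = d at hd0 hdM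
  set s := (t - c) / e with hs
  have hts : t - c = e * s := by rw [hs]; field_simp
  have hsN : s ∈ N := N.div_mem (N.sub_mem htN (hMN hc)) (hMN he)
  have hs1 : v s = 1 := by rw [hs, map_div₀, ← hve, div_self hve0]
  have hMA : M ≤ Subfield.closure ((M : Set U) ∪ {θ' / d}) := fun x hx => Subfield.subset_closure (Or.inl hx)
  refine ⟨d, hdM, hd0, vfix_up hN' h fun φ δ hpd h3 h4 => ?_⟩
  have hδM : ∀ b ∈ M, δ b = 0 := fun b hb => h4 b (hMA hb)
  have hδc : ∀ b ∈ M, ∀ x ∈ N', δ (b * x) = b * δ x := fun b hb x hx => by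
    rw [hpd.δ_mul _ (hNN (hMN hb)) _ hx, hδM b hb]; ring
  have hθd : θ' ∈ Subfield.closure ((M : Set U) ∪ {θ' / d}) := by
    have := Subfield.mul_mem _ (hMA hdM) (Subfield.subset_closure (Or.inr rfl) : θ' / d ∈ Subfield.closure ((M : Set U) ∪ {θ' / d}))
    rwa [mul_div_cancel₀ _ hd0] at this
  have hδθ : δ (Q.eval (t - c) + o) = 0 := by
    rw [← hAS]; exact h4 _ (Subfield.sub_mem _ (Subfield.pow_mem _ hθd _) hθd)
  have hlip := hpd.lip_Rg (hMN.trans hNN) hδM (t := fun _ : Fin 1 => s) (fun _ => hNN hsN) (fun _ => hs1.le) (γ := v (δ s)) (fun _ => le_rfl)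
  have hδo : v (δ o) ≤ v (δ s) := hpd.lipschitz (hpd.res (I.hLM.trans (hMN.trans hNN)) (fun a ha => h3 a (hMA (I.hLM ha)))
    fun x hx => I.h1 x (hNC' hx)) hNN _ (fun r hr _ _ => (hlip r hr).2.2) ho
  have hδp : ∀ j, v (δ (s ^ j)) ≤ v (δ s) := fun j => (hlip (s ^ j) ((Rg v M fun _ : Fin 1 => s).pow_mem (Subring.subset_closure (Or.inr ⟨0, rfl⟩)) j)).2.2
  have hterm : ∀ j, Q.coeff j * (e * s) ^ j ∈ N := fun j => N.mul_mem (hMN (hQM j)) (N.pow_mem (N.mul_mem (hMN he) hsN) j)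
  have hδs : δ s = 0 := by
    by_contra hc0
    have hv0 : 0 < v (δ s) := zero_lt_iff.2 (by simpa using hc0)
    rw [hts, eval_eq_sum, Polynomial.sum, hpd.δ_add _ (N'.sum_mem fun j _ => hNN (hterm j)) _ (hNN hoN),
      hpd.δ_sum _ _ fun j _ => hNN (hterm j)] at hδθ
    have hδt : ∀ j, δ (Q.coeff j * (e * s) ^ j) = Q.coeff j * e ^ j * δ (s ^ j) := fun j => by
      rw [mul_pow, ← mul_assoc, hδc _ (M.mul_mem (hQM j) (M.pow_mem he j)) _ (N'.pow_mem (hNN hsN) j)]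
    simp only [hδt] at hδθ
    have hvs : v (∑ j ∈ Q.support, Q.coeff j * e ^ j * δ (s ^ j)) = v (Q.coeff 1) * v e * v (δ s) := by
      rw [v_sum_eq (i := 1)]
      · simp
      · exact mem_support_iff.2 hq1
      · intro j _ hj
        rw [pow_one, pow_one, map_mul, map_mul v _ (δ s), map_mul, map_mul, map_pow]
        exact lt_of_le_of_lt (mul_le_mul_right (hδp j) _) ((mul_lt_mul_iff_left₀ hv0).2 (h2 j hj))
    rw [add_eq_zero_iff_eq_neg] at hδθ
    rw [hδθ, Valuation.map_neg] at hvs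
    rw [hvs] at hδo
    exact hδo.not_gt (by simpa using (mul_lt_mul_iff_left₀ hv0).2 h1)
  refine ⟨fun a ha => ?_, fun h5 => ?_⟩
  · have : Subfield.closure ((M : Set U) ∪ {t}) ≤ hpd.ker := by
      refine Subfield.closure_le.2 ?_
      rintro x (hx | hx)
      · exact ⟨hNN (hMN hx), hδM x hx⟩
      · rw [Set.mem_singleton_iff] at hx
        subst hx
        have e1 : c ∈ hpd.ker := ⟨hNN (hMN hc), hδM c hc⟩
        have e2 : e ∈ hpd.ker := ⟨hNN (hMN he), hδM e he⟩
        have e3 : s ∈ hpd.ker := ⟨hNN hsN, hδs⟩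
        have : x = e * s + c := by rw [← hts]; ring
        rw [this]; exact hpd.ker.add_mem (hpd.ker.mul_mem e2 e3) e1
    exact (this ha).2
  · have h9 := h5 _ hθ
    rw [hpd.δ_sub hθN hθN', h4 _ hθd, sub_zero] at h9
    exact h9

theorem exists_max_term (B : ℕ → Γ₀) (n : ℕ) (h0 : ∀ j, n < j → B j = 0) (hd : ∀ i j, i ≠ j → B i ≠ 0 → B i ≠ B j)
    (h : ∃ j, 1 < B j) : ∃ j0, 1 < B j0 ∧ ∀ j, j ≠ j0 → B j < B j0 := by
  obtain ⟨j1, hj1⟩ := h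
  have hj1n : j1 ∈ Finset.range (n + 1) := by
    rw [Finset.mem_range]; by_contra hc; rw [h0 j1 (by omega)] at hj1; simp at hj1
  obtain ⟨j0, hj0, hm⟩ := Finset.exists_max_image (Finset.range (n + 1)) B ⟨j1, hj1n⟩
  have h1 := hj1.trans_le (hm _ hj1n)
  have h10 : B j0 ≠ 0 := by intro h; rw [h] at h1; simp at h1
  refine ⟨j0, h1, fun j hj => ?_⟩
  by_cases hjn : n < j
  · rw [h0 j hjn]; exact zero_lt_iff.2 h10
  · exact lt_of_le_of_ne (hm j (Finset.mem_range.2 (by omega))) (hd j0 j hj.symm h10).symm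

theorem Imm.step [IsAlgClosed U] (I : Imm v L M C) (hp : (ringExpChar U).Prime) (htC : t ∈ C) (htM : t ∉ M)
    (N1 : IntermediateField (Subfield.closure ((M : Set U) ∪ {t})) U) [FiniteDimensional (Subfield.closure ((M : Set U) ∪ {t})) N1]
    (hN1 : N1.toSubfield = N) (hNC : N ≤ C) (hVF : VFix v (Subfield.closure ((M : Set U) ∪ {t})) N) {θ : U} (hθC : θ ∈ C)
    (hθN : θ ∉ N) (hAS : θ ^ ringExpChar U - θ ∈ N) :
    ∃ t' ∈ Subfield.closure ((N : Set U) ∪ {θ}), t' ∉ M ∧ VFix v (Subfield.closure ((M : Set U) ∪ {t'})) (Subfield.closure ((N : Set U) ∪ {θ})) := by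
  have hA : Subfield.closure ((M : Set U) ∪ {t}) ≤ N := fun x hx => hN1 ▸ N1.algebraMap_mem ⟨x, hx⟩
  have hMA : M ≤ Subfield.closure ((M : Set U) ∪ {t}) := fun x hx => Subfield.subset_closure (Or.inl hx)
  have hMN : M ≤ N := hMA.trans hA
  have htN : t ∈ N := hA (Subfield.subset_closure (Or.inr rfl))
  have hNC' : Subfield.closure ((N : Set U) ∪ {θ}) ≤ C := by
    refine Subfield.closure_le.2 ?_
    rintro x (hx | rfl)
    exacts [hNC hx, hθC]
  obtain ⟨P, hP, o, hoN, ho1, hPo⟩ := I.decomp htC htM N1 (hN1 ▸ hNC) (hN1 ▸ hVF) (a := θ ^ ringExpChar U - θ) (by rw [← hN1] at hAS; exact hAS)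
  have hev := I.ev_et htC htM N1 (hN1 ▸ hVF) {o} (by simpa using ⟨hoN, ho1.le⟩)
  have hoN : o ∈ N := hN1 ▸ hoN
  rw [hN1] at hev
  set n := P.natDegree with hn
  choose G hG hGe using fun j => redc_taylor (n + 1) P j hP
  have hpow : ∀ c j, v ((G j).eval c) = v ((G j).eval t) → v (redc (n + 1) (taylor c P) j) = v (redc (n + 1) (taylor t P) j) := by
    intro c j h
    rw [← hGe, ← hGe, map_pow, map_pow] at h
    exact (pow_left_inj₀ (zero_le) (zero_le) (qpos _)).1 h
  let A : ℕ → Γ₀ := fun j => v (redc (n + 1) (taylor t P) j)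
  have ev1 : Ev v M t fun c => ∀ j ∈ Finset.range (n + 2), v ((G j).eval c) = v ((G j).eval t) :=
    Ev.fin _ fun j _ => I.ev_poly htC htM (hG j)
  have ev2 : Ev v M t fun c => ∀ ij ∈ (Finset.range (n + 1) ×ˢ Finset.range (n + 1)),
      ¬ (ij.1 < ij.2 ∧ A ij.1 ≠ 0 ∧ A ij.1 * v (t - c) ^ ij.1 = A ij.2 * v (t - c) ^ ij.2) := by
    refine Ev.fin _ fun ij _ => I.ev_bad htC htM (P := fun g => ij.1 < ij.2 ∧ A ij.1 ≠ 0 ∧ A ij.1 * g ^ ij.1 = A ij.2 * g ^ ij.2) ?_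
    rintro g hg g' hg' ⟨h1, h2, h3⟩ ⟨-, -, h4⟩
    obtain ⟨k, hk⟩ := Nat.exists_eq_add_of_lt h1
    have aux : ∀ g : Γ₀, g ≠ 0 → A ij.1 * g ^ ij.1 = A ij.2 * g ^ ij.2 → A ij.1 = A ij.2 * g ^ (k + 1) := by
      intro g hg h
      rw [show g ^ ij.2 = g ^ ij.1 * g ^ (k + 1) by rw [← pow_add, hk, add_assoc], mul_left_comm, mul_comm] at h
      exact mul_left_cancel₀ (pow_ne_zero _ hg) h
    have h5 := (aux g hg h3).symm.trans (aux g' hg' h4)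
    have hA2 : A ij.2 ≠ 0 := by intro h; rw [aux g hg h3, h, zero_mul] at h2; exact h2 rfl
    exact (pow_left_inj₀ (zero_le) (zero_le) (Nat.succ_ne_zero k)).1 (mul_left_cancel₀ hA2 h5)
  obtain ⟨c, hc, ⟨hc1, hc2⟩, hc3⟩ := ((ev1.and ev2).and hev).ex
  obtain ⟨e, he, he0, hve⟩ := I.ex htC htM hc
  have ho := hc3 e he hve o (by simp)
  obtain ⟨H, Q, hHM, hQM, hHn, hQn, hQ, hPQ⟩ := red_exists hp I.hM (f := taylor c P) (n := n) (fun i => by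
    rw [taylor_coeff]
    exact eval_mem_subfield (fun k => by rw [hasseDeriv_coeff]; exact M.mul_mem (natCast_mem M _) (hP _)) hc) (by rw [natDegree_taylor])
  have hQc : ∀ j, ¬ ringExpChar U ∣ j → Q.coeff j = redc (n + 1) (taylor c P) j := fun j hj => by
    rw [hPQ, redc_eq hp (Nat.lt_succ_self n) hHn hQ hj]
  have hcN := N.sub_mem htN (hMN hc)
  have hHN : H.eval (t - c) ∈ N := eval_mem_subfield (fun i => hMN (hHM i)) hcN
  set θ' := θ - H.eval (t - c) with hθ'
  have hsub : θ - θ' ∈ N := by rw [hθ', sub_sub_cancel]; exact hHN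
  have hASq : θ' ^ ringExpChar U - θ' = Q.eval (t - c) + o := by
    have e1 : P.eval t = (taylor c P).eval (t - c) := by rw [taylor_eval, sub_add_cancel]
    rw [hθ', sub_pow_expChar, show ∀ a b c d : U, a - b - (c - d) = (a - c) - (b - d) by intros; ring, hPo, e1, hPQ]
    simp only [eval_add, eval_sub, eval_pow]; ring
  have hte0 : v (t - c) ≠ 0 := by rw [← hve]; simpa using he0
  have hBA : ∀ j, ¬ ringExpChar U ∣ j → j ≤ n → v (Q.coeff j) = A j := fun j hj hjn => by
    rw [hQc j hj, hpow c j (hc1 j (Finset.mem_range.2 (by omega)))]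
  by_cases hcase : ∃ j, 1 < v (Q.coeff j) * v e ^ j
  · obtain ⟨j0, hj0, hj0m⟩ := exists_max_term (fun j => v (Q.coeff j) * v e ^ j) n (fun j hj => by
      simp [coeff_eq_zero_of_natDegree_lt (hQn.trans_lt hj)]) (fun i j hij hi hij2 => by
        have hnz : ∀ i, v (Q.coeff i) * v e ^ i ≠ 0 → ¬ ringExpChar U ∣ i ∧ i ≤ n := fun i hi => by
          refine ⟨fun h => hi (by simp [hQ i h]), ?_⟩
          by_contra hc; exact hi (by simp [coeff_eq_zero_of_natDegree_lt (hQn.trans_lt (not_le.1 hc))])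
        obtain ⟨a1, a2⟩ := hnz i hi
        obtain ⟨b1, b2⟩ := hnz j (hij2 ▸ hi)
        have a3 := hBA i a1 a2
        have b3 := hBA j b1 b2
        have b4 := hij2 ▸ hi
        simp only [a3, b3, hve] at hij2 hi b4
        rcases lt_or_gt_of_ne hij with h | h
        · exact hc2 (i, j) (by simp; omega) ⟨h, left_ne_zero_of_mul hi, hij2⟩
        · exact hc2 (j, i) (by simp; omega) ⟨h, left_ne_zero_of_mul b4, hij2.symm⟩) hcase
    have hj1 : j0 = 1 := by
      by_contra hne
      obtain ⟨c', hc', h1, h2⟩ := ((I.ev_lt htC htM hc).and (I.ev_poly htC htM (hG 1))).ex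
      have hd : v (c' - c) = v e := by rw [h1.2, hve]
      have hd0 : c' - c ≠ 0 := by intro h; rw [h, map_zero] at hd; exact hte0 (hve ▸ hd.symm)
      have h3 := redc_val hp hQ (cast_one I.htriv hp) hd0 (j0 := j0) (by rw [hd]; exact hj0) (fun j hj => by rw [hd]; exact hj0m j hj)
        (K := n + 1) (Nat.succ_pos n)
      have h1p : ¬ ringExpChar U ∣ 1 := fun h => hp.one_lt.ne' (Nat.dvd_one.1 h)
      have h4 : redc (n + 1) (taylor c' P) 1 = redc (n + 1) (taylor (c' - c) Q) 1 := by
        have : taylor c' P = taylor (c' - c) Q + ((taylor (c' - c) H) ^ ringExpChar U - taylor (c' - c) H) := by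
          rw [← taylor_pow, ← map_sub, ← map_add, ← hPQ, taylor_taylor]; congr 2; ring
        rw [this, redc_add, redc_AS hp (Nat.lt_succ_self n) (by rw [natDegree_taylor]; exact hHn) h1p, add_zero]
      have h5 : v (redc (n + 1) (taylor (c' - c) Q) 1) = v (Q.coeff 1) := by
        rw [← h4, hpow c' 1 h2, ← hpow c 1 (hc1 1 (by simp)), hQc 1 h1p]
      rw [h5, hd] at h3
      have h6 := hj0m 1 (Ne.symm hne)
      rw [pow_one, h3] at h6
      exact lt_irrefl _ h6
    subst hj1
    obtain ⟨d, hd, hd0, hV⟩ := I.case2 htC htN rfl hNC' hMN hVF hp hsub hc he hve he0 hQM hASq hoN ho (by simpa using hj0)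
      (fun j hj => by simpa using hj0m j hj)
    have hmem : θ' ∈ Subfield.closure ((N : Set U) ∪ {θ}) := Subfield.sub_mem _ (Subfield.subset_closure (Or.inr rfl))
      (Subfield.subset_closure (Or.inl hHN))
    refine ⟨θ' / d, Subfield.div_mem _ hmem (Subfield.subset_closure (Or.inl (hMN hd))), fun h => hθN ?_, hV⟩
    have h3 : θ' ∈ N := by have := N.mul_mem (hMN hd) (hMN h); rwa [mul_div_cancel₀ _ hd0] at this
    simpa using N.add_mem hsub h3
  · push Not at hcase
    refine ⟨t, Subfield.subset_closure (Or.inl htN), htM, vfix_AS1 rfl hVF hp (I.hLM.trans hMN) (I.hLM.trans hMA)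
      (fun x hx => I.h1 x (hNC' hx)) hsub ?_ ?_⟩
    · rw [hASq]; exact N.add_mem (eval_mem_subfield (fun i => hMN (hQM i)) hcN) hoN
    · rw [hASq]
      refine v.map_add_le ?_ ho1.le
      rw [eval_eq_sum, Polynomial.sum]
      refine v.map_sum_le fun j _ => ?_
      rw [map_mul, map_pow, ← hve]; exact hcase j
end ImmStep2

section ImmGU
variable {U : Type*} [Field U] {Γ₀ : Type*} [LinearOrderedCommGroupWithZero Γ₀] {v : Valuation U Γ₀}

theorem gu_gens {B E : Subfield U} {q : U[X]} (hq : q ≠ 0) (W0 : Finset U) (hW0 : ∀ w ∈ W0, w ∈ E)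
    (hE : E ≤ Subfield.closure ((B : Set U) ∪ W0)) : ∃ W : Finset U, (∀ w ∈ W, w ∈ Fd B E q ∧ v w ≤ 1) ∧
      ∀ T : Set U, (∀ w ∈ W, w ∈ T) → Fd B E q ≤ Subfield.closure ((B : Set U) ∪ T) := by
  classical
  let g : U → U := fun w => if v w ≤ 1 then w else w⁻¹
  have hg : ∀ (D : Subfield U) w, g w ∈ D ↔ w ∈ D := fun D w => by
    dsimp only [g]; split_ifs
    exacts [Iff.rfl, inv_mem_iff]
  have hgv : ∀ w, v (g w) ≤ 1 := fun w => by
    dsimp only [g]; split_ifs with h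
    · exact h
    · rw [map_inv₀]; exact inv_le_one_of_one_le₀ (not_le.1 h).le
  refine ⟨(W0 ∪ q.roots.toFinset).image g, fun w hw => ?_, fun T hT => ?_⟩
  · obtain ⟨w, hw1, rfl⟩ := Finset.mem_image.1 hw
    refine ⟨(hg _ w).2 ?_, hgv w⟩
    rcases Finset.mem_union.1 hw1 with h | h
    · exact Fd_E (hW0 w h)
    · exact Fd_root (by simpa [hq] using h)
  · have h1 : ∀ w ∈ W0 ∪ q.roots.toFinset, w ∈ Subfield.closure ((B : Set U) ∪ T) := fun w hw =>
      (hg _ w).1 (Subfield.subset_closure (Or.inr (hT _ (Finset.mem_image_of_mem g hw))))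
    have hB : B ≤ Subfield.closure ((B : Set U) ∪ T) := fun x hx => Subfield.subset_closure (Or.inl hx)
    refine Fd_le hB (hE.trans (Subfield.closure_le.2 ?_)) fun x hx => h1 x (by simp [hq, hx])
    rintro x (hx | hx)
    exacts [hB hx, h1 x (by simp at hx; simp [hx])]

theorem Imm.gu [IsAlgClosed U] {L M C M0 E : Subfield U} (I : Imm v L M C) {x : U} (hxC : x ∈ C) (hxM : x ∉ M)
    (hE : E = Subfield.closure ((M0 : Set U) ∪ {x})) (hM0 : M0 ≤ M) : GU v M E 1 := by
  classical
  intro p hp0 hpE Z hZ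
  have hx0 : x ≠ 0 := by rintro rfl; exact hxM M.zero_mem
  have hxE : x ∈ E := by rw [hE]; exact Subfield.subset_closure (Or.inr rfl)
  have hEM : E ≤ Subfield.closure ((M : Set U) ∪ {x}) := by
    rw [hE]; exact Subfield.closure_mono (Set.union_subset_union_left _ hM0)
  have hEC : E ≤ C := by
    rw [hE]; refine Subfield.closure_le.2 ?_
    rintro z (hz | rfl)
    exacts [I.hMC (hM0 hz), hxC]
  obtain ⟨q, hq0, hqE, hpq, y, hy, k, hyx, F, hFD, hGal, hF, -⟩ := setup I.hM (fun _ : Fin 1 => x) (fun _ => hx0)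
    (fun _ => hxE) (by simpa using hEM) hp0 hpE (n := 1) (by simp)
  have hAeq : Subfield.closure ((M : Set U) ∪ Set.range y) = Subfield.closure ((M : Set U) ∪ {y 0}) := by
    rw [Set.range_unique]; rfl
  have hFC : F.toSubfield ≤ C := by
    rw [hF]; exact Fd_le I.hMC hEC fun r hr => I.hC.root hq0 (fun i => hEC (hqE i)) hr
  have hMA : ∀ t, M ≤ Subfield.closure ((M : Set U) ∪ {t}) := fun t x hx => Subfield.subset_closure (Or.inl hx)
  have hMA' : M ≤ Subfield.closure ((M : Set U) ∪ Set.range y) := fun x hx => Subfield.subset_closure (Or.inl hx)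
  have hAF : Subfield.closure ((M : Set U) ∪ Set.range y) ≤ F.toSubfield := fun x hx => F.algebraMap_mem ⟨x, hx⟩
  have hFa : F.toSubfield ≤ acl (Subfield.closure ((M : Set U) ∪ {y 0})) := fun z hz => by
    rw [← hAeq, mem_acl]
    have : IsIntegral (Subfield.closure ((M : Set U) ∪ Set.range y)) (⟨z, hz⟩ : F) := IsIntegral.of_finite _ _
    exact (this.map F.val).isAlgebraic
  have hyM : y 0 ∉ M := fun h => hxM (by rw [← hyx 0]; exact M.pow_mem h _)
  have := I.hL.isAlgClosed
  have hN1 : ∀ N, Subfield.closure ((M : Set U) ∪ Set.range y) ≤ N → N ≤ F.toSubfield → ∀ t ∈ N, t ∉ M →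
      ∃ N' : IntermediateField (Subfield.closure ((M : Set U) ∪ {t})) U, N'.toSubfield = N ∧
        FiniteDimensional (Subfield.closure ((M : Set U) ∪ {t})) N' := by
    intro N hAN hNF t ht htM
    refine fd_between hAN hNF {y 0} (by rw [hAeq]; simp) (hMA t) (Subfield.closure_le.2 ?_) (hNF.trans (hFa.trans (acl_le (acl_acl _)
      (Subfield.closure_le.2 ?_))))
    · rintro z (hz | rfl)
      exacts [hAN (hMA' hz), ht]
    · rintro z (hz | rfl)
      · exact le_acl _ (hMA t hz)
      · exact acl_exchange (hFa (hNF ht)) fun h => htM (I.hM h)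
  obtain ⟨t, htF, htM, hVF⟩ := tower F F.toSubfield L (fun σ x _ => (σ x).2) (fun x hx => Subfield.subset_closure (Or.inr hx)) le_rfl
    (I.hLM.trans hMA') (I.hLM.trans (hMA'.trans hAF)) I.htriv (fun x hx => I.h1 x (hFC hx)) (fun u hu hu0 => by
      obtain ⟨m, hm, h⟩ := I.h2 u (hFC hu) hu0
      exact ⟨0, m, hMA' hm, by simpa using h⟩)
    (fun N => ∃ t ∈ N, t ∉ M ∧ VFix v (Subfield.closure ((M : Set U) ∪ {t})) N)
    (fun N hAN hNF hV => ⟨y 0, hAN (Subfield.subset_closure (Or.inr ⟨0, rfl⟩)), hyM, hAeq ▸ hV⟩)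
    (fun N θ hAN hNF ⟨t, htN, htM, hV⟩ hθ hθN hAS hp => by
      obtain ⟨N1, e1, e2⟩ := hN1 N hAN hNF t htN htM
      exact I.step hp (hFC (hNF htN)) htM N1 e1 (hNF.trans hFC) hV (hFC hθ) hθN hAS)
  obtain ⟨N1, e1, e2⟩ := hN1 _ hAF le_rfl t htF htM
  rw [← e1] at hVF
  obtain ⟨W, hW, hWT⟩ := gu_gens (v := v) (B := M) (E := E) hq0 {x} (by simpa using hxE) (by simpa using hEM)
  have e3 : N1.toSubfield = Fd M E q := e1.trans hF
  obtain ⟨c, hc, h⟩ := (I.ev_et (hFC htF) htM N1 hVF (Z ∪ W) (fun z hz => by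
    rw [← IntermediateField.mem_toSubfield, e3]
    rcases Finset.mem_union.1 hz with hz | hz
    · exact ⟨Fd_mono le_rfl le_rfl hpq (hZ z hz).1, (hZ z hz).2⟩
    · exact hW z hz)).ex
  obtain ⟨e, he, he0, hve⟩ := I.ex (hFC htF) htM hc
  have h := h e he hve
  rw [e3] at h
  refine ⟨q, hq0, hqE, hpq, fun _ => (t - c) / e, fun _ => ⟨?_, ?_⟩, fun z hz => h z (by simp [hz]), hWT _ fun w hw => h w (by simp [hw])⟩
  · exact (Fd M E q).div_mem ((Fd M E q).sub_mem (hF ▸ htF) (Fd_B hc)) (Fd_B he)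
  · rw [map_div₀, hve, div_self]; simpa using Imm.ne htM hc
end ImmGU

section Mon
variable {U : Type*} [Field U] {Γ₀ : Type*} [LinearOrderedCommGroupWithZero Γ₀] {v : Valuation U Γ₀}
variable {ι : Type*} [Fintype ι] {x : ι → U} {L C : Subfield U}

/-- Laurent monomials -/
def mon (x : ι → U) (α : ι → ℤ) : U := ∏ i, x i ^ α i

/-- value-independent families -/
def IndV (v : Valuation U Γ₀) (x : ι → U) : Prop := (∀ i, x i ≠ 0) ∧ ∀ α, v (mon x α) = 1 → α = 0

/-- the ring generated by the integral monomials -/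
def Rx (v : Valuation U Γ₀) (L : Subfield U) (x : ι → U) : Subring U :=
  Subring.closure ((L : Set U) ∪ {u | ∃ α, u = mon x α ∧ v u ≤ 1})

theorem mon_zero : mon x 0 = 1 := by simp [mon]

theorem mon_ne (hx : ∀ i, x i ≠ 0) (α : ι → ℤ) : mon x α ≠ 0 :=
  Finset.prod_ne_zero_iff.2 fun i _ => zpow_ne_zero _ (hx i)

theorem mon_add (hx : ∀ i, x i ≠ 0) (α β : ι → ℤ) : mon x (α + β) = mon x α * mon x β := by
  simp only [mon, ← Finset.prod_mul_distrib]
  exact Finset.prod_congr rfl fun i _ => zpow_add₀ (hx i) _ _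

theorem mon_neg (α : ι → ℤ) : mon x (-α) = (mon x α)⁻¹ := by simp [mon]

theorem mon_sub (hx : ∀ i, x i ≠ 0) (α β : ι → ℤ) : mon x (α - β) = mon x α / mon x β := by
  rw [sub_eq_add_neg, mon_add hx, mon_neg, div_eq_mul_inv]

theorem mon_smul (n : ℤ) (α : ι → ℤ) : mon x (n • α) = mon x α ^ n := by
  simp only [mon, ← Finset.prod_zpow]
  exact Finset.prod_congr rfl fun i _ => by simp [mul_comm n, zpow_mul]

theorem mon_single [DecidableEq ι] (i : ι) : mon x (Pi.single i 1) = x i := by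
  rw [mon, Finset.prod_eq_single i] <;> simp +contextual [Pi.single_apply]

theorem mon_mem {D : Subfield U} (h : ∀ i, x i ∈ D) (α : ι → ℤ) : mon x α ∈ D :=
  D.prod_mem fun i _ => D.zpow_mem (h i) _

theorem IndV.inj (h : IndV v x) {α β : ι → ℤ} (e : v (mon x α) = v (mon x β)) : α = β := by
  refine sub_eq_zero.1 (h.2 _ ?_)
  rw [mon_sub h.1, map_div₀, e, div_self]
  simpa using mon_ne h.1 β

theorem mem_lau {u : U} (hx : ∀ i, x i ≠ 0) (hu : u ∈ Subring.closure ((L : Set U) ∪ Set.range (mon x))) :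
    ∃ f : (ι → ℤ) →₀ U, (∀ α, f α ∈ L) ∧ u = f.sum fun α c => c * mon x α := by
  classical
  rw [Subring.mem_closure_iff] at hu
  induction hu using AddSubgroup.closure_induction with
  | mem u hu =>
    suffices h : ∃ c ∈ L, ∃ α, u = c * mon x α by
      obtain ⟨c, hc, α, rfl⟩ := h
      refine ⟨Finsupp.single α c, fun β => ?_, by rw [Finsupp.sum_single_index (by simp)]⟩
      rw [Finsupp.single_apply]; split_ifs
      exacts [hc, L.zero_mem]
    induction hu using Submonoid.closure_induction with
    | mem u hu =>
      rcases hu with hu | ⟨α, rfl⟩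
      · exact ⟨u, hu, 0, by simp [mon_zero]⟩
      · exact ⟨1, L.one_mem, α, by simp⟩
    | one => exact ⟨1, L.one_mem, 0, by simp [mon_zero]⟩
    | mul a b _ _ h1 h2 =>
      obtain ⟨c, hc, α, rfl⟩ := h1
      obtain ⟨d, hd, β, rfl⟩ := h2
      exact ⟨c * d, L.mul_mem hc hd, α + β, by rw [mon_add hx]; ring⟩
  | zero => exact ⟨0, fun _ => L.zero_mem, by simp⟩
  | add a b _ _ h1 h2 =>
    obtain ⟨f, hf, rfl⟩ := h1
    obtain ⟨g, hg, rfl⟩ := h2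
    exact ⟨f + g, fun α => L.add_mem (hf α) (hg α), by rw [Finsupp.sum_add_index'] <;> simp [add_mul]⟩
  | neg a _ h1 =>
    obtain ⟨f, hf, rfl⟩ := h1
    exact ⟨-f, fun α => L.neg_mem (hf α), by rw [Finsupp.sum_neg_index (by simp)]; simp [Finsupp.sum]⟩

theorem IndV.lead (h : IndV v x) {s : Finset (ι → ℤ)} (hs : s.Nonempty) :
    ∃ α ∈ s, ∀ β ∈ s, β ≠ α → v (mon x β) < v (mon x α) := by
  obtain ⟨α, hα, hm⟩ := Finset.exists_max_image s (fun α => v (mon x α)) hs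
  exact ⟨α, hα, fun β hβ hne => lt_of_le_of_ne (hm β hβ) fun e => hne (h.inj e)⟩

theorem mon_Rx {α : ι → ℤ} (h : v (mon x α) ≤ 1) : mon x α ∈ Rx v L x := Subring.subset_closure (Or.inr ⟨α, rfl, h⟩)

theorem L_Rx {l : U} (h : l ∈ L) : l ∈ Rx v L x := Subring.subset_closure (Or.inl h)

theorem triv_le (hL : ∀ l ∈ L, l ≠ 0 → v l = 1) {l : U} (h : l ∈ L) : v l ≤ 1 := by
  by_cases h0 : l = 0
  · simp [h0]
  · exact (hL l h h0).le

theorem Rx_et (hL : ∀ l ∈ L, l ≠ 0 → v l = 1) {F : Subfield U} (hLF : L ≤ F) (hxF : ∀ i, x i ∈ F) {u : U}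
    (hu : u ∈ Rx v L x) : Et v F (Rx v L x) u := by
  have : u ∈ F ∧ v u ≤ 1 := by
    induction hu using Subring.closure_induction with
    | mem u hu =>
      rcases hu with hu | ⟨α, rfl, h⟩
      exacts [⟨hLF hu, triv_le hL hu⟩, ⟨mon_mem hxF α, h⟩]
    | zero => simp
    | one => simp
    | add a b _ _ h1 h2 => exact ⟨F.add_mem h1.1 h2.1, v.map_add_le h1.2 h2.2⟩
    | neg a _ h1 => exact ⟨F.neg_mem h1.1, by rw [Valuation.map_neg]; exact h1.2⟩
    | mul a b _ _ h1 h2 => exact ⟨F.mul_mem h1.1 h2.1, by rw [map_mul]; exact mle1 h1.2 h2.2⟩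
  exact .base _ hu this.1 this.2

theorem IndV.nf (h : IndV v x) (hL : ∀ l ∈ L, l ≠ 0 → v l = 1) {F : Subfield U} (hLF : L ≤ F) (hxF : ∀ i, x i ∈ F)
    {u : U} (hu : u ∈ Subfield.closure ((L : Set U) ∪ Set.range x)) (hu0 : u ≠ 0) :
    ∃ c ∈ L, c ≠ 0 ∧ ∃ α ε, Et v F (Rx v L x) ε ∧ v ε = 1 ∧ u = c * mon x α * ε := by
  classical
  have key : ∀ u ∈ Subring.closure ((L : Set U) ∪ Set.range x), u ≠ 0 →
      ∃ c ∈ L, c ≠ 0 ∧ ∃ α ε, Et v F (Rx v L x) ε ∧ v ε = 1 ∧ u = c * mon x α * ε := by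
    intro u hu hu0
    obtain ⟨f, hf, e⟩ := mem_lau h.1 (Subring.closure_mono (Set.union_subset_union_right (L : Set U) (by
      rintro _ ⟨i, rfl⟩; exact ⟨_, mon_single i⟩)) hu)
    have hs : f.support.Nonempty := by
      rw [Finsupp.support_nonempty_iff]; rintro rfl; simp at e; exact hu0 e
    obtain ⟨α, hα, hm⟩ := h.lead hs
    have hc0 : f α ≠ 0 := by simpa using hα
    have hm0 := mon_ne h.1 α
    have hvm : 0 < v (mon x α) := zero_lt_iff.2 (by simpa using hm0)
    have hvf : ∀ β ∈ f.support, v (f β) = 1 := fun β hβ => hL _ (hf β) (by simpa using hβ)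
    have hvu : v u = v (mon x α) := by
      rw [e, Finsupp.sum, v_sum_eq f.support _ hα, map_mul, hvf α hα, one_mul]
      intro β hβ hne
      rw [map_mul, map_mul, hvf α hα, hvf β hβ, one_mul, one_mul]; exact hm β hβ hne
    refine ⟨f α, hf α, hc0, α, u / (f α * mon x α), Rx_et hL hLF hxF ?_, ?_, by field_simp⟩
    · rw [e, Finsupp.sum, Finset.sum_div]
      refine Subring.sum_mem _ fun β hβ => ?_
      rw [mul_div_mul_comm, ← mon_sub h.1]
      refine Subring.mul_mem _ (L_Rx (L.div_mem (hf β) (hf α))) (mon_Rx ?_)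
      rw [mon_sub h.1, map_div₀]
      refine (div_le_one₀ hvm).2 ?_
      by_cases hb : β = α
      exacts [hb ▸ le_rfl, (hm β hβ hb).le]
    · rw [map_div₀, map_mul, hvf α hα, one_mul, hvu, div_self hvm.ne']
  obtain ⟨a, ha, b, hb, rfl⟩ := Subfield.mem_closure_iff.1 hu
  have ha0 : a ≠ 0 := by rintro rfl; simp at hu0
  have hb0 : b ≠ 0 := by rintro rfl; simp at hu0
  obtain ⟨c, hc, hc0, α, ε, h1, h2, rfl⟩ := key a ha ha0
  obtain ⟨d, hd, hd0, β, ε', h1', h2', rfl⟩ := key b hb hb0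
  refine ⟨c / d, L.div_mem hc hd, div_ne_zero hc0 hd0, α - β, ε * ε'⁻¹, h1.mul _ _ (h1'.inv h2'), by simp [h2, h2'], ?_⟩
  rw [mon_sub h.1]; ring

theorem IndV.val (h : IndV v x) (hL : ∀ l ∈ L, l ≠ 0 → v l = 1) {u : U}
    (hu : u ∈ Subfield.closure ((L : Set U) ∪ Set.range x)) (hu0 : u ≠ 0) : ∃ α, v u = v (mon x α) := by
  obtain ⟨c, hc, hc0, α, ε, h1, h2, rfl⟩ := h.nf hL (F := ⊤) le_top (fun _ => trivial) hu hu0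
  exact ⟨α, by rw [map_mul, map_mul, hL c hc hc0, h2]; simp⟩

theorem IndV.et (h : IndV v x) (hL : ∀ l ∈ L, l ≠ 0 → v l = 1) {F : Subfield U} (hLF : L ≤ F) (hxF : ∀ i, x i ∈ F)
    {u : U} (hu : u ∈ Subfield.closure ((L : Set U) ∪ Set.range x)) (huv : v u ≤ 1) : Et v F (Rx v L x) u := by
  by_cases hu0 : u = 0
  · rw [hu0]; exact .zero
  obtain ⟨c, hc, hc0, α, ε, h1, h2, rfl⟩ := h.nf hL hLF hxF hu hu0
  rw [map_mul, map_mul, hL c hc hc0, h2, one_mul, mul_one] at huv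
  exact .mul _ _ (Rx_et hL hLF hxF (Subring.mul_mem _ (L_Rx hc) (mon_Rx huv))) h1

theorem IndV.val_acl (h : IndV v x) (hL : ∀ l ∈ L, l ≠ 0 → v l = 1) {u : U}
    (hu : u ∈ acl (Subfield.closure ((L : Set U) ∪ Set.range x))) (hu0 : u ≠ 0) : ∃ n : ℕ, n ≠ 0 ∧ ∃ α, v u ^ n = v (mon x α) := by
  obtain ⟨n, hn, a, ha, ha0, e⟩ := val_alg (v := v) hu hu0
  obtain ⟨α, h'⟩ := h.val hL ha ha0
  exact ⟨n, hn, α, e.trans h'⟩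
end Mon

section Abh1
variable {U : Type*} [Field U] {Γ₀ : Type*} [LinearOrderedCommGroupWithZero Γ₀] {v : Valuation U Γ₀}
variable {ι : Type*} [Fintype ι] {x : ι → U} {L C : Subfield U}

theorem IndV.ne_one (h : IndV v x) (i : ι) : v (x i) ≠ 1 := by
  classical
  intro e
  rw [← mon_single (x := x) i] at e
  have := congrFun (h.2 _ e) i
  simp at this

theorem Imm.decompA [IsAlgClosed U] [Nonempty ι] (I : Imm v L C C) (h : IndV v x)
    (N1 : IntermediateField (Subfield.closure ((L : Set U) ∪ Set.range x)) U)
    [FiniteDimensional (Subfield.closure ((L : Set U) ∪ Set.range x)) N1] (hNC : N1.toSubfield ≤ C)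
    (hVF : VFix v (Subfield.closure ((L : Set U) ∪ Set.range x)) N1.toSubfield) {a : U} (ha : a ∈ N1) :
    ∃ f : (ι → ℤ) →₀ U, (∀ α, f α ∈ L) ∧ ∃ o ∈ N1, v o < 1 ∧ a = (f.sum fun α c => c * mon x α) + o := by
  classical
  have hA : Subfield.closure ((L : Set U) ∪ Set.range x) ≤ N1.toSubfield := fun x hx => N1.algebraMap_mem ⟨x, hx⟩
  have hLA : L ≤ Subfield.closure ((L : Set U) ∪ Set.range x) := fun x hx => Subfield.subset_closure (Or.inl hx)
  have hxA : ∀ i, x i ∈ Subfield.closure ((L : Set U) ∪ Set.range x) := fun i => Subfield.subset_closure (Or.inr ⟨i, rfl⟩)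
  have hm0 := mon_ne h.1
  have hvm : ∀ α, 0 < v (mon x α) := fun α => zero_lt_iff.2 (by simpa using hm0 α)
  obtain ⟨m, hm1, hma⟩ : ∃ m, 1 ≤ v (mon x m) ∧ v a ≤ v (mon x m) := by
    rcases le_total (v a) 1 with h1 | h1
    · exact ⟨0, by simp [mon_zero], by simpa [mon_zero] using h1⟩
    · have ha' : a ∈ acl (Subfield.closure ((L : Set U) ∪ Set.range x)) := by
        rw [mem_acl]
        have : IsIntegral (Subfield.closure ((L : Set U) ∪ Set.range x)) (⟨a, ha⟩ : N1) := IsIntegral.of_finite _ _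
        exact (this.map N1.val).isAlgebraic
      obtain ⟨n, hn, m, e⟩ := h.val_acl I.htriv ha' (by rintro rfl; simp at h1)
      exact ⟨m, e ▸ one_le_pow₀ h1, e ▸ le_self_pow₀ h1 hn⟩
  obtain ⟨π, hπ1⟩ : ∃ π, v (mon x π) < 1 := by
    have i := Classical.arbitrary ι
    rcases lt_or_gt_of_ne (h.ne_one i) with h1 | h1
    · exact ⟨Pi.single i 1, by rwa [mon_single]⟩
    · exact ⟨-Pi.single i 1, by rw [mon_neg, mon_single, map_inv₀]; exact inv_lt_one_of_one_lt₀ h1⟩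
  set R := Subring.closure ((L : Set U) ∪ Set.range (mon x)) with hR
  have h1 : Et v N1.toSubfield R (a / mon x m) := by
    refine (hVF.et hLA I.hL.infinite I.htriv (N1.div_mem ha (hA (mon_mem hxA m))) ?_).trans le_rfl fun r hr _ hv => ?_
    · rw [map_div₀]; exact (div_le_one₀ (hvm m)).2 hma
    · refine (h.et I.htriv (hLA.trans hA) (fun i => hA (hxA i)) hr hv).mono le_rfl (Subring.closure_mono (Set.union_subset_union_right _ ?_))
      rintro _ ⟨α, rfl, -⟩
      exact ⟨α, rfl⟩
  obtain ⟨r, hr, hrN, h2⟩ := h1.approx (L := L) (fun x hx => Subring.subset_closure (Or.inl hx)) (hLA.trans hA)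
    (fun x hx => I.h1 x (hNC hx)) (fun a ha h b hb => I.h3 a (hNC ha) h b (hNC hb)) (b := mon x (π - m)) (hA (mon_mem hxA _))
    (hm0 _) (by rw [mon_sub h.1, map_div₀]; exact (div_le_one₀ (hvm m)).2 (hπ1.le.trans hm1))
  obtain ⟨f, hf, hfe⟩ := mem_lau h.1 (R.mul_mem (Subring.subset_closure (Or.inr ⟨m, rfl⟩)) hr)
  refine ⟨f, hf, a - mon x m * r, N1.sub_mem ha (N1.mul_mem (hA (mon_mem hxA m)) hrN), ?_, by rw [← hfe]; ring⟩
  have := hm0 m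
  rw [show a - mon x m * r = mon x m * (a / mon x m - r) by field_simp, map_mul]
  refine lt_of_le_of_lt (mul_le_mul_right h2 _) ?_
  rw [mon_sub h.1, map_div₀, mul_div_cancel₀ _ (hvm m).ne']; exact hπ1

/-- reduced form modulo Artin-Schreier elements -/
def Red (v : Valuation U Γ₀) (L : Subfield U) (x : ι → U) (u : U) : Prop :=
  ∃ f : (ι → ℤ) →₀ U, (∀ α, f α ∈ L) ∧ (∀ α, f α ≠ 0 → 1 < v (mon x α) ∧ ∃ i, ¬ (ringExpChar U : ℤ) ∣ α i) ∧
    ∃ o ∈ Rx v L x, ∃ H ∈ Subfield.closure ((L : Set U) ∪ Set.range x),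
      u = (f.sum fun α c => c * mon x α) + o + (H ^ ringExpChar U - H)

theorem Red.add {u w : U} (h1 : Red v L x u) (h2 : Red v L x w) : Red v L x (u + w) := by
  classical
  obtain ⟨f, hf, hf1, o, ho, H, hH, rfl⟩ := h1
  obtain ⟨f', hf', hf1', o', ho', H', hH', rfl⟩ := h2
  refine ⟨f + f', fun α => L.add_mem (hf α) (hf' α), fun α hα => ?_, o + o', Subring.add_mem _ ho ho', H + H', Subfield.add_mem _ hH hH', ?_⟩
  · by_cases h : f α = 0
    · exact hf1' α fun h' => hα (by simp [h, h'])
    · exact hf1 α h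
  · rw [Finsupp.sum_add_index' (by simp) (by simp [add_mul]), add_pow_expChar]; ring

theorem Red.mon [IsAlgClosed U] (hL : AC L) (hp : (ringExpChar U).Prime) (n : ℕ) :
    ∀ c ∈ L, ∀ α : ι → ℤ, ∑ i, (α i).natAbs ≤ n → Red v L x (c * mon x α) := by
  classical
  induction n using Nat.strong_induction_on with
  | _ n ih =>
    intro c hc α hα
    by_cases h1 : v (_root_.mon x α) ≤ 1
    · exact ⟨0, fun _ => L.zero_mem, by simp, _, Subring.mul_mem _ (L_Rx hc) (mon_Rx h1), 0, zero_mem _, by simp [hp.ne_zero]⟩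
    by_cases h2 : ∃ i, ¬ (ringExpChar U : ℤ) ∣ α i
    · refine ⟨Finsupp.single α c, fun β => ?_, fun β hβ => ?_, 0, zero_mem _, 0, zero_mem _, ?_⟩
      · rw [Finsupp.single_apply]; split_ifs
        exacts [hc, L.zero_mem]
      · have : α = β := by by_contra h; exact hβ (Finsupp.single_eq_of_ne (Ne.symm h))
        exact this ▸ ⟨not_le.1 h1, h2⟩
      · rw [Finsupp.sum_single_index (by simp)]; simp [hp.ne_zero]
    push Not at h2
    choose β hβ using h2
    have hαβ : α = (ringExpChar U : ℤ) • β := funext fun i => by simp [hβ i]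
    have hd : rt 1 c ^ ringExpChar U = c := by simpa using rt_pow 1 c
    have hdL : rt 1 c ∈ L := hL.of_pow hp.ne_zero (by rwa [hd])
    have hlt : ∑ i, (β i).natAbs < n := by
      refine lt_of_lt_of_le ?_ hα
      have hne : ∃ i, β i ≠ 0 := by
        by_contra hcon; push Not at hcon
        exact h1 (by rw [hαβ, show β = 0 from funext hcon, smul_zero, mon_zero]; simp)
      obtain ⟨i, hi⟩ := hne
      have h2 := hp.two_le
      refine Finset.sum_lt_sum (fun j _ => ?_) ⟨i, Finset.mem_univ _, ?_⟩
      · rw [hβ j, Int.natAbs_mul]; simp; nlinarith [Nat.zero_le (β j).natAbs]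
      · rw [hβ i, Int.natAbs_mul]; simp
        have := Int.natAbs_pos.2 hi
        nlinarith
    obtain ⟨f, hf, hf1, o, ho, H, hH, e⟩ := ih _ hlt (rt 1 c) hdL β le_rfl
    have hxA : ∀ i, x i ∈ Subfield.closure ((L : Set U) ∪ Set.range x) := fun i => Subfield.subset_closure (Or.inr ⟨i, rfl⟩)
    refine ⟨f, hf, hf1, o, ho, H + rt 1 c * _root_.mon x β, Subfield.add_mem _ hH (Subfield.mul_mem _ (Subfield.subset_closure (Or.inl hdL)) (mon_mem hxA β)), ?_⟩
    rw [add_pow_expChar, mul_pow, hd, hαβ, mon_smul, zpow_natCast]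
    linear_combination e

theorem Red.all [IsAlgClosed U] (hL : AC L) (hp : (ringExpChar U).Prime) {f : (ι → ℤ) →₀ U} (hf : ∀ α, f α ∈ L) :
    Red v L x (f.sum fun α c => c * _root_.mon x α) := by
  classical
  rw [Finsupp.sum]
  have h0 : Red v L x 0 := ⟨0, fun _ => L.zero_mem, by simp, 0, zero_mem _, 0, zero_mem _, by simp [hp.ne_zero]⟩
  induction f.support using Finset.induction_on with
  | empty => simpa using h0
  | insert a s ha ih => rw [Finset.sum_insert ha]; exact (Red.mon hL hp _ _ (hf a) a le_rfl).add ih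
end Abh1

section Abh2
variable {U : Type*} [Field U] {Γ₀ : Type*} [LinearOrderedCommGroupWithZero Γ₀] {v : Valuation U Γ₀}
variable {ι : Type*} [Fintype ι] {x : ι → U} {L C N : Subfield U}

theorem mon_comp {κ : Type*} [Fintype κ] {σ : κ → ι} (hσ : Function.Injective σ) (γ : κ → ℤ) :
    mon (x ∘ σ) γ = mon x (Function.extend σ γ 0) := by
  refine Fintype.prod_of_injective σ hσ _ _ (fun i hi => ?_) fun i => ?_
  · rw [Function.extend_apply' _ _ _ hi]; simp
  · rw [hσ.extend_apply]; rfl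

theorem IndV.comp {κ : Type*} [Fintype κ] {σ : κ → ι} (hσ : Function.Injective σ) (h : IndV v x) : IndV v (x ∘ σ) := by
  refine ⟨fun i => h.1 _, fun γ hγ => ?_⟩
  rw [mon_comp hσ] at hγ
  exact funext fun i => by rw [← hσ.extend_apply γ 0 i, h.2 _ hγ]; rfl

theorem IndV.not_acl [DecidableEq ι] (h : IndV v x) (hL : ∀ l ∈ L, l ≠ 0 → v l = 1) (i : ι) :
    x i ∉ acl (Subfield.closure ((L : Set U) ∪ Set.range fun l : {l // l ≠ i} => x l)) := by
  intro hi
  obtain ⟨n, hn, γ, e⟩ := (h.comp (σ := ((↑) : {l // l ≠ i} → ι)) Subtype.val_injective).val_acl hL hi (h.1 i)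
  rw [mon_comp Subtype.val_injective, ← map_pow, ← zpow_natCast, ← mon_single (x := x) i, ← mon_smul] at e
  have := congrFun (h.inj e) i
  rw [Function.extend_apply' _ _ _ (by rintro ⟨a, ha⟩; exact a.2 ha)] at this
  simp at this; exact hn this

theorem mon_update [DecidableEq ι] (i : ι) (w : U) (α : ι → ℤ) :
    mon (Function.update x i w) α = mon x (Function.update α i 0) * w ^ α i := by
  rw [mon, mon, ← Finset.mul_prod_erase _ _ (Finset.mem_univ i), ← Finset.mul_prod_erase (a := i) _ (fun j => x j ^ _) (Finset.mem_univ i), mul_comm]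
  simp only [Function.update_self, zpow_zero, one_mul]
  congr 1
  refine Finset.prod_congr rfl fun j hj => ?_
  have := Finset.ne_of_mem_erase hj
  simp [this]

theorem mon_split [DecidableEq ι] (i : ι) (α : ι → ℤ) : mon x α = mon x (Function.update α i 0) * x i ^ α i := by
  conv_lhs => rw [← Function.update_eq_self i x]
  exact mon_update i _ α

theorem PD.pow_unit {φ δ : U → U} (hpd : PD v N φ δ) {u : U} (hu : u ∈ N) (hu1 : v u = 1) (hL : L ≤ N) (hδL : ∀ b ∈ L, δ b = 0) (n : ℤ) :
    v (δ (u ^ n)) ≤ v (δ u) := by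
  have hu0 : u ≠ 0 := by rintro rfl; simp at hu1
  have hui := N.inv_mem hu
  have h1 : v (δ u⁻¹) ≤ v (δ u) := by
    have := hpd.δ_mul u hu _ hui
    rw [mul_inv_cancel₀ hu0, hpd.δ_one, eq_comm, add_eq_zero_iff_eq_neg] at this
    have := congrArg v this
    rw [Valuation.map_neg, map_mul, map_mul, hu1, one_mul] at this
    rw [← this]
    exact mle1 le_rfl ((hpd.φ_val _ hui).2 (by simp [hu1]))
  have h2 := hpd.lip_Rg (t := ![u, u⁻¹]) (γ := v (δ u)) hL hδL
    (fun i => by fin_cases i; exacts [hu, hui]) (fun i => by fin_cases i <;> simp [hu1]) (fun i => by fin_cases i; exacts [le_rfl, h1])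
  refine (h2 _ ?_).2.2
  obtain ⟨k, rfl | rfl⟩ := n.eq_nat_or_neg
  · rw [zpow_natCast]; exact (Rg v L ![u, u⁻¹]).pow_mem (Subring.subset_closure (Or.inr ⟨0, rfl⟩)) k
  · rw [zpow_neg, zpow_natCast, ← inv_pow]; exact (Rg v L ![u, u⁻¹]).pow_mem (Subring.subset_closure (Or.inr ⟨1, rfl⟩)) k

theorem PD.lip_Rx {φ δ : U → U} (h : PD v N φ δ) (hL : ∀ l ∈ L, l ≠ 0 → v l = 1) (hLN : L ≤ N) (hδL : ∀ b ∈ L, δ b = 0) (hxN : ∀ i, x i ∈ N)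
    {γ : Γ₀} (hm : ∀ α, v (mon x α) ≤ 1 → v (δ (mon x α)) ≤ γ) {r : U} (hr : r ∈ Rx v L x) : r ∈ N ∧ v r ≤ 1 ∧ v (δ r) ≤ γ := by
  induction hr using Subring.closure_induction with
  | mem u hu =>
    rcases hu with hu | ⟨α, rfl, hu⟩
    · exact ⟨hLN hu, triv_le hL hu, by rw [hδL u hu, map_zero]; exact zero_le⟩
    · exact ⟨mon_mem hxN α, hu, hm α hu⟩
  | zero => exact ⟨N.zero_mem, by simp, by simp [h.δ_zero]⟩
  | one => exact ⟨N.one_mem, by simp, by simp [h.δ_one]⟩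
  | add a b _ _ h1 h2 => exact ⟨N.add_mem h1.1 h2.1, v.map_add_le h1.2.1 h2.2.1, by rw [h.δ_add _ h1.1 _ h2.1]; exact v.map_add_le h1.2.2 h2.2.2⟩
  | neg a _ h1 => exact ⟨N.neg_mem h1.1, by rw [Valuation.map_neg]; exact h1.2.1, by rw [h.δ_neg h1.1, Valuation.map_neg]; exact h1.2.2⟩
  | mul a b _ _ h1 h2 =>
    refine ⟨N.mul_mem h1.1 h2.1, by rw [map_mul]; exact mle1 h1.2.1 h2.2.1, ?_⟩
    rw [h.δ_mul _ h1.1 _ h2.1]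
    refine v.map_add_le ?_ ?_ <;> rw [map_mul]
    · exact mle1 h1.2.2 ((h.φ_val _ h2.1).2 h2.2.1)
    · exact mle2 h1.2.1 h2.2.2
end Abh2

section Abh3
variable {U : Type*} [Field U] {Γ₀ : Type*} [LinearOrderedCommGroupWithZero Γ₀] {v : Valuation U Γ₀}
variable {ι : Type*} [Fintype ι] {x : ι → U} {L C N : Subfield U}

theorem Imm.case2A [IsAlgClosed U] (I : Imm v L C C) (h : IndV v x) (hxN : ∀ i, x i ∈ N) {N' : Subfield U} {θ θ' o : U}
    (hN' : N' = Subfield.closure ((N : Set U) ∪ {θ})) (hNC' : N' ≤ C) (hLN : L ≤ N)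
    (hVF : VFix v (Subfield.closure ((L : Set U) ∪ Set.range x)) N) (hp : (ringExpChar U).Prime)
    (hNa : N' ≤ acl (Subfield.closure ((L : Set U) ∪ Set.range x)))
    (hθ : θ - θ' ∈ N) {f : (ι → ℤ) →₀ U} (hf : ∀ α, f α ∈ L) (hf0 : f ≠ 0)
    (hf1 : ∀ α, f α ≠ 0 → 1 < v (mon x α) ∧ ∃ i, ¬ (ringExpChar U : ℤ) ∣ α i)
    (hAS : θ' ^ ringExpChar U - θ' = (f.sum fun α c => c * mon x α) + o) (ho : Et v N (Rx v L x) o) :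
    ∃ x' : ι → U, (∀ i, x' i ∈ N') ∧ IndV v x' ∧
      Subfield.closure ((L : Set U) ∪ Set.range x) ≤ acl (Subfield.closure ((L : Set U) ∪ Set.range x')) ∧
      VFix v (Subfield.closure ((L : Set U) ∪ Set.range x')) N' := by
  classical
  have hNN : N ≤ N' := fun x hx => by rw [hN']; exact Subfield.subset_closure (Or.inl hx)
  have hθN : θ ∈ N' := by rw [hN']; exact Subfield.subset_closure (Or.inr rfl)
  have hθN' : θ' ∈ N' := by simpa using N'.sub_mem hθN (hNN hθ)
  obtain ⟨α, hα, hlead⟩ := h.lead (Finsupp.support_nonempty_iff.2 hf0)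
  have hc0 : f α ≠ 0 := by simpa using hα
  obtain ⟨hm1, i, hi⟩ := hf1 α hc0
  have hm0 := mon_ne h.1 α
  have hvm0 : v (mon x α) ≠ 0 := by simpa using hm0
  have hvf : ∀ β ∈ f.support, v (f β) = 1 := fun β hβ => I.htriv _ (hf β) (by simpa using hβ)
  set q := ringExpChar U with hqdef
  -- values
  have hvs : v (θ' ^ q - θ') = v (mon x α) := by
    rw [hAS]
    have e1 : v (f.sum fun α c => c * mon x α) = v (mon x α) := by
      rw [Finsupp.sum, v_sum_eq f.support _ hα, map_mul, hvf α hα, one_mul]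
      intro β hβ hne
      rw [map_mul, map_mul, hvf α hα, hvf β hβ, one_mul, one_mul]; exact hlead β hβ hne
    rw [Valuation.map_add_eq_of_lt_left v (by rw [e1]; exact ho.le_one.trans_lt hm1), e1]
  have hθ1 : 1 < v θ' := by
    by_contra hcon
    rw [not_lt] at hcon
    rw [← hvs] at hm1
    exact hm1.not_ge ((v.map_sub _ _).trans (max_le (by rw [map_pow]; exact pow_le_one₀ (zero_le) hcon) hcon))
  rw [v_AS_eq hp.two_le hθ1] at hvs
  have hθm : v θ' < v (mon x α) := by rw [← hvs]; exact lt_self_pow₀ hθ1 hp.one_lt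
  have hθ0 : θ' ≠ 0 := by rintro rfl; simp at hθ1
  -- the new generator
  have hd : rt 1 (f α) ^ q = f α := by simpa using rt_pow 1 (f α)
  have hdL : rt 1 (f α) ∈ L := I.hL.of_pow hp.ne_zero (by rw [hd]; exact hf α)
  generalize rt 1 (f α) = d at hd hdL
  have hd0 : d ≠ 0 := by rintro rfl; rw [zero_pow hp.ne_zero] at hd; exact hc0 hd.symm
  have hvd := I.htriv d hdL hd0
  obtain ⟨a, b, hab⟩ : IsCoprime (q : ℤ) (α i) := (Nat.prime_iff_prime_int.1 hp).coprime_iff_not_dvd.2 hi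
  set k := α i with hk
  set θ2 := θ' / d with hθ2
  have hθ20 : θ2 ≠ 0 := div_ne_zero hθ0 hd0
  set y := mon x (Function.update α i 0) with hy
  have hy0 : y ≠ 0 := mon_ne h.1 _
  have hmy : mon x α = y * x i ^ k := mon_split i α
  set u := θ2 ^ q / mon x α with hu
  have hu0 : u ≠ 0 := div_ne_zero (pow_ne_zero _ hθ20) hm0
  have hu1 : v u = 1 := by rw [hu, hθ2, map_div₀, map_pow, map_div₀, hvd, div_one, hvs, div_self hvm0]
  have hθ2q : θ2 ^ q = y * x i ^ k * u := by rw [← hmy, hu]; field_simp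
  set w := x i ^ a * θ2 ^ b with hw
  have hxi := h.1 i
  have hw0 : w ≠ 0 := mul_ne_zero (zpow_ne_zero _ hxi) (zpow_ne_zero _ hθ20)
  have hwq : w ^ q = x i * y ^ b * u ^ b := by
    have : w ^ q = x i ^ (a * q) * (θ2 ^ q) ^ b := by
      rw [hw, mul_pow, ← zpow_natCast, ← zpow_mul, ← zpow_natCast, ← zpow_natCast, ← zpow_mul, ← zpow_mul, mul_comm b]
    rw [this, hθ2q, mul_zpow, mul_zpow, ← zpow_mul]
    have e2 : x i = x i ^ (a * q) * x i ^ (k * b) := by rw [← zpow_add₀ hxi, mul_comm k b, hab, zpow_one]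
    conv_rhs => rw [e2]
    ring
  have hwk : θ2 = w ^ k * y ^ a * u ^ a := by
    have : w ^ k = x i ^ (a * k) * θ2 ^ (b * k) := by rw [hw, mul_zpow, ← zpow_mul, ← zpow_mul]
    rw [this, show b * k = 1 + -(q * a) by linear_combination hab, zpow_add₀ hθ20, zpow_neg, zpow_mul θ2 q a, zpow_natCast, hθ2q, mul_zpow, mul_zpow,
      ← zpow_mul, mul_comm k a, zpow_one]
    have := zpow_ne_zero a hy0
    have := zpow_ne_zero a hu0
    have := zpow_ne_zero (a * k) hxi
    field_simp
  have hθ2N : θ2 ∈ N' := N'.div_mem hθN' (hNN (hLN hdL))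
  have huN : u ∈ N' := N'.div_mem (N'.pow_mem hθ2N _) (mon_mem (fun i => hNN (hxN i)) _)
  have hwN : w ∈ N' := N'.mul_mem (N'.zpow_mem (hNN (hxN i)) _) (N'.zpow_mem hθ2N _)
  set x' := Function.update x i w with hx'
  have hx'N : ∀ j, x' j ∈ N' := fun j => by
    rw [hx']; by_cases hj : j = i
    · subst hj; simpa using hwN
    · simpa [hj] using hNN (hxN j)
  set A' := Subfield.closure ((L : Set U) ∪ Set.range x') with hA'
  have hLA' : L ≤ A' := fun z hz => Subfield.subset_closure (Or.inl hz)
  have hx'A : ∀ j, x' j ∈ A' := fun j => Subfield.subset_closure (Or.inr ⟨j, rfl⟩)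
  have hwA : w ∈ A' := by simpa [hx'] using hx'A i
  have hmA : ∀ β, mon x (Function.update β i 0) ∈ A' := fun β => by
    have := mon_mem hx'A (Function.update β i 0)
    rw [hx', mon_update] at this
    simpa using this
  have hA'N : A' ≤ N' := Subfield.closure_le.2 (by
    rintro z (hz | ⟨j, rfl⟩)
    exacts [hNN (hLN hz), hx'N j])
  have hyA : y ∈ A' := hmA α
  have hvw : v w ^ q = v (x i) * v y ^ b := by rw [← map_pow, hwq]; simp [hu1]
  have hind : IndV v x' := by
    refine ⟨fun j => ?_, fun γ hγ => ?_⟩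
    · rw [hx']; by_cases hj : j = i
      · subst hj; simpa using hw0
      · simpa [hj] using h.1 j
    · have e : v (mon x ((q : ℤ) • Function.update γ i 0 + γ i • (Pi.single i 1 + b • Function.update α i 0))) = 1 := by
        rw [hx', mon_update] at hγ
        rw [mon_add h.1, mon_smul, mon_smul, mon_add h.1, mon_smul, mon_single, map_mul, map_zpow₀, map_zpow₀, map_mul, map_zpow₀, ← hy, ← hvw,
          ← zpow_natCast, ← zpow_mul, mul_comm _ (γ i), zpow_mul, ← mul_zpow, ← map_zpow₀, ← map_mul, hγ, one_zpow]
      have e1 := h.2 _ e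
      have e2 := congrFun e1 i
      simp at e2
      funext j
      by_cases hj : j = i
      · rw [hj, e2]; rfl
      · have e3 := congrFun e1 j
        simp [hj, e2] at e3
        exact e3.resolve_left hp.ne_zero
  refine ⟨x', hx'N, hind, ?_, vfix_up hN' hVF fun φ δ hpd h3 h4 => ?_⟩
  · -- algebraicity
    set E := Subfield.closure ((L : Set U) ∪ Set.range fun l : {l // l ≠ i} => x' l) with hE
    have hEA : Subfield.closure ((E : Set U) ∪ {w}) ≤ A' := Subfield.closure_le.2 (by
      rintro z (hz | rfl)
      · exact Subfield.closure_mono (Set.union_subset_union_right _ (by rintro _ ⟨l, rfl⟩; exact ⟨l, rfl⟩)) hz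
      · exact hwA)
    have hAE : Subfield.closure ((L : Set U) ∪ Set.range x) ≤ Subfield.closure ((E : Set U) ∪ {x i}) := Subfield.closure_le.2 (by
      rintro z (hz | ⟨j, rfl⟩)
      · exact Subfield.subset_closure (Or.inl (Subfield.subset_closure (Or.inl hz)))
      · by_cases hj : j = i
        · exact Subfield.subset_closure (Or.inr (by rw [hj]; rfl))
        · exact Subfield.subset_closure (Or.inl (Subfield.subset_closure (Or.inr ⟨⟨j, hj⟩, by simp [hx', hj]⟩))))
    have hwE : w ∉ acl E := by simpa [hx'] using hind.not_acl I.htriv i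
    have := acl_exchange (acl_mono hAE (hNa hwN)) hwE
    refine Subfield.closure_le.2 ?_
    rintro z (hz | ⟨j, rfl⟩)
    · exact le_acl _ (hLA' hz)
    · by_cases hj : j = i
      · rw [hj]; exact acl_mono hEA this
      · exact le_acl _ (by simpa [hx', hj] using hx'A j)
  -- the derivation estimate
  have hδL : ∀ l ∈ L, δ l = 0 := fun l hl => h4 l (hLA' hl)
  have hzu : ∀ z ∈ A', ∀ n : ℤ, v (δ (z * u ^ n)) ≤ v (z * u ^ n) * v (δ u) := fun z hz n => by
    rw [hpd.δ_mul _ (hA'N hz) _ (N'.zpow_mem huN n), h4 z hz, zero_mul, zero_add, map_mul, map_mul, map_zpow₀, hu1, one_zpow, mul_one]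
    exact mul_le_mul_right (hpd.pow_unit huN hu1 (hLN.trans hNN) hδL n) _
  have hxi' : x i = w ^ q * y ^ (-b) * u ^ (-b) := by
    rw [hwq, zpow_neg, zpow_neg]
    have := zpow_ne_zero b hy0
    have := zpow_ne_zero b hu0
    field_simp
  have hmon : ∀ β, ∃ z ∈ A', ∃ n : ℤ, mon x β = z * u ^ n := fun β => by
    refine ⟨mon x (Function.update β i 0) * (w ^ q * y ^ (-b)) ^ β i, A'.mul_mem (hmA β) (A'.zpow_mem (A'.mul_mem (A'.pow_mem hwA _) (A'.zpow_mem hyA _)) _),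
      -b * β i, ?_⟩
    rw [mon_split i β]
    conv_lhs => rw [hxi']
    rw [mul_zpow _ (u ^ (-b)), ← zpow_mul, mul_assoc]
  have hL1 : ∀ {l}, l ∈ L → v l ≤ 1 := fun hl => triv_le I.htriv hl
  have hδm : ∀ l ∈ L, ∀ β, v (δ (l * mon x β)) ≤ v (mon x β) * v (δ u) := fun l hl β => by
    obtain ⟨z, hz, n, e⟩ := hmon β
    rw [e, ← mul_assoc]
    refine (hzu _ (A'.mul_mem (hLA' hl) hz) n).trans ?_
    rw [mul_assoc, map_mul]
    exact mul_le_mul_left (mle2 (hL1 hl) le_rfl) _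
  have hδo : v (δ o) ≤ v (δ u) := hpd.lipschitz (hpd.res (hLN.trans hNN) (fun a ha => h3 a (hLA' ha))
    fun x hx => I.h1 x (hNC' hx)) hNN _ (fun r hr _ _ => (hpd.lip_Rx I.htriv (hLN.trans hNN) hδL (fun i => hNN (hxN i)) (fun β hβ => by
      have := hδm 1 L.one_mem β
      rw [one_mul] at this
      exact this.trans (mle2 hβ le_rfl)) hr).2.2) ho
  have hcL : (f α)⁻¹ ∈ L := L.inv_mem (hf α)
  have hthN : (f α)⁻¹ * mon x (-α) ∈ N' := N'.mul_mem (hNN (hLN hcL)) (mon_mem (fun i => hNN (hxN i)) _)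
  have hvth : v (mon x (-α)) < 1 := by rw [mon_neg, map_inv₀]; exact inv_lt_one_of_one_lt₀ hm1
  have hvc : v (f α)⁻¹ = 1 := by rw [map_inv₀, hvf α hα, inv_one]
  have hθ'e : θ' = d * (w ^ k * y ^ a) * u ^ a := by rw [mul_assoc, ← hwk, hθ2]; field_simp
  obtain ⟨z1, hz1, n1, e1⟩ := hmon (-α)
  have hθth : θ' * ((f α)⁻¹ * mon x (-α)) = (d * (w ^ k * y ^ a) * (f α)⁻¹ * z1) * u ^ (a + n1) := by
    rw [e1, zpow_add₀ hu0]; conv_lhs => rw [hθ'e]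
    ring
  have hzA : d * (w ^ k * y ^ a) ∈ A' := A'.mul_mem (hLA' hdL) (A'.mul_mem (A'.zpow_mem hwA _) (A'.zpow_mem hyA _))
  have hδu : δ u = 0 := by
    by_contra hcon
    have hD : v (δ u) ≠ 0 := by simpa using hcon
    have hD0 : 0 < v (δ u) := zero_lt_iff.2 hD
    have key : u = 1 + (∑ β ∈ f.support.erase α, (f β * (f α)⁻¹) * mon x (β - α)) + o * ((f α)⁻¹ * mon x (-α)) + θ' * ((f α)⁻¹ * mon x (-α)) := by
      have e2 : θ' ^ q = f α * mon x α + (∑ β ∈ f.support.erase α, f β * mon x β) + o + θ' := by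
        rw [Finset.add_sum_erase f.support (fun β => f β * mon x β) hα]
        rw [sub_eq_iff_eq_add] at hAS; exact hAS
      have e3 : ∑ β ∈ f.support.erase α, (f β * (f α)⁻¹) * mon x (β - α) = (∑ β ∈ f.support.erase α, f β * mon x β) * ((f α)⁻¹ * (mon x α)⁻¹) := by
        rw [Finset.sum_mul]; exact Finset.sum_congr rfl fun β _ => by rw [mon_sub h.1]; ring
      rw [e3, hu, hθ2, div_pow, hd, e2, mon_neg]
      generalize ∑ β ∈ f.support.erase α, f β * mon x β = S
      field_simp
    have hSN : ∀ β, (f β * (f α)⁻¹) * mon x (β - α) ∈ N' := fun β => N'.mul_mem (hNN (hLN (L.mul_mem (hf β) hcL))) (mon_mem (fun i => hNN (hxN i)) _)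
    have hoN := hNN ho.mem
    have hd1 : δ u = (∑ β ∈ f.support.erase α, δ ((f β * (f α)⁻¹) * mon x (β - α))) + (δ o * φ ((f α)⁻¹ * mon x (-α)) + o * δ ((f α)⁻¹ * mon x (-α)))
        + δ (θ' * ((f α)⁻¹ * mon x (-α))) := by
      conv_lhs => rw [key]
      rw [hpd.δ_add _ (N'.add_mem (N'.add_mem N'.one_mem (N'.sum_mem fun β _ => hSN β)) (N'.mul_mem hoN hthN)) _ (N'.mul_mem hθN' hthN),
        hpd.δ_add _ (N'.add_mem N'.one_mem (N'.sum_mem fun β _ => hSN β)) _ (N'.mul_mem hoN hthN),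
        hpd.δ_add _ N'.one_mem _ (N'.sum_mem fun β _ => hSN β), hpd.δ_one, hpd.δ_sum _ _ fun β _ => hSN β, hpd.δ_mul _ hoN _ hthN]
      ring
    have hlt : ∀ {g : Γ₀}, g < 1 → g * v (δ u) < v (δ u) := fun hg => by simpa using (mul_lt_mul_iff_left₀ hD0).2 hg
    refine lt_irrefl (v (δ u)) ?_
    conv_lhs => rw [hd1]
    refine v.map_add_lt (v.map_add_lt (v.map_sum_lt hD fun β hβ => ?_) (v.map_add_lt ?_ ?_)) ?_
    · refine (hδm _ (L.mul_mem (hf β) hcL) _).trans_lt (hlt ?_)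
      rw [mon_sub h.1, map_div₀]
      exact (div_lt_one₀ (zero_lt_iff.2 hvm0)).2 (hlead β (Finset.mem_of_mem_erase hβ) (Finset.ne_of_mem_erase hβ))
    · rw [map_mul, mul_comm]
      have h7 : v (φ ((f α)⁻¹ * mon x (-α))) < 1 := hpd.lt_one hthN (by rw [map_mul, hvc, one_mul]; exact hvth)
      exact (mul_le_mul_right hδo _).trans_lt (hlt h7)
    · rw [map_mul]
      exact (mle2 ho.le_one (hδm _ hcL _)).trans_lt (hlt hvth)
    · rw [hθth]
      refine (hzu _ (A'.mul_mem (A'.mul_mem hzA (hLA' hcL)) hz1) _).trans_lt (hlt ?_)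
      rw [← hθth, map_mul, map_mul, hvc, one_mul, mon_neg, map_inv₀, ← div_eq_mul_inv]
      exact (div_lt_one₀ (zero_lt_iff.2 hvm0)).2 hθm
  have hzu0 : ∀ z ∈ A', ∀ n : ℤ, δ (z * u ^ n) = 0 := fun z hz n => by
    have := hzu z hz n
    rw [hδu, map_zero, mul_zero, nonpos_iff_eq_zero] at this
    simpa using this
  refine ⟨fun a ha => ?_, fun h5 => ?_⟩
  · have : Subfield.closure ((L : Set U) ∪ Set.range x) ≤ hpd.ker := by
      refine Subfield.closure_le.2 ?_
      rintro z (hz | ⟨j, rfl⟩)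
      · exact ⟨hNN (hLN hz), hδL z hz⟩
      · refine ⟨hNN (hxN j), ?_⟩
        obtain ⟨z, hz, n, e⟩ := hmon (Pi.single j 1)
        rw [mon_single] at e
        rw [e]; exact hzu0 z hz n
    exact (this ha).2
  · have h9 := h5 _ hθ
    rw [hpd.δ_sub hθN hθN'] at h9
    have : δ θ' = 0 := by rw [hθ'e]; exact hzu0 _ hzA _
    rwa [this, sub_zero] at h9
end Abh3

section Abh4
variable {U : Type*} [Field U] {Γ₀ : Type*} [LinearOrderedCommGroupWithZero Γ₀] {v : Valuation U Γ₀}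
variable {ι : Type*} [Fintype ι] {x : ι → U} {L C N : Subfield U}

theorem IndV.vfix_et [IsAlgClosed U] (hL : AC L) (htriv : ∀ l ∈ L, l ≠ 0 → v l = 1) (h : IndV v x)
    (N1 : IntermediateField (Subfield.closure ((L : Set U) ∪ Set.range x)) U)
    [FiniteDimensional (Subfield.closure ((L : Set U) ∪ Set.range x)) N1]
    (hVF : VFix v (Subfield.closure ((L : Set U) ∪ Set.range x)) N1.toSubfield) {a : U} (ha : a ∈ N1) (hva : v a ≤ 1) :
    Et v N1.toSubfield (Rx v L x) a := by
  have hA : Subfield.closure ((L : Set U) ∪ Set.range x) ≤ N1.toSubfield := fun x hx => N1.algebraMap_mem ⟨x, hx⟩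
  have hLA : L ≤ Subfield.closure ((L : Set U) ∪ Set.range x) := fun x hx => Subfield.subset_closure (Or.inl hx)
  exact (hVF.et hLA hL.infinite htriv ha hva).trans le_rfl fun r hr _ hv =>
    h.et htriv (hLA.trans hA) (fun i => hA (Subfield.subset_closure (Or.inr ⟨i, rfl⟩))) hr hv

theorem Imm.stepA [IsAlgClosed U] [Nonempty ι] (I : Imm v L C C) (hp : (ringExpChar U).Prime) (h : IndV v x)
    (N1 : IntermediateField (Subfield.closure ((L : Set U) ∪ Set.range x)) U)
    [FiniteDimensional (Subfield.closure ((L : Set U) ∪ Set.range x)) N1] (hN1 : N1.toSubfield = N) (hNC : N ≤ C)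
    (hVF : VFix v (Subfield.closure ((L : Set U) ∪ Set.range x)) N) {θ : U} (hθC : θ ∈ C) (hAS : θ ^ ringExpChar U - θ ∈ N) :
    ∃ x' : ι → U, (∀ i, x' i ∈ Subfield.closure ((N : Set U) ∪ {θ})) ∧ IndV v x' ∧
      Subfield.closure ((L : Set U) ∪ Set.range x) ≤ acl (Subfield.closure ((L : Set U) ∪ Set.range x')) ∧
      VFix v (Subfield.closure ((L : Set U) ∪ Set.range x')) (Subfield.closure ((N : Set U) ∪ {θ})) := by
  have hA : Subfield.closure ((L : Set U) ∪ Set.range x) ≤ N := fun x hx => hN1 ▸ N1.algebraMap_mem ⟨x, hx⟩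
  have hLA : L ≤ Subfield.closure ((L : Set U) ∪ Set.range x) := fun x hx => Subfield.subset_closure (Or.inl hx)
  have hxN : ∀ i, x i ∈ N := fun i => hA (Subfield.subset_closure (Or.inr ⟨i, rfl⟩))
  have hLN : L ≤ N := hLA.trans hA
  have hNC' : Subfield.closure ((N : Set U) ∪ {θ}) ≤ C := by
    refine Subfield.closure_le.2 ?_
    rintro x (hx | rfl)
    exacts [hNC hx, hθC]
  have hNa : N ≤ acl (Subfield.closure ((L : Set U) ∪ Set.range x)) := fun z hz => by
    rw [← hN1] at hz
    rw [mem_acl]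
    have : IsIntegral (Subfield.closure ((L : Set U) ∪ Set.range x)) (⟨z, hz⟩ : N1) := IsIntegral.of_finite _ _
    exact (this.map N1.val).isAlgebraic
  have hNa' : Subfield.closure ((N : Set U) ∪ {θ}) ≤ acl (Subfield.closure ((L : Set U) ∪ Set.range x)) := by
    refine Subfield.closure_le.2 ?_
    rintro z (hz | hz)
    · exact hNa hz
    · rw [Set.mem_singleton_iff] at hz
      subst hz
      refine (acl_acl _).root (f := X ^ ringExpChar U - X - Polynomial.C (z ^ ringExpChar U - z)) ?_ (fun i => ?_) (by simp)
      · intro h0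
        have := congrArg natDegree h0
        rw [natDegree_sub_C, natDegree_sub_eq_left_of_natDegree_lt, natDegree_X_pow, natDegree_zero] at this
        · exact hp.ne_zero this
        · simpa using hp.one_lt
      · simp only [coeff_sub, coeff_X_pow, coeff_X, coeff_C]
        refine Subfield.sub_mem _ (Subfield.sub_mem _ ?_ ?_) ?_ <;> split_ifs
        all_goals first | exact Subfield.one_mem _ | exact Subfield.zero_mem _ | exact hNa hAS
  obtain ⟨f, hf, o, hoN, ho1, e⟩ := I.decompA h N1 (hN1 ▸ hNC) (hN1 ▸ hVF) (a := θ ^ ringExpChar U - θ) (by rw [← hN1] at hAS; exact hAS)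
  have ho := h.vfix_et I.hL I.htriv N1 (hN1 ▸ hVF) hoN ho1.le
  rw [hN1] at ho
  obtain ⟨g, hg, hg1, o', ho', H, hH, e'⟩ := Red.all (v := v) (x := x) I.hL hp hf
  have ho2 := (Rx_et I.htriv hLN hxN ho').add _ _ ho
  have e2 : (θ - H) ^ ringExpChar U - (θ - H) = (g.sum fun α c => c * mon x α) + (o' + o) := by
    rw [sub_pow_expChar, show ∀ a b c d : U, a - b - (c - d) = (a - c) - (b - d) by intros; ring, e, e']; ring
  have hsub : θ - (θ - H) ∈ N := by rw [sub_sub_cancel]; exact hA hH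
  by_cases hg0 : g = 0
  · rw [hg0, Finsupp.sum_zero_index, zero_add] at e2
    exact ⟨x, fun i => Subfield.subset_closure (Or.inl (hxN i)), h, le_acl _, vfix_AS1 rfl hVF hp hLN hLA (fun x hx => I.h1 x (hNC' hx)) hsub
      (e2 ▸ ho2.mem) (e2 ▸ ho2.le_one)⟩
  · exact I.case2A h hxN rfl hNC' hLN hVF hp hNa' hsub hg hg0 hg1 e2 ho2
end Abh4

section Perron
variable {U : Type*} [Field U] {Γ₀ : Type*} [LinearOrderedCommGroupWithZero Γ₀] {v : Valuation U Γ₀}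
variable {ι : Type*} [Fintype ι]

/-- `x'` is a refinement of `x` -/
def Mv (v : Valuation U Γ₀) (x x' : ι → U) : Prop := IndV v x' ∧ (∀ i, v (x' i) < 1) ∧ (∀ i, x' i ∈ Subfield.closure (Set.range x)) ∧
  ∀ i, x i ∈ Submonoid.closure (Set.range x')

theorem Mv.le {x x' : ι → U} (h : Mv v x x') : Submonoid.closure (Set.range x) ≤ Submonoid.closure (Set.range x') :=
  Submonoid.closure_le.2 (by rintro _ ⟨i, rfl⟩; exact h.2.2.2 i)

theorem Mv.trans {x x' x'' : ι → U} (h : Mv v x x') (h' : Mv v x' x'') : Mv v x x'' :=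
  ⟨h'.1, h'.2.1, fun i => Subfield.closure_le.2 (by rintro _ ⟨i, rfl⟩; exact h.2.2.1 i) (h'.2.2.1 i), fun i => h'.le (h.2.2.2 i)⟩

theorem mon_nonneg {x : ι → U} {α : ι → ℤ} (h : ∀ i, 0 ≤ α i) : mon x α ∈ Submonoid.closure (Set.range x) := by
  refine Submonoid.prod_mem _ fun i _ => ?_
  obtain ⟨n, hn⟩ := Int.eq_ofNat_of_zero_le (h i)
  rw [hn, zpow_natCast]
  exact (Submonoid.closure (Set.range x)).pow_mem (Submonoid.subset_closure ⟨i, rfl⟩) n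

theorem mon_le_one {x : ι → U} (hx : ∀ i, v (x i) < 1) {α : ι → ℤ} (h : ∀ i, 0 ≤ α i) : v (mon x α) ≤ 1 := by
  rw [mon, map_prod]
  refine Finset.prod_le_one' fun i _ => ?_
  obtain ⟨n, hn⟩ := Int.eq_ofNat_of_zero_le (h i)
  rw [hn, zpow_natCast, map_pow]
  exact pow_le_one₀ (zero_le) (hx i).le

theorem IndV.move [DecidableEq ι] {x : ι → U} (h : IndV v x) (hx : ∀ i, v (x i) < 1) {i j : ι} (hij : i ≠ j) (hv : v (x i) < v (x j)) (α : ι → ℤ) :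
    Mv v x (Function.update x i (x i / x j)) ∧ mon x α = mon (Function.update x i (x i / x j)) (Function.update α j (α i + α j)) := by
  have key : ∀ β, mon (Function.update x i (x i / x j)) β = mon x (β - β i • Pi.single j 1) := fun β => by
    rw [mon_update, mon_sub h.1, mon_split i β, mon_smul, mon_single, div_zpow]; ring
  have hcl : ∀ l, x l ∈ Subfield.closure (Set.range x) := fun l => Subfield.subset_closure ⟨l, rfl⟩
  refine ⟨⟨⟨fun l => ?_, fun β hβ => ?_⟩, fun l => ?_, fun l => ?_, fun l => ?_⟩, ?_⟩
  · by_cases hl : l = i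
    · rw [hl, Function.update_self]; exact div_ne_zero (h.1 _) (h.1 _)
    · rw [Function.update_of_ne hl]; exact h.1 l
  · rw [key] at hβ
    have h1 := h.2 _ hβ
    have h2 : β i = 0 := by simpa [hij] using congrFun h1 i
    simpa [h2] using h1
  · by_cases hl : l = i
    · rw [hl, Function.update_self, map_div₀]; exact (div_lt_one₀ (zero_lt_iff.2 (by simpa using h.1 j))).2 hv
    · rw [Function.update_of_ne hl]; exact hx l
  · by_cases hl : l = i
    · rw [hl, Function.update_self]; exact Subfield.div_mem _ (hcl i) (hcl j)
    · rw [Function.update_of_ne hl]; exact hcl l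
  · have hm : ∀ l, Function.update x i (x i / x j) l ∈ Submonoid.closure (Set.range (Function.update x i (x i / x j))) :=
      fun l => Submonoid.subset_closure ⟨l, rfl⟩
    by_cases hl : l = i
    · have := Submonoid.mul_mem _ (hm i) (hm j)
      rw [Function.update_self, Function.update_of_ne hij.symm, div_mul_cancel₀ _ (h.1 j)] at this
      rwa [hl]
    · simpa [Function.update_of_ne hl] using hm l
  · rw [key]
    congr 1
    funext l
    by_cases hl : l = j
    · subst hl; simp [hij]
    · simp [hl, hij]

theorem IndV.perron1 (n : ℕ) : ∀ (x : ι → U) (α : ι → ℤ) (A B : ℤ), IndV v x → (∀ i, v (x i) < 1) → v (mon x α) ≤ 1 → (∀ i, α i ≤ A) → (∀ i, B ≤ α i) →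
    (A - B).toNat * (Fintype.card ι + 1) + {i | α i = A ∨ α i = B}.ncard ≤ n →
    ∃ x', Mv v x x' ∧ mon x α ∈ Submonoid.closure (Set.range x') := by
  classical
  induction n using Nat.strong_induction_on with
  | _ n ih =>
    intro x α A B h hx hα hA hB hn
    have hrefl : Mv v x x := ⟨h, hx, fun i => Subfield.subset_closure ⟨i, rfl⟩, fun i => Submonoid.subset_closure ⟨i, rfl⟩⟩
    by_cases hB0 : 0 ≤ B
    · exact ⟨x, hrefl, mon_nonneg fun i => hB0.trans (hB i)⟩
    by_cases hA0 : A ≤ 0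
    · have h1 := mon_le_one hx (α := -α) fun i => by have := hA i; simp; omega
      rw [mon_neg, map_inv₀] at h1
      have h2 : 1 ≤ v (mon x α) := (inv_le_one₀ (zero_lt_iff.2 (by simpa using mon_ne h.1 α))).1 h1
      exact ⟨x, hrefl, by rw [h.2 _ (le_antisymm hα h2), mon_zero]; exact Submonoid.one_mem _⟩
    have hcard : ∀ s : Set ι, s.ncard ≤ Fintype.card ι := fun s => by
      rw [← Nat.card_eq_fintype_card, ← Set.ncard_univ]; exact Set.ncard_le_ncard (Set.subset_univ s)
    by_cases h1 : ∃ i, α i = A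
    swap
    · push Not at h1
      refine ih _ ?_ x α (A - 1) B h hx hα (fun i => by have := hA i; have := h1 i; omega) hB le_rfl
      have := hcard {i | α i = A - 1 ∨ α i = B}
      rw [show (A - B).toNat = (A - 1 - B).toNat + 1 by omega, add_mul] at hn
      omega
    by_cases h2 : ∃ i, α i = B
    swap
    · push Not at h2
      refine ih _ ?_ x α A (B + 1) h hx hα hA (fun i => by have := hB i; have := h2 i; omega) le_rfl
      have := hcard {i | α i = A ∨ α i = B + 1}
      rw [show (A - B).toNat = (A - (B + 1)).toNat + 1 by omega, add_mul] at hn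
      omega
    obtain ⟨i, hi⟩ := h1
    obtain ⟨j, hj⟩ := h2
    have hij : i ≠ j := by rintro rfl; omega
    have hne : v (x i) ≠ v (x j) := fun e => by
      rw [← mon_single (x := x) i, ← mon_single (x := x) j] at e
      have := congrFun (h.inj e) i
      simp [hij] at this
    have fin : ∀ (k : ι) (x' : ι → U), (α k = A ∨ α k = B) → Mv v x x' → mon x α = mon x' (Function.update α k (A + B)) →
        ∃ x', Mv v x x' ∧ mon x α ∈ Submonoid.closure (Set.range x') := by
      intro k x' hk hm e
      have hlt : {l | Function.update α k (A + B) l = A ∨ Function.update α k (A + B) l = B}.ncard < {i | α i = A ∨ α i = B}.ncard := by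
        refine Set.ncard_lt_ncard ⟨fun l hl => ?_, fun hcon => ?_⟩
        · by_cases hlk : l = k
          · rw [hlk]; exact hk
          · simpa [hlk] using hl
        · have := hcon hk
          simp at this; omega
      obtain ⟨x'', h1, h2⟩ := ih _ (lt_of_lt_of_le (Nat.add_lt_add_left hlt _) hn) x' (Function.update α k (A + B)) A B hm.1 hm.2.1 (e ▸ hα)
        (fun l => by by_cases hlk : l = k; · rw [hlk, Function.update_self]; omega
                     · rw [Function.update_of_ne hlk]; exact hA l)
        (fun l => by by_cases hlk : l = k; · rw [hlk, Function.update_self]; omega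
                     · rw [Function.update_of_ne hlk]; exact hB l) le_rfl
      exact ⟨x'', hm.trans h1, e ▸ h2⟩
    rcases lt_or_gt_of_ne hne with hv | hv
    · obtain ⟨h1, h2⟩ := h.move hx hij hv α
      exact fin j _ (Or.inr hj) h1 (by rw [h2, hi, hj])
    · obtain ⟨h1, h2⟩ := h.move hx hij.symm hv α
      exact fin i _ (Or.inl hi) h1 (by rw [h2, hi, hj, add_comm])

theorem IndV.perron2 (s : List U) : ∀ x : ι → U, IndV v x → (∀ i, v (x i) < 1) → (∀ m ∈ s, v m ≤ 1 ∧ ∃ α, m = mon x α) →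
    ∃ x', Mv v x x' ∧ ∀ m ∈ s, m ∈ Submonoid.closure (Set.range x') := by
  classical
  induction s with
  | nil => exact fun x h hx _ => ⟨x, ⟨h, hx, fun i => Subfield.subset_closure ⟨i, rfl⟩, fun i => Submonoid.subset_closure ⟨i, rfl⟩⟩, by simp⟩
  | cons a s ih =>
    intro x h hx hs
    obtain ⟨x1, h1, h2⟩ := ih x h hx fun m hm => hs m (by simp [hm])
    obtain ⟨ha, α, rfl⟩ := hs a (by simp)
    have : ∃ α', mon x α = mon x1 α' := by
      have hx1 : ∀ u ∈ Submonoid.closure (Set.range x1), ∃ β, u = mon x1 β := fun u hu => by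
        induction hu using Submonoid.closure_induction with
        | mem u hu => obtain ⟨i, rfl⟩ := hu; exact ⟨_, (mon_single i).symm⟩
        | one => exact ⟨0, mon_zero.symm⟩
        | mul a b _ _ h1' h2 =>
          obtain ⟨β, rfl⟩ := h1'
          obtain ⟨γ, rfl⟩ := h2
          exact ⟨_, (mon_add h1.1.1 β γ).symm⟩
      choose β hβ using fun i => hx1 _ (h1.2.2.2 i)
      refine ⟨∑ i, α i • β i, ?_⟩
      have : ∀ s : Finset ι, ∏ i ∈ s, x i ^ α i = mon x1 (∑ i ∈ s, α i • β i) := fun s => by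
        induction s using Finset.induction_on with
        | empty => simp [mon_zero]
        | insert a s ha ih => rw [Finset.prod_insert ha, Finset.sum_insert ha, mon_add h1.1.1, mon_smul, ih, hβ a]
      exact this _
    obtain ⟨α', e⟩ := this
    obtain ⟨A, hA⟩ := Finite.exists_le α'
    obtain ⟨B, hB⟩ := Finite.exists_le (fun i => -α' i)
    obtain ⟨x2, h3, h4⟩ := IndV.perron1 (v := v) _ x1 α' A (-B) h1.1 h1.2.1 (e ▸ ha) hA (fun i => by have := hB i; omega) le_rfl
    refine ⟨x2, h1.trans h3, fun m hm => ?_⟩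
    rcases List.mem_cons.1 hm with rfl | hm
    · rw [e]; exact h4
    · exact h3.le (h2 m hm)

theorem IndV.perron {x : ι → U} (h : IndV v x) (s : Finset U) (hs : ∀ m ∈ s, v m ≤ 1 ∧ ∃ α, m = mon x α) :
    ∃ x' : ι → U, (∀ i, v (x' i) < 1) ∧ (∀ i, x' i ∈ Subfield.closure (Set.range x)) ∧ ∀ m ∈ s, m ∈ Submonoid.closure (Set.range x') := by
  classical
  let ε : ι → ℤ := fun i => if v (x i) < 1 then 1 else -1
  have hε : ∀ i, ε i * ε i = 1 := fun i => by dsimp only [ε]; split_ifs <;> rfl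
  have key : ∀ α, mon (fun i => x i ^ ε i) α = mon x (ε * α) := fun α => Finset.prod_congr rfl fun i _ => by simp [zpow_mul]
  have h1 : IndV v (fun i => x i ^ ε i) := by
    refine ⟨fun i => zpow_ne_zero _ (h.1 i), fun α hα => ?_⟩
    rw [key] at hα
    funext i
    have := congrFun (h.2 _ hα) i
    have h2 := hε i
    simp only [Pi.mul_apply, Pi.zero_apply] at this ⊢
    linear_combination ε i * this - α i * h2
  obtain ⟨x', h2, h3⟩ := IndV.perron2 s.toList _ h1 (fun i => by
    dsimp only [ε]; split_ifs with h'
    · simpa using h'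
    · rw [zpow_neg_one, map_inv₀]; exact inv_lt_one_of_one_lt₀ (lt_of_le_of_ne (not_lt.1 h') (h.ne_one i).symm)) (fun m hm => by
      obtain ⟨hv, α, rfl⟩ := hs m (by simpa using hm)
      refine ⟨hv, ε * α, ?_⟩
      rw [key, ← mul_assoc, show ε * ε = 1 from funext hε, one_mul])
  refine ⟨x', h2.2.1, fun i => Subfield.closure_le.2 ?_ (h2.2.2.1 i), fun m hm => h3 m (by simpa using hm)⟩
  rintro _ ⟨i, rfl⟩
  exact (Subfield.closure (Set.range x)).zpow_mem (Subfield.subset_closure ⟨i, rfl⟩) _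
end Perron

section Abh5
variable {U : Type*} [Field U] {Γ₀ : Type*} [LinearOrderedCommGroupWithZero Γ₀] {v : Valuation U Γ₀}

theorem split_char (D : ℕ) (hD : D ≠ 0) : ∃ a n, D = ringExpChar U ^ a * n ∧ (n : U) ≠ 0 := by
  rcases expChar_is_prime_or_one U (ringExpChar U) with hp | h1
  · have := charP_of_expChar_prime' hp
    obtain ⟨a, n, hn, e⟩ := Nat.exists_eq_pow_mul_and_not_dvd hD (ringExpChar U) hp.ne_one
    exact ⟨a, n, e, fun h => hn ((CharP.cast_eq_zero_iff U (ringExpChar U) n).1 h)⟩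
  · have : CharZero U := by
      have : ExpChar U 1 := h1 ▸ inferInstance
      exact charZero_of_expChar_one' U
    exact ⟨0, D, by simp, by exact_mod_cast hD⟩

theorem mem_acl_of_fd {A : Subfield U} (F : IntermediateField A U) [FiniteDimensional A F] : F.toSubfield ≤ acl A := fun z hz => by
  rw [mem_acl]
  have : IsIntegral A (⟨z, hz⟩ : F) := IsIntegral.of_finite _ _
  exact (this.map F.val).isAlgebraic

theorem val_fd {A F1 : Subfield U} {p : U[X]} (hp0 : p ≠ 0) (hpA : ∀ i, p.coeff i ∈ A) (hF1 : F1 ≤ Subfield.closure ((A : Set U) ∪ {r | p.eval r = 0})) :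
    ∃ d : ℕ, ∀ u ∈ F1, u ≠ 0 → ∃ n : ℕ, n ≠ 0 ∧ n ≤ d ∧ ∃ a ∈ A, a ≠ 0 ∧ v u ^ n = v a := by
  classical
  have e : {r | p.eval r = 0} = (p.roots.toFinset : Set U) := by ext; simp [hp0]
  rw [e] at hF1
  obtain ⟨N, hN, hfd⟩ := fd_of (A := A) p.roots.toFinset rfl fun s hs => mem_acl'.2 ⟨p, hp0, hpA, by simpa [hp0] using hs⟩
  refine ⟨Module.finrank A N, fun u hu hu0 => ?_⟩
  have huN : u ∈ N := by rw [← hN] at hF1; exact hF1 hu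
  have hi : IsIntegral A (⟨u, huN⟩ : N) := IsIntegral.of_finite _ _
  obtain ⟨n, h1, h2, h3⟩ := val_algb (v := v) (A := A) (y := u) (f := (minpoly A (⟨u, huN⟩ : N)).map A.subtype)
    ((Polynomial.map_ne_zero_iff A.subtype.injective).2 (minpoly.ne_zero hi)) (fun i => by simp [coeff_map]) (by
      have := congrArg N.val (minpoly.aeval A (⟨u, huN⟩ : N))
      rw [← Polynomial.aeval_algHom_apply, map_zero] at this
      rw [← this, aeval_def, eval_map]; rfl) hu0
  refine ⟨n, h1, h2.trans ?_, h3⟩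
  rw [natDegree_map]
  exact minpoly.natDegree_le _

theorem Imm.guA [IsAlgClosed U] {L C L0 E : Subfield U} (I : Imm v L C C) {ρ : ℕ} (hρ : 0 < ρ) {x : Fin ρ → U} (h : IndV v x) (hxC : ∀ i, x i ∈ C)
    (hE : E = Subfield.closure ((L0 : Set U) ∪ Set.range x)) (hL0 : L0 ≤ L) : GU v L E ρ := by
  classical
  have : Nonempty (Fin ρ) := ⟨⟨0, hρ⟩⟩
  intro p hp0 hpE Z hZ
  have hxE : ∀ i, x i ∈ E := fun i => by rw [hE]; exact Subfield.subset_closure (Or.inr ⟨i, rfl⟩)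
  have hEM : E ≤ Subfield.closure ((L : Set U) ∪ Set.range x) := by
    rw [hE]; exact Subfield.closure_mono (Set.union_subset_union_left _ hL0)
  have hLC := I.hLM
  have hEC : E ≤ C := by
    rw [hE]; refine Subfield.closure_le.2 ?_
    rintro z (hz | ⟨i, rfl⟩)
    exacts [hLC (hL0 hz), hxC i]
  have hF1 : Fd L E p ≤ Subfield.closure ((Subfield.closure ((L : Set U) ∪ Set.range x) : Set U) ∪ {r | p.eval r = 0}) :=
    Fd_le (fun z hz => Subfield.subset_closure (Or.inl (Subfield.subset_closure (Or.inl hz)))) (fun z hz => Subfield.subset_closure (Or.inl (hEM hz)))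
      fun z hz => Subfield.subset_closure (Or.inr hz)
  obtain ⟨d, hd⟩ := val_fd (v := v) hp0 (fun i => hEM (hpE i)) hF1
  obtain ⟨a, n, hdn, hn⟩ := split_char (U := U) d.factorial d.factorial_ne_zero
  have hn0 : n ≠ 0 := by rintro rfl; simp at hn
  obtain ⟨q, hq0, hqE, hpq, y, hy, k, hyx, F, hFD, hGal, hF, hroots⟩ := setup I.hL x h.1 hxE hEM hp0 hpE hn
  have hM0 : n * ringExpChar U ^ k ≠ 0 := mul_ne_zero hn0 (qpos k)
  have hmon : ∀ α, mon x α = mon y α ^ (n * ringExpChar U ^ k) := fun α => by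
    simp only [mon, ← Finset.prod_pow]
    exact Finset.prod_congr rfl fun i _ => by rw [← hyx i, ← zpow_natCast, ← zpow_natCast, ← zpow_mul, ← zpow_mul, mul_comm]
  have hyV : IndV v y := ⟨fun i h0 => h.1 i (by rw [← hyx, h0, zero_pow hM0]), fun α hα => h.2 α (by rw [hmon, map_pow, hα, one_pow])⟩
  have hFC : F.toSubfield ≤ C := by
    rw [hF]; exact Fd_le hLC hEC fun r hr => I.hC.root hq0 (fun i => hEC (hqE i)) hr
  have hMA : ∀ t : Fin ρ → U, L ≤ Subfield.closure ((L : Set U) ∪ Set.range t) := fun t x hx => Subfield.subset_closure (Or.inl hx)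
  have hyA : ∀ i, y i ∈ Subfield.closure ((L : Set U) ∪ Set.range y) := fun i => Subfield.subset_closure (Or.inr ⟨i, rfl⟩)
  have hEA : E ≤ Subfield.closure ((L : Set U) ∪ Set.range y) := hEM.trans (Subfield.closure_le.2 (by
    rintro z (hz | ⟨i, rfl⟩)
    · exact hMA y hz
    · rw [← hyx i]; exact Subfield.pow_mem _ (hyA i) _))
  have hAF : Subfield.closure ((L : Set U) ∪ Set.range y) ≤ F.toSubfield := fun x hx => F.algebraMap_mem ⟨x, hx⟩
  have hFa : F.toSubfield ≤ acl (Subfield.closure ((L : Set U) ∪ Set.range y)) := mem_acl_of_fd F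
  have hF1F : Fd L E p ≤ F.toSubfield := hF ▸ Fd_mono le_rfl le_rfl hpq
  have := I.hL.isAlgClosed
  have hN1 : ∀ N, Subfield.closure ((L : Set U) ∪ Set.range y) ≤ N → N ≤ F.toSubfield → ∀ t : Fin ρ → U, (∀ i, t i ∈ N) →
      F.toSubfield ≤ acl (Subfield.closure ((L : Set U) ∪ Set.range t)) →
      ∃ N' : IntermediateField (Subfield.closure ((L : Set U) ∪ Set.range t)) U, N'.toSubfield = N ∧
        FiniteDimensional (Subfield.closure ((L : Set U) ∪ Set.range t)) N' := by
    intro N hAN hNF t ht htF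
    refine fd_between hAN hNF (Finset.univ.image y) (by simp) (hMA t) (Subfield.closure_le.2 ?_) (hNF.trans htF)
    rintro z (hz | ⟨i, rfl⟩)
    exacts [hAN (hMA y hz), ht i]
  obtain ⟨t, htF, htV, hta, hVF⟩ := tower F (Fd L E p) L (fun σ z hz => by
      let τ : F →+* U := F.val.toRingHom.comp σ.toAlgHom.toRingHom
      have : Fd L E p ≤ ((Fd L E p).comap τ).map F.val.toRingHom := by
        have hσ : ∀ s, ∀ hs : s ∈ Subfield.closure ((L : Set U) ∪ Set.range y), s ∈ Fd L E p → s ∈ ((Fd L E p).comap τ).map F.val.toRingHom := fun s hs h1 => by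
          refine ⟨algebraMap (Subfield.closure ((L : Set U) ∪ Set.range y)) F ⟨s, hs⟩, ?_, rfl⟩
          change ((σ (algebraMap (Subfield.closure ((L : Set U) ∪ Set.range y)) F ⟨s, hs⟩) : F) : U) ∈ Fd L E p
          rw [σ.commutes]; exact h1
        refine Fd_le (fun l hl => hσ l (hMA y hl) (Fd_B hl)) (fun l hl => hσ l (hEA hl) (Fd_E hl)) fun r hr => ?_
        have hrF : r ∈ F := hF1F (Fd_root hr)
        refine ⟨⟨r, hrF⟩, ?_, rfl⟩
        refine Fd_root ?_
        obtain ⟨g, hg⟩ := lift_sub (fun i => hEA (hpE i))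
        rw [← hg, eval_map] at hr ⊢
        have h1 : aeval (⟨r, hrF⟩ : F) g = 0 := Subtype.ext ((Polynomial.aeval_algHom_apply F.val (⟨r, hrF⟩ : F) g).symm.trans hr)
        have h2 := congrArg (F.val.comp σ.toAlgHom) h1
        exact (Polynomial.aeval_algHom_apply (F.val.comp σ.toAlgHom) (⟨r, hrF⟩ : F) g).trans (h2.trans (map_zero _))
      obtain ⟨z', hz', e⟩ := this hz
      have : z' = z := Subtype.ext e
      exact this ▸ hz')
    (by
      rw [hF]
      refine Fd_le (fun l hl => Subfield.subset_closure (Or.inl (hMA y hl))) (fun l hl => Subfield.subset_closure (Or.inl (hEA hl))) fun r hr => ?_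
      rcases hroots r hr with h1 | ⟨i, h1⟩
      · exact Subfield.subset_closure (Or.inr (Fd_root h1))
      · have h2 : r / y i ∈ L := I.hL.of_pow hn0 (by rw [div_pow, h1, div_self (pow_ne_zero _ (hyV.1 i))]; exact L.one_mem)
        have := Subfield.mul_mem _ (hMA y h2) (hyA i)
        rw [div_mul_cancel₀ _ (hyV.1 i)] at this
        exact Subfield.subset_closure (Or.inl this)) hF1F
    (hMA y) Fd_B I.htriv (fun x hx => I.h1 x (hFC hx)) (fun u hu hu0 => by
      obtain ⟨m, hm, hmd, b, hb, hb0, e⟩ := hd u hu hu0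
      obtain ⟨α, hα⟩ := h.val I.htriv hb hb0
      obtain ⟨m', hm'⟩ := Nat.dvd_factorial (Nat.pos_of_ne_zero hm) hmd
      refine ⟨a, mon y (((m' * ringExpChar U ^ k : ℕ) : ℤ) • α), mon_mem hyA _, ?_⟩
      refine (pow_left_inj₀ (zero_le) (zero_le) hn0).1 ?_
      rw [map_pow, ← pow_mul, ← hdn, hm', pow_mul, e, hα, hmon, mon_smul, zpow_natCast, map_pow, map_pow, ← pow_mul, ← pow_mul]
      congr 1; ring)
    (fun N => ∃ t : Fin ρ → U, (∀ i, t i ∈ N) ∧ IndV v t ∧ F.toSubfield ≤ acl (Subfield.closure ((L : Set U) ∪ Set.range t)) ∧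
      VFix v (Subfield.closure ((L : Set U) ∪ Set.range t)) N)
    (fun N hAN hNF hV => ⟨y, fun i => hAN (hyA i), hyV, hFa, hV⟩)
    (fun N θ hAN hNF ⟨t, htN, htV, hta, hV⟩ hθ hθN hAS hp => by
      obtain ⟨N1, e1, e2⟩ := hN1 N hAN hNF t htN hta
      obtain ⟨t', h1, h2, h3, h4⟩ := I.stepA hp htV N1 e1 (hNF.trans hFC) hV (hFC hθ) hAS
      exact ⟨t', h1, h2, hta.trans (acl_le (acl_acl _) h3), h4⟩)
  obtain ⟨N1, e1, e2⟩ := hN1 _ hAF le_rfl t htF hta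
  rw [← e1] at hVF
  obtain ⟨W, hW, hWT⟩ := gu_gens (v := v) (B := L) (E := E) hq0 (Finset.univ.image x) (by simpa using hxE) (by simpa using hEM)
  have e3 : N1.toSubfield = Fd L E q := e1.trans hF
  obtain ⟨S, T, hS, hT, hfin⟩ := Et.finite_set (v := v) (F := N1.toSubfield) (R := Rx v L t) (Z ∪ W) fun z hz => by
    have : z ∈ Fd L E q ∧ v z ≤ 1 := by
      rcases Finset.mem_union.1 hz with hz | hz
      · exact ⟨Fd_mono le_rfl le_rfl hpq (hZ z hz).1, (hZ z hz).2⟩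
      · exact hW z hz
    rw [← e3] at this
    exact htV.vfix_et I.hL I.htriv N1 hVF this.1 this.2
  rw [e3] at hS hT
  obtain ⟨S0, hS0, hT0⟩ := fin_srs (S := {u | ∃ α, u = mon t α ∧ v u ≤ 1}) (T := (L : Set U)) T fun r hr => by
    rw [Set.union_comm]; exact (hT r hr).1
  obtain ⟨x', hx1, hx2, hx3⟩ := htV.perron S0 fun m hm => by
    obtain ⟨α, h1, h2⟩ := hS0 hm
    exact ⟨h2, α, h1⟩
  have hfin := hfin (Fd L E q) (Rg v L x') hS fun r hr => by
    refine .base _ (Subring.closure_le.2 ?_ (hT0 r hr)) (hT r hr).2.1 (hT r hr).2.2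
    rintro z (hz | hz)
    · have : Submonoid.closure (Set.range x') ≤ (Rg v L x').toSubmonoid := Submonoid.closure_le.2 fun w hw => Subring.subset_closure (Or.inr hw)
      exact this (hx3 z hz)
    · exact Subring.subset_closure (Or.inl ⟨hz, triv_le I.htriv hz⟩)
  refine ⟨q, hq0, hqE, hpq, x', fun i => ⟨?_, (hx1 i).le⟩, fun z hz => hfin z (by simp [hz]), hWT _ fun w hw => hfin w (by simp [hw])⟩
  rw [← hF]
  exact Subfield.closure_le.2 (by rintro _ ⟨i, rfl⟩; exact htF i) (hx2 i)
end Abh5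

section J
variable {U : Type*} [Field U] {Γ₀ : Type*} [LinearOrderedCommGroupWithZero Γ₀] {v : Valuation U Γ₀}

theorem exists_max {P : ℕ → Prop} (h : ∃ k, P k) (N : ℕ) (hb : ∀ k, P k → k ≤ N) : ∃ m, P m ∧ ∀ k, P k → k ≤ m := by
  classical
  obtain ⟨k, hk⟩ := h
  exact ⟨_, Nat.findGreatest_spec (hb k hk) hk, fun k hk => Nat.le_findGreatest (hb k hk) hk⟩

theorem res_lift [IsAlgClosed U] {L : Subfield U} (hL : AC L) (ht : ∀ l ∈ L, l ≠ 0 → v l = 1) {g : U[X]} (hg : g ≠ 0)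
    (hc : ∀ i, g.coeff i ∈ L) {y : U} (hgy : v (g.eval y) < 1) : ∃ l ∈ L, v (y - l) < 1 := by
  by_contra! hcon
  refine hgy.not_ge ?_
  rw [(IsAlgClosed.splits g).eval_eq_prod_roots, map_mul, ht g.leadingCoeff (hc _) (leadingCoeff_ne_zero.2 hg), one_mul, map_multiset_prod, Multiset.map_map]
  refine Multiset.one_le_prod_of_one_le fun z hz => ?_
  obtain ⟨r, hr, rfl⟩ := Multiset.mem_map.1 hz
  exact hcon r (hL.root hg hc (mem_roots'.1 hr).2)

theorem res_up [IsAlgClosed U] {L E : Subfield U} (hL : AC L) (ht : ∀ l ∈ L, l ≠ 0 → v l = 1)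
    (hE : ∀ y ∈ E, v y ≤ 1 → ∃ l ∈ L, v (y - l) < 1) : ∀ y ∈ acl E, v y ≤ 1 → ∃ l ∈ L, v (y - l) < 1 := by
  classical
  intro y hy hvy
  obtain ⟨f, hf, hc, h0⟩ := mem_acl'.1 hy
  obtain ⟨i, hi, hmax⟩ := Finset.exists_max_image f.support (fun i => v (f.coeff i)) (by simpa using hf)
  have hi0 : f.coeff i ≠ 0 := mem_support_iff.1 hi
  have ha : ∀ j, ∃ l ∈ L, v (f.coeff j / f.coeff i - l) < 1 := fun j => hE _ (E.div_mem (hc _) (hc _)) (by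
    by_cases hj : j ∈ f.support
    · rw [map_div₀]; exact (div_le_one₀ (by simpa [zero_lt_iff] using hi0)).2 (hmax j hj)
    · simp [notMem_support_iff.1 hj])
  choose l hl hl1 using ha
  have hco : ∀ k, (∑ j ∈ f.support, Polynomial.C (l j) * X ^ j : U[X]).coeff k = if k ∈ f.support then l k else 0 := fun k => by
    simp [coeff_X_pow]
  refine res_lift (g := ∑ j ∈ f.support, Polynomial.C (l j) * X ^ j) hL ht (fun h => ?_) (fun k => ?_) ?_
  · have := hco i
    rw [h, coeff_zero, if_pos hi] at this
    have h2 := hl1 i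
    rw [div_self hi0, ← this] at h2
    simp at h2
  · rw [hco]; split_ifs
    exacts [hl k, L.zero_mem]
  · have e : (∑ j ∈ f.support, Polynomial.C (l j) * X ^ j : U[X]).eval y = - ∑ j ∈ f.support, (f.coeff j / f.coeff i - l j) * y ^ j := by
      have h1 : ∑ j ∈ f.support, f.coeff j / f.coeff i * y ^ j = 0 := by
        rw [eval_eq_sum, Polynomial.sum] at h0
        rw [← zero_div (f.coeff i), ← h0, Finset.sum_div]
        exact Finset.sum_congr rfl fun _ _ => by ring
      simp only [sub_mul, Finset.sum_sub_distrib, h1, eval_finsetSum, eval_mul, eval_C, eval_pow, eval_X]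
      ring
    rw [e, Valuation.map_neg]
    refine Valuation.map_sum_lt _ one_ne_zero fun j _ => ?_
    rw [map_mul, map_pow]
    exact (mle1 le_rfl (pow_le_one' hvy _)).trans_lt (hl1 j)

theorem exists_coarse (W : ValuationSubring U) {a b : U} (ha : W.valuation a < 1)
    (h : ∀ n : ℕ, W.valuation b < W.valuation a ^ n) (hb0 : b ≠ 0) : ∃ W' : ValuationSubring U, W ≤ W' ∧ W'.valuation b ≠ 1 ∧
      ∀ x, (∃ k : ℤ, W.valuation x = W.valuation a ^ k) → W'.valuation x = 1 := by
  have ha0 : a ≠ 0 := by rintro rfl; simpa using h 1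
  have hva : W.valuation a ≠ 0 := by simpa using ha0
  let R : Subring U :=
    { carrier := {x | ∃ n : ℕ, W.valuation (x * a ^ n) ≤ 1}
      mul_mem' := by
        rintro x y ⟨n, hn⟩ ⟨m, hm⟩
        refine ⟨n + m, ?_⟩
        rw [show x * y * a ^ (n + m) = (x * a ^ n) * (y * a ^ m) by ring, map_mul]
        exact mul_le_one' hn hm
      one_mem' := ⟨0, by simp⟩
      add_mem' := by
        rintro x y ⟨n, hn⟩ ⟨m, hm⟩
        refine ⟨n + m, ?_⟩
        rw [show (x + y) * a ^ (n + m) = (x * a ^ n) * a ^ m + (y * a ^ m) * a ^ n by ring]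
        refine Valuation.map_add_le _ ?_ ?_ <;> rw [map_mul, map_pow]
        exacts [mul_le_one' hn (pow_le_one' ha.le _), mul_le_one' hm (pow_le_one' ha.le _)]
      zero_mem' := ⟨0, by simp⟩
      neg_mem' := by
        rintro x ⟨n, hn⟩
        exact ⟨n, by rwa [neg_mul, Valuation.map_neg]⟩ }
  refine ⟨W.ofLE R fun x hx => ⟨0, by simpa using (W.valuation_le_one_iff x).2 hx⟩, fun x hx => ⟨0, by simpa using (W.valuation_le_one_iff x).2 hx⟩, fun h1 => ?_, ?_⟩
  · have h2 : b⁻¹ ∈ W.ofLE R fun x hx => ⟨0, by simpa using (W.valuation_le_one_iff x).2 hx⟩ := by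
      rw [← ValuationSubring.valuation_le_one_iff, map_inv₀, h1, inv_one]
    obtain ⟨n, hn⟩ := h2
    rw [map_mul, map_inv₀, map_pow] at hn
    have h3 := (mul_le_mul_right hn (W.valuation b))
    rw [mul_one, ← mul_assoc, mul_inv_cancel₀ (by simpa using hb0), one_mul] at h3
    exact (h n).not_ge h3
  · have key : ∀ x, ∀ k : ℤ, W.valuation x = W.valuation a ^ k → x ∈ W.ofLE R fun x hx => ⟨0, by simpa using (W.valuation_le_one_iff x).2 hx⟩ := by
      intro x k hk
      refine ⟨k.natAbs, ?_⟩
      rw [map_mul, map_pow, hk, ← zpow_natCast, ← zpow_add₀ hva]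
      obtain ⟨m, hm⟩ := Int.eq_ofNat_of_zero_le (show 0 ≤ k + (k.natAbs : ℤ) by omega)
      rw [hm, zpow_natCast]
      exact pow_le_one' ha.le _
    rintro x ⟨k, hk⟩
    refine le_antisymm ((ValuationSubring.valuation_le_one_iff _ _).2 (key x k hk)) ?_
    have h2 := (ValuationSubring.valuation_le_one_iff _ _).2 (key x⁻¹ (-k) (by rw [map_inv₀, hk, zpow_neg]))
    rw [map_inv₀] at h2
    by_contra! h3
    refine h2.not_gt ((one_lt_inv₀ ?_).2 h3)
    rw [zero_lt_iff, ne_eq, map_eq_zero]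
    rintro rfl
    rw [map_zero] at hk
    exact zpow_ne_zero k hva hk.symm

abbrev Mt (K : Subfield U) := AlgebraicIndependent.matroid K U
abbrev cl (K : Subfield U) (J : Set U) : Subfield U := Subfield.closure ((K : Set U) ∪ J)

theorem cl_mono {K : Subfield U} {I J : Set U} (h : I ⊆ J) : cl K I ≤ cl K J := Subfield.closure_mono (Set.union_subset_union_right _ h)
theorem cl_le {K E : Subfield U} {I : Set U} (h : K ≤ E) (h2 : I ⊆ E) : cl K I ≤ E := Subfield.closure_le.2 (Set.union_subset h h2)
theorem le_cl (K : Subfield U) (I : Set U) : K ≤ cl K I := fun _ h => Subfield.subset_closure (Or.inl h)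
theorem sub_cl (K : Subfield U) (I : Set U) : I ⊆ cl K I := fun _ h => Subfield.subset_closure (Or.inr h)

theorem cl_union (K : Subfield U) (I J : Set U) : cl K (I ∪ J) = cl (cl K I) J := le_antisymm
  (cl_le ((le_cl K I).trans (le_cl _ _)) (Set.union_subset ((sub_cl K I).trans (le_cl (cl K I) J)) (sub_cl _ _)))
  (cl_le (cl_mono Set.subset_union_left) (Set.subset_union_right.trans (sub_cl _ _)))

theorem ind_insert {K : Subfield U} {J : Set U} (h : (Mt K).Indep J) {y : U} (hy : y ∉ acl (cl K J)) : (Mt K).Indep (insert y J) := by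
  rw [acl_matroid] at hy
  exact ((h.notMem_closure_iff (by simp)).1 hy).1

theorem ind_card {K : Subfield U} {I J : Finset U} (h : (Mt K).Indep (J : Set U)) (hy : (J : Set U) ⊆ acl (cl K I)) : J.card ≤ I.card := by
  have h1 : (J : Set U) ⊆ (Mt K).closure I := fun z hz => (acl_matroid _ _).1 (hy hz)
  have h2 := h.encard_le_eRk_of_subset h1
  rw [Matroid.eRk_closure_eq] at h2
  have h3 := h2.trans (Matroid.eRk_le_encard _ _)
  simpa using h3

theorem indV_ind {K E0 : Subfield U} {J : Finset U} [DecidableEq U] (hJ : (Mt K).Indep (J : Set U)) (hE0 : cl K (J : Set U) ≤ E0)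
    (ht : ∀ a ∈ E0, a ≠ 0 → v a = 1) {ρ : ℕ} {x : Fin ρ → U} (h : IndV v x) (S : Finset (Fin ρ)) :
    (Mt K).Indep ((J ∪ S.image x : Finset U) : Set U) ∧ (J ∪ S.image x).card = J.card + S.card := by
  induction S using Finset.induction_on with
  | empty => simpa using hJ
  | insert i S hi ih =>
    have hn : x i ∉ acl (cl K ((J ∪ S.image x : Finset U) : Set U)) := fun hx => h.not_acl ht i (acl_mono (cl_le ((le_cl K J).trans (hE0.trans (le_cl _ _))) (by
      intro z hz
      rcases Finset.mem_union.1 hz with hz | hz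
      · exact le_cl _ _ (hE0 (sub_cl _ _ hz))
      · obtain ⟨l, hl, rfl⟩ := Finset.mem_image.1 hz
        exact sub_cl _ _ ⟨⟨l, fun e => hi (e ▸ hl)⟩, rfl⟩)) hx)
    rw [Finset.image_insert, Finset.union_insert]
    refine ⟨by rw [Finset.coe_insert]; exact ind_insert ih.1 hn, ?_⟩
    rw [Finset.card_insert_of_notMem fun h => hn (le_acl _ (sub_cl _ _ h)), ih.2, Finset.card_insert_of_notMem hi, add_assoc]
end J

section J2
variable {U : Type*} [Field U] {Γ₀ : Type*} [LinearOrderedCommGroupWithZero Γ₀] {v : Valuation U Γ₀}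

theorem lt_one_of_inv {x : U} (h : v x ≠ 1) : v x < 1 ∨ v x⁻¹ < 1 := by
  rcases lt_or_gt_of_ne h with h | h
  · exact Or.inl h
  · right; rw [map_inv₀]; exact inv_lt_one_of_one_lt₀ h

theorem indV_one {a : U} (ha0 : a ≠ 0) (ha : v a < 1) : IndV v (fun _ : Fin 1 => a) := by
  refine ⟨fun _ => ha0, fun α hα => ?_⟩
  have hva : 0 < v a := by simpa [zero_lt_iff] using ha0
  simp only [mon, Fin.prod_univ_one, Fin.isValue, map_zpow₀] at hα
  ext i
  rw [Subsingleton.elim i 0, Pi.zero_apply]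
  by_contra hne
  rcases lt_or_gt_of_ne hne with h1 | h1
  · exact absurd hα (one_lt_zpow_of_neg₀ hva ha h1).ne'
  · exact absurd hα (zpow_lt_one₀ hva ha h1).ne

theorem triv_not_acl {A : Subfield U} (h : ∀ a ∈ A, a ≠ 0 → v a = 1) {a : U} (ha0 : a ≠ 0) (ha : v a ≠ 1) : a ∉ acl A :=
  fun h1 => ha (triv_acl h a h1 ha0)

theorem coarse_max [IsAlgClosed U] {K E : Subfield U} {n : ℕ}
    (hn : ∀ J : Finset U, (J : Set U) ⊆ E → (Mt K).Indep (J : Set U) → J.card ≤ n) (hK : ∀ a ∈ K, a ≠ 0 → v a = 1)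
    (hE : ∃ a ∈ E, a ≠ 0 ∧ v a ≠ 1) : ∃ (W : ValuationSubring U) (I : Finset U), v.valuationSubring ≤ W ∧ (I : Set U) ⊆ E ∧
      (Mt K).Indep (I : Set U) ∧ (∀ a ∈ cl K I, a ≠ 0 → W.valuation a = 1) ∧ (∃ a ∈ E, a ≠ 0 ∧ W.valuation a ≠ 1) ∧
      (∀ y ∈ acl E, W.valuation y ≤ 1 → ∃ l ∈ acl (cl K I), W.valuation (y - l) < 1) ∧
      (∀ a ∈ acl E, W.valuation a < 1 → ∀ b ∈ acl E, b ≠ 0 → ∃ n : ℕ, W.valuation a ^ n ≤ W.valuation b) := by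
  classical
  obtain ⟨m, ⟨W, I, hW, hIE, hI, hWI, hWE, hIm⟩, hm⟩ := exists_max (P := fun k => ∃ (W : ValuationSubring U) (I : Finset U), v.valuationSubring ≤ W ∧ (I : Set U) ⊆ E ∧
      (Mt K).Indep (I : Set U) ∧ (∀ a ∈ cl K I, a ≠ 0 → W.valuation a = 1) ∧ (∃ a ∈ E, a ≠ 0 ∧ W.valuation a ≠ 1) ∧ I.card = k) (by
        have e : ∀ x, v.valuationSubring.valuation x = 1 ↔ v x = 1 := fun x =>
          ((Valuation.isEquiv_valuation_valuationSubring v).eq_one_iff_eq_one (x := x)).symm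
        refine ⟨0, v.valuationSubring, ∅, le_rfl, by simp, by simp, fun a ha h0 => ?_, ?_, rfl⟩
        · rw [e]; exact hK a ((cl_le (le_refl K) (by simp)) ha) h0
        · simpa only [ne_eq, e] using hE) n (by
        rintro k ⟨W, I, hW, hIE, hI, hWI, hWE, rfl⟩
        exact hn I hIE hI)
  subst hIm
  have hmax : ∀ W' : ValuationSubring U, W ≤ W' → ∀ u ∈ E, u ∉ acl (cl K I) → (∀ a ∈ cl (cl K I) {u}, a ≠ 0 → W'.valuation a = 1) →
      ¬ ∃ a ∈ E, a ≠ 0 ∧ W'.valuation a ≠ 1 := fun W' hWW u hu huI ht hne => by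
    have := hm _ ⟨W', insert u I, hW.trans hWW, by
      rw [Finset.coe_insert]; exact Set.insert_subset hu hIE, by rw [Finset.coe_insert]; exact ind_insert hI huI, by
        rw [Finset.coe_insert, Set.insert_eq, Set.union_comm, cl_union]; exact ht, hne, rfl⟩
    rw [Finset.card_insert_of_notMem fun h => huI (le_acl _ (sub_cl _ _ h))] at this
    omega
  have hL := triv_acl hWI
  refine ⟨W, I, hW, hIE, hI, hWI, hWE, res_up (acl_acl _) hL fun u hu hu1 => ?_, ?_⟩
  · by_cases huI : u ∈ acl (cl K I)
    · exact ⟨u, huI, by simp⟩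
    have h1 : ¬ ∀ a ∈ cl (cl K I) {u}, a ≠ 0 → W.valuation a = 1 := fun h => hmax W le_rfl u hu huI h hWE
    push Not at h1
    obtain ⟨a, ha, ha0, hva⟩ := h1
    obtain ⟨g, hg0, hg, hgu⟩ : ∃ g : U[X], g ≠ 0 ∧ (∀ i, g.coeff i ∈ cl K I) ∧ W.valuation (g.eval u) < 1 := by
      have hp : ∀ g : U[X], (∀ i, g.coeff i ∈ cl K I) → W.valuation (g.eval u) ≤ 1 := fun g hg => by
        rw [eval_eq_sum, Polynomial.sum]
        refine Valuation.map_sum_le _ fun i _ => ?_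
        rw [map_mul, map_pow]
        exact mul_le_one' (triv_le hWI (hg i)) (pow_le_one' hu1 _)
      obtain ⟨g, h, hg, hh, e⟩ := mem_field_cl ha
      by_contra! hcon
      have h1 : ∀ g : U[X], (∀ i, g.coeff i ∈ cl K I) → g.eval u ≠ 0 → W.valuation (g.eval u) = 1 := fun g hg h0 =>
        le_antisymm (hp g hg) (hcon g (by rintro rfl; simp at h0) hg)
      rw [← e] at ha0
      rw [← e, map_div₀, h1 g hg (by rintro h; simp [h] at ha0), h1 h hh (by rintro h; simp [h] at ha0), div_one] at hva
      exact hva rfl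
    exact res_lift (acl_acl _) hL hg0 (fun i => le_acl _ (hg i)) hgu
  · have hEE : ∀ a ∈ E, W.valuation a < 1 → ∀ b ∈ E, b ≠ 0 → ∃ n : ℕ, W.valuation a ^ n ≤ W.valuation b := by
      intro a ha ha1 b hb hb0
      by_contra! hcon
      have ha0 : a ≠ 0 := by rintro rfl; simpa using hcon 1
      obtain ⟨W', hWW, hb', hu⟩ := exists_coarse W ha1 hcon hb0
      refine hmax W' hWW a ha (triv_not_acl hWI ha0 ha1.ne) (fun c hc hc0 => hu c ?_) ⟨b, hb, hb0, hb'⟩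
      obtain ⟨α, hα⟩ := (indV_one ha0 ha1).val hWI (u := c) (by rw [Set.range_const]; exact hc) hc0
      exact ⟨α 0, by simpa [mon] using hα⟩
    intro a ha ha1 b hb hb0
    by_cases ha0 : a = 0
    · exact ⟨1, by simp [ha0]⟩
    obtain ⟨k, hk, a', ha', ha0', ea⟩ := val_alg (v := W.valuation) ha ha0
    obtain ⟨l, hl, b', hb', hb0', eb⟩ := val_alg (v := W.valuation) hb hb0
    obtain ⟨N, hN⟩ := hEE a' ha' (by rw [← ea]; exact pow_lt_one' ha1 hk) b' hb' hb0'
    by_cases hb1 : W.valuation b ≤ 1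
    · refine ⟨k * N, ?_⟩
      rw [pow_mul, ea]
      refine hN.trans ?_
      rw [← eb]
      exact pow_le_of_le_one (zero_le) hb1 hl
    · exact ⟨0, by simpa using (not_le.1 hb1).le⟩
end J2

section J3
variable {U : Type*} [Field U] {Γ₀ : Type*} [LinearOrderedCommGroupWithZero Γ₀] {v : Valuation U Γ₀}

theorem indV_h2 [IsAlgClosed U] {E M : Subfield U} (hM : AC M) {ρ : ℕ} {x : Fin ρ → U} (hx : IndV v x) (hxM : ∀ i, x i ∈ M)
    (hmax : ∀ y ∈ E, y ≠ 0 → ¬ IndV v (Fin.snoc x y : Fin (ρ + 1) → U)) : ∀ y ∈ acl E, y ≠ 0 → ∃ e ∈ M, v y = v e := by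
  intro y hy hy0
  obtain ⟨n, hn, z, hz, hz0, e⟩ := val_alg (v := v) hy hy0
  have h1 := hmax z hz hz0
  rw [IndV, not_and_or] at h1
  have h2 : ∀ i, (Fin.snoc x z : Fin (ρ + 1) → U) i ≠ 0 := fun i => by
    refine Fin.lastCases ?_ (fun i => ?_) i
    · simpa using hz0
    · simpa using hx.1 i
  have h1 := h1.resolve_left (not_not.2 h2)
  push Not at h1
  obtain ⟨α, hα, hα0⟩ := h1
  have hm : mon (Fin.snoc x z : Fin (ρ + 1) → U) α = mon x (fun i => α i.castSucc) * z ^ α (Fin.last ρ) := by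
    simp [mon, Fin.prod_univ_castSucc]
  rw [hm, map_mul] at hα
  have hk : α (Fin.last ρ) ≠ 0 := fun hk => by
    rw [hk, zpow_zero, map_one, mul_one] at hα
    refine hα0 (funext fun i => Fin.lastCases hk (fun i => congrFun (hx.2 _ hα) i) i)
  set k := α (Fin.last ρ)
  obtain ⟨m, hmM, hm⟩ : ∃ m ∈ M, v z ^ k.natAbs = v m := by
    have hM1 := mon_mem hxM fun i => α i.castSucc
    have e1 := eq_inv_of_mul_eq_one_right hα
    rw [map_zpow₀] at e1
    rcases Int.natAbs_eq k with h | h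
    · refine ⟨_, M.inv_mem hM1, ?_⟩
      rw [map_inv₀, ← e1, ← zpow_natCast, ← h]
    · refine ⟨_, hM1, ?_⟩
      rw [h, zpow_neg, zpow_natCast] at e1
      exact inv_injective e1
  obtain ⟨r, hr⟩ := IsAlgClosed.exists_pow_nat_eq m (n := n * k.natAbs) (Nat.pos_of_ne_zero (by simp [hn, hk]))
  refine ⟨r, hM.of_pow (n := n * k.natAbs) (by simp [hn, hk]) (hr ▸ hmM), ?_⟩
  refine (pow_left_inj₀ (zero_le) (zero_le) (show n * k.natAbs ≠ 0 by simp [hn, hk])).1 ?_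
  rw [pow_mul, e, hm, ← hr, map_pow]

theorem gu_main [IsAlgClosed U] {K : Subfield U} (hK : ∀ a ∈ K, a ≠ 0 → v a = 1) (n : ℕ) : ∀ E : Subfield U, K ≤ E →
    (∀ J : Finset U, (J : Set U) ⊆ E → (Mt K).Indep (J : Set U) → J.card ≤ n) → ∃ J : Finset U, (J : Set U) ⊆ E ∧
      (Mt K).Indep (J : Set U) ∧ E ≤ acl (cl K J) ∧ GU v (acl K) (cl K J) J.card := by
  classical
  induction n using Nat.strong_induction_on with
  | _ n ih =>
  intro E hKE hn
  by_cases htr : ∀ a ∈ E, a ≠ 0 → v a = 1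
  · obtain ⟨m, ⟨J, hJE, hJ, rfl⟩, hm⟩ := exists_max (P := fun k => ∃ J : Finset U, (J : Set U) ⊆ E ∧ (Mt K).Indep (J : Set U) ∧ J.card = k)
      ⟨0, ∅, by simp, by simp, rfl⟩ n (by rintro k ⟨J, h1, h2, rfl⟩; exact hn J h1 h2)
    refine ⟨J, hJE, hJ, fun y hy => ?_, ?_⟩
    · by_contra hyJ
      have := hm _ ⟨insert y J, by rw [Finset.coe_insert]; exact Set.insert_subset hy hJE, by rw [Finset.coe_insert]; exact ind_insert hJ hyJ, rfl⟩
      rw [Finset.card_insert_of_notMem fun h => hyJ (le_acl _ (sub_cl _ _ h))] at this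
      omega
    · let e : Fin J.card → U := fun i => J.equivFin.symm i
      have he : Set.range e = J := by
        ext z; constructor
        · rintro ⟨i, rfl⟩; exact (J.equivFin.symm i).2
        · intro hz; exact ⟨J.equivFin ⟨z, hz⟩, by simp [e]⟩
      have := GU.triv (v := v) (K := K) e (fun i h0 => by
          have h1 : e i ∈ (J : Set U) := (J.equivFin.symm i).2
          have h2 := hJ.notMem_closure_sdiff_of_mem h1
          rw [← acl_matroid, h0] at h2
          exact h2 (Subfield.zero_mem _)) (fun a ha => htr a (by
          rw [he] at ha; exact cl_le hKE hJE ha))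
      rwa [he] at this
  push Not at htr
  obtain ⟨W, I, hW, hIE, hI, hWI, ⟨a, haE, ha0, ha1⟩, hres, harch⟩ := coarse_max hn hK htr
  have hin : I.card < n := by
    have hna := triv_not_acl hWI ha0 ha1
    have := hn (insert a I) (by rw [Finset.coe_insert]; exact Set.insert_subset haE hIE) (by rw [Finset.coe_insert]; exact ind_insert hI hna)
    rw [Finset.card_insert_of_notMem fun h => hna (le_acl _ (sub_cl _ _ h))] at this
    omega
  obtain ⟨J1, hJ1E, hJ1, hIJ, hG1⟩ := ih _ hin (cl K I) (le_cl _ _) fun J h1 h2 => ind_card h2 (h1.trans (le_acl _))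
  have hKI : cl K I ≤ E := cl_le hKE hIE
  have hJI : cl K J1 ≤ cl K I := cl_le (le_cl _ _) hJ1E
  have eL : acl (cl K I) = acl (cl K J1) := le_antisymm (acl_le (acl_acl _) hIJ) (acl_mono hJI)
  rw [eL] at hres
  have hWJ : ∀ a ∈ cl K J1, a ≠ 0 → W.valuation a = 1 := fun a ha => hWI a (hJI ha)
  have hb : ∀ ρ (x : Fin ρ → U), (∀ i, x i ∈ E) → IndV W.valuation x → (Mt K).Indep ((J1 ∪ Finset.univ.image x : Finset U) : Set U) ∧
      (((J1 ∪ Finset.univ.image x : Finset U) : Set U) ⊆ E) ∧ (J1 ∪ Finset.univ.image x).card = J1.card + ρ := fun ρ x hxE hx => by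
    have := indV_ind hJ1 le_rfl hWJ hx Finset.univ
    refine ⟨this.1, ?_, by simpa using this.2⟩
    rw [Finset.coe_union, Set.union_subset_iff]
    refine ⟨hJ1E.trans hKI, ?_⟩
    simpa [Set.range_subset_iff] using hxE
  obtain ⟨ρ, ⟨hρ, x, hxE, hx⟩, hmax⟩ := exists_max (P := fun ρ => 0 < ρ ∧ ∃ x : Fin ρ → U, (∀ i, x i ∈ E) ∧ IndV W.valuation x) (by
      rcases lt_one_of_inv ha1 with h | h
      · exact ⟨1, one_pos, _, fun _ => haE, indV_one ha0 h⟩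
      · exact ⟨1, one_pos, _, fun _ => E.inv_mem haE, indV_one (inv_ne_zero ha0) h⟩) n (by
      rintro k ⟨-, x, hxE, hx⟩
      obtain ⟨h1, h2, h3⟩ := hb k x hxE hx
      have := hn _ h2 h1
      omega)
  have hmax' : ∀ y ∈ E, y ≠ 0 → ¬ IndV W.valuation (Fin.snoc x y : Fin (ρ + 1) → U) := fun y hy _ h => by
    have := hmax (ρ + 1) ⟨by omega, _, fun i => by
      refine Fin.lastCases ?_ (fun i => ?_) i
      · simpa using hy
      · simpa using hxE i, h⟩
    omega
  have hLC : acl (cl K J1) ≤ acl E := acl_mono (hJI.trans hKI)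
  have hLt := triv_acl hWJ
  obtain ⟨hX1, hX2, hX3⟩ := hb ρ x hxE hx
  set J2 := J1 ∪ Finset.univ.image x with hJ2
  have hJ12 : J1 ⊆ J2 := Finset.subset_union_left
  have e2 : cl K J2 = cl (cl K J1) (Set.range x) := by
    rw [hJ2, ← cl_union]; simp
  have hG2 : GU W.valuation (acl (cl K J1)) (cl K J2) ρ :=
    Imm.guA (C := acl E) ⟨acl_acl _, acl_acl _, acl_acl _, hLC, le_rfl, hLt, hres, fun y hy _ => ⟨y, hy, rfl⟩, harch⟩ hρ hx
      (fun i => le_acl _ (hxE i)) e2 (le_acl _)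
  obtain ⟨m, ⟨J, hJ2J, hJE, hJ, rfl, k, hk, hGJ⟩, hm⟩ := exists_max (P := fun m => ∃ J : Finset U, J2 ⊆ J ∧ (J : Set U) ⊆ E ∧ (Mt K).Indep (J : Set U) ∧
      J.card = m ∧ ∃ k, J.card = J1.card + k ∧ GU W.valuation (acl (cl K J1)) (cl K J) k)
    ⟨_, J2, subset_rfl, hX2, hX1, rfl, ρ, hX3, hG2⟩ n (by rintro m ⟨J, -, h1, h2, rfl, -⟩; exact hn J h1 h2)
  have hJ1J : cl K J1 ≤ cl K J := cl_mono (Finset.coe_subset.2 (hJ12.trans hJ2J))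
  have hspan : E ≤ acl (cl K J) := fun y hy => by
    by_contra hyJ
    have hxM : ∀ i, x i ∈ acl (cl K J) := fun i => le_acl _ (sub_cl _ _ (hJ2J (by simp [hJ2])))
    have e3 : cl K (insert y J : Finset U) = cl (cl K J) {y} := by
      rw [Finset.coe_insert, Set.insert_eq, Set.union_comm, cl_union]
    have hG3 : GU W.valuation (acl (cl K J)) (cl K (insert y J : Finset U)) 1 :=
      Imm.gu (L := acl (cl K J1)) (C := acl E) ⟨acl_acl _, acl_acl _, acl_acl _, acl_mono hJ1J, acl_mono (cl_le hKE hJE), hLt, hres,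
        indV_h2 (acl_acl _) hx hxM hmax', harch⟩ (le_acl _ hy) hyJ e3 (le_acl _)
    have hG4 := GU.trans (cl_mono (by simp)) {y} (by rw [e3, Finset.coe_singleton]) (acl_mono hJ1J) hGJ hG3
    have hcard := Finset.card_insert_of_notMem (s := J) (a := y) fun h => hyJ (le_acl _ (sub_cl _ _ h))
    have := hm _ ⟨insert y J, hJ2J.trans (Finset.subset_insert _ _), by rw [Finset.coe_insert]; exact Set.insert_subset hy hJE,
      by rw [Finset.coe_insert]; exact ind_insert hJ hyJ, rfl, k + 1, by omega, hG4⟩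
    omega
  refine ⟨J, hJE, hJ, hspan, ?_⟩
  have hG5 : GU v (acl (cl K J1)) (cl K J) k := GU.rescale (fun z hz => (W.valuation_le_one_iff z).2 (hW hz)) hLt (acl_acl E) hLC
    ((cl_le hKE hJE).trans (le_acl _)) hres J (cl_le ((le_cl _ _).trans ((le_acl _).trans (le_cl _ _))) (sub_cl _ _)) (sub_cl _ _) hGJ
  rw [hk]
  refine GU.trans hJ1J J ?_ (acl_mono (le_cl _ _)) hG1 hG5
  exact le_antisymm (cl_le ((le_cl _ _).trans (le_cl _ _)) (sub_cl _ _)) (cl_le hJ1J (sub_cl _ _))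
end J3

section A9
variable {U : Type*} [Field U] {Γ₀ : Type*} [LinearOrderedCommGroupWithZero Γ₀] {v : Valuation U Γ₀} {R : Subring U}

/-- triangular systems -/
def Gd (v : Valuation U Γ₀) (R : Subring U) {n : ℕ} (η : Fin n → U) : Prop :=
  ∃ f : Fin n → MvPolynomial (Fin n) R, (∀ i j : Fin n, i < j → j ∉ (f i).vars) ∧ (∀ i, MvPolynomial.aeval η (f i) = 0) ∧
    (∀ i, v (MvPolynomial.aeval η (MvPolynomial.pderiv i (f i))) = 1) ∧ ∀ i, v (η i) ≤ 1

theorem Gd.snoc {n : ℕ} {η : Fin n → U} (h : Gd v R η) {y : U} (hy : v y ≤ 1) (g : MvPolynomial (Fin (n + 1)) R)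
    (h0 : MvPolynomial.aeval (Fin.snoc η y : Fin (n + 1) → U) g = 0)
    (h1 : v (MvPolynomial.aeval (Fin.snoc η y : Fin (n + 1) → U) (MvPolynomial.pderiv (Fin.last n) g)) = 1) :
    Gd v R (Fin.snoc η y : Fin (n + 1) → U) := by
  classical
  obtain ⟨f, hf1, hf2, hf3, hf4⟩ := h
  have e : (Fin.snoc η y : Fin (n + 1) → U) ∘ Fin.castSucc = η := funext fun i => by simp
  refine ⟨Fin.snoc (fun i => MvPolynomial.rename Fin.castSucc (f i)) g, fun i j hij => ?_, fun i => ?_, fun i => ?_, fun i => ?_⟩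
  · induction i using Fin.lastCases with
    | last => exact absurd hij (not_lt.2 (Fin.le_last j))
    | cast i =>
      rw [Fin.snoc_castSucc]
      intro hj
      obtain ⟨k, hk, rfl⟩ := Finset.mem_image.1 (MvPolynomial.vars_rename _ _ hj)
      exact hf1 i k (by simpa using hij) hk
  · induction i using Fin.lastCases with
    | last => simpa using h0
    | cast i => rw [Fin.snoc_castSucc, MvPolynomial.aeval_rename, e]; exact hf2 i
  · induction i using Fin.lastCases with
    | last => simpa using h1
    | cast i => rw [Fin.snoc_castSucc, MvPolynomial.pderiv_rename (Fin.castSucc_injective n), MvPolynomial.aeval_rename, e]; exact hf3 i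
  · induction i using Fin.lastCases with
    | last => simpa using hy
    | cast i => simpa using hf4 i

theorem snoc_range {n : ℕ} (η : Fin n → U) (y : U) : Set.range η ⊆ Set.range (Fin.snoc η y : Fin (n + 1) → U) ∧
    y ∈ Set.range (Fin.snoc η y : Fin (n + 1) → U) :=
  ⟨by rintro _ ⟨i, rfl⟩; exact ⟨i.castSucc, by simp⟩, ⟨Fin.last n, by simp⟩⟩

theorem Gd.fin {X : U → Prop} (hX : ∀ x, X x → ∀ n (η : Fin n → U), Gd v R η → ∃ n', ∃ η' : Fin n' → U, Gd v R η' ∧ Set.range η ⊆ Set.range η' ∧ x ∈ Set.range η')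
    (Z : Finset U) (hZ : ∀ z ∈ Z, X z) (n : ℕ) (η : Fin n → U) (h : Gd v R η) :
    ∃ n', ∃ η' : Fin n' → U, Gd v R η' ∧ Set.range η ⊆ Set.range η' ∧ (Z : Set U) ⊆ Set.range η' := by
  classical
  induction Z using Finset.induction_on with
  | empty => exact ⟨n, η, h, subset_rfl, by simp⟩
  | insert a Z ha ih =>
    obtain ⟨n', η', h1, h2, h3⟩ := ih fun z hz => hZ z (Finset.mem_insert_of_mem hz)
    obtain ⟨n'', η'', h4, h5, h6⟩ := hX a (hZ a (Finset.mem_insert_self _ _)) n' η' h1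
    exact ⟨n'', η'', h4, h2.trans h5, by rw [Finset.coe_insert]; exact Set.insert_subset h6 (h3.trans h5)⟩

theorem Et.gd {F : Subfield U} {x : U} (hx : Et v F R x) : ∀ n (η : Fin n → U), Gd v R η → ∃ n', ∃ η' : Fin n' → U, Gd v R η' ∧
    Set.range η ⊆ Set.range η' ∧ x ∈ Set.range η' := by
  classical
  have hne : ∀ {n : ℕ} (i : Fin n), Fin.castSucc i ≠ Fin.last n := fun i => (Fin.castSucc_lt_last i).ne
  induction hx with
  | base x hR hF hv =>
    intro n η h
    exact ⟨n + 1, _, h.snoc hv (MvPolynomial.X (Fin.last n) - MvPolynomial.C ⟨x, hR⟩) (by simp; exact sub_self x) (by simp), snoc_range η x⟩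
  | add x y hx hy h1 h2 =>
    intro n η h
    obtain ⟨n1, η1, g1, r1, m1⟩ := h1 n η h
    obtain ⟨n2, η2, g2, r2, j, rfl⟩ := h2 n1 η1 g1
    obtain ⟨i, rfl⟩ := r2 m1
    exact ⟨n2 + 1, _, g2.snoc (v.map_add_le hx.le_one hy.le_one) (MvPolynomial.X (Fin.last n2) - MvPolynomial.X i.castSucc - MvPolynomial.X j.castSucc)
      (by simp) (by simp [hne]), (r1.trans r2).trans (snoc_range _ _).1, (snoc_range _ _).2⟩
  | mul x y hx hy h1 h2 =>
    intro n η h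
    obtain ⟨n1, η1, g1, r1, m1⟩ := h1 n η h
    obtain ⟨n2, η2, g2, r2, j, rfl⟩ := h2 n1 η1 g1
    obtain ⟨i, rfl⟩ := r2 m1
    exact ⟨n2 + 1, _, g2.snoc (by rw [map_mul]; exact mul_le_one' hx.le_one hy.le_one) (MvPolynomial.X (Fin.last n2) - MvPolynomial.X i.castSucc * MvPolynomial.X j.castSucc)
      (by simp) (by simp [hne]), (r1.trans r2).trans (snoc_range _ _).1, (snoc_range _ _).2⟩
  | root f y hf hF hv h0 h1 ih =>
    intro n η h
    obtain ⟨n', η', g', r', m'⟩ := Gd.fin (X := fun x => ∃ i, x = f.coeff i) (by rintro x ⟨i, rfl⟩; exact ih i)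
      ((Finset.range (f.natDegree + 1)).image f.coeff) (by
        intro z hz; obtain ⟨i, -, rfl⟩ := Finset.mem_image.1 hz; exact ⟨i, rfl⟩) n η h
    have hc : ∀ i : ℕ, ∃ j, i < f.natDegree + 1 → η' j = f.coeff i := fun i => by
      obtain ⟨j0, -⟩ := m' (Finset.mem_coe.2 (Finset.mem_image.2 ⟨0, by simp, rfl⟩))
      by_cases hi : i < f.natDegree + 1
      · obtain ⟨j, hj⟩ := m' (Finset.mem_coe.2 (Finset.mem_image.2 ⟨i, by simpa using hi, rfl⟩))
        exact ⟨j, fun _ => hj⟩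
      · exact ⟨j0, fun h => absurd h hi⟩
    choose c hc using hc
    refine ⟨n' + 1, _, g'.snoc hv (∑ i ∈ Finset.range (f.natDegree + 1), MvPolynomial.X (c i).castSucc * MvPolynomial.X (Fin.last n') ^ i) ?_ ?_,
      r'.trans (snoc_range _ _).1, (snoc_range _ _).2⟩
    · rw [eval_eq_sum_range] at h0
      rw [map_sum, ← h0]
      exact Finset.sum_congr rfl fun i hi => by simp [hc i (Finset.mem_range.1 hi)]
    · rw [← h1, derivative_eval, Polynomial.sum_over_range _ (by simp), map_sum, map_sum]
      congr 1
      refine Finset.sum_congr rfl fun i hi => ?_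
      simp [hne, hc i (Finset.mem_range.1 hi), mul_assoc]

theorem Et.gd_fin {F : Subfield U} (Z : Finset U) (h : ∀ z ∈ Z, Et v F R z) : ∃ n, ∃ η : Fin n → U, Gd v R η ∧ (Z : Set U) ⊆ Set.range η := by
  obtain ⟨n, η, h1, -, h2⟩ := Gd.fin (v := v) (R := R) (X := fun x => Et v F R x) (fun x hx => hx.gd) Z h 0 Fin.elim0
    ⟨fun i => i.elim0, fun i => i.elim0, fun i => i.elim0, fun i => i.elim0, fun i => i.elim0⟩
  exact ⟨n, η, h1, h2⟩

theorem Gd.out {n : ℕ} {η : Fin n → U} (h : Gd v R η) : ∃ f : Fin n → MvPolynomial (Fin n) U, (∀ i m, (f i).coeff m ∈ R) ∧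
    (∀ i j : Fin n, (i : ℕ) < (j : ℕ) → MvPolynomial.degreeOf j (f i) = 0) ∧ (∀ i, MvPolynomial.eval η (f i) = 0) ∧
    v (Matrix.det (Matrix.of fun i j : Fin n => MvPolynomial.eval η (MvPolynomial.pderiv j (f i)))) = 1 := by
  classical
  obtain ⟨f, hf1, hf2, hf3, -⟩ := h
  have hev : ∀ p : MvPolynomial (Fin n) R, MvPolynomial.eval η (MvPolynomial.map R.subtype p) = MvPolynomial.aeval η p := fun p => by
    rw [MvPolynomial.eval_map]; rfl
  refine ⟨fun i => MvPolynomial.map R.subtype (f i), fun i m => ?_, fun i j hij => ?_, fun i => by rw [hev, hf2], ?_⟩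
  · rw [MvPolynomial.coeff_map]; exact Subtype.prop _
  · rw [MvPolynomial.degreeOf_def, Multiset.count_eq_zero]
    intro hj
    refine hf1 i j hij ?_
    rw [← MvPolynomial.vars_map_of_injective (f i) R.subtype_injective, MvPolynomial.vars_def]
    exact Multiset.mem_toFinset.2 hj
  · simp only [MvPolynomial.pderiv_map, hev]
    rw [Matrix.det_of_isLowerTriangular, map_prod]
    · exact Finset.prod_eq_one fun i _ => hf3 i
    · intro i j hij
      simp only [Matrix.of_apply]
      rw [MvPolynomial.pderiv_eq_zero_of_notMem_vars (hf1 i j hij), map_zero]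
end A9

section K1
variable {U : Type*} [Field U] {Γ₀ : Type*} [LinearOrderedCommGroupWithZero Γ₀] {v : Valuation U Γ₀}

theorem Et.comap {W : Type*} [Field W] (φ : W →+* U) {F : Subfield U} (hF : F ≤ φ.fieldRange) {R : Subring U} {x : U} (hx : Et v F R x) :
    ∀ y, φ y = x → Et (v.comap φ) ⊤ (R.comap φ) y := by
  induction hx with
  | base x hR hF hv => rintro y rfl; exact .base _ hR trivial hv
  | add x y hx hy h1 h2 =>
    intro z hz
    obtain ⟨a, rfl⟩ := hF hx.mem
    obtain ⟨b, rfl⟩ := hF hy.mem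
    rw [← map_add] at hz
    rw [φ.injective hz]
    exact .add _ _ (h1 a rfl) (h2 b rfl)
  | mul x y hx hy h1 h2 =>
    intro z hz
    obtain ⟨a, rfl⟩ := hF hx.mem
    obtain ⟨b, rfl⟩ := hF hy.mem
    rw [← map_mul] at hz
    rw [φ.injective hz]
    exact .mul _ _ (h1 a rfl) (h2 b rfl)
  | root f x hf hxF hv h0 h1 ih =>
    rintro y rfl
    obtain ⟨g, rfl⟩ : ∃ g : W[X], g.map φ = f := by
      rw [← mem_lifts, lifts_iff_coeff_lifts]
      intro n
      obtain ⟨a, ha⟩ := hF (hf n).mem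
      exact ⟨a, ha⟩
    rw [eval_map, eval₂_at_apply] at h0
    rw [derivative_map, eval_map, eval₂_at_apply] at h1
    exact .root g y (fun i => ih i _ (coeff_map _ _).symm) trivial hv (φ.injective (h0.trans (map_zero φ).symm)) h1

theorem acl_map {W : Type*} [Field W] (φ : W →+* U) {M : Subfield W} {x : W} (hx : x ∈ acl M) : φ x ∈ acl (M.map φ) := by
  obtain ⟨f, hf, hc, h0⟩ := mem_acl'.1 hx
  refine mem_acl'.2 ⟨f.map φ, (Polynomial.map_ne_zero_iff φ.injective).2 hf, fun i => ?_, ?_⟩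
  · rw [coeff_map]; exact ⟨_, hc i, rfl⟩
  · rw [eval_map, eval₂_at_apply, h0, map_zero]

theorem acl_comap {W : Type*} [Field W] (φ : W →+* U) {M : Subfield W} {x : W} (hx : φ x ∈ acl (M.map φ)) : x ∈ acl M := by
  obtain ⟨f, hf, hc, h0⟩ := mem_acl'.1 hx
  obtain ⟨g, rfl⟩ : ∃ g : W[X], g.map φ = f := by
    rw [← mem_lifts, lifts_iff_coeff_lifts]
    intro n
    obtain ⟨a, -, ha⟩ := hc n
    exact ⟨a, ha⟩
  refine mem_acl'.2 ⟨g, (Polynomial.map_ne_zero_iff φ.injective).1 hf, fun i => ?_, ?_⟩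
  · obtain ⟨a, ha, e⟩ := hc i
    rw [coeff_map] at e
    exact φ.injective e ▸ ha
  · rw [eval_map, eval₂_at_apply] at h0
    exact φ.injective (h0.trans (map_zero φ).symm)

theorem cl_map {W : Type*} [Field W] (φ : W →+* U) (M : Subfield W) (S : Set W) : (cl M S).map φ = cl (M.map φ) (φ '' S) := by
  rw [cl, cl, RingHom.map_field_closure, Set.image_union, Subfield.coe_map]

theorem Et.alg {F M : Subfield U} {R : Subring U} (hR : ∀ r ∈ R, r ∈ acl M) {x : U} (hx : Et v F R x) : x ∈ acl M := by
  induction hx with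
  | base x h => exact hR x h
  | add x y _ _ h1 h2 => exact Subfield.add_mem _ h1 h2
  | mul x y _ _ h1 h2 => exact Subfield.mul_mem _ h1 h2
  | root f x hf hxF hv h0 h1 ih =>
    refine (acl_acl M).root (f := f) ?_ ih h0
    rintro rfl
    simp at h1

theorem exists_ext {W : Type*} [Field W] (O : ValuationSubring W) (φ : W →+* U) : ∃ V : ValuationSubring U, V.comap φ = O := by
  obtain ⟨V, h, hloc⟩ := IsLocalRing.exists_factor_valuationRing (φ.comp O.subtype)
  have h1 : ∀ x ∈ O, φ x ∈ V := fun x hx => h (⟨x, hx⟩ : O)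
  refine ⟨V, le_antisymm (fun x hx => ?_) h1⟩
  by_contra hxO
  have hx' := (O.mem_or_inv_mem x).resolve_left hxO
  have hx0 : x ≠ 0 := by rintro rfl; exact hxO O.zero_mem
  have hu : IsUnit (⟨x⁻¹, hx'⟩ : O) := by
    refine hloc.map_nonunit _ (IsUnit.of_mul_eq_one ⟨φ x, hx⟩ ?_)
    ext
    change φ x⁻¹ * φ x = 1
    rw [← map_mul, inv_mul_cancel₀ hx0, map_one]
  obtain ⟨⟨b, hb⟩, hb'⟩ := hu.exists_right_inv
  have : x⁻¹ * b = 1 := congrArg Subtype.val hb'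
  rw [inv_mul_eq_one₀ hx0] at this
  clear hb'
  exact hxO (this ▸ hb)

/-- separable over a purely inseparable extension -/
theorem insep [IsAlgClosed U] {K : Subfield U} (B : Finset U) (hB : ∀ b ∈ B, b ∈ acl K) : ∃ (k : ℕ) (P : Finset U),
    (∀ a ∈ P, a ^ ringExpChar U ^ k ∈ K) ∧ ∀ b ∈ B, ∃ g : U[X], (∀ i, g.coeff i ∈ cl K P) ∧ g.eval b = 0 ∧ g.derivative.eval b ≠ 0 := by
  classical
  obtain ⟨k, hk⟩ := sep_pow_fin B hB
  have hfr : ∀ x : U, iterateFrobenius U (ringExpChar U) k x = x ^ ringExpChar U ^ k := fun x => rfl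
  have key : ∀ b, ∃ g : U[X], b ∈ B → (∀ i, g.coeff i ^ ringExpChar U ^ k ∈ K) ∧ g.eval b = 0 ∧ g.derivative.eval b ≠ 0 := fun b => by
    by_cases hb : b ∈ B
    · obtain ⟨f, hs, hf, h0⟩ := hk b hb
      have h1 : f.derivative.eval (b ^ ringExpChar U ^ k) ≠ 0 := by simpa using hs.aeval_derivative_ne_zero (x := b ^ ringExpChar U ^ k) (by simpa using h0)
      obtain ⟨g, rfl⟩ : ∃ g : U[X], g.map (iterateFrobenius U (ringExpChar U) k) = f := by
        rw [← mem_lifts, lifts_iff_coeff_lifts]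
        intro n
        obtain ⟨a, ha⟩ := IsAlgClosed.exists_pow_nat_eq (f.coeff n) (Nat.pos_of_ne_zero (qpos (U := U) k))
        exact ⟨a, ha⟩
      rw [← hfr, eval_map, eval₂_at_apply] at h0
      rw [← hfr, derivative_map, eval_map, eval₂_at_apply] at h1
      refine ⟨g, fun _ => ⟨fun i => ?_, ?_, fun h => h1 (by rw [h, map_zero])⟩⟩
      · have := hf i; rwa [coeff_map] at this
      · exact (iterateFrobenius U (ringExpChar U) k).injective (h0.trans (map_zero _).symm)
    · exact ⟨0, fun h => absurd h hb⟩
  choose g hg using key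
  refine ⟨k, B.biUnion fun b => (Finset.range ((g b).natDegree + 1)).image (g b).coeff, fun a ha => ?_, fun b hb => ⟨g b, fun i => ?_, (hg b hb).2⟩⟩
  · obtain ⟨b, hb, ha⟩ := Finset.mem_biUnion.1 ha
    obtain ⟨i, -, rfl⟩ := Finset.mem_image.1 ha
    exact (hg b hb).1 i
  · by_cases hi : i < (g b).natDegree + 1
    · exact sub_cl _ _ (Finset.mem_coe.2 (Finset.mem_biUnion.2 ⟨b, hb, Finset.mem_image.2 ⟨i, by simpa using hi, rfl⟩⟩))
    · rw [coeff_eq_zero_of_natDegree_lt (by omega)]; exact Subfield.zero_mem _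
end K1

section K2
variable {U : Type*} [Field U] {Γ₀ : Type*} [LinearOrderedCommGroupWithZero Γ₀] {v : Valuation U Γ₀}

theorem final_U [IsAlgClosed U] {K E F0 : Subfield U} (S Z : Finset U) (hKE : K ≤ E) (hEF : E ≤ F0) (hF0 : F0 = cl K S) (hFE : F0 ≤ acl E)
    (hK : ∀ a ∈ K, a ≠ 0 → v a = 1) (hZ : ∀ z ∈ Z, z ∈ F0 ∧ v z ≤ 1) :
    ∃ (g : U[X]) (k : ℕ) (P J Y : Finset U) (t : Fin J.card → U), g ≠ 0 ∧ (∀ i, g.coeff i ∈ E) ∧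
      (∀ a ∈ P, a ^ ringExpChar U ^ k ∈ K ∧ g.eval a = 0) ∧ (J : Set U) ⊆ E ∧ (Mt K).Indep (J : Set U) ∧ F0 ≤ Fd K E g ∧
      (∀ i, t i ∈ Fd K E g ∧ v (t i) ≤ 1) ∧ (∀ y ∈ Y, Et v (Fd K E g) (Subring.closure ((cl K P : Set U) ∪ Set.range t)) y) ∧ Z ⊆ Y ∧
      Fd K E g ≤ Subfield.closure ((cl K P : Set U) ∪ Set.range t ∪ Y) := by
  classical
  obtain ⟨J, hJE, hJ, hEJ, hG⟩ := gu_main hK S.card E hKE fun J h1 h2 => ind_card h2 (h1.trans ((hEF.trans hF0.le).trans (le_acl _)))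
  have hA : cl K J ≤ E := cl_le hKE hJE
  have hSF : ∀ s ∈ S, s ∈ F0 := fun s hs => hF0 ▸ sub_cl K _ hs
  obtain ⟨p, hp, hpA, hpS⟩ := exists_poly_of_alg (E := cl K J) S fun s hs => acl_le (acl_acl _) hEJ (hFE (hSF s hs))
  have hF0p : F0 ≤ Fd (acl K) (cl K J) p := hF0 ▸ cl_le ((le_acl K).trans Fd_B) fun s hs => Fd_root (hpS s hs)
  obtain ⟨q, hq, hqA, ⟨r, rfl⟩, t, ht, hEt, hgen⟩ := hG p hp hpA Z fun z hz => ⟨hF0p (hZ z hz).1, (hZ z hz).2⟩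
  set q := p * r
  have hqS : ∀ s ∈ S, q.eval s = 0 := fun s hs => by simp [q, hpS s hs]
  obtain ⟨B0, hB0, h0⟩ := fin_sfs q.roots.toFinset fun x hx => hgen (Fd_root (by simpa [hq] using hx))
  simp only [Set.union_comm (B0 : Set U)] at h0
  obtain ⟨Y0, hY0, h0⟩ := fin_sfs q.roots.toFinset h0
  obtain ⟨S1, T1, hS1, hT1, hfin⟩ := Et.finite_set (Z ∪ Y0) fun x hx => (Finset.mem_union.1 hx).elim (hEt x) fun h => hY0 h
  obtain ⟨B1, hB1, h1⟩ := fin_srs T1 fun r hr => (hT1 r hr).1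
  obtain ⟨B2, hB2, h2⟩ := fin_sfs (S1 ∪ Finset.univ.image t) (S := (acl K : Set U)) (T := (cl K J : Set U) ∪ {x | q.eval x = 0}) fun x hx => by
    rcases Finset.mem_union.1 hx with hx | hx
    · exact hS1 hx
    · obtain ⟨i, -, rfl⟩ := Finset.mem_image.1 hx
      exact (ht i).1
  obtain ⟨k0, hk0, hk0K, hk0B⟩ := exists_poly_of_alg (E := K) (B0 ∪ B1 ∪ B2) fun x hx => by
    rcases Finset.mem_union.1 hx with hx | hx
    · exact (Finset.mem_union.1 hx).elim (fun h => hB0 h) fun h => (hB1 h).1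
    · exact hB2 hx
  have hB : ∀ b ∈ k0.roots.toFinset, b ∈ acl K := fun b hb => mem_acl'.2 ⟨k0, hk0, hk0K, by simpa [hk0] using hb⟩
  obtain ⟨k, P, hP, hg⟩ := insep k0.roots.toFinset hB
  have hPK : cl K P ≤ acl K := cl_le (le_acl K) fun a ha => (acl_acl K).of_pow (qpos k) (le_acl K (hP a ha))
  let w : U[X] := ∏ a ∈ P, (X ^ ringExpChar U ^ k - C (a ^ ringExpChar U ^ k))
  let g := q * (k0 * w)
  have hgE : ∀ i, g.coeff i ∈ E := by
    have h1 : ∀ f : U[X], (∀ i, f.coeff i ∈ E) ↔ f ∈ Polynomial.lifts E.subtype := fun f => by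
      rw [lifts_iff_coeff_lifts]; simp
    rw [h1]
    refine mul_mem ((h1 _).1 fun i => hA (hqA i)) (mul_mem ((h1 _).1 fun i => hKE (hk0K i)) (prod_mem fun a ha => ?_))
    rw [sub_eq_add_neg, ← C_neg]
    exact add_mem (pow_mem (X_mem_lifts _) _) (C'_mem_lifts (f := E.subtype) ⟨⟨_, E.neg_mem (hKE (hP a ha))⟩, rfl⟩)
  have hgP : ∀ a ∈ P, g.eval a = 0 := fun a ha => by
    simp only [g, w, eval_mul, eval_prod]
    rw [Finset.prod_eq_zero ha (by simp), mul_zero, mul_zero]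
  have hgr : ∀ x, g.eval x = 0 → q.eval x = 0 ∨ k0.eval x = 0 ∨ x ∈ P := fun x hx => by
    simp only [g, w, eval_mul, eval_prod, mul_eq_zero, Finset.prod_eq_zero_iff] at hx
    refine hx.imp_right (Or.imp_right fun ⟨a, ha, h⟩ => ?_)
    rw [qpow_inj k (x := x) (y := a) (by simpa [sub_eq_zero] using h)]; exact ha
  have hqN : ∀ x, q.eval x = 0 → x ∈ Fd K E g := fun x hx => Fd_root (by simp [g, hx])
  have hkN : ∀ x, k0.eval x = 0 → x ∈ Fd K E g := fun x hx => Fd_root (by simp [g, hx])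
  have hPN : cl K P ≤ Fd K E g := cl_le Fd_B fun a ha => Fd_root (hgP a ha)
  have hBk : ∀ b ∈ B0 ∪ B1 ∪ B2, b ∈ k0.roots.toFinset := fun b hb => by simpa [hk0] using hk0B b hb
  have hN2 : ∀ x ∈ S1 ∪ Finset.univ.image t, x ∈ Fd K E g := fun x hx => by
    refine Subfield.closure_le.2 ?_ (h2 x hx)
    rintro y (hy | hy | hy)
    exacts [hkN y (hk0B y (Finset.mem_union_right _ hy)), Fd_E (hA hy), hqN y hy]
  have htN : ∀ i, t i ∈ Fd K E g := fun i => hN2 _ (Finset.mem_union_right _ (Finset.mem_image_of_mem _ (Finset.mem_univ i)))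
  set R := Subring.closure ((cl K P : Set U) ∪ Set.range t) with hR
  have htr := triv_acl hK
  have hEB : ∀ b ∈ k0.roots.toFinset, Et v (Fd K E g) R b := fun b hb => by
    obtain ⟨f, hf, f0, f1⟩ := hg b hb
    refine .root f b (fun i => .base _ (Subring.subset_closure (Or.inl (hf i))) (hPN (hf i)) (triv_le htr (hPK (hf i))))
      (hkN b (by simpa [hk0] using hb)) (triv_le htr (hB b hb)) f0 (htr _ ?_ f1)
    exact eval_mem_subfield (deriv_coeff_mem fun i => hPK (hf i)) (hB b hb)
  have hall := hfin (Fd K E g) R (fun x hx => hN2 x (Finset.mem_union_left _ hx)) fun r hr => by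
    rw [← mem_EtRing]
    refine Subring.closure_le.2 ?_ (h1 r hr)
    rintro y (hy | ⟨i, rfl⟩)
    · exact hEB y (hBk y (by simp_all))
    · exact .base _ (Subring.subset_closure (Or.inr ⟨i, rfl⟩)) (htN i) (ht i).2
  have hF0N : F0 ≤ Fd K E g := hF0 ▸ cl_le Fd_B fun s hs => hqN s (hqS s hs)
  refine ⟨g, k, P, J, Z ∪ Y0 ∪ k0.roots.toFinset, t, mul_ne_zero hq (mul_ne_zero hk0 (Finset.prod_ne_zero_iff.2 fun a _ =>
    X_pow_sub_C_ne_zero (Nat.pos_of_ne_zero (qpos k)) _)), hgE, fun a ha => ⟨hP a ha, hgP a ha⟩, hJE, hJ, hF0N, fun i => ⟨htN i, (ht i).2⟩,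
    fun y hy => (Finset.mem_union.1 hy).elim (hall y) (hEB y), fun z hz => by simp [hz], ?_⟩
  set Q := Subfield.closure ((cl K P : Set U) ∪ Set.range t ∪ ((Z ∪ Y0 ∪ k0.roots.toFinset : Finset U) : Set U))
  have hPQ : cl K P ≤ Q := fun x hx => Subfield.subset_closure (Or.inl (Or.inl hx))
  have hYQ : ∀ x ∈ Z ∪ Y0 ∪ k0.roots.toFinset, x ∈ Q := fun x hx => Subfield.subset_closure (Or.inr hx)
  have hqQ : ∀ x, q.eval x = 0 → x ∈ Q := fun x hx => by
    refine Subfield.closure_le.2 ?_ (h0 x (by simpa [hq] using hx))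
    rintro y (hy | hy)
    · exact hYQ y (Finset.mem_union_left _ (Finset.mem_union_right _ hy))
    · exact hYQ y (Finset.mem_union_right _ (hBk y (Finset.mem_union_left _ (Finset.mem_union_left _ hy))))
  have hKQ : K ≤ Q := (le_cl K _).trans hPQ
  refine Fd_le hKQ (hEF.trans (hF0 ▸ cl_le hKQ fun s hs => hqQ s (hqS s hs))) fun x hx => ?_
  rcases hgr x hx with hx | hx | hx
  · exact hqQ x hx
  · exact hYQ x (Finset.mem_union_right _ (by simpa [hk0] using hx))
  · exact hPQ (sub_cl K _ hx)
end K2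

section K3
variable {U : Type*} [Field U]

theorem alg_ind {M : Subfield U} {d : ℕ} {t : Fin d → U} (hi : Function.Injective t) (h : ∀ i, t i ∉ acl (cl M (Set.range t \ {t i}))) :
    AlgebraicIndependent M t := by
  rw [← algebraicIndependent_subtype_range hi]
  refine (AlgebraicIndependent.matroid_indep_iff (R := M) (A := U)).1 ((Matroid.indep_iff_forall_notMem_closure_sdiff (by simp)).2 ?_)
  rintro _ ⟨i, rfl⟩
  rw [← acl_matroid]
  exact h i

theorem t_ind {K M : Subfield U} (hM : M ≤ acl K) {J : Finset U} (hJ : (Mt K).Indep (J : Set U)) {t : Fin J.card → U}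
    (h : (J : Set U) ⊆ acl (cl M (Set.range t))) : Function.Injective t ∧ ∀ i, t i ∉ acl (cl M (Set.range t \ {t i})) := by
  classical
  have hc : ∀ T : Finset U, acl (cl M T) ≤ acl (cl K T) := fun T => acl_le (acl_acl _) (cl_le (hM.trans (acl_mono (le_cl _ _))) ((sub_cl _ _).trans (le_acl _)))
  have e : Set.range t = ((Finset.univ.image t : Finset U) : Set U) := by simp
  have h1 : J.card ≤ (Finset.univ.image t).card := ind_card hJ fun x hx => hc _ (e ▸ h hx)
  refine ⟨?_, fun i hi => ?_⟩
  · have h2 : (Finset.univ.image t).card = (Finset.univ : Finset (Fin J.card)).card := le_antisymm Finset.card_image_le (by simpa using h1)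
    exact fun a b hab => Finset.card_image_iff.1 h2 (by simp) (by simp) hab
  · have e' : Set.range t \ {t i} = (((Finset.univ.image t).erase (t i) : Finset U) : Set U) := by simp
    have h3 : J.card ≤ ((Finset.univ.image t).erase (t i)).card := ind_card hJ fun x hx => hc _ (by
      rw [← e']
      refine acl_le (acl_acl _) (cl_le ((le_cl _ _).trans (le_acl _)) ?_) (h hx)
      intro y hy
      by_cases hyi : y = t i
      · exact hyi ▸ hi
      · exact le_acl _ (sub_cl _ _ ⟨hy, hyi⟩))
    rw [Finset.card_erase_of_mem (by simp)] at h3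
    have : (Finset.univ.image t).card ≤ J.card := by simpa using Finset.card_image_le (s := Finset.univ) (f := t)
    have : 0 < J.card := i.pos
    omega

theorem unif_out {W : Type*} [Field W] (φ : W →+* U) (V : ValuationSubring U) {K M : Subfield U} (hM : M ≤ acl K) (hMV : ∀ x ∈ M, x ∈ V) {J Y : Finset U}
    (hJ : (Mt K).Indep (J : Set U)) (hJN : (J : Set U) ⊆ φ.fieldRange) {t : Fin J.card → U} (htN : ∀ i, t i ∈ φ.fieldRange ∧ V.valuation (t i) ≤ 1)
    (hMN : M ≤ φ.fieldRange)
    (hY : ∀ y ∈ Y, Et V.valuation φ.fieldRange (Subring.closure ((M : Set U) ∪ Set.range t)) y)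
    (hgen : φ.fieldRange ≤ Subfield.closure ((M : Set U) ∪ Set.range t ∪ Y)) {m : ℕ} (ζ : Fin m → W) (hζ : ∀ k, φ (ζ k) ∈ Y) :
    LocalUnif.UnifWrt ⊤ (M.comap φ) (V.comap φ) ζ := by
  classical
  choose s hs using fun i => (htN i).1
  obtain rfl : t = fun i => φ (s i) := funext fun i => (hs i).symm
  have ert : Set.range (fun i => φ (s i)) = φ '' Set.range s := by rw [← Set.range_comp]; rfl
  have eM : (M.comap φ).map φ = M := by
    ext x; exact ⟨fun ⟨y, hy, e⟩ => e ▸ hy, fun h => by obtain ⟨y, rfl⟩ := hMN h; exact ⟨y, h, rfl⟩⟩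
  have eMs : φ '' (M.comap φ : Set W) = M := by rw [← Subfield.coe_map, eM]
  have hYr : ∀ y ∈ Y, y ∈ φ.fieldRange := fun y hy => (hY y hy).mem
  let Y' : Finset W := Y.preimage φ φ.injective.injOn
  have eY : φ '' (Y' : Set W) = Y := by
    ext x; exact ⟨fun ⟨y, hy, e⟩ => e ▸ Finset.mem_preimage.1 hy, fun h => by obtain ⟨y, rfl⟩ := hYr x h; exact ⟨y, Finset.mem_preimage.2 h, rfl⟩⟩
  have hRle : ∀ y, φ y ∈ Subring.closure ((M : Set U) ∪ Set.range fun i => φ (s i)) → y ∈ Subring.closure ((M.comap φ : Set W) ∪ Set.range s) := fun y hy => by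
    rw [ert, ← eMs, ← Set.image_union, ← RingHom.map_closure] at hy
    obtain ⟨z, hz, e⟩ := hy
    exact φ.injective e ▸ hz
  obtain ⟨n, η, hη, hYη⟩ := Et.gd_fin Y' fun y hy => (hY (φ y) (Finset.mem_preimage.1 hy)).comap φ le_rfl y rfl
  obtain ⟨f, f1, f2, f3, f4⟩ := hη.out
  obtain ⟨-, -, -, -, hη1⟩ := hη
  have hNalg : ∀ x ∈ φ.fieldRange, x ∈ acl (cl M (Set.range fun i => φ (s i))) := fun x hx => by
    refine Subfield.closure_le.2 ?_ (hgen hx)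
    rintro y (hy | hy)
    · exact le_acl _ (Subfield.subset_closure hy)
    · exact (hY y hy).alg fun r hr => le_acl _ (Subring.closure_le (t := (cl M (Set.range fun i => φ (s i))).toSubring).2 Subfield.subset_closure hr)
  obtain ⟨hin, hind⟩ := t_ind hM hJ fun x hx => hNalg x (hJN hx)
  have ecl : ∀ T : Set W, (cl (M.comap φ) T).map φ = cl M (φ '' T) := fun T => by rw [cl_map, eM]
  have hD : ∀ D : W, V.valuation (φ D) = 1 → LocalUnif.IsVUnit (V.comap φ) D := fun D h =>
    ⟨by rintro rfl; simp at h, (V.valuation_le_one_iff _).1 h.le, (V.valuation_le_one_iff _).1 (by rw [map_inv₀, map_inv₀, h, inv_one])⟩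
  refine ⟨_, n, s, η, ⟨fun i => ⟨trivial, ?_⟩, fun i => ⟨trivial, ?_⟩, alg_ind (fun a b h => hin (by simp [h])) fun i hi => hind i ?_, fun z _ => ?_, ?_, f, fun i m => ?_, f2, f3, ?_⟩, ?_⟩
  · exact (V.valuation_le_one_iff _).1 (htN i).2
  · exact (V.valuation_le_one_iff _).1 (hη1 i)
  · have := acl_map φ hi
    rwa [ecl, Set.image_sdiff φ.injective, ← ert, Set.image_singleton] at this
  · have h1 : z ∈ acl (cl (M.comap φ) (Set.range s)) := acl_comap φ (by rw [ecl, ← ert]; exact hNalg _ ⟨z, rfl⟩)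
    rw [cl, ← adjoin_toSubfield'] at h1
    exact mem_acl.1 h1
  · refine top_unique fun z _ => ?_
    have h1 := hgen ⟨z, rfl⟩
    rw [ert, ← eMs, ← eY, ← Set.image_union, ← Set.image_union, ← RingHom.map_field_closure] at h1
    obtain ⟨w, hw, e⟩ := h1
    rw [← φ.injective e]
    exact Subfield.closure_mono (Set.union_subset_union_right _ hYη) hw
  · refine Subring.closure_mono (Set.union_subset_union_left _ ?_) (hRle _ (f1 i m))
    exact fun x hx => ⟨hx, hMV _ hx⟩
  · exact hD _ f4
  · have : ∀ k, ∃ j, η j = ζ k := fun k => hYη (Finset.mem_coe.2 (Finset.mem_preimage.2 (hζ k)))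
    choose σ hσ using this
    exact ⟨σ, hσ⟩
end K3

section K4
variable {U : Type*} [Field U]

theorem normal_of [IsAlgClosed U] {A L : Type*} [Field A] [Field L] [Algebra A L] (φ : L →+* U) {D : Subfield U}
    (hD : (φ.comp (algebraMap A L)).fieldRange = D) {g : U[X]} (hg : g ≠ 0) (hc : ∀ i, g.coeff i ∈ D) (hr : ∀ x, g.eval x = 0 → x ∈ φ.fieldRange)
    (hN : φ.fieldRange ≤ Subfield.closure ((D : Set U) ∪ {x | g.eval x = 0})) : Normal A L ∧ FiniteDimensional A L := by
  obtain ⟨h, rfl⟩ : ∃ h : A[X], h.map (φ.comp (algebraMap A L)) = g := by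
    rw [← mem_lifts, lifts_iff_coeff_lifts]
    intro n
    have := hc n
    rw [← hD] at this
    obtain ⟨a, ha⟩ := this
    exact ⟨a, ha⟩
  have h0 : h ≠ 0 := by rintro rfl; simp at hg
  have e : ∀ x : L, (h.map (φ.comp (algebraMap A L))).eval (φ x) = φ (aeval x h) := fun x => by
    rw [← Polynomial.map_map, eval_map, eval₂_at_apply, eval_map_algebraMap]
  have : IsSplittingField A L h := by
    refine isSplittingField_iff_intermediateField.2 ⟨?_, top_unique fun z _ => ?_⟩
    · refine Splits.of_splits_map φ (IsAlgClosed.splits _) fun a ha => ?_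
      rw [Polynomial.map_map] at ha
      obtain ⟨b, hb⟩ := hr a (mem_roots'.1 ha).2
      exact ⟨b, hb⟩
    · have h1 : Subfield.closure ((D : Set U) ∪ {x | (h.map (φ.comp (algebraMap A L))).eval x = 0}) ≤
          (IntermediateField.adjoin A (h.rootSet L)).toSubfield.map φ := Subfield.closure_le.2 (by
        rintro x (hx | hx)
        · rw [← hD] at hx
          obtain ⟨a, rfl⟩ := hx
          exact ⟨_, (IntermediateField.adjoin A (h.rootSet L)).algebraMap_mem a, rfl⟩
        · obtain ⟨y, rfl⟩ := hr x hx
          refine ⟨y, IntermediateField.subset_adjoin _ _ ((mem_rootSet_of_ne h0).2 ?_), rfl⟩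
          exact φ.injective ((e y).symm.trans (Eq.trans hx (map_zero φ).symm)))
      obtain ⟨w, hw, e⟩ := h1 (hN ⟨z, rfl⟩)
      exact φ.injective e ▸ hw
  exact ⟨Normal.of_isSplittingField h, IsSplittingField.finiteDimensional L h⟩

theorem fd_incl {A N : Subfield U} (hle : A ≤ N) (S : Finset U) (hN : N = cl A S) (hS : ∀ s ∈ S, s ∈ acl A) :
    let _ : Algebra A N := (Subfield.inclusion hle).toAlgebra
    FiniteDimensional A N := by
  obtain ⟨N', rfl, h⟩ := fd_of S hN hS
  intro _
  let e : N' →ₗ[A] N'.toSubfield :=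
    { toFun := fun x => x
      map_add' := fun _ _ => rfl
      map_smul' := fun _ _ => rfl }
  exact Module.Finite.of_surjective e fun x => ⟨x, rfl⟩
end K4


end Helpers

set_option synthInstance.maxHeartbeats 400000 in
set_option maxHeartbeats 1000000 in
open LocalUnif in
/-- Theorem 1.4 of the paper. In addition to the assertion of
Theorem 1.3, for any subextension `E|K` of `F|K` of the same transcendence degree
(i.e. with `F|E` algebraic), the finite extension `𝓕` can be chosen to be a normal
extension of `E` and of `F`. -/
theorem statement_1
    (F : Type*) [Field F] (K : Subfield F) (O : ValuationSubring F)
    (hff : IsFunctionField K) (htriv : TrivialOn O K)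
    (E : Subfield F) (hKE : K ≤ E) (hFEalg : ∀ x : F, IsAlgebraic ↥E x)
    (m : ℕ) (ζ : Fin m → F) (hζ : ∀ k, ζ k ∈ O) :
    ∃ (𝓕 : IntermediateField F (AlgebraicClosure F)) (Q : ValuationSubring ↥𝓕)
      (𝓚 : Subfield ↥𝓕),
      FiniteDimensional F ↥𝓕 ∧
      Q.comap (algebraMap F ↥𝓕) = O ∧
      -- `𝓕` is a normal extension of `F` …
      Normal F ↥𝓕 ∧
      -- … and of `E`
      (letI : Algebra ↥E ↥𝓕 := ((algebraMap F ↥𝓕).comp E.subtype).toAlgebra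
       Normal ↥E ↥𝓕) ∧
      (∃ hle : K.map (algebraMap F ↥𝓕) ≤ 𝓚,
        (letI : Algebra ↥(K.map (algebraMap F ↥𝓕)) ↥𝓚 := (Subfield.inclusion hle).toAlgebra
         FiniteDimensional ↥(K.map (algebraMap F ↥𝓕)) ↥𝓚) ∧
        ∀ x ∈ 𝓚, ∃ nn : ℕ, x ^ ringExpChar F ^ nn ∈ K.map (algebraMap F ↥𝓕)) ∧
      UnifWrt (F := ↥𝓕) ⊤ 𝓚 Q (fun k => algebraMap F ↥𝓕 (ζ k)) := by
  classical
  obtain ⟨⟨S, hS⟩, -⟩ := hff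
  let ι := algebraMap F (AlgebraicClosure F)
  obtain ⟨V, hV⟩ := exists_ext O ι
  have hVO : ∀ x, ι x ∈ V ↔ x ∈ O := fun x => by rw [← hV]; rfl
  have hKO : ∀ a ∈ K.map ι, a ∈ V ∧ a⁻¹ ∈ V := by
    rintro _ ⟨a, ha, rfl⟩
    rw [← map_inv₀, hVO, hVO]
    exact htriv a ha
  have hS' : Subfield.closure ((K : Set F) ∪ S) = ⊤ := by
    rw [← adjoin_toSubfield', hS]; rfl
  have hFS : ι.fieldRange = cl (K.map ι) ((S.image ι : Finset _) : Set (AlgebraicClosure F)) := by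
    rw [Finset.coe_image, ← cl_map, cl, hS', RingHom.fieldRange_eq_map]
  have hKtr : ∀ a ∈ K.map ι, a ≠ 0 → V.valuation a = 1 := fun a ha h0 => by
    refine le_antisymm ((V.valuation_le_one_iff _).2 (hKO a ha).1) ?_
    have := (V.valuation_le_one_iff _).2 (hKO a ha).2
    rw [map_inv₀] at this
    exact (inv_le_one₀ (by simpa [zero_lt_iff] using h0)).1 this
  have hKE' : K.map ι ≤ E.map ι := (Subfield.gc_map_comap ι).monotone_l hKE
  obtain ⟨g, k, P, J, Y, t, hg, hgE, hP, hJE, hJ, hFN, ht, hY, hZY, hgen⟩ := final_U (v := V.valuation) (K := K.map ι) (E := E.map ι)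
    (F0 := ι.fieldRange) (S.image ι) (Finset.univ.image fun k => ι (ζ k)) hKE' (by rintro _ ⟨a, -, rfl⟩; exact ⟨a, rfl⟩) hFS
    (by rintro _ ⟨a, rfl⟩; exact acl_map ι (mem_acl.2 (hFEalg a))) hKtr (fun z hz => by
      obtain ⟨k, -, rfl⟩ := Finset.mem_image.1 hz
      exact ⟨⟨_, rfl⟩, (V.valuation_le_one_iff _).2 ((hVO _).2 (hζ k))⟩)
  let 𝓕 : IntermediateField F (AlgebraicClosure F) := (Fd (K.map ι) (E.map ι) g).toIntermediateField fun a => hFN ⟨a, rfl⟩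
  let φ : 𝓕 →+* AlgebraicClosure F := 𝓕.val.toRingHom
  have hφ : φ.fieldRange = Fd (K.map ι) (E.map ι) g := by
    ext x; exact ⟨by rintro ⟨y, rfl⟩; exact y.2, fun h => ⟨⟨x, h⟩, rfl⟩⟩
  have hφa : ∀ a, φ (algebraMap F 𝓕 a) = ι a := fun a => rfl
  have hroot : ∀ x, g.eval x = 0 → x ∈ φ.fieldRange := fun x hx => hφ ▸ Fd_root hx
  have hKN : cl (K.map ι) P ≤ φ.fieldRange := hφ ▸ cl_le Fd_B fun a ha => Fd_root (hP a ha).2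
  have hPac : ∀ a ∈ P, a ∈ acl (K.map ι) := fun a ha => (acl_acl _).of_pow (qpos k) (le_acl _ (hP a ha).1)
  have hM : cl (K.map ι) P ≤ acl (K.map ι) := cl_le (le_acl _) hPac
  have hF := normal_of (A := F) (L := 𝓕) φ (D := ι.fieldRange) rfl hg (fun i => by obtain ⟨a, -, e⟩ := hgE i; exact ⟨a, e⟩) hroot
    (hφ ▸ Fd_le (fun x hx => by obtain ⟨a, -, rfl⟩ := hx; exact Subfield.subset_closure (Or.inl ⟨a, rfl⟩))
      (fun x hx => by obtain ⟨a, -, rfl⟩ := hx; exact Subfield.subset_closure (Or.inl ⟨a, rfl⟩)) fun x hx => Subfield.subset_closure (Or.inr hx))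
  have hKmap : (K.map (algebraMap F 𝓕)).map φ = K.map ι := by rw [Subfield.map_map]; rfl
  have hle : K.map (algebraMap F 𝓕) ≤ (cl (K.map ι) P).comap φ := by
    rintro _ ⟨a, ha, rfl⟩
    exact le_cl (K.map ι) P ⟨a, ha, rfl⟩
  let P' : Finset 𝓕 := P.preimage φ φ.injective.injOn
  have eP : φ '' (P' : Set 𝓕) = P := by
    ext x
    exact ⟨fun ⟨y, hy, e⟩ => e ▸ Finset.mem_preimage.1 hy, fun h => by obtain ⟨y, rfl⟩ := hroot x (hP x h).2; exact ⟨y, Finset.mem_preimage.2 h, rfl⟩⟩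
  refine ⟨𝓕, V.comap φ, (cl (K.map ι) P).comap φ, hF.2, ?_, hF.1, ?_, ⟨hle, ?_, fun x hx => ⟨k, ?_⟩⟩, ?_⟩
  · rw [← hV]; rfl
  · let _ : Algebra E 𝓕 := ((algebraMap F 𝓕).comp E.subtype).toAlgebra
    refine (normal_of (A := E) (L := 𝓕) φ (D := E.map ι) ?_ hg hgE hroot ?_).1
    · ext x; exact ⟨by rintro ⟨a, rfl⟩; exact ⟨a, a.2, rfl⟩, by rintro ⟨a, ha, rfl⟩; exact ⟨⟨a, ha⟩, rfl⟩⟩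
    · rw [hφ]
      exact Fd_le (fun x hx => Subfield.subset_closure (Or.inl (hKE' hx))) (fun x hx => Subfield.subset_closure (Or.inl hx))
        fun x hx => Subfield.subset_closure (Or.inr hx)
  · refine fd_incl hle P' ?_ fun s hs => acl_comap φ (hKmap ▸ hPac _ (Finset.mem_preimage.1 hs))
    have h := cl_map φ (K.map (algebraMap F 𝓕)) P'
    rw [hKmap, eP] at h
    refine le_antisymm (fun x hx => ?_) fun x hx => ?_
    · obtain ⟨y, hy, e⟩ := h.ge hx
      exact φ.injective e ▸ hy
    · exact h.le ⟨x, hx, rfl⟩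
  · have hq : ringExpChar F = ringExpChar (AlgebraicClosure F) :=
      (ringExpChar.eq_iff.2 (expChar_of_injective_ringHom ι.injective _)).symm
    have h1 : cl (K.map ι) P ≤ (K.map ι).comap (iterateFrobenius _ (ringExpChar (AlgebraicClosure F)) k) :=
      cl_le (fun a ha => (K.map ι).pow_mem ha _) fun a ha => (hP a ha).1
    obtain ⟨a, ha, e⟩ := h1 hx
    rw [hq]
    exact ⟨a, ha, φ.injective (e.trans (map_pow φ _ _).symm)⟩
  · refine unif_out φ V hM (fun x hx => (V.valuation_le_one_iff _).1 (triv_le (triv_acl hKtr) (hM hx))) hJ (hJE.trans (hφ ▸ Fd_E)) (hφ ▸ ht) hKN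
      (hφ ▸ hY) (hφ ▸ hgen) _ fun j => hZY (Finset.mem_image_of_mem _ (Finset.mem_univ j))
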